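/- For every ε ∈ (0, 1/2) there exist C = C(ε) > 0 and x₀ = x₀(ε) such that the following holds for all x ≥ x₀. Let r be an integer with (1+ε)·Log₂ x ≤ r ≤ (2−ε)·Log₂ x, set α := r/Log₂ x − 1, and let y ∈ 𝒴. Then ∏_{y ≤ p < x}(1 + 1/p)^{-1} · ∑_{n ∈ S_{[y,x)}, Δ^{(Log y)}(n) < (Log₂ x)^{η − ε/2}} 1/n ≤ C/Log₂ x. -/

import Mathlib

open Filter Topology
open scoped Classical

noncomputable def LLog (x : ℝ) : ℝ := max 1 (Real.log x)
noncomputable def LLog2 (x : ℝ) : ℝ := LLog (LLog x)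
noncomputable def LLog3 (x : ℝ) : ℝ := LLog (LLog2 x)

/-- `Δ^{(v)}(n)`: the maximal number of divisors of `n` in an interval `(e^u, e^{u+v}]`. -/
noncomputable def DeltaV (v : ℝ) (n : ℕ) : ℕ :=
  ⨆ u : ℝ, (n.divisors.filter fun d => Real.exp u < (d : ℝ) ∧ (d : ℝ) ≤ Real.exp (u + v)).card

/-- The Erdős–Hooley Delta function. -/
noncomputable def Delta (n : ℕ) : ℕ := DeltaV 1 n

/-- `S_{[y,x)}`: squarefree positive integers all of whose prime factors `p` satisfy `y ≤ p < x`. -/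
def Sset (y x : ℝ) : Set ℕ :=
  {n | 0 < n ∧ Squarefree n ∧ ∀ p ∈ n.primeFactors, y ≤ (p : ℝ) ∧ (p : ℝ) < x}

/-- `∏_{y ≤ p < x} (1 + 1/p)⁻¹`, product over primes. -/
noncomputable def primeProd (y x : ℝ) : ℝ :=
  ∏ᶠ p ∈ {p : ℕ | p.Prime ∧ y ≤ (p : ℝ) ∧ (p : ℝ) < x}, ((1 : ℝ) + 1 / p)⁻¹

/-- number of distinct prime factors -/
def omegaN (n : ℕ) : ℕ := n.primeFactors.card

/-- number of divisors -/
def tauN (n : ℕ) : ℕ := n.divisors.card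

/-- `n_{<y}`: the largest divisor of `n` (squarefree) composed of primes `< y`. -/
noncomputable def nsmall (n : ℕ) (y : ℝ) : ℕ :=
  ∏ p ∈ n.primeFactors.filter (fun p : ℕ => (p : ℝ) < y), p

def Yset (α x : ℝ) : Set ℝ :=
  {y | 0 < y ∧ |LLog2 y - α * LLog2 x| ≤ Real.sqrt (LLog2 x) ∧ ∃ m : ℤ, LLog2 y = m * Real.log 2}

def Uset (α x : ℝ) : Set ℤ :=
  {u | |(u : ℝ) - (Real.log 4 - 1) / Real.log 2 * (α * LLog2 x)| ≤ Real.sqrt (LLog2 x)}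

noncomputable def Qfun (t : ℝ) : ℝ := t * Real.log t - t + 1


namespace FGK

set_option linter.unusedSectionVars false

section Entropy
variable {E : Type*} [AddCommGroup E] [Module ℚ E] {Ω : Type*} [Fintype Ω]

/-- mass of the coset of `ω` modulo `W` -/
noncomputable def cmass (ν : Ω → ℝ) (vec : Ω → E) (W : Submodule ℚ E) (ω : Ω) : ℝ :=
  ∑ ω', if vec ω' - vec ω ∈ W then ν ω' else 0

/-- entropy of `ν` modulo `W` -/
noncomputable def ent (ν : Ω → ℝ) (vec : Ω → E) (W : Submodule ℚ E) : ℝ :=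
  ∑ ω, ν ω * (-Real.log (cmass ν vec W ω))

variable {ν : Ω → ℝ} {vec : Ω → E}

lemma le_cmass (hν : ∀ ω, 0 < ν ω) (W : Submodule ℚ E) (ω : Ω) : ν ω ≤ cmass ν vec W ω := by
  unfold cmass
  have := Finset.single_le_sum (f := fun ω' => if vec ω' - vec ω ∈ W then ν ω' else 0)
    (s := Finset.univ) (by intro i _; split_ifs; exact (hν i).le; exact le_rfl)
    (Finset.mem_univ ω)
  simpa using this

lemma cmass_pos (hν : ∀ ω, 0 < ν ω) (W : Submodule ℚ E) (ω : Ω) : 0 < cmass ν vec W ω :=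
  lt_of_lt_of_le (hν ω) (le_cmass hν W ω)

lemma cmass_mono (hν : ∀ ω, 0 < ν ω) {W W' : Submodule ℚ E} (h : W ≤ W') (ω : Ω) :
    cmass ν vec W ω ≤ cmass ν vec W' ω := by
  unfold cmass
  apply Finset.sum_le_sum
  intro i _
  by_cases h1 : vec i - vec ω ∈ W
  · simp [h1, h h1]
  · simp only [h1, if_false]; split_ifs; exact (hν i).le; exact le_rfl

lemma cmass_le_one (hν : ∀ ω, 0 < ν ω) (h1 : ∑ ω, ν ω = 1) (W : Submodule ℚ E) (ω : Ω) :
    cmass ν vec W ω ≤ 1 := by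
  rw [← h1]; unfold cmass
  apply Finset.sum_le_sum
  intro i _
  split_ifs; exact le_rfl; exact (hν i).le

lemma cmass_congr (W : Submodule ℚ E) {ω ω' : Ω} (h : vec ω' - vec ω ∈ W) :
    cmass ν vec W ω' = cmass ν vec W ω := by
  unfold cmass
  apply Finset.sum_congr rfl
  intro i _
  have : vec i - vec ω' ∈ W ↔ vec i - vec ω ∈ W := by
    constructor
    · intro h2; have := W.add_mem h2 h; simpa using this
    · intro h2; have := W.sub_mem h2 h; simpa using this
  simp [this]

lemma cmass_eq_one (h1 : ∑ ω, ν ω = 1) (W : Submodule ℚ E) (ω : Ω)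
    (h : ∀ ω', vec ω' - vec ω ∈ W) : cmass ν vec W ω = 1 := by
  unfold cmass; simp [h, h1]

lemma ent_anti (hν : ∀ ω, 0 < ν ω) {W W' : Submodule ℚ E} (h : W ≤ W') :
    ent ν vec W' ≤ ent ν vec W := by
  unfold ent
  apply Finset.sum_le_sum
  intro i _
  apply mul_le_mul_of_nonneg_left _ (hν i).le
  exact neg_le_neg (Real.log_le_log (cmass_pos hν W i) (cmass_mono hν h i))

lemma ent_nonneg (hν : ∀ ω, 0 < ν ω) (h1 : ∑ ω, ν ω = 1) (W : Submodule ℚ E) :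
    0 ≤ ent ν vec W := by
  unfold ent
  apply Finset.sum_nonneg
  intro i _
  apply mul_nonneg (hν i).le
  have := Real.log_nonpos (cmass_pos (vec := vec) hν W i).le (cmass_le_one hν h1 W i)
  linarith

lemma ent_top (h1 : ∑ ω, ν ω = 1) (W : Submodule ℚ E)
    (h : ∀ ω ω', vec ω' - vec ω ∈ W) : ent ν vec W = 0 := by
  unfold ent
  apply Finset.sum_eq_zero
  intro i _
  rw [cmass_eq_one h1 W i (h i)]; simp

lemma ent_congr {W W' : Submodule ℚ E}
    (h : ∀ ω ω', vec ω' - vec ω ∈ W ↔ vec ω' - vec ω ∈ W') : ent ν vec W = ent ν vec W' := by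
  unfold ent cmass
  simp [h]

lemma ent_submod_aux (hν : ∀ ω, 0 < ν ω) (h1 : ∑ ω, ν ω = 1) (U W : Submodule ℚ E) :
    ∑ ω, ν ω * (cmass ν vec U ω * cmass ν vec W ω /
      (cmass ν vec (U ⊓ W) ω * cmass ν vec (U ⊔ W) ω)) ≤ 1 := by
  -- expand
  have e1 : ∀ ω, ν ω * (cmass ν vec U ω * cmass ν vec W ω /
      (cmass ν vec (U ⊓ W) ω * cmass ν vec (U ⊔ W) ω)) =
      ∑ a, ∑ b, ν a * ν b * (if vec a - vec ω ∈ U ∧ vec b - vec ω ∈ W then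
        ν ω / (cmass ν vec (U ⊓ W) ω * cmass ν vec (U ⊔ W) ω) else 0) := by
    intro ω
    have : cmass ν vec U ω * cmass ν vec W ω = ∑ a, ∑ b,
        (if vec a - vec ω ∈ U then ν a else 0) * (if vec b - vec ω ∈ W then ν b else 0) := by
      unfold cmass; rw [Finset.sum_mul_sum]
    rw [this, mul_div_assoc', Finset.mul_sum, Finset.sum_div]
    apply Finset.sum_congr rfl; intro a _
    rw [Finset.mul_sum, Finset.sum_div]
    apply Finset.sum_congr rfl; intro b _
    by_cases ha : vec a - vec ω ∈ U <;> by_cases hb : vec b - vec ω ∈ W <;> simp [ha, hb]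
    ring
  rw [Finset.sum_congr rfl (fun ω _ => e1 ω), Finset.sum_comm]
  have key : ∀ a, ∑ ω, ∑ b, ν a * ν b * (if vec a - vec ω ∈ U ∧ vec b - vec ω ∈ W then
        ν ω / (cmass ν vec (U ⊓ W) ω * cmass ν vec (U ⊔ W) ω) else 0) ≤ ν a := by
    intro a
    rw [Finset.sum_comm]
    have hb : ∀ b, ∑ ω, ν a * ν b * (if vec a - vec ω ∈ U ∧ vec b - vec ω ∈ W then
        ν ω / (cmass ν vec (U ⊓ W) ω * cmass ν vec (U ⊔ W) ω) else 0) ≤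
        ν a * ((if vec b - vec a ∈ U ⊔ W then ν b else 0) / cmass ν vec (U ⊔ W) a) := by
      intro b
      by_cases hex : ∃ ω0, vec a - vec ω0 ∈ U ∧ vec b - vec ω0 ∈ W
      · obtain ⟨ω0, hU0, hW0⟩ := hex
        have hab : vec b - vec a ∈ U ⊔ W := by
          have h3 := (U ⊔ W).sub_mem (Submodule.mem_sup_right (S := U) hW0)
            (Submodule.mem_sup_left (T := W) hU0)
          simpa using h3
        rw [← Finset.mul_sum]
        simp only [hab, if_true]
        have : ∑ ω, (if vec a - vec ω ∈ U ∧ vec b - vec ω ∈ W then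
          ν ω / (cmass ν vec (U ⊓ W) ω * cmass ν vec (U ⊔ W) ω) else 0) ≤
          ∑ ω, (if vec ω - vec ω0 ∈ U ⊓ W then ν ω else 0) /
            (cmass ν vec (U ⊓ W) ω0 * cmass ν vec (U ⊔ W) a) := by
          apply Finset.sum_le_sum
          intro ω _
          by_cases h : vec a - vec ω ∈ U ∧ vec b - vec ω ∈ W
          · have hin : vec ω - vec ω0 ∈ U ⊓ W := by
              constructor
              · have := U.sub_mem hU0 h.1; simpa using this
              · have := W.sub_mem hW0 h.2; simpa using this
            have hs : vec ω - vec a ∈ U ⊔ W := by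
              have := (U ⊔ W).neg_mem (Submodule.mem_sup_left (T := W) h.1); simpa using this
            rw [if_pos h, if_pos hin, cmass_congr (U ⊓ W) hin, cmass_congr (U ⊔ W) hs]
          · rw [if_neg h]
            apply div_nonneg
            · split_ifs; exact (hν ω).le; exact le_rfl
            · exact (mul_pos (cmass_pos hν _ _) (cmass_pos hν _ _)).le
        rw [← Finset.sum_div] at this
        have h4 : (∑ ω, (if vec ω - vec ω0 ∈ U ⊓ W then ν ω else 0)) = cmass ν vec (U ⊓ W) ω0 := rfl
        rw [h4] at this
        have h5 := cmass_pos (vec := vec) hν (U ⊓ W) ω0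
        have h6 := cmass_pos (vec := vec) hν (U ⊔ W) a
        have h7 : cmass ν vec (U ⊓ W) ω0 / (cmass ν vec (U ⊓ W) ω0 * cmass ν vec (U ⊔ W) a) =
          1 / cmass ν vec (U ⊔ W) a := by field_simp
        rw [h7] at this
        calc _ ≤ ν a * ν b * (1 / cmass ν vec (U ⊔ W) a) := by
              apply mul_le_mul_of_nonneg_left this (mul_pos (hν a) (hν b)).le
          _ = _ := by ring
      · have : ∀ ω, ¬ (vec a - vec ω ∈ U ∧ vec b - vec ω ∈ W) := fun ω h => hex ⟨ω, h⟩
        simp only [this, if_false, mul_zero, Finset.sum_const_zero]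
        apply mul_nonneg (hν a).le
        apply div_nonneg _ (cmass_pos hν _ _).le
        split_ifs; exact (hν b).le; exact le_rfl
    calc _ ≤ ∑ b, ν a * ((if vec b - vec a ∈ U ⊔ W then ν b else 0) / cmass ν vec (U ⊔ W) a) :=
          Finset.sum_le_sum (fun b _ => hb b)
      _ = ν a * (cmass ν vec (U ⊔ W) a / cmass ν vec (U ⊔ W) a) := by
          rw [← Finset.mul_sum, ← Finset.sum_div]; rfl
      _ = ν a := by rw [div_self (cmass_pos hν _ _).ne', mul_one]
  calc _ ≤ ∑ a, ν a := Finset.sum_le_sum (fun a _ => key a)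
    _ = 1 := h1

lemma ent_submod (hν : ∀ ω, 0 < ν ω) (h1 : ∑ ω, ν ω = 1) (U W : Submodule ℚ E) :
    ent ν vec (U ⊓ W) + ent ν vec (U ⊔ W) ≤ ent ν vec U + ent ν vec W := by
  have h := ent_submod_aux (vec := vec) hν h1 U W
  have h2 : ∑ ω, ν ω * (Real.log (cmass ν vec U ω) + Real.log (cmass ν vec W ω)
      - Real.log (cmass ν vec (U ⊓ W) ω) - Real.log (cmass ν vec (U ⊔ W) ω)) ≤
      ∑ ω, ν ω * (cmass ν vec U ω * cmass ν vec W ω /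
      (cmass ν vec (U ⊓ W) ω * cmass ν vec (U ⊔ W) ω) - 1) := by
    apply Finset.sum_le_sum
    intro ω _
    apply mul_le_mul_of_nonneg_left _ (hν ω).le
    have a1 := cmass_pos (vec := vec) hν U ω
    have a2 := cmass_pos (vec := vec) hν W ω
    have a3 := cmass_pos (vec := vec) hν (U ⊓ W) ω
    have a4 := cmass_pos (vec := vec) hν (U ⊔ W) ω
    have := Real.log_le_sub_one_of_pos (div_pos (mul_pos a1 a2) (mul_pos a3 a4))
    rw [Real.log_div (mul_pos a1 a2).ne' (mul_pos a3 a4).ne', Real.log_mul a1.ne' a2.ne',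
      Real.log_mul a3.ne' a4.ne'] at this
    linarith
  simp only [mul_sub, mul_add, mul_one, Finset.sum_sub_distrib, Finset.sum_add_distrib] at h2
  rw [h1] at h2
  unfold ent
  simp only [mul_neg, Finset.sum_neg_distrib]
  linarith

variable [FiniteDimensional ℚ E]

/-- the missing dimension of `W` at level `i` of the flag `V` -/
noncomputable def udim (V : ℕ → Submodule ℚ E) (i : ℕ) (W : Submodule ℚ E) : ℝ :=
  (Module.finrank ℚ (V i) : ℝ) - Module.finrank ℚ ((W ⊓ V i) ⊔ V (i-1) : Submodule ℚ E)

lemma ent_linear (hν : ∀ ω, 0 < ν ω) (h1 : ∑ ω, ν ω = 1) (V : ℕ → Submodule ℚ E)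
    (hV : Monotone V) (j : ℕ) (hj : ∀ ω ω', vec ω' - vec ω ∈ V j) (lam : ℕ → ℝ)
    (hmin : ∀ i < j, ∀ W, V i ≤ W → W ≤ V (i+1) →
      lam (i+1) * ((Module.finrank ℚ (V (i+1)) : ℝ) - Module.finrank ℚ W) ≤
        ent ν vec W - ent ν vec (V (i+1)))
    (W : Submodule ℚ E) (hW : V 0 ≤ W) :
    ∑ i ∈ Finset.range j, lam (i+1) * udim V (i+1) W ≤ ent ν vec W := by
  have step : ∀ i < j, lam (i+1) * udim V (i+1) W ≤
      ent ν vec (W ⊔ V i) - ent ν vec (W ⊔ V (i+1)) := by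
    intro i hi
    have hm : V (i+1) ⊓ (W ⊔ V i) = (W ⊓ V (i+1)) ⊔ V i := by
      rw [inf_comm, sup_comm W, sup_inf_assoc_of_le _ (hV (Nat.le_succ i)), sup_comm]
    have hs : V (i+1) ⊔ (W ⊔ V i) = W ⊔ V (i+1) := by
      rw [sup_comm, sup_assoc, sup_eq_right.mpr (hV (Nat.le_succ i))]
    have h2 := ent_submod (vec := vec) hν h1 (V (i+1)) (W ⊔ V i)
    rw [hm, hs] at h2
    have h3 := hmin i hi ((W ⊓ V (i+1)) ⊔ V i) le_sup_right
      (sup_le inf_le_right (hV (Nat.le_succ i)))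
    unfold udim
    rw [Nat.add_sub_cancel]
    linarith
  have htel : ∑ i ∈ Finset.range j, (ent ν vec (W ⊔ V i) - ent ν vec (W ⊔ V (i+1)))
      = ent ν vec (W ⊔ V 0) - ent ν vec (W ⊔ V j) := by
    rw [Finset.sum_range_sub' (fun i => ent ν vec (W ⊔ V i))]
  have h0 : W ⊔ V 0 = W := sup_eq_left.mpr hW
  have hjj : ent ν vec (W ⊔ V j) = 0 :=
    ent_top h1 _ (fun ω ω' => Submodule.mem_sup_right (hj ω ω'))
  rw [h0, hjj, sub_zero] at htel
  rw [← htel]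
  exact Finset.sum_le_sum (fun i hi => step i (Finset.mem_range.mp hi))

lemma ent_finite_range (ν : Ω → ℝ) (vec : Ω → E) : (Set.range (ent ν vec)).Finite := by
  have : Set.range (ent ν vec) ⊆ Set.range (fun R : Ω → Ω → Prop =>
      ∑ ω, ν ω * (-Real.log (∑ ω', if R ω ω' then ν ω' else 0))) := by
    rintro _ ⟨W, rfl⟩
    exact ⟨fun ω ω' => vec ω' - vec ω ∈ W, rfl⟩
  exact (Set.finite_range _).subset this

lemma ent_min_invariant (hν : ∀ ω, 0 < ν ω) (h1 : ∑ ω, ν ω = 1) (A B : Submodule ℚ E)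
    (hAB : A ≤ B) (lam : ℝ) (F : Set (E ≃ₗ[ℚ] E))
    (hF : ∀ f ∈ F, ∀ W, ent ν vec (W.map (f : E →ₗ[ℚ] E)) = ent ν vec W)
    (hFA : ∀ f ∈ F, A.map (f : E →ₗ[ℚ] E) = A) (hFB : ∀ f ∈ F, B.map (f : E →ₗ[ℚ] E) = B)
    (hinv : ∀ W, A ≤ W → W ≤ B → (∀ f ∈ F, W ≤ W.map (f : E →ₗ[ℚ] E)) → W = A ∨ W = B)
    (hlam : lam * ((Module.finrank ℚ B : ℝ) - Module.finrank ℚ A) ≤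
        ent ν vec A - ent ν vec B)
    (W : Submodule ℚ E) (hAW : A ≤ W) (hWB : W ≤ B) :
    lam * ((Module.finrank ℚ B : ℝ) - Module.finrank ℚ W) ≤ ent ν vec W - ent ν vec B := by
  set Φ : Submodule ℚ E → ℝ := fun W => ent ν vec W + lam * Module.finrank ℚ W with hΦ
  have hsub : ∀ U W, Φ (U ⊓ W) + Φ (U ⊔ W) ≤ Φ U + Φ W := by
    intro U W
    have a := ent_submod (vec := vec) hν h1 U W
    have b : (Module.finrank ℚ (U ⊔ W : Submodule ℚ E) : ℝ) + Module.finrank ℚ (U ⊓ W : Submodule ℚ E)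
      = Module.finrank ℚ U + Module.finrank ℚ W := by
      exact_mod_cast Submodule.finrank_sup_add_finrank_inf_eq U W
    have c : lam * ((Module.finrank ℚ (U ⊔ W : Submodule ℚ E) : ℝ) + Module.finrank ℚ (U ⊓ W : Submodule ℚ E))
      = lam * (Module.finrank ℚ U + Module.finrank ℚ W) := by rw [b]
    simp only [hΦ]; linarith
  -- finite range
  have hfin : (Φ '' {W | A ≤ W ∧ W ≤ B}).Finite := by
    have : Φ '' {W | A ≤ W ∧ W ≤ B} ⊆ Set.image2 (fun e (d : ℕ) => e + lam * (d:ℝ))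
        (Set.range (ent ν vec)) (Set.Iic (Module.finrank ℚ E)) := by
      rintro _ ⟨W, _, rfl⟩
      exact ⟨ent ν vec W, ⟨W, rfl⟩, Module.finrank ℚ W, Submodule.finrank_le W, rfl⟩
    exact (Set.Finite.image2 _ (ent_finite_range ν vec) (Set.finite_Iic _)).subset this
  obtain ⟨m, ⟨W0, hW0, rfl⟩, hm⟩ := Set.exists_min_image _ id hfin ⟨Φ A, A, ⟨le_rfl, hAB⟩, rfl⟩
  have hm' : ∀ W, A ≤ W → W ≤ B → Φ W0 ≤ Φ W := fun W h h' => hm _ ⟨W, ⟨h, h'⟩, rfl⟩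
  -- minimal rank minimizer
  have hex : ∃ d : ℕ, ∃ W, A ≤ W ∧ W ≤ B ∧ Φ W = Φ W0 ∧ Module.finrank ℚ W = d :=
    ⟨_, W0, hW0.1, hW0.2, rfl, rfl⟩
  obtain ⟨Ws, hs1, hs2, hs3, hs4⟩ := Nat.find_spec hex
  have hsmin : ∀ W, A ≤ W → W ≤ B → Φ W = Φ W0 → Module.finrank ℚ Ws ≤ Module.finrank ℚ W := by
    intro W a b c
    rw [hs4]; exact Nat.find_min' hex ⟨W, a, b, c, rfl⟩
  have hWs : ∀ f ∈ F, Ws ≤ Ws.map (f : E →ₗ[ℚ] E) := by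
    intro f hf
    set W1 := Ws.map (f : E →ₗ[ℚ] E) with hW1
    have a1 : A ≤ W1 := by rw [← hFA f hf]; exact Submodule.map_mono hs1
    have a2 : W1 ≤ B := by rw [← hFB f hf]; exact Submodule.map_mono hs2
    have a3 : Φ W1 = Φ W0 := by
      rw [← hs3]; simp only [hΦ]
      rw [hF f hf Ws]
      have : Module.finrank ℚ W1 = Module.finrank ℚ Ws := LinearEquiv.finrank_map_eq f Ws
      rw [this]
    have b1 := hsub Ws W1
    have b2 := hm' (Ws ⊓ W1) (le_inf hs1 a1) (inf_le_left.trans hs2)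
    have b3 := hm' (Ws ⊔ W1) (hs1.trans le_sup_left) (sup_le hs2 a2)
    have b4 : Φ (Ws ⊓ W1) = Φ W0 := by rw [a3, hs3] at b1; linarith
    have b5 := hsmin _ (le_inf hs1 a1) (inf_le_left.trans hs2) b4
    have b6 : Ws ⊓ W1 = Ws := Submodule.eq_of_le_of_finrank_le inf_le_left b5
    rw [← b6]; exact inf_le_right
  have hfinal : Φ B ≤ Φ W := by
    have hB : Φ B ≤ Φ Ws := by
      rcases hinv Ws hs1 hs2 hWs with h | h
      · rw [h]; simp only [hΦ]; linarith
      · rw [h]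
    rw [hs3] at hB
    exact hB.trans (hm' W hAW hWB)
  simp only [hΦ] at hfinal
  linarith

/-- invariance of the entropy under a symmetry of the measure -/
lemma ent_map_of_symm (f : E ≃ₗ[ℚ] E) (σ : Ω ≃ Ω) (hσ : ∀ ω, ν (σ ω) = ν ω)
    (hv : ∀ ω, vec (σ ω) = f (vec ω)) (W : Submodule ℚ E) :
    ent ν vec (W.map (f : E →ₗ[ℚ] E)) = ent ν vec W := by
  have hm : ∀ ω ω', vec (σ ω') - vec (σ ω) ∈ W.map (f : E →ₗ[ℚ] E) ↔ vec ω' - vec ω ∈ W := by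
    intro ω ω'
    rw [hv, hv, ← map_sub]
    constructor
    · rintro ⟨w, hw, he⟩
      have : w = vec ω' - vec ω := f.injective he
      rwa [← this]
    · intro h; exact ⟨_, h, rfl⟩
  have hc : ∀ ω, cmass ν vec (W.map (f : E →ₗ[ℚ] E)) (σ ω) = cmass ν vec W ω := by
    intro ω
    unfold cmass
    rw [← Equiv.sum_comp σ]
    apply Finset.sum_congr rfl
    intro i _
    simp only [hm, hσ]
  unfold ent
  rw [← Equiv.sum_comp σ]
  apply Finset.sum_congr rfl
  intro i _
  rw [hc, hσ]

end Entropy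
end FGK


namespace FGK
set_option linter.unusedSectionVars false

section Chain
variable {X : Type*} [Fintype X] (R : ℕ → X → X → Prop) (ρ : ℝ)

/-- class of `x` -/
noncomputable def cl (l : ℕ) (x : X) : Finset X := Finset.univ.filter (fun y => R l x y)

/-- size of the class of `x` -/
noncomputable def csz (l : ℕ) (x : X) : ℝ := ((cl R l x).card : ℝ)

/-- partition functions -/
noncomputable def gg : ℕ → X → ℝ
  | 0 => fun x => csz R 0 x
  | l+1 => fun x => ∑ y ∈ cl R (l+1) x, gg l y ^ ρ / csz R l y

/-- number of subclasses -/
noncomputable def nsub (l : ℕ) (x : X) : ℝ := ∑ y ∈ cl R (l+1) x, 1 / csz R l y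

/-- class masses -/
noncomputable def MM (h l : ℕ) (x : X) : ℝ :=
  ∏ m ∈ Finset.Ico l h, (gg R ρ m x ^ ρ / gg R ρ (m+1) x)

/-- the Gibbs measure -/
noncomputable def nu (h : ℕ) (x : X) : ℝ := (csz R 0 x)⁻¹ * MM R ρ h 0 x

variable {R} {ρ}

lemma mem_cl {l : ℕ} {x y : X} : y ∈ cl R l x ↔ R l x y := by simp [cl]

variable (hE : ∀ l, Equivalence (R l)) (hm : ∀ l x y, R l x y → R (l+1) x y)

include hE in
lemma csz_ge_one (l : ℕ) (x : X) : 1 ≤ csz R l x := by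
  unfold csz
  have : 0 < (cl R l x).card := Finset.card_pos.mpr ⟨x, mem_cl.mpr ((hE l).refl x)⟩
  exact_mod_cast this

include hE in
lemma cl_congr {l : ℕ} {x y : X} (h : R l x y) : cl R l y = cl R l x := by
  ext z; rw [mem_cl, mem_cl]
  exact ⟨fun h2 => (hE l).trans h h2, fun h2 => (hE l).trans ((hE l).symm h) h2⟩

include hE in
lemma csz_congr {l : ℕ} {x y : X} (h : R l x y) : csz R l y = csz R l x := by
  unfold csz; rw [cl_congr hE h]

include hE in
lemma gg_congr {l : ℕ} {x y : X} (h : R l x y) : gg R ρ l y = gg R ρ l x := by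
  cases l with
  | zero => exact csz_congr hE h
  | succ l => simp only [gg]; rw [cl_congr hE h]

/-- averaging over classes -/
lemma sum_avg (hE : ∀ l, Equivalence (R l)) (l : ℕ) (S : Finset X)
    (hS : ∀ x ∈ S, ∀ y, R l x y → y ∈ S) (f : X → ℝ) :
    ∑ y ∈ S, f y = ∑ y ∈ S, (∑ z ∈ cl R l y, f z) / csz R l y := by
  have h1 : ∀ y ∈ S, (∑ z ∈ cl R l y, f z) / csz R l y =
      ∑ z ∈ S, if R l y z then f z / csz R l y else 0 := by
    intro y hy
    rw [Finset.sum_div, ← Finset.sum_filter]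
    apply Finset.sum_congr _ (fun _ _ => rfl)
    ext z; simp only [mem_cl, Finset.mem_filter]
    exact ⟨fun h => ⟨hS y hy z h, h⟩, fun h => h.2⟩
  rw [Finset.sum_congr rfl h1, Finset.sum_comm]
  apply Finset.sum_congr rfl
  intro z hz
  have h2 : ∀ y ∈ S, (if R l y z then f z / csz R l y else 0) =
      if R l z y then f z / csz R l z else 0 := by
    intro y _
    by_cases h : R l z y
    · rw [if_pos h, if_pos ((hE l).symm h), csz_congr hE h]
    · rw [if_neg h, if_neg (fun h' => h ((hE l).symm h'))]
  rw [Finset.sum_congr rfl h2, ← Finset.sum_filter, Finset.sum_const]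
  have h3 : (S.filter (fun y => R l z y)) = cl R l z := by
    ext y; simp only [mem_cl, Finset.mem_filter]
    exact ⟨fun h => h.2, fun h => ⟨hS z hz y h, h⟩⟩
  rw [h3, nsmul_eq_mul]
  have := csz_ge_one hE l z
  change f z = csz R l z * (f z / csz R l z)
  field_simp

include hE hm

lemma cl_sat (l : ℕ) (x : X) : ∀ y ∈ cl R (l+1) x, ∀ z, R l y z → z ∈ cl R (l+1) x := by
  intro y hy z hz
  rw [mem_cl] at *
  exact (hE _).trans hy (hm _ _ _ hz)

lemma nsub_ge_one (l : ℕ) (x : X) : 1 ≤ nsub R l x := by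
  unfold nsub
  have hsub : cl R l x ⊆ cl R (l+1) x := by
    intro y hy; rw [mem_cl] at *; exact hm _ _ _ hy
  have h2 : ∑ y ∈ cl R l x, 1 / csz R l y ≤ ∑ y ∈ cl R (l+1) x, 1 / csz R l y := by
    apply Finset.sum_le_sum_of_subset_of_nonneg hsub
    intro i _ _
    have := csz_ge_one hE l i
    positivity
  have h3 : ∑ y ∈ cl R l x, 1 / csz R l y = 1 := by
    rw [Finset.sum_congr rfl (g := fun _ => 1 / csz R l x)
      (fun y hy => by rw [csz_congr hE (mem_cl.mp hy)]), Finset.sum_const, nsmul_eq_mul]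
    change csz R l x * (1 / csz R l x) = 1
    have := csz_ge_one hE l x
    field_simp
  linarith

lemma gg_ge_nsub' (hρ : 0 ≤ ρ) (l : ℕ) (hg : ∀ y, 1 ≤ gg R ρ l y) (x : X) :
    nsub R l x ≤ gg R ρ (l+1) x := by
  unfold nsub; simp only [gg]
  apply Finset.sum_le_sum
  intro y _
  have h1 := csz_ge_one hE l y
  have h2 := Real.one_le_rpow (hg y) hρ
  gcongr

lemma gg_ge_one (hρ : 0 ≤ ρ) (l : ℕ) (x : X) : 1 ≤ gg R ρ l x := by
  induction l generalizing x with
  | zero => exact csz_ge_one hE 0 x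
  | succ l ih =>
    exact (nsub_ge_one hE hm l x).trans (gg_ge_nsub' hE hm hρ l ih x)

lemma gg_ge_nsub (hρ : 0 ≤ ρ) (l : ℕ) (x : X) :
    nsub R l x ≤ gg R ρ (l+1) x := gg_ge_nsub' hE hm hρ l (gg_ge_one hE hm hρ l) x

lemma gg_le_csz (hρ : 0 ≤ ρ) (hρ1 : ρ ≤ 1) (l : ℕ) (x : X) : gg R ρ l x ≤ csz R l x := by
  induction l generalizing x with
  | zero => exact le_rfl
  | succ l ih =>
    simp only [gg]
    have : csz R (l+1) x = ∑ y ∈ cl R (l+1) x, 1 := by simp [csz]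
    rw [this]
    apply Finset.sum_le_sum
    intro y _
    have h1 := csz_ge_one hE l y
    rw [div_le_one (by linarith)]
    calc gg R ρ l y ^ ρ ≤ gg R ρ l y ^ (1:ℝ) :=
          Real.rpow_le_rpow_of_exponent_le (gg_ge_one hE hm hρ l y) hρ1
      _ = gg R ρ l y := Real.rpow_one _
      _ ≤ csz R l y := ih y

lemma R_le (l k : ℕ) (h : l ≤ k) {x y : X} (hR : R l x y) : R k x y := by
  induction k, h using Nat.le_induction with
  | base => exact hR
  | succ k _ ih => exact hm _ _ _ ih

lemma MM_congr {h l : ℕ} {x y : X} (hR : R l x y) : MM R ρ h l y = MM R ρ h l x := by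
  unfold MM
  apply Finset.prod_congr rfl
  intro m hm'
  have h1 := (Finset.mem_Ico.mp hm').1
  rw [gg_congr hE (R_le hE hm l m h1 hR), gg_congr hE (R_le hE hm l (m+1) (by omega) hR)]

lemma MM_pos (hρ : 0 ≤ ρ) (h l : ℕ) (x : X) : 0 < MM R ρ h l x := by
  unfold MM
  apply Finset.prod_pos
  intro m _
  have h1 := gg_ge_one hE hm hρ m x
  have h2 := gg_ge_one hE hm hρ (m+1) x
  positivity

lemma nu_pos (hρ : 0 ≤ ρ) (h : ℕ) (x : X) : 0 < nu R ρ h x := by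
  unfold nu
  have := csz_ge_one hE 0 x
  have := MM_pos hE hm hρ h 0 x
  positivity

lemma MM_succ {h l : ℕ} (hl : l < h) (x : X) :
    MM R ρ h l x = gg R ρ l x ^ ρ / gg R ρ (l+1) x * MM R ρ h (l+1) x := by
  unfold MM
  rw [Finset.prod_eq_prod_Ico_succ_bot hl]

lemma nu_class (hρ : 0 ≤ ρ) (h l : ℕ) (hl : l ≤ h) (x : X) :
    ∑ y ∈ cl R l x, nu R ρ h y = MM R ρ h l x := by
  induction l generalizing x with
  | zero =>
    have : ∀ y ∈ cl R 0 x, nu R ρ h y = nu R ρ h x := by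
      intro y hy
      unfold nu
      rw [csz_congr hE (mem_cl.mp hy), MM_congr hE hm (mem_cl.mp hy)]
    rw [Finset.sum_congr rfl this, Finset.sum_const, nsmul_eq_mul]
    unfold nu
    change csz R 0 x * _ = _
    have := csz_ge_one hE 0 x
    field_simp
  | succ l ih =>
    rw [sum_avg hE l _ (cl_sat hE hm l x)]
    have : ∀ y ∈ cl R (l+1) x, (∑ z ∈ cl R l y, nu R ρ h z) / csz R l y =
        (gg R ρ l y ^ ρ / csz R l y) * (MM R ρ h (l+1) x / gg R ρ (l+1) x) := by
      intro y hy
      rw [ih (by omega) y, MM_succ hE hm (by omega) y, MM_congr hE hm (mem_cl.mp hy),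
        gg_congr hE (mem_cl.mp hy)]
      ring
    rw [Finset.sum_congr rfl this, ← Finset.sum_mul]
    change gg R ρ (l+1) x * _ = _
    have := gg_ge_one hE hm hρ (l+1) x
    field_simp

lemma nu_sum (hρ : 0 ≤ ρ) (h : ℕ) (htot : ∀ x y, R h x y) [Nonempty X] :
    ∑ y, nu R ρ h y = 1 := by
  obtain ⟨x⟩ := (inferInstance : Nonempty X)
  have := nu_class hE hm hρ h h le_rfl x
  have h2 : cl R h x = Finset.univ := by ext y; simp [mem_cl, htot]
  rw [h2] at this
  rw [this]; simp [MM]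

omit hE hm in
/-- expectations of log g -/
noncomputable def phi (R : ℕ → X → X → Prop) (ρ : ℝ) (h l : ℕ) : ℝ :=
  ∑ x, nu R ρ h x * Real.log (gg R ρ l x)

omit hE hm in
/-- entropy at level `l` -/
noncomputable def HH (R : ℕ → X → X → Prop) (ρ : ℝ) (h l : ℕ) : ℝ :=
  ∑ x, nu R ρ h x * (-Real.log (∑ y ∈ cl R l x, nu R ρ h y))

lemma HH_sub (hρ : 0 ≤ ρ) (h l : ℕ) (hl : l < h) :
    HH R ρ h l - HH R ρ h (l+1) = phi R ρ h (l+1) - ρ * phi R ρ h l := by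
  unfold HH phi
  rw [← Finset.sum_sub_distrib, Finset.mul_sum, ← Finset.sum_sub_distrib]
  apply Finset.sum_congr rfl
  intro x _
  have h1 := gg_ge_one hE hm hρ l x
  have h2 := gg_ge_one hE hm hρ (l+1) x
  have h3 := MM_pos hE hm hρ h (l+1) x
  have h4 : 0 < gg R ρ l x ^ ρ := by positivity
  rw [nu_class hE hm hρ h l hl.le, nu_class hE hm hρ h (l+1) hl, MM_succ hE hm hl,
    Real.log_mul (by positivity) h3.ne', Real.log_div h4.ne' (by positivity),
    Real.log_rpow (by linarith)]
  ring

lemma phi_jensen (hρ : 0 ≤ ρ) (hρ1 : ρ ≤ 1) (h l : ℕ) (hl : l < h) (htot : ∀ x y, R h x y)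
    [Nonempty X] :
    (1 - ρ) * phi R ρ h l ≤
      (∑ x, nu R ρ h x * Real.log (csz R (l+1) x)) - phi R ρ h (l+1) := by
  have key : ∑ x, nu R ρ h x * (gg R ρ l x ^ (1 - ρ) * gg R ρ (l+1) x / csz R (l+1) x) ≤ 1 := by
    rw [sum_avg hE l _ (fun x _ y _ => Finset.mem_univ y)]
    have e : ∀ x, (∑ z ∈ cl R l x, nu R ρ h z *
        (gg R ρ l z ^ (1 - ρ) * gg R ρ (l+1) z / csz R (l+1) z)) / csz R l x ≤
        MM R ρ h (l+1) x / csz R (l+1) x := by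
      intro x
      have : ∀ z ∈ cl R l x, nu R ρ h z *
        (gg R ρ l z ^ (1 - ρ) * gg R ρ (l+1) z / csz R (l+1) z) = nu R ρ h z *
        (gg R ρ l x ^ (1 - ρ) * gg R ρ (l+1) x / csz R (l+1) x) := by
        intro z hz
        have hz1 := mem_cl.mp hz
        rw [gg_congr hE hz1, gg_congr hE (hm _ _ _ hz1), csz_congr hE (hm _ _ _ hz1)]
      rw [Finset.sum_congr rfl this, ← Finset.sum_mul, nu_class hE hm hρ h l hl.le,
        MM_succ hE hm hl]
      have h1 := gg_ge_one hE hm hρ l x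
      have h2 := gg_ge_one hE hm hρ (l+1) x
      have h3 := MM_pos hE hm hρ h (l+1) x
      have h4 := csz_ge_one hE l x
      have h5 := csz_ge_one hE (l+1) x
      have h6 : gg R ρ l x ^ ρ * gg R ρ l x ^ (1 - ρ) = gg R ρ l x := by
        rw [← Real.rpow_add (by linarith)]; simp
      have h7 := gg_le_csz hE hm hρ hρ1 l x
      calc _ = (gg R ρ l x ^ ρ * gg R ρ l x ^ (1 - ρ)) / csz R l x *
            (MM R ρ h (l+1) x / csz R (l+1) x) := by field_simp
        _ ≤ 1 * (MM R ρ h (l+1) x / csz R (l+1) x) := by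
            rw [h6]
            apply mul_le_mul_of_nonneg_right _ (by positivity)
            rw [div_le_one (by linarith)]; exact h7
        _ = _ := one_mul _
    refine (Finset.sum_le_sum (fun x _ => e x)).trans ?_
    have e2 : ∀ x ∈ (Finset.univ : Finset X), MM R ρ h (l+1) x / csz R (l+1) x =
        (∑ z ∈ cl R (l+1) x, nu R ρ h z) / csz R (l+1) x := by
      intro x _; rw [nu_class hE hm hρ h (l+1) hl]
    rw [Finset.sum_congr rfl e2, ← sum_avg hE (l+1) _ (fun x _ y _ => Finset.mem_univ y),
      nu_sum hE hm hρ h htot]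
  have key2 : ∑ x, nu R ρ h x * Real.log (gg R ρ l x ^ (1 - ρ) * gg R ρ (l+1) x / csz R (l+1) x)
      ≤ 0 := by
    calc _ ≤ ∑ x, nu R ρ h x * (gg R ρ l x ^ (1 - ρ) * gg R ρ (l+1) x / csz R (l+1) x - 1) := by
          apply Finset.sum_le_sum
          intro x _
          apply mul_le_mul_of_nonneg_left _ (nu_pos hE hm hρ h x).le
          apply Real.log_le_sub_one_of_pos
          have h1 := gg_ge_one hE hm hρ l x
          have h2 := gg_ge_one hE hm hρ (l+1) x
          have h5 := csz_ge_one hE (l+1) x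
          positivity
      _ ≤ 0 := by
          simp only [mul_sub, mul_one, Finset.sum_sub_distrib]
          rw [nu_sum hE hm hρ h htot]; linarith
  have e3 : ∀ x ∈ (Finset.univ : Finset X), nu R ρ h x * Real.log (gg R ρ l x ^ (1 - ρ) *
      gg R ρ (l+1) x / csz R (l+1) x) = (1 - ρ) * (nu R ρ h x * Real.log (gg R ρ l x))
      + nu R ρ h x * Real.log (gg R ρ (l+1) x) - nu R ρ h x * Real.log (csz R (l+1) x) := by
    intro x _
    have h1 := gg_ge_one hE hm hρ l x
    have h2 := gg_ge_one hE hm hρ (l+1) x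
    have h5 := csz_ge_one hE (l+1) x
    rw [Real.log_div (by positivity) (by positivity), Real.log_mul (by positivity) (by positivity),
      Real.log_rpow (by linarith)]
    ring
  rw [Finset.sum_congr rfl e3, Finset.sum_sub_distrib, Finset.sum_add_distrib,
    ← Finset.mul_sum] at key2
  unfold phi
  linarith

omit hE hm in
lemma nu_symm (σ : X ≃ X) (hσ : ∀ l x y, R l (σ x) (σ y) ↔ R l x y) (h : ℕ) (x : X) :
    nu R ρ h (σ x) = nu R ρ h x := by
  have hcl : ∀ l x, cl R l (σ x) = (cl R l x).map σ.toEmbedding := by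
    intro l x; ext y
    rw [mem_cl, Finset.mem_map]
    constructor
    · intro hy
      refine ⟨σ.symm y, ?_, by simp⟩
      rw [mem_cl, ← hσ]; simpa using hy
    · rintro ⟨z, hz, rfl⟩
      exact (hσ _ _ _).mpr (mem_cl.mp hz)
  have hcs : ∀ l x, csz R l (σ x) = csz R l x := by
    intro l x; unfold csz; rw [hcl, Finset.card_map]
  have hg : ∀ l x, gg R ρ l (σ x) = gg R ρ l x := by
    intro l
    induction l with
    | zero => exact hcs 0
    | succ l ih =>
      intro x
      simp only [gg]
      rw [hcl, Finset.sum_map]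
      apply Finset.sum_congr rfl
      intro y _
      simp [ih, hcs]
  unfold nu MM
  simp only [hg, hcs]

end Chain
end FGK


namespace FGK
set_option linter.unusedSectionVars false

section Tree

/-- 0/1 functions on the leaves of the binary tree of depth `h` -/
abbrev XT (h : ℕ) := (Fin h → Bool) → Bool

/-- value of a bit -/
def bv (b : Bool) : ℚ := if b then 1 else 0

lemma bv_inj {a b : Bool} (h : bv a = bv b) : a = b := by
  cases a <;> cases b <;> simp_all [bv]

/-- congruence modulo functions of the first `l` bits -/
def RT (h l : ℕ) (x y : XT h) : Prop :=
  ∀ s s' : Fin h → Bool, (∀ i : Fin h, i.val < l → s i = s' i) →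
    bv (x s) - bv (y s) = bv (x s') - bv (y s')

lemma RT_equiv (h l : ℕ) : Equivalence (RT h l) := by
  refine ⟨fun x s s' _ => by simp, fun {x y} hxy s s' hs => ?_, fun {x y z} h1 h2 s s' hs => ?_⟩
  · have := hxy s s' hs; linarith
  · have a := h1 s s' hs; have b := h2 s s' hs; linarith

lemma RT_mono (h l : ℕ) (x y : XT h) (hr : RT h l x y) : RT h (l+1) x y :=
  fun s s' hs => hr s s' (fun i hi => hs i (by omega))

lemma RT_total (h : ℕ) (x y : XT h) : RT h h x y := by
  intro s s' hs
  have : s = s' := funext (fun i => hs i i.2)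
  rw [this]

/-- halves -/
def hf {h : ℕ} (b : Bool) (x : XT (h+1)) : XT h := fun s => x (Fin.cons b s)

lemma RT_succ (h l : ℕ) (x y : XT (h+1)) :
    RT (h+1) (l+1) x y ↔ ∀ b, RT h l (hf b x) (hf b y) := by
  constructor
  · intro hr b s s' hs
    apply hr
    intro i
    refine Fin.cases ?_ (fun j => ?_) i
    · intro _; simp
    · intro hj
      simp only [Fin.cons_succ]
      exact hs j (by simpa using hj)
  · intro hr s s' hs
    have h0 : s 0 = s' 0 := hs 0 (by simp)
    have := hr (s 0) (Fin.tail s) (Fin.tail s') (fun i hi => hs i.succ (by simpa using hi))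
    unfold hf at this
    rw [Fin.cons_self_tail] at this
    rw [h0, Fin.cons_self_tail] at this
    exact this

/-- splitting a function into halves -/
def splitX (h : ℕ) : XT (h+1) ≃ XT h × XT h where
  toFun x := (hf false x, hf true x)
  invFun p := fun s => if s 0 then p.2 (Fin.tail s) else p.1 (Fin.tail s)
  left_inv x := by
    funext s
    unfold hf
    by_cases h0 : s 0 = true
    · simp only [h0, if_true]
      conv_rhs => rw [← Fin.cons_self_tail s, h0]
    · have h1 : s 0 = false := by simpa using h0
      simp only [h1]
      conv_rhs => rw [← Fin.cons_self_tail s, h1]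
      simp
  right_inv p := by
    ext s <;> simp [hf]

lemma sum_cl_succ (h l : ℕ) (x : XT (h+1)) (F : XT h → XT h → ℝ) :
    ∑ y ∈ cl (RT (h+1)) (l+1) x, F (hf false y) (hf true y) =
      ∑ u ∈ cl (RT h) l (hf false x), ∑ v ∈ cl (RT h) l (hf true x), F u v := by
  rw [← Finset.sum_product']
  apply Finset.sum_bij (fun y _ => splitX h y)
  · intro y hy
    rw [mem_cl, RT_succ] at hy
    rw [Finset.mem_product, mem_cl, mem_cl]
    exact ⟨hy false, hy true⟩
  · intro a _ b _ hab; exact (splitX h).injective hab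
  · intro p hp
    refine ⟨(splitX h).symm p, ?_, by simp⟩
    rw [Finset.mem_product, mem_cl, mem_cl] at hp
    rw [mem_cl, RT_succ]
    have e := (splitX h).apply_symm_apply p
    have e1 : hf false ((splitX h).symm p) = p.1 := congrArg Prod.fst e
    have e2 : hf true ((splitX h).symm p) = p.2 := congrArg Prod.snd e
    intro b; cases b
    · rw [e1]; exact hp.1
    · rw [e2]; exact hp.2
  · intro y _; rfl

lemma csz_succ (h l : ℕ) (x : XT (h+1)) :
    csz (RT (h+1)) (l+1) x = csz (RT h) l (hf false x) * csz (RT h) l (hf true x) := by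
  have := sum_cl_succ h l x (fun _ _ => 1)
  simp only [Finset.sum_const, nsmul_eq_mul, mul_one] at this
  exact this

/-- functions depending on the first `l` bits only -/
def InV (h l : ℕ) (x : XT h) : Prop := RT h l (fun _ => false) x

lemma InV_succ (h l : ℕ) (x : XT (h+1)) :
    InV (h+1) (l+1) x ↔ ∀ b, InV h l (hf b x) := RT_succ h l _ x

lemma InV_zero (h : ℕ) (x : XT h) : InV h 0 x ↔ ∃ b, x = fun _ => b := by
  constructor
  · intro hx
    refine ⟨x (fun _ => false), funext fun s => ?_⟩
    have := hx s (fun _ => false) (by simp)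
    apply bv_inj
    linarith
  · rintro ⟨b, rfl⟩ s s' _; rfl

lemma cl_zero_InV (h : ℕ) (x : XT h) (hx : InV h 0 x) :
    cl (RT h) 0 x = {(fun _ => false), (fun _ => true)} := by
  rw [← cl_congr (RT_equiv h) hx |>.symm]
  ext y
  have : y ∈ cl (RT h) 0 (fun _ => false) ↔ InV h 0 y := mem_cl
  rw [this, InV_zero]
  simp only [Finset.mem_insert, Finset.mem_singleton]
  constructor
  · rintro ⟨b, rfl⟩; cases b <;> simp
  · rintro (h | h)
    · exact ⟨_, h⟩
    · exact ⟨_, h⟩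

lemma csz_zero_InV (h : ℕ) (x : XT h) (hx : InV h 0 x) : csz (RT h) 0 x = 2 := by
  unfold csz
  rw [cl_zero_InV h x hx, Finset.card_pair]
  · norm_num
  · intro h0; simpa using congrFun h0 (fun _ => false)

lemma csz_zero_not (h : ℕ) (x : XT h) (hx : ¬ InV h 0 x) : csz (RT h) 0 x = 1 := by
  have : cl (RT h) 0 x = {x} := by
    ext y
    rw [mem_cl, Finset.mem_singleton]
    constructor
    · intro hr
      by_contra hne
      apply hx
      -- some s with y s ≠ x s
      have : ∃ s, y s ≠ x s := by
        by_contra hall; push Not at hall; exact hne (funext hall)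
      obtain ⟨s0, hs0⟩ := this
      have key : ∀ s, x s = x s0 := by
        intro s
        have h1 := hr s s0 (by simp)
        revert h1 hs0
        cases x s <;> cases y s <;> cases x s0 <;> cases y s0 <;> simp [bv] <;> norm_num
      rw [InV_zero]
      exact ⟨x s0, funext key⟩
    · rintro rfl; exact (RT_equiv h 0).refl _
  unfold csz; rw [this]; simp

lemma InV_congr {h l : ℕ} {x y : XT h} (hr : RT h l x y) : InV h l x ↔ InV h l y :=
  ⟨fun h1 => (RT_equiv h l).trans h1 hr, fun h1 => (RT_equiv h l).trans h1 ((RT_equiv h l).symm hr)⟩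

lemma InV_mono {h l : ℕ} {x : XT h} (hx : InV h l x) : InV h (l+1) x := RT_mono h l _ _ hx

/-- the sum over `y` in `V_l` -/
lemma sum_InV (h l : ℕ) (x : XT h) :
    ∑ y ∈ cl (RT h) (l+1) x, (if InV h l y then 1 / csz (RT h) l y else 0) =
      if InV h (l+1) x then 1 else 0 := by
  have hE := RT_equiv h
  split_ifs with hx
  · rw [← Finset.sum_filter]
    have : (cl (RT h) (l+1) x).filter (fun y => InV h l y) = cl (RT h) l (fun _ => false) := by
      ext y
      simp only [Finset.mem_filter, mem_cl]
      constructor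
      · exact fun h => h.2
      · intro hy; exact ⟨(hE (l+1)).trans ((hE (l+1)).symm hx) (RT_mono _ _ _ _ hy), hy⟩
    rw [this, Finset.sum_congr rfl (g := fun _ => 1 / csz (RT h) l (fun _ => false))
      (fun y hy => by rw [csz_congr hE (mem_cl.mp hy)]), Finset.sum_const, nsmul_eq_mul]
    change csz (RT h) l (fun _ => false) * (1 / csz (RT h) l (fun _ => false)) = 1
    have := csz_ge_one hE l (fun _ => false)
    field_simp
  · apply Finset.sum_eq_zero
    intro y hy
    rw [if_neg]
    intro hy2
    exact hx ((InV_congr (mem_cl.mp hy)).mpr (InV_mono hy2))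

variable (ρ : ℝ) (b : ℕ → ℝ)

/-- correction terms -/
noncomputable def ecorr : ℕ → ℝ
  | 0 => (2:ℝ) ^ ρ - 2
  | l+1 => b (l+1) ^ ρ - (b l * b l) ^ ρ

lemma gg_tree (hρ : 0 ≤ ρ) (hb0 : b 0 = 2) (hb : ∀ l, b (l+1) = b l * b l + ecorr ρ b l) (l : ℕ) :
    (∀ h, l ≤ h → ∀ x : XT h, InV h l x → gg (RT h) ρ l x = b l) ∧
    (∀ h, l ≤ h → ∀ x : XT (h+1), gg (RT (h+1)) ρ (l+1) x =
      gg (RT h) ρ l (hf false x) * gg (RT h) ρ l (hf true x) +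
      if InV (h+1) (l+1) x then ecorr ρ b l else 0) := by
  induction l with
  | zero =>
    refine ⟨fun h _ x hx => ?_, fun h _ x => ?_⟩
    · rw [hb0]; exact csz_zero_InV h x hx
    · simp only [gg]
      rw [← csz_succ]
      have e : ∀ y ∈ cl (RT (h+1)) (0+1) x, csz (RT (h+1)) 0 y ^ ρ / csz (RT (h+1)) 0 y =
          1 + ((2:ℝ)^ρ - 2) * (if InV (h+1) 0 y then 1 / csz (RT (h+1)) 0 y else 0) := by
        intro y _
        by_cases hy : InV (h+1) 0 y
        · rw [if_pos hy, csz_zero_InV _ _ hy]; ring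
        · rw [if_neg hy, csz_zero_not _ _ hy]; simp
      rw [Finset.sum_congr rfl e, Finset.sum_add_distrib, ← Finset.mul_sum, sum_InV]
      simp only [Finset.sum_const, nsmul_eq_mul, mul_one, mul_ite, mul_zero, ecorr]
      rfl
  | succ l ih =>
    have p1 : ∀ h, l + 1 ≤ h → ∀ x : XT h, InV h (l+1) x → gg (RT h) ρ (l+1) x = b (l+1) := by
      intro h hl x hx
      obtain ⟨h, rfl⟩ : ∃ h', h = h' + 1 := ⟨h - 1, by omega⟩
      rw [ih.2 h (by omega) x, if_pos hx, hb]
      rw [InV_succ] at hx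
      rw [ih.1 h (by omega) _ (hx false), ih.1 h (by omega) _ (hx true)]
    refine ⟨p1, fun h hl x => ?_⟩
    obtain ⟨h, rfl⟩ : ∃ h', h = h' + 1 := ⟨h - 1, by omega⟩
    have hE := RT_equiv (h+1)
    have e : ∀ y ∈ cl (RT (h+1+1)) (l+1+1) x,
        gg (RT (h+1+1)) ρ (l+1) y ^ ρ / csz (RT (h+1+1)) (l+1) y =
        (gg (RT (h+1)) ρ l (hf false y) ^ ρ / csz (RT (h+1)) l (hf false y)) *
        (gg (RT (h+1)) ρ l (hf true y) ^ ρ / csz (RT (h+1)) l (hf true y))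
        + ecorr ρ b (l+1) * (if InV (h+1+1) (l+1) y then 1 / csz (RT (h+1+1)) (l+1) y else 0) := by
      intro y _
      have g0 := gg_ge_one hE (RT_mono (h+1)) hρ l (hf false y)
      have g1 := gg_ge_one hE (RT_mono (h+1)) hρ l (hf true y)
      have c0 := csz_ge_one hE l (hf false y)
      have c1 := csz_ge_one hE l (hf true y)
      by_cases hy : InV (h+1+1) (l+1) y
      · rw [if_pos hy, csz_succ, p1 (h+1+1) (by omega) y hy]
        rw [InV_succ] at hy
        rw [ih.1 (h+1) (by omega) _ (hy false), ih.1 (h+1) (by omega) _ (hy true)]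
        have hbl : 0 ≤ b l := by rw [← ih.1 (h+1) (by omega) _ (hy false)]; linarith
        simp only [ecorr]
        rw [Real.mul_rpow hbl hbl]
        field_simp
        ring
      · rw [if_neg hy, ih.2 (h+1) (by omega) y, if_neg hy, add_zero, mul_zero, add_zero, csz_succ,
          Real.mul_rpow (by linarith) (by linarith)]
        field_simp
    have hstep : gg (RT (h+1+1)) ρ (l+1+1) x = ∑ y ∈ cl (RT (h+1+1)) (l+1+1) x,
        gg (RT (h+1+1)) ρ (l+1) y ^ ρ / csz (RT (h+1+1)) (l+1) y := rfl
    rw [hstep, Finset.sum_congr rfl e, Finset.sum_add_distrib, ← Finset.mul_sum, sum_InV]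
    rw [sum_cl_succ (h+1) (l+1) x (fun u v => (gg (RT (h+1)) ρ l u ^ ρ / csz (RT (h+1)) l u) *
        (gg (RT (h+1)) ρ l v ^ ρ / csz (RT (h+1)) l v))]
    rw [← Finset.sum_mul_sum]
    simp only [mul_ite, mul_one, mul_zero]
    rfl

lemma gg_top (hρ : 0 ≤ ρ) (hb0 : b 0 = 2) (hb : ∀ l, b (l+1) = b l * b l + ecorr ρ b l)
    (h : ℕ) (x : XT h) : gg (RT h) ρ h x = b h :=
  (gg_tree ρ b hρ hb0 hb h).1 h le_rfl x (RT_total h _ _)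

lemma nsub_tree (l : ℕ) : ∀ h, l ≤ h → ∀ x : XT (h+1),
    csz (RT (h+1)) (l+1) x ^ (Real.log 3 / Real.log 4) ≤ nsub (RT (h+1)) l x := by
  have hβ1 : Real.log 3 / Real.log 4 ≤ 1 := by
    rw [div_le_one (Real.log_pos (by norm_num))]
    exact Real.log_le_log (by norm_num) (by norm_num)
  have hβ0 : 0 ≤ Real.log 3 / Real.log 4 :=
    div_nonneg (Real.log_nonneg (by norm_num)) (Real.log_nonneg (by norm_num))
  induction l with
  | zero =>
    intro h _ x
    have hn : nsub (RT (h+1)) 0 x = csz (RT (h+1)) 1 x + if InV (h+1) 1 x then -1 else 0 := by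
      unfold nsub
      have e : ∀ y ∈ cl (RT (h+1)) (0+1) x, 1 / csz (RT (h+1)) 0 y =
          1 + (-1) * (if InV (h+1) 0 y then 1 / csz (RT (h+1)) 0 y else 0) := by
        intro y _
        by_cases hy : InV (h+1) 0 y
        · rw [if_pos hy, csz_zero_InV _ _ hy]; norm_num
        · rw [if_neg hy, csz_zero_not _ _ hy]; simp
      rw [Finset.sum_congr rfl e, Finset.sum_add_distrib, ← Finset.mul_sum, sum_InV]
      simp [csz]
    rw [hn]
    have hc := csz_ge_one (RT_equiv (h+1)) 1 x
    by_cases hx : InV (h+1) 1 x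
    · have h4 : csz (RT (h+1)) 1 x = 4 := by
        rw [csz_succ]
        rw [InV_succ] at hx
        rw [csz_zero_InV _ _ (hx _), csz_zero_InV _ _ (hx _)]; norm_num
      rw [if_pos hx, zero_add, h4]
      have : (4:ℝ) ^ (Real.log 3 / Real.log 4) = 3 := by
        rw [Real.rpow_def_of_pos (by norm_num), mul_div_cancel₀ _ (Real.log_pos (by norm_num)).ne',
          Real.exp_log (by norm_num)]
      rw [this]; norm_num
    · rw [if_neg hx, add_zero]
      calc _ ≤ csz (RT (h+1)) (0+1) x ^ (1:ℝ) := Real.rpow_le_rpow_of_exponent_le hc hβ1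
        _ = _ := Real.rpow_one _
  | succ l ih =>
    intro h hl x
    obtain ⟨h, rfl⟩ : ∃ h', h = h' + 1 := ⟨h - 1, by omega⟩
    have hE := RT_equiv (h+1)
    have hn : nsub (RT (h+1+1)) (l+1) x = nsub (RT (h+1)) l (hf false x) *
        nsub (RT (h+1)) l (hf true x) := by
      unfold nsub
      rw [Finset.sum_mul_sum, ← sum_cl_succ (h+1) (l+1) x
        (fun u v => 1 / csz (RT (h+1)) l u * (1 / csz (RT (h+1)) l v))]
      apply Finset.sum_congr rfl
      intro y _
      rw [csz_succ]
      have c0 := csz_ge_one hE l (hf false y)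
      have c1 := csz_ge_one hE l (hf true y)
      field_simp
    have c0 := csz_ge_one hE (l+1) (hf false x)
    have c1 := csz_ge_one hE (l+1) (hf true x)
    rw [hn, csz_succ, Real.mul_rpow (by linarith) (by linarith)]
    apply mul_le_mul (ih h (by omega) _) (ih h (by omega) _) (by positivity)
    exact zero_le_one.trans (nsub_ge_one hE (RT_mono (h+1)) l _)

lemma phi_decay (hρ : 0 ≤ ρ) (hρ1 : ρ ≤ 1/3) (J l : ℕ) (hl : l < J) :
    phi (RT J) ρ J l ≤ 2/5 * phi (RT J) ρ J (l+1) := by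
  have hE := RT_equiv J
  have hm := RT_mono J
  have h1 := phi_jensen hE hm hρ (by linarith) J l hl (RT_total J)
  have h34 : 15 * Real.log 4 ≤ 19 * Real.log 3 := by
    have : Real.log ((4:ℝ)^15) ≤ Real.log ((3:ℝ)^19) := Real.log_le_log (by norm_num) (by norm_num)
    rw [Real.log_pow, Real.log_pow] at this
    exact_mod_cast this
  have l3 : 0 < Real.log 3 := Real.log_pos (by norm_num)
  have l4 : 0 < Real.log 4 := Real.log_pos (by norm_num)
  have h2 : ∑ x, nu (RT J) ρ J x * Real.log (csz (RT J) (l+1) x) ≤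
      19/15 * phi (RT J) ρ J (l+1) := by
    unfold phi
    rw [Finset.mul_sum]
    apply Finset.sum_le_sum
    intro x _
    obtain ⟨h, rfl⟩ : ∃ h', J = h' + 1 := ⟨J - 1, by omega⟩
    have a1 := nsub_tree l h (by omega) x
    have a2 := gg_ge_nsub hE hm hρ l x
    have a3 := csz_ge_one hE (l+1) x
    have a4 := Real.log_le_log (by positivity) (a1.trans a2)
    rw [Real.log_rpow (by linarith)] at a4
    have a5 : Real.log (csz (RT (h+1)) (l+1) x) ≤
        19/15 * Real.log (gg (RT (h+1)) ρ (l+1) x) := by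
      have b0 : 0 ≤ Real.log (csz (RT (h+1)) (l+1) x) := Real.log_nonneg a3
      have b1 : (15:ℝ)/19 ≤ Real.log 3 / Real.log 4 := by
        rw [div_le_div_iff₀ (by norm_num) l4]; linarith
      nlinarith [mul_le_mul_of_nonneg_right b1 b0]
    have := mul_le_mul_of_nonneg_left a5 (nu_pos hE hm hρ (h+1) x).le
    linarith
  have h3 : 0 ≤ phi (RT J) ρ J l := by
    unfold phi
    apply Finset.sum_nonneg
    intro x _
    exact mul_nonneg (nu_pos hE hm hρ J x).le (Real.log_nonneg (gg_ge_one hE hm hρ l x))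
  nlinarith

end Tree
end FGK


namespace FGK
set_option linter.unusedSectionVars false

section Clusters

lemma prod_sum_fn {S X : Type*} [Fintype S] [DecidableEq S] [Fintype X] (f : S → X → ℝ) :
    ∑ ω : S → X, ∏ s, f s (ω s) = ∏ s, ∑ x, f s x := by
  rw [Finset.prod_univ_sum]
  simp

lemma prod_marginal {S X : Type*} [Fintype S] [DecidableEq S] [Fintype X] (ν : X → ℝ) (h1 : ∑ x, ν x = 1)
    (F : X → ℝ) (s0 : S) :
    ∑ ω : S → X, (∏ s, ν (ω s)) * F (ω s0) = ∑ x, ν x * F x := by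
  have : ∀ ω : S → X, (∏ s, ν (ω s)) * F (ω s0) =
      ∏ s, (fun s x => ν x * if s = s0 then F x else 1) s (ω s) := by
    intro ω
    simp only [Finset.prod_mul_distrib]
    congr 1
    rw [Finset.prod_eq_single s0]
    · simp
    · intro b _ hb; simp [hb]
    · simp
  simp_rw [this]
  rw [prod_sum_fn (fun s x => ν x * if s = s0 then F x else 1)]
  rw [Finset.prod_eq_single s0]
  · simp
  · intro b _ hb; simp [hb, h1]
  · simp

/-- vector of a 0/1 function -/
def vecX {r : ℕ} (ω : XT r) : (Fin r → Bool) → ℚ := fun s => bv (ω s)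

/-- agreement on the first `l` bits -/
def agr {r : ℕ} (l : ℕ) (x y : Fin r → Bool) : Prop := ∀ i : Fin r, i.val < l → x i = y i

/-- functions of the first `i` bits -/
def VV (r i : ℕ) : Submodule ℚ ((Fin r → Bool) → ℚ) where
  carrier := {f | ∀ x y, agr i x y → f x = f y}
  zero_mem' := by intro x y _; rfl
  add_mem' := by intro f g hf hg x y h; simp [hf x y h, hg x y h]
  smul_mem' := by intro c f hf x y h; simp [hf x y h]

lemma mem_VV {r i : ℕ} {f : (Fin r → Bool) → ℚ} : f ∈ VV r i ↔ ∀ x y, agr i x y → f x = f y :=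
  Iff.rfl

lemma VV_mono (r : ℕ) : Monotone (VV r) := by
  intro i j hij f hf x y h
  exact hf x y (fun t ht => h t (by omega))

lemma VV_top (r : ℕ) : VV r r = ⊤ := by
  rw [eq_top_iff]
  intro f _ x y h
  have : x = y := funext fun i => h i i.2
  rw [this]

/-- initial segment -/
def pre {r a : ℕ} (h : a ≤ r) (x : Fin r → Bool) : Fin a → Bool := fun i => x (Fin.castLE h i)

/-- middle bits -/
def mid {r a h : ℕ} (hr : a + h ≤ r) (x : Fin r → Bool) : Fin h → Bool :=
  fun i => x ⟨a + i, by omega⟩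

/-- joining -/
def join (r a h : ℕ) (s : Fin a → Bool) (t : Fin h → Bool) : Fin r → Bool :=
  fun i => if h1 : i.val < a then s ⟨i, h1⟩ else if h2 : i.val - a < h then t ⟨i - a, h2⟩ else false

lemma pre_join {r a h : ℕ} (hr : a + h ≤ r) (s : Fin a → Bool) (t : Fin h → Bool) :
    pre (by omega : a ≤ r) (join r a h s t) = s := by
  funext i; simp [pre, join]

lemma mid_join {r a h : ℕ} (hr : a + h ≤ r) (s : Fin a → Bool) (t : Fin h → Bool) :
    mid hr (join r a h s t) = t := by
  funext i; simp [mid, join]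

lemma finrank_VV (r i : ℕ) (hi : i ≤ r) : Module.finrank ℚ (VV r i) = 2 ^ i := by
  let e : VV r i ≃ₗ[ℚ] ((Fin i → Bool) → ℚ) :=
    { toFun := fun f s => f.1 (join r i 0 s (fun _ => false))
      map_add' := by intro f g; rfl
      map_smul' := by intro c f; rfl
      invFun := fun g => ⟨fun x => g (pre hi x), by
        intro x y h
        have : pre hi x = pre hi y := by
          funext t; exact h _ (by simp)
        simp only [this]⟩
      left_inv := by
        intro f; ext x
        apply f.2
        intro t ht
        simp [join, ht, pre]
      right_inv := by
        intro g; funext s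
        simp only
        rw [pre_join (h := 0) (by omega)] }
  rw [e.finrank_eq]
  simp

variable {r a h : ℕ} (hr : a + h ≤ r)

/-- cluster configurations as 0/1 functions on the leaves -/
def emb (ω : (Fin a → Bool) → XT h) : XT r := fun x => ω (pre (by omega : a ≤ r) x) (mid hr x)

lemma emb_mem (l : ℕ) (ω ω' : (Fin a → Bool) → XT h) :
    vecX (emb hr ω) - vecX (emb hr ω') ∈ VV r (a + l) ↔ ∀ s, RT h l (ω s) (ω' s) := by
  constructor
  · intro H s t t' htt
    have := H (join r a h s t) (join r a h s t') (by
      intro i hi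
      unfold join
      split_ifs with h1 h2
      · rfl
      · exact htt _ (by simp; omega)
      · rfl)
    simpa [vecX, emb, pre_join hr, mid_join hr] using this
  · intro H x y hxy
    have e1 : pre (by omega : a ≤ r) x = pre (by omega : a ≤ r) y := by
      funext i; exact hxy _ (by simp; omega)
    have := H (pre (by omega : a ≤ r) x) (mid hr x) (mid hr y) (by
      intro i hi; exact hxy _ (by simp; omega))
    simpa [vecX, emb, e1] using this

/-- product Gibbs measure -/
noncomputable def cnu (ρ : ℝ) (a h : ℕ) (ω : (Fin a → Bool) → XT h) : ℝ := ∏ s, nu (RT h) ρ h (ω s)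

variable {ρ : ℝ} (hρ : 0 ≤ ρ)

include hρ in
lemma cnu_pos (ω : (Fin a → Bool) → XT h) : 0 < cnu ρ a h ω :=
  Finset.prod_pos fun _ _ => nu_pos (RT_equiv h) (RT_mono h) hρ h _

include hρ in
lemma nuT_sum (h : ℕ) : ∑ x, nu (RT h) ρ h x = 1 :=
  nu_sum (RT_equiv h) (RT_mono h) hρ h (RT_total h)

include hρ in
lemma cnu_sum : ∑ ω, cnu ρ a h ω = 1 := by
  unfold cnu
  rw [prod_sum_fn (fun _ x => nu (RT h) ρ h x)]
  simp [nuT_sum hρ]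

lemma cnu_cmass (l : ℕ) (ω : (Fin a → Bool) → XT h) :
    cmass (cnu ρ a h) (fun ω => vecX (emb hr ω)) (VV r (a+l)) ω =
      ∏ s, ∑ y ∈ cl (RT h) l (ω s), nu (RT h) ρ h y := by
  unfold cmass
  simp_rw [emb_mem hr l]
  have : ∀ s, ∑ y ∈ cl (RT h) l (ω s), nu (RT h) ρ h y =
      ∑ y, (if RT h l y (ω s) then nu (RT h) ρ h y else 0) := by
    intro s
    unfold cl
    rw [Finset.sum_filter]
    refine Finset.sum_congr rfl fun y _ => ?_
    simp only [show RT h l (ω s) y ↔ RT h l y (ω s) from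
      ⟨fun q => (RT_equiv h l).symm q, fun q => (RT_equiv h l).symm q⟩]
  simp_rw [this]
  rw [← prod_sum_fn (fun s y => if RT h l y (ω s) then nu (RT h) ρ h y else 0)]
  refine Finset.sum_congr rfl fun ω' _ => ?_
  unfold cnu
  by_cases H : ∀ s, RT h l (ω' s) (ω s)
  · simp [H]
  · rw [if_neg H]
    push Not at H
    obtain ⟨s, hs⟩ := H
    rw [Finset.prod_eq_zero (Finset.mem_univ s)]
    simp [hs]

include hρ in
lemma cnu_ent (l : ℕ) :
    ent (cnu ρ a h) (fun ω => vecX (emb hr ω)) (VV r (a+l)) = 2^a * HH (RT h) ρ h l := by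
  unfold ent
  simp_rw [cnu_cmass hr]
  have hpos : ∀ x : XT h, 0 < ∑ y ∈ cl (RT h) l x, nu (RT h) ρ h y := by
    intro x
    apply Finset.sum_pos (fun y _ => nu_pos (RT_equiv h) (RT_mono h) hρ h y)
    exact ⟨x, mem_cl.2 ((RT_equiv h l).refl x)⟩
  have : ∀ ω : (Fin a → Bool) → XT h, cnu ρ a h ω *
      (-Real.log (∏ s, ∑ y ∈ cl (RT h) l (ω s), nu (RT h) ρ h y)) =
      ∑ s0, (∏ s, nu (RT h) ρ h (ω s)) *
        (fun x => -Real.log (∑ y ∈ cl (RT h) l x, nu (RT h) ρ h y)) (ω s0) := by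
    intro ω
    rw [Real.log_prod (fun s _ => (hpos _).ne')]
    rw [← Finset.mul_sum, Finset.sum_neg_distrib]; rfl
  simp_rw [this]
  rw [Finset.sum_comm]
  simp_rw [prod_marginal _ (nuT_sum hρ h) (fun x => -Real.log (∑ y ∈ cl (RT h) l x, nu (RT h) ρ h y))]
  simp [HH]

end Clusters

section Flips

/-- conditional flip -/
noncomputable def cx {r : ℕ} (i : ℕ) (x0 m : Fin r → Bool) (x : Fin r → Bool) : Fin r → Bool :=
  if agr i x x0 then (fun t => xor (x t) (m t)) else x

variable {r : ℕ} {i : ℕ} {x0 m : Fin r → Bool} (hm : ∀ t : Fin r, t.val < i → m t = false)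

include hm in
lemma cx_agr_iff (x : Fin r → Bool) : agr i (cx i x0 m x) x0 ↔ agr i x x0 := by
  unfold cx
  split_ifs with H
  · refine ⟨fun _ => H, fun _ t ht => ?_⟩
    simp [hm t ht, H t ht]
  · rfl

include hm in
lemma cx_invol (x : Fin r → Bool) : cx i x0 m (cx i x0 m x) = x := by
  have := cx_agr_iff (x0 := x0) hm x
  by_cases H : agr i x x0
  · have H2 := this.2 H
    rw [cx, if_pos H2]
    rw [cx, if_pos H]
    funext t; simp
  · have H2 : ¬ agr i (cx i x0 m x) x0 := fun q => H (this.1 q)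
    rw [cx, if_neg H2]
    rw [cx, if_neg H]

include hm in
lemma cx_agr_imp (l : ℕ) (x y : Fin r → Bool) (h : agr l x y) : agr l (cx i x0 m x) (cx i x0 m y) := by
  by_cases hl : l ≤ i
  · have : ∀ z : Fin r → Bool, ∀ t : Fin r, t.val < l → cx i x0 m z t = z t := by
      intro z t ht
      unfold cx
      split_ifs
      · simp [hm t (by omega)]
      · rfl
    intro t ht
    rw [this _ t ht, this _ t ht, h t ht]
  · have : agr i x x0 ↔ agr i y x0 := by
      constructor
      · intro q t ht; rw [← h t (by omega), q t ht]
      · intro q t ht; rw [h t (by omega), q t ht]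
    intro t ht
    unfold cx
    by_cases H : agr i x x0
    · rw [if_pos H, if_pos (this.1 H)]; simp [h t ht]
    · rw [if_neg H, if_neg (fun q => H (this.2 q))]; exact h t ht

/-- as an equivalence -/
noncomputable def cxE (hm : ∀ t : Fin r, t.val < i → m t = false) (x0 : Fin r → Bool) :
    (Fin r → Bool) ≃ (Fin r → Bool) where
  toFun := cx i x0 m
  invFun := cx i x0 m
  left_inv := cx_invol hm
  right_inv := cx_invol hm

/-- tree automorphism -/
def IsAut {h : ℕ} (T : (Fin h → Bool) ≃ (Fin h → Bool)) : Prop :=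
  ∀ l x y, agr l (T x) (T y) ↔ agr l x y

lemma cxE_aut : IsAut (cxE hm x0) := by
  intro l x y
  constructor
  · intro H
    have := cx_agr_imp (x0 := x0) hm l _ _ H
    simpa [cxE, cx_invol hm] using this
  · exact cx_agr_imp hm l x y

lemma nu_aut {h : ℕ} {ρ : ℝ} (T : (Fin h → Bool) ≃ (Fin h → Bool)) (hT : IsAut T) (x : XT h) :
    nu (RT h) ρ h (fun s => x (T s)) = nu (RT h) ρ h x := by
  have := nu_symm (R := RT h) (ρ := ρ) (Equiv.arrowCongr T.symm (Equiv.refl Bool)) (by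
    intro l x y
    constructor
    · intro H s s' hs
      have := H (T.symm s) (T.symm s') (by
        have := (hT l (T.symm s) (T.symm s')).1 (by simpa [agr] using hs)
        exact this)
      simpa [Equiv.arrowCongr] using this
    · intro H s s' hs
      have := H (T s) (T s') ((hT l s s').2 hs)
      simpa [Equiv.arrowCongr] using this) h x
  exact this

variable {a h : ℕ} (hr : a + h ≤ r)

/-- invariance of the cluster entropy -/
lemma ent_aut {ρ : ℝ} (T : (Fin r → Bool) ≃ (Fin r → Bool))
    (τ : (Fin a → Bool) ≃ (Fin a → Bool)) (κ : (Fin a → Bool) → ((Fin h → Bool) ≃ (Fin h → Bool)))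
    (hκ : ∀ s, IsAut (κ s)) (h1 : ∀ x, pre (by omega : a ≤ r) (T x) = τ (pre (by omega : a ≤ r) x))
    (h2 : ∀ x, mid hr (T x) = κ (pre (by omega : a ≤ r) x) (mid hr x))
    (W : Submodule ℚ ((Fin r → Bool) → ℚ)) :
    ent (cnu ρ a h) (fun ω => vecX (emb hr ω))
      (W.map ((LinearEquiv.funCongrLeft ℚ ℚ T : ((Fin r → Bool) → ℚ) ≃ₗ[ℚ] _) : _ →ₗ[ℚ] _)) =
    ent (cnu ρ a h) (fun ω => vecX (emb hr ω)) W := by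
  let σ0 : ((Fin a → Bool) → XT h) → ((Fin a → Bool) → XT h) := fun ω s t => ω (τ s) (κ s t)
  have hinj : Function.Injective σ0 := by
    intro ω ω' H
    funext s t
    have := congrFun (congrFun H (τ.symm s)) ((κ (τ.symm s)).symm t)
    simpa [σ0] using this
  let σ := Equiv.ofBijective σ0 (Finite.injective_iff_bijective.1 hinj)
  apply ent_map_of_symm _ σ
  · intro ω
    change cnu ρ a h (σ0 ω) = cnu ρ a h ω
    unfold cnu
    have : ∀ s, nu (RT h) ρ h (σ0 ω s) = nu (RT h) ρ h (ω (τ s)) := fun s => nu_aut _ (hκ s) _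
    simp_rw [this]
    exact Equiv.prod_comp τ (fun s => nu (RT h) ρ h (ω s))
  · intro ω
    funext x
    change bv (σ0 ω _ _) = bv (emb hr ω (T x))
    unfold emb
    rw [h1, h2]

end Flips
end FGK


namespace FGK
set_option linter.unusedSectionVars false

section Inv
variable {r : ℕ}

lemma agr_symm {l : ℕ} {x y : Fin r → Bool} (h : agr l x y) : agr l y x :=
  fun t ht => (h t ht).symm
lemma agr_trans {l : ℕ} {x y z : Fin r → Bool} (h : agr l x y) (h' : agr l y z) : agr l x z :=
  fun t ht => (h t ht).trans (h' t ht)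

/-- sign function at a node -/
noncomputable def Bz (i : Fin r) (z : Fin r → Bool) : (Fin r → Bool) → ℚ :=
  fun x => if agr i.val x z then (if x i then 1 else -1) else 0

lemma cx_zero (x0 m x : Fin r → Bool) : cx 0 x0 m x = fun t => xor (x t) (m t) := by
  unfold cx
  rw [if_pos]
  intro t ht; omega

lemma inv_VV (i : Fin r) (W : Submodule ℚ ((Fin r → Bool) → ℚ)) (h1 : VV r i.val ≤ W)
    (h2 : W ≤ VV r (i.val+1))
    (hx : ∀ m : Fin r → Bool, ∀ g ∈ W, (fun x => g (cx 0 x m x)) ∈ W)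
    (hc : ∀ x0 : Fin r → Bool, ∀ g ∈ W, (fun x => g (cx i.val x0 (fun t => decide (t = i)) x)) ∈ W) :
    W = VV r i.val ∨ W = VV r (i.val+1) := by
  by_cases hW : W ≤ VV r i.val
  · left; exact le_antisymm hW h1
  right
  apply le_antisymm h2
  have hW' : ∃ g ∈ W, g ∉ VV r i.val := by
    by_contra H; push Not at H; exact hW H
  obtain ⟨g, hgW, hgV⟩ := hW'
  rw [mem_VV] at hgV
  push Not at hgV
  obtain ⟨x0, y0, hxy, hne⟩ := hgV
  have hg1 := h2 hgW
  set c : ℚ := g (Function.update x0 i true) - g (Function.update x0 i false) with hcdef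
  have hval : ∀ x, agr i.val x x0 → ∀ b, x i = b → g x = g (Function.update x0 i b) := by
    intro x hx b hb
    apply hg1
    intro t ht
    by_cases hti : t = i
    · subst hti; simp [hb]
    · rw [Function.update_of_ne hti]
      exact hx t (by have : t.val ≠ i.val := fun q => hti (Fin.ext q)
                     omega)
  have hc0 : c ≠ 0 := by
    intro h0
    apply hne
    have e : g (Function.update x0 i true) = g (Function.update x0 i false) := by linarith [hcdef]
    rw [hval x0 (fun t _ => rfl) _ rfl, hval y0 (agr_symm hxy) _ rfl]
    cases x0 i <;> cases y0 i <;> simp [e]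
  have hB0 : Bz i x0 ∈ W := by
    have hD := W.sub_mem hgW (hc x0 g hgW)
    have : Bz i x0 = c⁻¹ • (g - fun x => g (cx i.val x0 (fun t => decide (t = i)) x)) := by
      funext x
      simp only [Bz, Pi.smul_apply, Pi.sub_apply, smul_eq_mul]
      by_cases H : agr i.val x x0
      · rw [if_pos H]
        have H2 : agr i.val (cx i.val x0 (fun t => decide (t = i)) x) x0 := by
          rw [cx_agr_iff]; exact H
          intro t ht
          simp only [decide_eq_false_iff_not]; intro q; rw [q] at ht; omega
        have e1 : cx i.val x0 (fun t => decide (t = i)) x i = !(x i) := by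
          unfold cx; rw [if_pos H]; simp
        rw [hval x H _ rfl, hval _ H2 _ e1]
        cases hxi : x i
        · simp only [Bool.not_false]
          rw [show g (Function.update x0 i false) - g (Function.update x0 i true) = -c by
            rw [hcdef]; ring]
          field_simp; simp
        · simp only [Bool.not_true]
          rw [← hcdef]
          field_simp; simp
      · rw [if_neg H]
        unfold cx; rw [if_neg H]; ring
    rw [this]
    exact W.smul_mem _ hD
  have hB : ∀ z, Bz i z ∈ W := by
    intro z
    have := hx (fun t => if t.val < i.val then xor (x0 t) (z t) else false) _ hB0
    convert this using 1
    funext x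
    unfold Bz cx
    have e0 : agr 0 x x := fun t ht => rfl
    simp only [if_pos e0, lt_irrefl, if_false, Bool.xor_false]
    have : agr i.val x z ↔ agr i.val (fun t => xor (x t) (if t.val < i.val then xor (x0 t) (z t) else false)) x0 := by
      unfold agr
      refine forall_congr' fun t => ?_
      refine imp_congr_right fun ht => ?_
      simp only [ht, if_true]
      cases x t <;> cases z t <;> cases x0 t <;> simp
    simp only [this]
  intro f hf
  set F : (Fin r → Bool) → ℚ := fun x =>
    (f (Function.update x i true) + f (Function.update x i false)) / 2 with hF
  set d : (Fin r → Bool) → ℚ := fun x =>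
    (f (Function.update x i true) - f (Function.update x i false)) / 2 with hd
  have hupd : ∀ b x y, agr i.val x y → f (Function.update x i b) = f (Function.update y i b) := by
    intro b x y hxy
    apply hf
    intro t ht
    by_cases hti : t = i
    · subst hti; simp
    · rw [Function.update_of_ne hti, Function.update_of_ne hti]
      exact hxy t (by have : t.val ≠ i.val := fun q => hti (Fin.ext q)
                      omega)
  have hFW : F ∈ W := by
    apply h1
    intro x y hxy
    simp only [hF, hupd _ x y hxy]
  have hdc : ∀ x y, agr i.val x y → d x = d y := by
    intro x y hxy
    simp only [hd, hupd _ x y hxy]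
  let N : (Fin r → Bool) → ℚ := fun x => ((Finset.univ.filter (fun z => agr i.val x z)).card : ℚ)
  have hN : ∀ x y, agr i.val x y → N x = N y := by
    intro x y hxy
    simp only [N]
    congr 2
    ext z
    simp only [Finset.mem_filter, Finset.mem_univ, true_and]
    exact ⟨fun q => agr_trans (agr_symm hxy) q, fun q => agr_trans hxy q⟩
  have hNpos : ∀ x, N x ≠ 0 := by
    intro x
    simp only [N]
    have : (Finset.univ.filter (fun z => agr i.val x z)).Nonempty := ⟨x, by simp [agr]⟩
    exact_mod_cast this.card_pos.ne'
  have key : f = F + ∑ z, (d z / N z) • Bz i z := by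
    funext x
    simp only [Pi.add_apply, Finset.sum_apply, Pi.smul_apply, smul_eq_mul, Bz]
    have : ∀ z, d z / N z * (if agr i.val x z then (if x i then (1:ℚ) else -1) else 0) =
        if agr i.val x z then d x / N x * (if x i then (1:ℚ) else -1) else 0 := by
      intro z
      by_cases H : agr i.val x z
      · simp only [H, if_true, hdc x z H, hN x z H]
      · simp [H]
    simp_rw [this]
    rw [← Finset.sum_filter, Finset.sum_const, nsmul_eq_mul]
    have hfx : f x = f (Function.update x i (x i)) := by simp
    change f x = F x + N x * _
    have := hNpos x
    rw [hfx]
    cases x i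
    · simp only [hF, hd]; field_simp; simp; ring
    · simp only [hF, hd]; field_simp; simp; ring
  rw [key]
  exact W.add_mem hFW (W.sum_mem fun z _ => W.smul_mem _ (hB z))

variable {a h : ℕ} (hr : a + h ≤ r) {ρ : ℝ} (hρ : 0 ≤ ρ)

include hρ in
lemma cluster_min (l : ℕ) (hl : l < h) (lam : ℝ)
    (hlam : lam * 2 ^ l ≤ HH (RT h) ρ h l - HH (RT h) ρ h (l+1))
    (W : Submodule ℚ ((Fin r → Bool) → ℚ)) (h1 : VV r (a+l) ≤ W) (h2 : W ≤ VV r (a+l+1)) :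
    lam * ((Module.finrank ℚ (VV r (a+l+1)) : ℝ) - Module.finrank ℚ W) ≤
      ent (cnu ρ a h) (fun ω => vecX (emb hr ω)) W -
      ent (cnu ρ a h) (fun ω => vecX (emb hr ω)) (VV r (a+l+1)) := by
  have har : a ≤ r := by omega
  let F : Set (((Fin r → Bool) → ℚ) ≃ₗ[ℚ] ((Fin r → Bool) → ℚ)) :=
    {f | ∃ T : (Fin r → Bool) ≃ (Fin r → Bool), f = LinearEquiv.funCongrLeft ℚ ℚ T ∧
      (∀ x, T (T x) = x) ∧ IsAut T ∧ ∃ (τ : (Fin a → Bool) ≃ (Fin a → Bool))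
      (κ : (Fin a → Bool) → ((Fin h → Bool) ≃ (Fin h → Bool))), (∀ s, IsAut (κ s)) ∧
      (∀ x, pre har (T x) = τ (pre har x)) ∧ (∀ x, mid hr (T x) = κ (pre har x) (mid hr x))}
  have hFV : ∀ f ∈ F, ∀ i, (VV r i).map (f : _ →ₗ[ℚ] _) = VV r i := by
    rintro f ⟨T, rfl, hTT, hT, -⟩ i
    have hle : (VV r i).map (((LinearEquiv.funCongrLeft ℚ ℚ T) :
        ((Fin r → Bool) → ℚ) ≃ₗ[ℚ] ((Fin r → Bool) → ℚ)) : _ →ₗ[ℚ] _) ≤ VV r i := by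
      rintro _ ⟨g, hg, rfl⟩ x y hxy
      exact hg _ _ ((hT i x y).2 hxy)
    apply le_antisymm hle
    intro g hg
    refine ⟨fun x => g (T x), ?_, ?_⟩
    · exact hle ⟨g, hg, rfl⟩
    · funext x
      change g (T (T x)) = g x
      rw [hTT]
  have hmem : ∀ (T : (Fin r → Bool) ≃ (Fin r → Bool)), (∀ x, T (T x) = x) →
      LinearEquiv.funCongrLeft ℚ ℚ T ∈ F →
      ∀ W : Submodule ℚ ((Fin r → Bool) → ℚ), (∀ f ∈ F, W ≤ W.map (f : _ →ₗ[ℚ] _)) →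
      ∀ g ∈ W, (fun x => g (T x)) ∈ W := by
    intro T hTT hTF W hW g hg
    obtain ⟨w, hw, he⟩ := hW _ hTF hg
    have : (fun x => g (T x)) = w := by
      funext x
      rw [← he]
      change w (T (T x)) = w x
      rw [hTT]
    rw [this]; exact hw
  have h0 : ∀ (n : ℕ) (m : Fin n → Bool) (t : Fin n), t.val < 0 → m t = false :=
    fun n m t ht => absurd ht (by omega)
  refine ent_min_invariant (cnu_pos hρ) (cnu_sum hρ) (VV r (a+l)) (VV r (a+l+1))
    (VV_mono r (by omega)) lam F ?_ (fun f hf => hFV f hf _) (fun f hf => hFV f hf _) ?_ ?_ W h1 h2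
  · rintro f ⟨T, rfl, hTT, hT, τ, κ, hκ, e1, e2⟩ W
    exact ent_aut hr T τ κ hκ e1 e2 W
  · intro W hA hB hinv
    have hi : a + l < r := by omega
    refine inv_VV ⟨a+l, hi⟩ W hA hB ?_ ?_
    · intro m g hg
      have := hmem (cxE (h0 r m) (fun _ => false)) (cx_invol (h0 r m)) ?_ W hinv g hg
      · convert this using 2
        rename_i x
        change _ = g (cx 0 _ m x)
        rw [cx_zero, cx_zero]
      · refine ⟨_, rfl, cx_invol (h0 r m), cxE_aut _, cxE (h0 a (pre har m)) (fun _ => false),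
          fun _ => cxE (h0 h (mid hr m)) (fun _ => false), fun s => cxE_aut _, ?_, ?_⟩
        · intro x
          change pre har (cx 0 _ m x) = cx 0 _ (pre har m) (pre har x)
          rw [cx_zero, cx_zero]
          rfl
        · intro x
          change mid hr (cx 0 _ m x) = cx 0 _ (mid hr m) (mid hr x)
          rw [cx_zero, cx_zero]
          rfl
    · intro x0 g hg
      set m : Fin r → Bool := fun t => decide (t = ⟨a+l, hi⟩) with hmdef
      have hm : ∀ t : Fin r, t.val < a + l → m t = false := by
        intro t ht
        simp only [hmdef, decide_eq_false_iff_not]; intro q; rw [q] at ht; simp at ht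
      have hm2 : ∀ t : Fin h, t.val < l → mid hr m t = false := by
        intro t ht
        exact hm _ (by simp; omega)
      refine hmem (cxE hm x0) (cx_invol hm) ?_ W hinv g hg
      refine ⟨_, rfl, cx_invol hm, cxE_aut _, Equiv.refl _,
        fun s => if s = pre har x0 then cxE hm2 (mid hr x0) else Equiv.refl _, ?_, ?_, ?_⟩
      · intro s
        beta_reduce
        split_ifs
        · exact cxE_aut _
        · intro l x y; rfl
      · intro x
        change pre har (cx _ x0 m x) = pre har x
        funext t
        change cx _ x0 m x _ = x _
        unfold cx
        split_ifs
        · simp only; rw [hm _ (by simp; omega)]; simp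
        · rfl
      · intro x
        change mid hr (cx _ x0 m x) = _
        beta_reduce
        split_ifs with H
        · change _ = cx l (mid hr x0) (mid hr m) (mid hr x)
          unfold cx
          have : agr (a+l) x x0 ↔ agr l (mid hr x) (mid hr x0) := by
            constructor
            · intro q t ht; exact q _ (by simp; omega)
            · intro q t ht
              by_cases hta : t.val < a
              · exact congrFun H ⟨t.val, hta⟩
              · have := q ⟨t.val - a, by omega⟩ (by simp; omega)
                simp only [mid] at this
                have e : (⟨a + (t.val - a), by omega⟩ : Fin r) = t := Fin.ext (by simp; omega)
                rw [e] at this; exact this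
          by_cases H2 : agr (a+l) x x0
          · rw [if_pos H2, if_pos (this.1 H2)]; rfl
          · rw [if_neg H2, if_neg (fun q => H2 (this.2 q))]
        · change _ = mid hr x
          have : ¬ agr (a+l) x x0 := by
            intro q; apply H
            funext t; exact q _ (by simp; omega)
          unfold cx
          rw [if_neg this]
  · rw [cnu_ent hr hρ, add_assoc, cnu_ent hr hρ, finrank_VV r _ (by omega), finrank_VV r _ (by omega)]
    push_cast
    have : lam * ((2:ℝ)^(a+(l+1)) - 2^(a+l)) = 2^a * (lam * 2^l) := by rw [pow_add, pow_add]; ring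
    rw [this, ← mul_sub]
    gcongr

end Inv
end FGK


namespace FGK
set_option linter.unusedSectionVars false

section Push
variable {Ω X : Type*} [Fintype Ω] [Fintype X]

/-- pushforward of a mass function -/
noncomputable def push (e : Ω → X) (ν : Ω → ℝ) (x : X) : ℝ := ∑ ω, if e ω = x then ν ω else 0

lemma push_sum (e : Ω → X) (ν : Ω → ℝ) (F : X → ℝ) :
    ∑ x, push e ν x * F x = ∑ ω, ν ω * F (e ω) := by
  unfold push
  simp_rw [Finset.sum_mul]
  rw [Finset.sum_comm]
  refine Finset.sum_congr rfl fun ω _ => ?_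
  rw [Finset.sum_eq_single (e ω)]
  · simp
  · intro b _ hb; simp [hb.symm]
  · simp

lemma push_nonneg (e : Ω → X) {ν : Ω → ℝ} (h : ∀ ω, 0 < ν ω) (x : X) : 0 ≤ push e ν x := by
  unfold push
  apply Finset.sum_nonneg; intro ω _; split_ifs; exact (h ω).le; exact le_rfl

lemma push_ne (e : Ω → X) {ν : Ω → ℝ} {x : X} (h : push e ν x ≠ 0) : ∃ ω, e ω = x := by
  by_contra H; push Not at H
  apply h; unfold push; simp [H]

lemma push_ent {E : Type*} [AddCommGroup E] [Module ℚ E] (e : Ω → X) (ν : Ω → ℝ) (vec : X → E)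
    (W : Submodule ℚ E) : ent (push e ν) vec W = ent ν (fun ω => vec (e ω)) W := by
  unfold ent
  rw [push_sum]
  refine Finset.sum_congr rfl fun ω _ => ?_
  congr 3
  unfold cmass
  have := push_sum e ν (fun x => if vec x - vec (e ω) ∈ W then 1 else 0)
  simpa using this

end Push

section ClusterLin
variable {r a h : ℕ} (hr : a + h ≤ r) {ρ : ℝ} (hρ : 0 ≤ ρ)

include hρ in
lemma cluster_lin (lam : ℕ → ℝ) (h0 : ∀ i < a, lam (i+1) = 0)
    (hlam : ∀ l < h, lam (a+l+1) * 2 ^ l ≤ HH (RT h) ρ h l - HH (RT h) ρ h (l+1))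
    (W : Submodule ℚ ((Fin r → Bool) → ℚ)) (hW : VV r 0 ≤ W) :
    ∑ i ∈ Finset.range (a+h), lam (i+1) * udim (VV r) (i+1) W ≤
      ent (push (emb hr) (cnu ρ a h)) vecX W := by
  rw [push_ent]
  refine ent_linear (cnu_pos hρ) (cnu_sum hρ) (VV r) (VV_mono r) (a+h) ?_ lam ?_ W hW
  · intro ω ω'
    rw [emb_mem hr]
    intro s; exact RT_total h _ _
  · intro i hi W h1 h2
    by_cases hia : i < a
    · rw [h0 i hia, zero_mul, sub_nonneg]
      exact ent_anti (cnu_pos hρ) h2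
    · obtain ⟨l, rfl⟩ : ∃ l, i = a + l := ⟨i - a, by omega⟩
      exact cluster_min hr hρ l (by omega) _ (hlam l (by omega)) W h1 h2

end ClusterLin

section Psi
variable (ρ : ℝ)

/-- normalised `E log g` -/
noncomputable def psi (J n : ℕ) : ℝ := 2 * phi (RT J) ρ J (J - n) / 2 ^ (J - n)

/-- entropy rates -/
noncomputable def lamf (J n : ℕ) : ℝ := if n < J then psi ρ J n - ρ/2 * psi ρ J (n+1) else 0

variable {ρ} (hρ : 0 < ρ) (hρ1 : ρ < 1/3)

include hρ

lemma psi_nonneg (J n : ℕ) : 0 ≤ psi ρ J n := by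
  unfold psi phi
  apply div_nonneg _ (by positivity)
  apply mul_nonneg (by norm_num)
  apply Finset.sum_nonneg
  intro x _
  exact mul_nonneg (nu_pos (RT_equiv J) (RT_mono J) hρ.le J x).le
    (Real.log_nonneg (gg_ge_one (RT_equiv J) (RT_mono J) hρ.le _ x))

include hρ1

lemma psi_succ (J n : ℕ) (hn : n < J) : psi ρ J (n+1) ≤ 4/5 * psi ρ J n := by
  have := phi_decay ρ hρ.le hρ1.le J (J - (n+1)) (by omega)
  unfold psi
  rw [show J - n = J - (n+1) + 1 by omega, pow_succ]
  set l := J - (n+1)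
  have h2 : (0:ℝ) < 2^l := by positivity
  rw [div_le_iff₀ h2]
  have : 4/5 * (2 * phi (RT J) ρ J (l+1) / (2^l * 2)) * 2^l = 2 * (2/5 * phi (RT J) ρ J (l+1)) := by
    field_simp; ring
  rw [this]; linarith

lemma lamf_nonneg (J n : ℕ) : 0 ≤ lamf ρ J n := by
  unfold lamf
  split_ifs with h
  · have := psi_succ hρ hρ1 J n h
    have := psi_nonneg hρ J n
    have := psi_nonneg hρ J (n+1)
    nlinarith
  · exact le_rfl

lemma lamf_le (J n : ℕ) : lamf ρ J n ≤ psi ρ J n := by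
  unfold lamf
  have := psi_nonneg hρ J n
  have := psi_nonneg hρ J (n+1)
  split_ifs with h
  · nlinarith
  · linarith

lemma lamf_HH (J l : ℕ) (hl : l < J) :
    lamf ρ J (J - (l+1)) * 2^l = HH (RT J) ρ J l - HH (RT J) ρ J (l+1) := by
  rw [HH_sub (RT_equiv J) (RT_mono J) hρ.le J l hl]
  unfold lamf psi
  rw [if_pos (by omega), show J - (J - (l+1)) = l + 1 by omega,
    show J - (J - (l+1) + 1) = l by omega, pow_succ]
  field_simp

variable {b : ℕ → ℝ} (hb0 : b 0 = 2) (hb : ∀ l, b (l+1) = b l * b l + ecorr ρ b l)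
include hb0 hb

lemma b_ge_one (l : ℕ) : 1 ≤ b l := by
  rw [← gg_top ρ b hρ.le hb0 hb l (fun _ => false)]
  exact gg_ge_one (RT_equiv l) (RT_mono l) hρ.le l _

lemma b_succ_le (l : ℕ) : b (l+1) ≤ b l * b l := by
  have : ecorr ρ b l ≤ 0 := by
    induction l with
    | zero =>
      simp only [ecorr]
      have : (2:ℝ)^ρ ≤ 2^(1:ℝ) := Real.rpow_le_rpow_of_exponent_le (by norm_num) (by linarith)
      rw [Real.rpow_one] at this; linarith
    | succ l ih =>
      simp only [ecorr]
      have h1 := hb l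
      have h2 := b_ge_one hρ hρ1 hb0 hb (l+1)
      have := Real.rpow_le_rpow (by linarith) (by linarith : b (l+1) ≤ b l * b l) hρ.le
      linarith
  rw [hb l]; linarith

lemma psi_zero (J : ℕ) : psi ρ J 0 = 2 * Real.log (b J) / 2^J := by
  unfold psi phi
  simp only [Nat.sub_zero, gg_top ρ b hρ.le hb0 hb]
  rw [← Finset.sum_mul, nuT_sum hρ.le, one_mul]

lemma psi_zero_anti : Antitone (fun J => psi ρ J 0) := by
  apply antitone_nat_of_succ_le
  intro J
  rw [psi_zero hρ hρ1 hb0 hb, psi_zero hρ hρ1 hb0 hb, pow_succ, div_le_div_iff₀ (by positivity) (by positivity)]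
  have h1 := b_ge_one hρ hρ1 hb0 hb (J+1)
  have h2 := b_ge_one hρ hρ1 hb0 hb J
  have := Real.log_le_log (by linarith) (b_succ_le hρ hρ1 hb0 hb J)
  rw [Real.log_mul (by linarith) (by linarith)] at this
  have h3 : (0:ℝ) < 2^J := by positivity
  nlinarith

lemma psi_zero_le (J : ℕ) (hJ : 1 ≤ J) : psi ρ J 0 ≤ 6/5 := by
  refine (psi_zero_anti hρ hρ1 hb0 hb hJ).trans ?_
  simp only
  rw [psi_zero hρ hρ1 hb0 hb, hb 0, hb0]
  simp only [ecorr]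
  have h1 : (2:ℝ)^ρ ≤ 63/50 := by
    have h2 : (2:ℝ)^ρ ≤ 2^(1/3:ℝ) := Real.rpow_le_rpow_of_exponent_le (by norm_num) hρ1.le
    refine h2.trans ?_
    have h3 : ((2:ℝ)^(1/3:ℝ))^3 = 2 := by
      rw [← Real.rpow_natCast, ← Real.rpow_mul (by norm_num)]; norm_num
    by_contra H
    push Not at H
    have : (63/50:ℝ)^3 < ((2:ℝ)^(1/3:ℝ))^3 := by gcongr
    rw [h3] at this; norm_num at this
  have h0 : (0:ℝ) < 2^ρ := by positivity
  have h2 : Real.log (2 * 2 + (2^ρ - 2)) ≤ 6/5 := by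
    rw [Real.log_le_iff_le_exp (by linarith)]
    have : (1 + (1/5) + (1/5)^2/2 : ℝ) ≤ Real.exp (1/5) := by
      have := Real.quadratic_le_exp_of_nonneg (x := 1/5) (by norm_num)
      linarith
    have h6 : Real.exp (6/5) = Real.exp (1/5) ^ 6 := by rw [← Real.exp_nat_mul]; norm_num
    rw [h6]
    have : (1 + (1/5) + (1/5)^2/2 : ℝ)^6 ≤ Real.exp (1/5)^6 := by gcongr
    norm_num at this ⊢
    linarith
  linarith

lemma psi_zero_ge (hlim : Tendsto (fun J : ℕ => (psi ρ J 0)⁻¹) atTop (𝓝 (1 - ρ/2))) (J : ℕ) :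
    1 ≤ (1 - ρ/2) * psi ρ J 0 := by
  have hpos : 0 < psi ρ J 0 := by
    have h0 := psi_nonneg hρ J 0
    rcases h0.lt_or_eq with h | h
    · exact h
    exfalso
    have hz : ∀ᶠ n in atTop, (psi ρ n 0)⁻¹ = 0 := by
      filter_upwards [eventually_ge_atTop J] with n hn
      have := psi_zero_anti hρ hρ1 hb0 hb hn
      simp only at this
      have h1 := psi_nonneg hρ n 0
      have : psi ρ n 0 = 0 := by linarith
      rw [this, inv_zero]
    have := tendsto_nhds_unique (Tendsto.congr' hz hlim) tendsto_const_nhds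
    linarith
  have : (psi ρ J 0)⁻¹ ≤ 1 - ρ/2 := by
    apply ge_of_tendsto hlim
    filter_upwards [eventually_ge_atTop J, hlim.eventually (lt_mem_nhds (show (0:ℝ) < 1 - ρ/2 by linarith))] with n hn hn2
    exact inv_anti₀ (inv_pos.1 hn2) (psi_zero_anti hρ hρ1 hb0 hb hn)
  have h3 := mul_le_mul_of_nonneg_right this hpos.le
  rwa [inv_mul_cancel₀ hpos.ne'] at h3

lemma psi_one_le (J n : ℕ) (hJ : 1 ≤ J) (hn : 1 ≤ n) (hnJ : n ≤ J) : psi ρ J n ≤ 24/25 := by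
  induction n, hn using Nat.le_induction with
  | base =>
    have := psi_succ hρ hρ1 J 0 (by omega)
    have := psi_zero_le hρ hρ1 hb0 hb J hJ
    simp only [zero_add] at *
    linarith
  | succ n hn ih =>
    have := psi_succ hρ hρ1 J n (by omega)
    have := ih (by omega)
    linarith

variable (hlow : ∀ J, 1 ≤ (1 - ρ/2) * psi ρ J 0)
include hlow

lemma psi_zero_ge' (J : ℕ) : 1 + ρ/2 ≤ psi ρ J 0 := by
  have := hlow J
  have h2 := psi_nonneg hρ J 0
  by_contra H
  push Not at H
  nlinarith

lemma lamf_zero_ge (J : ℕ) (hJ : 1 ≤ J) : 1 + ρ/50 ≤ lamf ρ J 0 := by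
  unfold lamf
  rw [if_pos (by omega)]
  have := psi_zero_ge' hρ hρ1 hb0 hb hlow J
  have := psi_one_le hρ hρ1 hb0 hb J 1 hJ le_rfl hJ
  simp only [zero_add]
  nlinarith

/-- the key partial sums -/
lemma S_ge (q : ℝ) (hq : 0 < q) (hqp : q < ρ/2) (J N : ℕ) (hN : N < J) :
    1 + (ρ/2 - q)/25 ≤
      (1 - q) * (∑ n ∈ Finset.range N, q^n * lamf ρ J n) + q^N * lamf ρ J N := by
  have key : ∀ N < J, (1-q) * psi ρ J 0 + q^(N+1) * (psi ρ J N - psi ρ J (N+1)) - (ρ/2-q) * psi ρ J 1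
      ≤ (1 - q) * (∑ n ∈ Finset.range N, q^n * lamf ρ J n) + q^N * lamf ρ J N := by
    intro N
    induction N with
    | zero =>
      intro hN
      simp [lamf, hN]; nlinarith
    | succ N ih =>
      intro hN
      have := ih (by omega)
      rw [Finset.sum_range_succ]
      have e1 : lamf ρ J N = psi ρ J N - ρ/2 * psi ρ J (N+1) := by
        unfold lamf; rw [if_pos (by omega)]
      have e2 : lamf ρ J (N+1) = psi ρ J (N+1) - ρ/2 * psi ρ J (N+1+1) := by
        unfold lamf; rw [if_pos (by omega)]
      have hq1 : 0 < q^(N+1) := by positivity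
      have hd := psi_succ hρ hρ1 J (N+1) hN
      have h0 := psi_nonneg hρ J (N+1)
      have h1 : 0 ≤ q^(N+1) * ((ρ/2 - q) * (psi ρ J (N+1) - psi ρ J (N+1+1))) := by
        apply mul_nonneg hq1.le
        apply mul_nonneg <;> linarith
      rw [e1] at this ⊢
      rw [e2]
      rw [pow_succ q (N+1)]
      rw [pow_succ] at h1 this ⊢
      nlinarith
  have h1 := key N hN
  have hd := psi_succ hρ hρ1 J N hN
  have h0 := psi_nonneg hρ J N
  have h2 : 0 ≤ q^(N+1) * (psi ρ J N - psi ρ J (N+1)) := by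
    apply mul_nonneg (by positivity); linarith
  have h3 := hlow J
  have h4 := psi_zero_ge' hρ hρ1 hb0 hb hlow J
  have h5 := psi_one_le hρ hρ1 hb0 hb J 1 (by omega) le_rfl (by omega)
  nlinarith

end Psi
end FGK


namespace FGK
set_option linter.unusedSectionVars false

/-- a system of levels, scales, rates and measures -/
structure Sys (r : ℕ) (c : ℕ → ℝ) (lam : ℕ → ℕ → ℝ) (μ : ℕ → XT r → ℝ) (δ : ℝ) : Prop where
  δ0 : 0 < δ
  δ1 : δ ≤ 1
  r1 : 1 ≤ r
  c1 : c 1 = 1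
  cpos : ∀ j, 0 < c j
  canti : ∀ j, 1 ≤ j → j ≤ r → c (j+1) < c j
  mu0 : ∀ j ≤ r, ∀ x, 0 ≤ μ j x
  mu1 : ∀ j ≤ r, ∑ x, μ j x = 1
  supp1 : ∀ j ≤ r, ∀ x, μ j x ≠ 0 → vecX x ∈ VV r j
  ent : ∀ j ≤ r, ∀ W, VV r 0 ≤ W →
    ∑ i ∈ Finset.range j, lam j (i+1) * udim (VV r) (i+1) W ≤ ent (μ j) vecX W
  diag : ∀ j, 1 ≤ j → j ≤ r → 1 + δ ≤ lam j j
  off : ∀ i j, 1 ≤ i → i < j → j ≤ r → 0 ≤ lam j i ∧ lam j i ≤ 1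
  tot : ∀ i, 1 ≤ i → i ≤ r → (1 + δ) * c i ≤ ∑ j ∈ Finset.Icc i r, (c j - c (j+1)) * lam j i

section
variable {ρ : ℝ} (hρ : 0 < ρ) (hρ1 : ρ < 1/3)
variable {b : ℕ → ℝ} (hb0 : b 0 = 2) (hb : ∀ l, b (l+1) = b l * b l + ecorr ρ b l)
variable (hlow : ∀ J, 1 ≤ (1 - ρ/2) * psi ρ J 0)
include hρ hρ1 hb0 hb hlow

/-- step factors -/
noncomputable def fac (J r : ℕ) (q q0 : ℝ) (j : ℕ) : ℝ := if j < J then q0 else if j < r then q else q0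

/-- scales -/
noncomputable def csc (J r : ℕ) (q q0 : ℝ) (j : ℕ) : ℝ := ∏ t ∈ Finset.Ico 1 j, fac J r q q0 t

omit hρ hρ1 hb0 hb hlow in
lemma csc_succ (J r : ℕ) (q q0 : ℝ) (j : ℕ) (hj : 1 ≤ j) :
    csc J r q q0 (j+1) = csc J r q q0 j * fac J r q q0 j := by
  unfold csc
  rw [Finset.prod_Ico_succ_top hj]

omit hρ hρ1 hb0 hb hlow in
lemma csc_pow (J r : ℕ) (q q0 : ℝ) (i n : ℕ) (hi : 1 ≤ i) (hJ : J ≤ i) (hn : i + n ≤ r) :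
    csc J r q q0 (i+n) = csc J r q q0 i * q^n := by
  induction n with
  | zero => simp
  | succ n ih =>
    rw [← add_assoc, csc_succ _ _ _ _ _ (by omega), ih (by omega), pow_succ]
    unfold fac
    rw [if_neg (by omega), if_pos (by omega)]; ring

/-- rates -/
noncomputable def lamS (ρ : ℝ) (J j i : ℕ) : ℝ :=
  if J ≤ j then lamf ρ J (j - i) else if i = j then lamf ρ j 0 else 0

/-- measures -/
noncomputable def muS (ρ : ℝ) (J r j : ℕ) (x : XT r) : ℝ :=
  if h : j ≤ r then push (emb (a := j - min j J) (h := min j J) (by omega)) (cnu ρ _ _) x else 0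

lemma sys_ex (q : ℝ) (hq : 0 < q) (hqp : q < ρ/2) (J r : ℕ) (hJ : 2 ≤ J) (hJr : J ≤ r)
    (hqJ : q^J ≤ (ρ/2-q)/50) :
    Sys r (csc J r q ((ρ/2-q)/200)) (lamS ρ J) (muS ρ J r) ((ρ/2-q)/200) := by
  set κ := ρ/2 - q with hκ
  set q0 := κ/200 with hq0
  have hκ0 : 0 < κ := by linarith
  have hκ1 : κ < 1/6 := by linarith
  have hfac : ∀ j, 0 < fac J r q q0 j ∧ fac J r q q0 j < 1 := by
    intro j; unfold fac
    split_ifs <;> constructor <;> linarith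
  have hcpos : ∀ j, 0 < csc J r q q0 j := fun j => Finset.prod_pos fun t _ => (hfac t).1
  have hp0 : ∀ J', 1 ≤ J' → psi ρ J' 0 ≤ 6/5 := fun J' h => psi_zero_le hρ hρ1 hb0 hb J' h
  refine ⟨by linarith, by linarith, by omega, by simp [csc], hcpos, ?_, ?_, ?_, ?_, ?_, ?_, ?_, ?_⟩
  · intro j h1 h2
    rw [csc_succ _ _ _ _ _ h1]
    have := hfac j; have := hcpos j
    nlinarith
  · intro j hj x
    unfold muS; rw [dif_pos hj]
    exact push_nonneg _ (cnu_pos hρ.le) x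
  · intro j hj
    unfold muS; simp only [dif_pos hj]
    have := push_sum (emb (r := r) (a := j - min j J) (h := min j J) (by omega)) (cnu ρ _ _) (fun _ => 1)
    simp only [mul_one] at this
    rw [this, cnu_sum hρ.le]
  · intro j hj x hx
    unfold muS at hx; rw [dif_pos hj] at hx
    obtain ⟨ω, rfl⟩ := push_ne _ hx
    have := (emb_mem (r := r) (a := j - min j J) (h := min j J) (by omega) (min j J) ω
      (fun _ _ => false)).2 (fun s => RT_total _ _ _)
    have e : j - min j J + min j J = j := by omega
    have h0 : vecX (emb (r := r) (a := j - min j J) (h := min j J) (by omega) (fun _ _ => false)) = 0 := by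
      funext s; simp [vecX, emb, bv]
    rw [h0, sub_zero] at this
    exact (VV_mono r e.le) this
  · intro j hj W hW
    have := cluster_lin (r := r) (a := j - min j J) (h := min j J) (by omega) hρ.le (lamS ρ J j) ?_ ?_ W hW
    · have e0 : j - min j J + min j J = j := by omega
      have e1 := Finset.sum_congr (congrArg Finset.range e0)
        (fun i _ => rfl : ∀ i ∈ Finset.range j, lamS ρ J j (i+1) * udim (VV r) (i+1) W = _)
      have e : muS ρ J r j = push (emb (a := j - min j J) (h := min j J) (by omega)) (cnu ρ _ _) := by
        funext x; unfold muS; rw [dif_pos hj]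
      rw [e, ← e1]; exact this
    · intro i hi
      unfold lamS
      rw [if_pos (by omega)]
      unfold lamf; rw [if_neg (by omega)]
    · intro l hl
      unfold lamS
      by_cases h1 : J ≤ j
      · rw [if_pos h1]
        have e : min j J = J := by omega
        rw [e] at hl ⊢
        rw [show j - (j - J + l + 1) = J - (l+1) by omega, lamf_HH hρ hρ1 J l hl]
      · rw [if_neg h1]
        have e : min j J = j := by omega
        rw [e] at hl ⊢
        rw [← lamf_HH hρ hρ1 j l hl]
        have h3 := lamf_nonneg hρ hρ1 j (j - (l+1))
        split_ifs with h2
        · rw [show j - (l+1) = 0 by omega]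
        · rw [zero_mul]; positivity
  · intro j h1 h2
    have hz : ∀ J', 1 ≤ J' → 1 + κ/200 ≤ lamf ρ J' 0 := by
      intro J' h
      have := lamf_zero_ge hρ hρ1 hb0 hb hlow J' h
      linarith
    unfold lamS
    split_ifs with h3
    · rw [Nat.sub_self]; exact hz J (by omega)
    · exact hz j h1
    · exact absurd rfl ‹_›
  · intro i j h1 h2 h3
    unfold lamS
    rw [if_neg (by omega : ¬ i = j)]
    split_ifs with h4
    · refine ⟨lamf_nonneg hρ hρ1 _ _, ?_⟩
      by_cases h5 : j - i < J
      · have := lamf_le hρ hρ1 J (j - i)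
        have := psi_one_le hρ hρ1 hb0 hb J (j-i) (by omega) (by omega) (by omega)
        linarith
      · unfold lamf; rw [if_neg h5]; norm_num
    · simp
  · intro i h1 h2
    have hci := hcpos i
    by_cases h3 : i < J
    · have hnn : ∀ j ∈ Finset.Icc i r, 0 ≤ (csc J r q q0 j - csc J r q q0 (j+1)) * lamS ρ J j i := by
        intro j hj
        rw [Finset.mem_Icc] at hj
        apply mul_nonneg
        · rw [csc_succ _ _ _ _ _ (by omega)]
          have := hfac j; have := hcpos j
          nlinarith
        · unfold lamS
          split_ifs
          · exact lamf_nonneg hρ hρ1 _ _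
          · exact lamf_nonneg hρ hρ1 _ _
          · exact le_rfl
      have := Finset.single_le_sum hnn (Finset.mem_Icc.2 ⟨le_rfl, h2⟩)
      refine le_trans ?_ this
      rw [csc_succ _ _ _ _ _ h1]
      have e1 : fac J r q q0 i = q0 := by unfold fac; rw [if_pos h3]
      have e2 : lamS ρ J i i = lamf ρ i 0 := by
        unfold lamS; rw [if_neg (by omega), if_pos rfl]
      rw [e1, e2]
      have := lamf_zero_ge hρ hρ1 hb0 hb hlow i h1
      have h6 : 1 + κ/200 ≤ (1 - q0) * lamf ρ i 0 := by
        have : (1 - q0) * (1 + ρ/50) ≤ (1 - q0) * lamf ρ i 0 := by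
          apply mul_le_mul_of_nonneg_left this; linarith
        nlinarith
      calc (1 + κ/200) * csc J r q q0 i ≤ ((1 - q0) * lamf ρ i 0) * csc J r q q0 i := by gcongr
        _ = _ := by ring
    · push Not at h3
      set N := r - i with hN
      have e1 : Finset.Icc i r = (Finset.range (N+1)).image (fun n => i + n) := by
        ext j; simp only [Finset.mem_Icc, Finset.mem_image, Finset.mem_range]
        constructor
        · intro h; exact ⟨j - i, by omega, by omega⟩
        · rintro ⟨n, h, rfl⟩; omega
      rw [e1, Finset.sum_image (by intro x _ y _ h; simpa using h)]
      have hl : ∀ n, lamS ρ J (i+n) i = lamf ρ J n := by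
        intro n; unfold lamS; rw [if_pos (by omega), show i + n - i = n by omega]
      simp_rw [hl]
      rw [Finset.sum_range_succ]
      have e2 : ∑ n ∈ Finset.range N, (csc J r q q0 (i+n) - csc J r q q0 (i+n+1)) * lamf ρ J n =
          csc J r q q0 i * ((1-q) * ∑ n ∈ Finset.range N, q^n * lamf ρ J n) := by
        rw [Finset.mul_sum, Finset.mul_sum]
        refine Finset.sum_congr rfl fun n hn => ?_
        rw [Finset.mem_range] at hn
        rw [add_assoc, csc_pow _ _ _ _ _ _ h1 h3 (by omega), csc_pow _ _ _ _ _ _ h1 h3 (by omega), pow_succ]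
        ring
      have e3 : (csc J r q q0 (i+N) - csc J r q q0 (i+N+1)) * lamf ρ J N =
          csc J r q q0 i * (q^N * lamf ρ J N * (1 - q0)) := by
        rw [csc_succ _ _ _ _ _ (by omega), csc_pow _ _ _ _ _ _ h1 h3 (by omega)]
        have : fac J r q q0 (i+N) = q0 := by
          unfold fac; rw [if_neg (by omega), if_neg (by omega)]
        rw [this]; ring
      rw [e2, e3, ← mul_add, mul_comm]
      apply mul_le_mul_of_nonneg_left _ hci.le
      by_cases hNJ : N < J
      · have hS := S_ge hρ hρ1 hb0 hb hlow q hq hqp J N hNJ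
        have h7 : lamf ρ J N ≤ 6/5 := by
          refine (lamf_le hρ hρ1 J N).trans ?_
          rcases Nat.eq_zero_or_pos N with h | h
          · rw [h]; exact hp0 J (by omega)
          · have := psi_one_le hρ hρ1 hb0 hb J N (by omega) h (by omega)
            linarith
        have h8 := lamf_nonneg hρ hρ1 J N
        have h9 : q^N ≤ 1 := pow_le_one₀ hq.le (by linarith)
        have h10 : 0 ≤ q^N := by positivity
        have h11 : q^N * lamf ρ J N ≤ 6/5 := by nlinarith
        have h12 : 0 ≤ q^N * lamf ρ J N := by positivity
        nlinarith
      · have hS := S_ge hρ hρ1 hb0 hb hlow q hq hqp J (J-1) (by omega)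
        have h7 : lamf ρ J N = 0 := by unfold lamf; rw [if_neg hNJ]
        have h8 : ∑ n ∈ Finset.range J, q^n * lamf ρ J n ≤ ∑ n ∈ Finset.range N, q^n * lamf ρ J n := by
          apply Finset.sum_le_sum_of_subset_of_nonneg
          · intro n hn; simp at hn ⊢; omega
          · intro n _ _; have := lamf_nonneg hρ hρ1 J n; positivity
        have h9 : ∑ n ∈ Finset.range J, q^n * lamf ρ J n =
            ∑ n ∈ Finset.range (J-1), q^n * lamf ρ J n + q^(J-1) * lamf ρ J (J-1) := by
          conv_lhs => rw [show J = (J-1)+1 by omega, Finset.sum_range_succ]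
          simp only [show J - 1 + 1 = J by omega]
        have h10 : q^J = q * q^(J-1) := by
          rw [← pow_succ', show J - 1 + 1 = J by omega]
        have h11 : lamf ρ J (J-1) ≤ 1 := by
          have := lamf_le hρ hρ1 J (J-1)
          have := psi_one_le hρ hρ1 hb0 hb J (J-1) (by omega) (by omega) (by omega)
          linarith
        have h12 := lamf_nonneg hρ hρ1 J (J-1)
        have h13 : q^J * lamf ρ J (J-1) ≤ κ/50 := by
          have : 0 < q^J := by positivity
          nlinarith
        have h14 : (1-q) * ∑ n ∈ Finset.range J, q^n * lamf ρ J n ≤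
          (1-q) * ∑ n ∈ Finset.range N, q^n * lamf ρ J n :=
          mul_le_mul_of_nonneg_left h8 (by linarith)
        rw [h7]
        rw [h9] at h14
        rw [h10] at h13
        nlinarith

end

/-- existence of systems of near-optimal exponent -/
theorem system_exists (ρ : ℝ) (hρ0 : 0 < ρ) (hρ1 : ρ < 1/3)
    (a : ℕ → ℝ) (ha1 : a 1 = 2) (ha2 : a 2 = 2 + (2:ℝ) ^ ρ)
    (harec : ∀ j : ℕ, 3 ≤ j → a j = a (j-1) ^ 2 + a (j-1) ^ ρ - a (j-2) ^ (2*ρ))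
    (hlim : Filter.Tendsto (fun j : ℕ => (2:ℝ) ^ ((j:ℝ) - 2) / Real.log (a j))
      Filter.atTop (nhds (1 - ρ/2))) (η' : ℝ) (hη0 : 0 < η')
    (hη : η' < Real.log 2 / Real.log (2/ρ)) :
    ∃ (r : ℕ) (c : ℕ → ℝ) (lam : ℕ → ℕ → ℝ) (μ : ℕ → XT r → ℝ) (δ : ℝ), Sys r c lam μ δ ∧
      η' * Real.log (1 / c (r+1)) < r * Real.log 2 := by
  have hage : ∀ l, 2 ≤ a (l+1) ∧ a (l+1) ≤ a (l+2) := by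
    intro l
    induction l with
    | zero =>
      simp only [zero_add, ha1, ha2]
      refine ⟨le_rfl, ?_⟩
      have : (0:ℝ) < 2^ρ := by positivity
      linarith
    | succ l ih =>
      obtain ⟨h1, h2⟩ := ih
      refine ⟨by simpa using h1.trans h2, ?_⟩
      have := harec (l+3) (by omega)
      simp only [show l + 3 - 1 = l + 2 by omega, show l + 3 - 2 = l + 1 by omega] at this
      change a (l+2) ≤ a (l+3)
      rw [this]
      have h3 : a (l+1)^(2*ρ) ≤ a (l+1)^(1:ℝ) :=
        Real.rpow_le_rpow_of_exponent_le (by linarith) (by linarith)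
      rw [Real.rpow_one] at h3
      have h4 : 0 < a (l+2)^ρ := Real.rpow_pos_of_pos (by linarith) _
      nlinarith
  let b : ℕ → ℝ := fun l => a (l+1)
  have hb0 : b 0 = 2 := ha1
  have hb : ∀ l, b (l+1) = b l * b l + ecorr ρ b l := by
    intro l
    cases l with
    | zero => simp only [b, ecorr, zero_add, ha1]; norm_num; rw [ha2]; ring
    | succ l =>
      simp only [b, ecorr]
      have := harec (l+3) (by omega)
      simp only [show l + 3 - 1 = l + 2 by omega, show l + 3 - 2 = l + 1 by omega] at this
      change a (l+3) = a (l+2) * a (l+2) + (a (l+2)^ρ - (a (l+1) * a (l+1))^ρ)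
      have h2 := (hage l).1
      rw [this, ← pow_two (a (l+1)), ← Real.rpow_natCast (a (l+1)) 2, ← Real.rpow_mul (by linarith)]
      push_cast; ring
  have hlow := psi_zero_ge hρ0 hρ1 hb0 hb (by
    have := (tendsto_add_atTop_iff_nat 1).2 hlim
    refine this.congr fun J => ?_
    rw [psi_zero hρ0 hρ1 hb0 hb]
    push_cast
    rw [inv_div]
    have e : (2:ℝ)^((J:ℝ)+1-2) = 2^J/2 := by
      rw [show (J:ℝ)+1-2 = J - 1 by ring, Real.rpow_sub (by norm_num), Real.rpow_natCast, Real.rpow_one]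
    rw [e]; simp only [b]
    rw [div_div])
  have hlp : 0 < Real.log (2/ρ) := Real.log_pos (by rw [lt_div_iff₀ hρ0]; linarith)
  rw [lt_div_iff₀ hlp] at hη
  have hl2 : 0 < Real.log 2 := Real.log_pos (by norm_num)
  set s := (Real.log 2 - η' * Real.log (2/ρ)) / (2*η') with hs
  have hs0 : 0 < s := by apply div_pos <;> linarith
  set q := ρ/2 * Real.exp (-s) with hqdef
  have hes : Real.exp (-s) < 1 := by rw [Real.exp_lt_one_iff]; linarith
  have hq : 0 < q := by positivity
  have hqp : q < ρ/2 := by rw [hqdef]; nlinarith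
  have hq1 : q < 1 := by linarith
  have hlogq : Real.log (1/q) = Real.log (2/ρ) + s := by
    rw [hqdef, one_div, Real.log_inv, Real.log_mul (by positivity) (by positivity), Real.log_exp,
      ← inv_div, Real.log_inv]; ring
  have hqη : η' * Real.log (1/q) < Real.log 2 := by
    rw [hlogq, hs, mul_add]
    have : η' * ((Real.log 2 - η' * Real.log (2/ρ)) / (2*η')) = (Real.log 2 - η' * Real.log (2/ρ))/2 := by
      field_simp
    rw [this]; linarith
  have hκ0 : 0 < ρ/2 - q := by linarith
  obtain ⟨J0, hJ0⟩ := exists_pow_lt_of_lt_one (show (0:ℝ) < (ρ/2-q)/50 by linarith) hq1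
  set J := J0 + 2 with hJ
  have hqJ : q^J ≤ (ρ/2-q)/50 := by
    refine le_trans ?_ hJ0.le
    exact pow_le_pow_of_le_one hq.le hq1.le (by omega)
  set q0 := (ρ/2-q)/200 with hq0
  have hq00 : 0 < q0 := by linarith
  set A := η' * (J * Real.log (1/q0)) with hA
  obtain ⟨n, hn⟩ := exists_nat_gt (A / (Real.log 2 - η' * Real.log (1/q)))
  refine ⟨J + n, _, _, _, _, sys_ex hρ0 hρ1 hb0 hb hlow q hq hqp J (J+n) (by omega) (by omega) hqJ, ?_⟩
  have hcJ : ∀ j, j + 1 ≤ J → csc J (J+n) q q0 (j+1) = q0^j := by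
    intro j
    induction j with
    | zero => intro _; simp [csc]
    | succ j ih =>
      intro hj
      rw [csc_succ _ _ _ _ _ (by omega), ih (by omega), pow_succ]
      unfold fac; rw [if_pos (by omega)]
  have hc : csc J (J+n) q q0 (J+n+1) = q0^J * q^n := by
    rw [csc_succ _ _ _ _ _ (by omega), csc_pow _ _ _ _ _ _ (by omega) le_rfl le_rfl]
    have := hcJ (J-1) (by omega)
    rw [show J - 1 + 1 = J by omega] at this
    rw [this]
    unfold fac; rw [if_neg (by omega), if_neg (by omega)]
    have : q0^J = q0^(J-1) * q0 := by rw [← pow_succ, show J - 1 + 1 = J by omega]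
    rw [this]; ring
  rw [hc, one_div, Real.log_inv, Real.log_mul (by positivity) (by positivity), Real.log_pow, Real.log_pow]
  rw [div_lt_iff₀ (by linarith)] at hn
  rw [hA] at hn
  rw [one_div, Real.log_inv] at hn hqη
  rw [one_div, Real.log_inv] at hn
  push_cast
  have : 0 ≤ (J:ℝ) * Real.log 2 := by positivity
  nlinarith
end FGK


namespace FGK

set_option linter.unusedSectionVars false

lemma sum_cons {X : Type*} [Fintype X] (n : ℕ) (F : (Fin (n+1) → X) → ℝ) :
    ∑ f, F f = ∑ x, ∑ f : Fin n → X, F (Fin.cons x f) := by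
  rw [← Fintype.sum_prod_type' (f := fun x (f : Fin n → X) => F (Fin.cons x f))]
  symm
  exact Fintype.sum_equiv (Fin.consEquiv (fun _ => X)) _ _ (fun _ => rfl)

lemma prob_pi {X : Type*} [Fintype X] (n : ℕ) (μ : ℕ → X → ℝ) (h : ∀ x, x < n → ∑ i, μ x i = 1) :
    ∑ f : Fin n → X, ∏ x : Fin n, μ x (f x) = 1 := by
  have := prod_sum_fn (S := Fin n) (X := X) (fun x i => μ x i)
  rw [this]
  exact Finset.prod_eq_one (fun x _ => h x x.2)

lemma rpow_sum_le {I : Type*} (s : Finset I) (f : I → ℝ) (hf : ∀ i ∈ s, 0 ≤ f i) {d : ℝ} (hd : 0 < d)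
    (hd1 : d ≤ 1) : (∑ i ∈ s, f i) ^ d ≤ ∑ i ∈ s, f i ^ d := by
  induction s using Finset.induction_on with
  | empty => simp [Real.zero_rpow hd.ne']
  | insert a s ha ih =>
    rw [Finset.sum_insert ha, Finset.sum_insert ha]
    have h1 : 0 ≤ f a := hf a (Finset.mem_insert_self _ _)
    have h2 : 0 ≤ ∑ i ∈ s, f i := Finset.sum_nonneg (fun i hi => hf i (Finset.mem_insert_of_mem hi))
    have := Real.rpow_add_le_add_rpow h1 h2 hd.le hd1
    have h3 := ih (fun i hi => hf i (Finset.mem_insert_of_mem hi))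
    linarith

/-- tangent line inequality -/
lemma rpow_tangent {m s d : ℝ} (hm : 0 ≤ m) (hs : 0 < s) (hd : 0 < d) (hd1 : d ≤ 1) :
    m ^ d ≤ s ^ d * (1 + d * (m / s - 1)) := by
  have h := rpow_one_add_le_one_add_mul_self (s := m / s - 1) (by
    have := div_nonneg hm hs.le; linarith) hd.le hd1
  have e : (1 + (m / s - 1)) = m / s := by ring
  rw [e, Real.div_rpow hm hs.le, div_le_iff₀ (Real.rpow_pos_of_pos hs d)] at h
  linarith

lemma jensen_pow {I : Type*} (s : Finset I) (P m : I → ℝ) (hP : ∀ i ∈ s, 0 ≤ P i)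
    (hm : ∀ i ∈ s, 0 ≤ m i) {p t d : ℝ} (hp : ∑ i ∈ s, P i = p) (ht : 0 ≤ t)
    (h : ∑ i ∈ s, P i * m i ≤ p * t) (hd : 0 < d) (hd1 : d ≤ 1) :
    ∑ i ∈ s, P i * m i ^ d ≤ p * t ^ d := by
  rcases ht.eq_or_lt with rfl | ht
  · have h0 : ∑ i ∈ s, P i * m i = 0 := le_antisymm (by simpa using h)
      (Finset.sum_nonneg (fun i hi => mul_nonneg (hP i hi) (hm i hi)))
    rw [Finset.sum_eq_zero_iff_of_nonneg (fun i hi => mul_nonneg (hP i hi) (hm i hi))] at h0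
    rw [Real.zero_rpow hd.ne', mul_zero]
    apply le_of_eq
    apply Finset.sum_eq_zero
    intro i hi
    rcases mul_eq_zero.mp (h0 i hi) with h | h
    · simp [h]
    · simp [h, Real.zero_rpow hd.ne']
  · have h1 : ∑ i ∈ s, P i * m i ^ d ≤ ∑ i ∈ s, (t^d * (1 - d) * P i + t^d * d / t * (P i * m i)) := by
      apply Finset.sum_le_sum
      intro i hi
      have := mul_le_mul_of_nonneg_left (rpow_tangent (hm i hi) ht hd hd1) (hP i hi)
      refine this.trans (le_of_eq ?_)
      field_simp; ring
    rw [Finset.sum_add_distrib, ← Finset.mul_sum, ← Finset.mul_sum, hp] at h1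
    have h2 : t^d * d / t * ∑ i ∈ s, P i * m i ≤ t^d * d / t * (p * t) := by
      apply mul_le_mul_of_nonneg_left h; positivity
    have h3 : t^d * d / t * (p * t) = t^d * d * p := by field_simp
    nlinarith

section Coll
variable {E : Type*} [AddCommGroup E] [Module ℚ E] {X : Type*} [Fintype X] {ι : Type*} [Fintype ι]
  (vec : X → E)

/-- mass of configurations colliding with `ω` -/
noncomputable def mm (n : ℕ) (μ : ℕ → X → ℝ) (a : Fin n → ℚ) (ω : Fin n → X) (u : E)
    (W : Submodule ℚ E) : ℝ :=
  ∑ ω' : Fin n → X, (∏ x : Fin n, μ x (ω' x)) *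
    (if u + ∑ x, a x • (vec (ω' x) - vec (ω x)) ∈ W then 1 else 0)

/-- averaged collision moment -/
noncomputable def GG (n : ℕ) (μ : ℕ → X → ℝ) (P : ℕ → ι → ℝ) (val : ℕ → ι → ℚ) (d : ℝ)
    (W : Submodule ℚ E) : ℝ :=
  ∑ o : Fin n → ι, (∏ x : Fin n, P x (o x)) * ∑ ω : Fin n → X, (∏ x : Fin n, μ x (ω x)) *
    (mm vec n μ (fun x => val x (o x)) ω 0 W) ^ d

variable {vec}

lemma mm_nonneg {n : ℕ} {μ : ℕ → X → ℝ} (hμ : ∀ x < n, ∀ i, 0 ≤ μ x i) (a : Fin n → ℚ)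
    (ω : Fin n → X) (u : E) (W : Submodule ℚ E) : 0 ≤ mm vec n μ a ω u W := by
  unfold mm
  apply Finset.sum_nonneg
  intro ω' _
  refine mul_nonneg (Finset.prod_nonneg (fun x _ => hμ x x.2 _)) ?_
  split_ifs <;> norm_num

lemma mm_add {n : ℕ} {μ : ℕ → X → ℝ} (a : Fin n → ℚ)
    (ω : Fin n → X) (u w : E) (W : Submodule ℚ E) (hw : w ∈ W) :
    mm vec n μ a ω (u + w) W = mm vec n μ a ω u W := by
  unfold mm
  apply Finset.sum_congr rfl
  intro ω' _
  have : ∀ s : E, (u + w + s ∈ W ↔ u + s ∈ W) := by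
    intro s
    rw [show u + w + s = (u + s) + w by abel]
    exact W.add_mem_iff_left hw
  simp only [this]

lemma GG_nonneg {n : ℕ} {μ : ℕ → X → ℝ} (hμ : ∀ x < n, ∀ i, 0 ≤ μ x i) {P : ℕ → ι → ℝ}
    (hP : ∀ x < n, ∀ i, 0 ≤ P x i) (val : ℕ → ι → ℚ) (d : ℝ) (W : Submodule ℚ E) :
    0 ≤ GG vec n μ P val d W := by
  unfold GG
  refine Finset.sum_nonneg (fun o _ => mul_nonneg (Finset.prod_nonneg (fun x _ => hP x x.2 _)) ?_)
  refine Finset.sum_nonneg (fun o _ => mul_nonneg (Finset.prod_nonneg (fun x _ => hμ x x.2 _)) ?_)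
  exact Real.rpow_nonneg (mm_nonneg hμ _ _ _ _) _

lemma mm_cons {n : ℕ} (μ : ℕ → X → ℝ) (a : Fin (n+1) → ℚ) (ω0 : X) (ω : Fin n → X) (u : E)
    (W : Submodule ℚ E) :
    mm vec (n+1) μ a (Fin.cons ω0 ω) u W = ∑ ω0', μ 0 ω0' *
      mm vec n (fun x => μ (x+1)) (fun x => a x.succ) ω (u + a 0 • (vec ω0' - vec ω0)) W := by
  unfold mm
  rw [sum_cons]
  apply Finset.sum_congr rfl
  intro ω0' _
  rw [Finset.mul_sum]
  apply Finset.sum_congr rfl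
  intro ω' _
  rw [Fin.prod_univ_succ, Fin.sum_univ_succ]
  simp only [Fin.cons_zero, Fin.cons_succ, Fin.val_zero, Fin.val_succ]
  rw [mul_assoc, add_assoc]

lemma GG_cons {n : ℕ} (μ : ℕ → X → ℝ) (P : ℕ → ι → ℝ) (val : ℕ → ι → ℚ) (d : ℝ)
    (W : Submodule ℚ E) :
    GG vec (n+1) μ P val d W = ∑ o : Fin n → ι, ∑ ω : Fin n → X, (∏ x : Fin n, P (x+1) (o x)) *
      ((∏ x : Fin n, μ (x+1) (ω x)) * ∑ ω0, μ 0 ω0 * ∑ i, P 0 i *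
        (∑ ω0', μ 0 ω0' * mm vec n (fun x => μ (x+1)) (fun x => val (x+1) (o x)) ω
          (val 0 i • (vec ω0' - vec ω0)) W) ^ d) := by
  unfold GG
  rw [sum_cons]
  simp only [sum_cons (X := X), mm_cons, Fin.prod_univ_succ, Fin.cons_zero, Fin.cons_succ, Fin.val_zero,
    Fin.val_succ, zero_add, Finset.mul_sum]
  rw [Finset.sum_comm]
  apply Finset.sum_congr rfl
  intro o _
  rw [Finset.sum_congr rfl (fun i _ => Finset.sum_comm)]
  rw [Finset.sum_comm]
  apply Finset.sum_congr rfl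
  intro ω _
  rw [Finset.sum_comm]
  apply Finset.sum_congr rfl
  intro i _
  apply Finset.sum_congr rfl
  intro i _
  ring

/-- concentration: averaging over the nonzero values of the head box -/
lemma mm_conc {n : ℕ} {μ : ℕ → X → ℝ} (hμ : ∀ x < n, ∀ i, 0 ≤ μ x i) (a : Fin n → ℚ)
    (ω : Fin n → X) (W : Submodule ℚ E) (v : E) (hv : v ∉ W) (p : ι → ℝ) (val : ι → ℚ)
    (hp : ∀ i, 0 ≤ p i) (q : ℝ) (hq : 0 ≤ q)
    (hc : ∀ t : ℚ, t ≠ 0 → ∑ i ∈ Finset.univ.filter (fun i => val i = t), p i ≤ q) :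
    ∑ i ∈ Finset.univ.filter (fun i => val i ≠ 0), p i * mm vec n μ a ω (val i • v) W ≤
      q * mm vec n μ a ω 0 (W ⊔ Submodule.span ℚ {v}) := by
  unfold mm
  simp only [Finset.mul_sum]
  rw [Finset.sum_comm]
  apply Finset.sum_le_sum
  intro ω' _
  have hpr : 0 ≤ ∏ x : Fin n, μ x (ω' x) := Finset.prod_nonneg (fun x _ => hμ x x.2 _)
  set s := ∑ x, a x • (vec (ω' x) - vec (ω x)) with hs
  by_cases hex : ∃ t : ℚ, t ≠ 0 ∧ t • v + s ∈ W
  · obtain ⟨t, ht, hts⟩ := hex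
    have hmem : 0 + s ∈ W ⊔ Submodule.span ℚ {v} := by
      rw [zero_add, show s = (t • v + s) + (-t) • v by rw [neg_smul]; abel]
      exact Submodule.add_mem_sup hts (Submodule.smul_mem _ _ (Submodule.mem_span_singleton_self v))
    rw [if_pos hmem]
    have huni : ∀ i, val i • v + s ∈ W → val i = t := by
      intro i hi
      by_contra hne
      apply hv
      have h := W.sub_mem hi hts
      rw [show val i • v + s - (t • v + s) = (val i - t) • v by rw [sub_smul]; abel] at h
      exact (W.smul_mem_iff (sub_ne_zero.mpr hne)).mp h
    calc _ ≤ ∑ i ∈ Finset.univ.filter (fun i => val i ≠ 0), (∏ x : Fin n, μ x (ω' x)) * (if val i = t then p i else 0) := by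
          apply Finset.sum_le_sum
          intro i _
          by_cases h : val i • v + s ∈ W
          · rw [if_pos h, if_pos (huni i h)]; apply le_of_eq; ring
          · rw [if_neg h]; simp only [mul_zero]; apply mul_nonneg hpr; split_ifs; exact hp i; exact le_rfl
      _ = (∏ x : Fin n, μ x (ω' x)) * ∑ i ∈ Finset.univ.filter (fun i => val i = t), p i := by
          rw [← Finset.mul_sum, ← Finset.sum_filter, Finset.filter_filter]
          congr 1
          apply Finset.sum_congr _ (fun _ _ => rfl)
          ext i; simp only [Finset.mem_filter, Finset.mem_univ, true_and]
          constructor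
          · exact fun h => h.2
          · exact fun h => ⟨by rw [h]; exact ht, h⟩
      _ ≤ (∏ x : Fin n, μ x (ω' x)) * q := mul_le_mul_of_nonneg_left (hc t ht) hpr
      _ = _ := by ring
  · push Not at hex
    have h0 : ∑ i ∈ Finset.univ.filter (fun i => val i ≠ 0), p i * ((∏ x : Fin n, μ x (ω' x)) *
        (if val i • v + s ∈ W then 1 else 0)) = 0 := by
      apply Finset.sum_eq_zero
      intro i hi
      rw [if_neg (hex _ (Finset.mem_filter.mp hi).2)]; simp
    rw [h0]
    apply mul_nonneg hq
    apply mul_nonneg hpr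
    split_ifs <;> norm_num

/-- pointwise head bound -/
lemma head_pt {n : ℕ} {μ : ℕ → X → ℝ} (hμ : ∀ x < n, ∀ i, 0 ≤ μ x i) (a : Fin n → ℚ)
    (ω : Fin n → X) (W : Submodule ℚ E) (ν : X → ℝ) (hν : ∀ i, 0 ≤ ν i) (hν1 : ∑ i, ν i = 1)
    (P : ι → ℝ) (val : ι → ℚ) (hP : ∀ i, 0 ≤ P i) (hP1 : ∑ i, P i = 1) (p κ : ℝ) (hκ : 0 ≤ κ)
    (hp : ∑ i ∈ Finset.univ.filter (fun i => val i ≠ 0), P i = p)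
    (hc : ∀ t : ℚ, t ≠ 0 → ∑ i ∈ Finset.univ.filter (fun i => val i = t), P i ≤ p * κ)
    {d : ℝ} (hd : 0 < d) (hd1 : d ≤ 1) (ω0 : X) :
    ∑ i, P i * (∑ ω0', ν ω0' * mm vec n μ a ω (val i • (vec ω0' - vec ω0)) W) ^ d ≤
      ((1 - p) + p * cmass ν vec W ω0 ^ d) * mm vec n μ a ω 0 W ^ d +
      ∑ ω0', if vec ω0' - vec ω0 ∉ W ∧ ν ω0' ≠ 0 then
        p * κ ^ d * mm vec n μ a ω 0 (W ⊔ Submodule.span ℚ {vec ω0' - vec ω0}) ^ d else 0 := by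
  have hp0 : 0 ≤ p := hp ▸ Finset.sum_nonneg (fun i _ => hP i)
  have hmm := fun u W => mm_nonneg (vec := vec) hμ a ω u W
  have hsplit : ∑ i ∈ Finset.univ.filter (fun i => ¬ val i ≠ 0), P i = 1 - p := by
    have := Finset.sum_filter_add_sum_filter_not Finset.univ (fun i => val i ≠ 0) P
    linarith
  have hν2 : ∀ i, ν i ≤ 1 := fun i => hν1 ▸ Finset.single_le_sum (fun j _ => hν j) (Finset.mem_univ i)
  rw [← Finset.sum_filter_add_sum_filter_not Finset.univ (fun i => val i ≠ 0)]
  have hA : ∑ i ∈ Finset.univ.filter (fun i => ¬ val i ≠ 0), P i *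
      (∑ ω0', ν ω0' * mm vec n μ a ω (val i • (vec ω0' - vec ω0)) W) ^ d
      = (1 - p) * mm vec n μ a ω 0 W ^ d := by
    rw [← hsplit, Finset.sum_mul]
    apply Finset.sum_congr rfl
    intro i hi
    have h0 : val i = 0 := by simpa using (Finset.mem_filter.mp hi).2
    rw [h0]
    simp only [zero_smul]
    rw [← Finset.sum_mul, hν1, one_mul]
  have hcm : 0 ≤ cmass ν vec W ω0 := by
    unfold cmass; apply Finset.sum_nonneg; intro i _; split_ifs; exact hν i; exact le_rfl
  have hB : ∀ i, (∑ ω0', ν ω0' * mm vec n μ a ω (val i • (vec ω0' - vec ω0)) W) ^ d ≤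
      cmass ν vec W ω0 ^ d * mm vec n μ a ω 0 W ^ d + ∑ ω0', if vec ω0' - vec ω0 ∉ W ∧ ν ω0' ≠ 0 then
        mm vec n μ a ω (val i • (vec ω0' - vec ω0)) W ^ d else 0 := by
    intro i
    have e1 : ∑ ω0', ν ω0' * mm vec n μ a ω (val i • (vec ω0' - vec ω0)) W =
        cmass ν vec W ω0 * mm vec n μ a ω 0 W + ∑ ω0', if vec ω0' - vec ω0 ∉ W ∧ ν ω0' ≠ 0 then
        ν ω0' * mm vec n μ a ω (val i • (vec ω0' - vec ω0)) W else 0 := by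
      unfold cmass
      rw [Finset.sum_mul, ← Finset.sum_add_distrib]
      apply Finset.sum_congr rfl
      intro ω0' _
      by_cases h : vec ω0' - vec ω0 ∈ W
      · have := mm_add (vec := vec) (μ := μ) a ω 0 (val i • (vec ω0' - vec ω0)) W (W.smul_mem _ h)
        rw [zero_add] at this
        simp [h, this]
      · by_cases h' : ν ω0' = 0 <;> simp [h, h']
    rw [e1]
    have hterm : ∀ ω0', 0 ≤ (if vec ω0' - vec ω0 ∉ W ∧ ν ω0' ≠ 0 then
        ν ω0' * mm vec n μ a ω (val i • (vec ω0' - vec ω0)) W else 0) := by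
      intro ω0'; split_ifs
      · exact mul_nonneg (hν _) (hmm _ _)
      · exact le_rfl
    refine (Real.rpow_add_le_add_rpow (mul_nonneg hcm (hmm _ _)) (Finset.sum_nonneg (fun j _ => hterm j))
      hd.le hd1).trans ?_
    rw [Real.mul_rpow hcm (hmm _ _)]
    gcongr
    refine (rpow_sum_le Finset.univ _ (fun j _ => hterm j) hd hd1).trans ?_
    apply Finset.sum_le_sum
    intro ω0' _
    split_ifs
    · apply Real.rpow_le_rpow (mul_nonneg (hν _) (hmm _ _)) _ hd.le
      exact mul_le_of_le_one_left (hmm _ _) (hν2 _)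
    · rw [Real.zero_rpow hd.ne']
  have hC : ∑ i ∈ Finset.univ.filter (fun i => val i ≠ 0), P i *
      (∑ ω0', ν ω0' * mm vec n μ a ω (val i • (vec ω0' - vec ω0)) W) ^ d ≤
      p * cmass ν vec W ω0 ^ d * mm vec n μ a ω 0 W ^ d + ∑ ω0', if vec ω0' - vec ω0 ∉ W ∧ ν ω0' ≠ 0 then
        p * κ ^ d * mm vec n μ a ω 0 (W ⊔ Submodule.span ℚ {vec ω0' - vec ω0}) ^ d else 0 := by
    calc _ ≤ ∑ i ∈ Finset.univ.filter (fun i => val i ≠ 0), P i * (cmass ν vec W ω0 ^ d * mm vec n μ a ω 0 W ^ d + ∑ ω0', if vec ω0' - vec ω0 ∉ W ∧ ν ω0' ≠ 0 then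
        mm vec n μ a ω (val i • (vec ω0' - vec ω0)) W ^ d else 0) :=
          Finset.sum_le_sum (fun i _ => mul_le_mul_of_nonneg_left (hB i) (hP i))
      _ = p * cmass ν vec W ω0 ^ d * mm vec n μ a ω 0 W ^ d + ∑ ω0', ∑ i ∈ Finset.univ.filter (fun i => val i ≠ 0), P i * (if vec ω0' - vec ω0 ∉ W ∧ ν ω0' ≠ 0 then
        mm vec n μ a ω (val i • (vec ω0' - vec ω0)) W ^ d else 0) := by
          simp only [mul_add, Finset.sum_add_distrib]
          rw [← Finset.sum_mul, hp, mul_assoc]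
          congr 1
          simp only [Finset.mul_sum]
          rw [Finset.sum_comm]
      _ ≤ _ := by
          gcongr with ω0' _
          split_ifs with h
          · have hj := jensen_pow (Finset.univ.filter (fun i => val i ≠ 0)) P
              (fun i => mm vec n μ a ω (val i • (vec ω0' - vec ω0)) W) (fun i _ => hP i)
              (fun i _ => hmm _ _) (p := p) (t := κ * mm vec n μ a ω 0 (W ⊔ Submodule.span ℚ {vec ω0' - vec ω0}))
              hp (mul_nonneg hκ (hmm _ _)) (by
                rw [← mul_assoc]
                exact mm_conc hμ a ω W _ h.1 P val hP (p * κ) (mul_nonneg hp0 hκ) hc) hd hd1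
            rw [Real.mul_rpow hκ (hmm _ _), ← mul_assoc] at hj
            exact hj
          · simp
  rw [hA]
  linarith

lemma head_step {n : ℕ} {μ : ℕ → X → ℝ} (hμ : ∀ x < n + 1, ∀ i, 0 ≤ μ x i)
    (hν1 : ∑ i, μ 0 i = 1) {P : ℕ → ι → ℝ} (hP : ∀ x < n + 1, ∀ i, 0 ≤ P x i) (hP1 : ∑ i, P 0 i = 1)
    (val : ℕ → ι → ℚ) (W : Submodule ℚ E) (p κ : ℝ) (hκ : 0 ≤ κ)
    (hp : ∑ i ∈ Finset.univ.filter (fun i => val 0 i ≠ 0), P 0 i = p)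
    (hc : ∀ t : ℚ, t ≠ 0 → ∑ i ∈ Finset.univ.filter (fun i => val 0 i = t), P 0 i ≤ p * κ)
    {d : ℝ} (hd : 0 < d) (hd1 : d ≤ 1) :
    GG vec (n+1) μ P val d W ≤
      ((1 - p) + p * ∑ ω, μ 0 ω * cmass (μ 0) vec W ω ^ d) *
        GG vec n (fun x => μ (x+1)) (fun x => P (x+1)) (fun x => val (x+1)) d W +
      ∑ ω, ∑ ω', if vec ω' - vec ω ∉ W ∧ μ 0 ω ≠ 0 ∧ μ 0 ω' ≠ 0 then p * κ ^ d *
        GG vec n (fun x => μ (x+1)) (fun x => P (x+1)) (fun x => val (x+1)) d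
          (W ⊔ Submodule.span ℚ {vec ω' - vec ω}) else 0 := by
  have hp0 : 0 ≤ p := hp ▸ Finset.sum_nonneg (fun i _ => hP 0 (by omega) i)
  have hν2 : ∀ i, μ 0 i ≤ 1 := fun i => hν1 ▸ Finset.single_le_sum (fun j _ => hμ 0 (by omega) j) (Finset.mem_univ i)
  have hμ' : ∀ x < n, ∀ i, 0 ≤ μ (x+1) i := fun x hx => hμ (x+1) (by omega)
  have hP' : ∀ x < n, ∀ i, 0 ≤ P (x+1) i := fun x hx => hP (x+1) (by omega)
  rw [GG_cons]
  set A := ((1 - p) + p * ∑ ω, μ 0 ω * cmass (μ 0) vec W ω ^ d) with hA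
  have key : ∀ (o : Fin n → ι) (ω : Fin n → X), ∑ ω0, μ 0 ω0 * ∑ i, P 0 i *
        (∑ ω0', μ 0 ω0' * mm vec n (fun x => μ (x+1)) (fun x => val (x+1) (o x)) ω
          (val 0 i • (vec ω0' - vec ω0)) W) ^ d ≤
      A * mm vec n (fun x => μ (x+1)) (fun x => val (x+1) (o x)) ω 0 W ^ d +
      ∑ ω0, ∑ ω0', if vec ω0' - vec ω0 ∉ W ∧ μ 0 ω0 ≠ 0 ∧ μ 0 ω0' ≠ 0 then p * κ ^ d *
        mm vec n (fun x => μ (x+1)) (fun x => val (x+1) (o x)) ω 0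
          (W ⊔ Submodule.span ℚ {vec ω0' - vec ω0}) ^ d else 0 := by
    intro o ω
    have h1 : A * mm vec n (fun x => μ (x+1)) (fun x => val (x+1) (o x)) ω 0 W ^ d =
        ∑ ω0, μ 0 ω0 * (((1 - p) + p * cmass (μ 0) vec W ω0 ^ d) *
          mm vec n (fun x => μ (x+1)) (fun x => val (x+1) (o x)) ω 0 W ^ d) := by
      simp only [← mul_assoc]
      rw [← Finset.sum_mul]
      congr 1
      simp only [mul_add, Finset.sum_add_distrib]
      rw [← Finset.sum_mul, hν1, one_mul, hA, Finset.mul_sum]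
      congr 1
      apply Finset.sum_congr rfl; intro i _; ring
    rw [h1, ← Finset.sum_add_distrib]
    apply Finset.sum_le_sum
    intro ω0 _
    refine (mul_le_mul_of_nonneg_left (head_pt hμ' (fun x => val (x+1) (o x)) ω W (μ 0) (hμ 0 (by omega))
      hν1 (P 0) (val 0) (hP 0 (by omega)) hP1 p κ hκ hp hc hd hd1 ω0) (hμ 0 (by omega) ω0)).trans ?_
    rw [mul_add, Finset.mul_sum]
    gcongr with ω0' _
    by_cases h0 : μ 0 ω0 = 0
    · simp [h0]
    · simp only [h0, ne_eq, not_false_eq_true, true_and]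
      split_ifs
      · apply mul_le_of_le_one_left _ (hν2 _)
        have := mm_nonneg (vec := vec) hμ' (fun x => val (x+1) (o x)) ω 0 (W ⊔ Submodule.span ℚ {vec ω0' - vec ω0})
        positivity
      · simp
  calc _ ≤ ∑ o : Fin n → ι, ∑ ω : Fin n → X, (∏ x : Fin n, P (x+1) (o x)) *
      ((∏ x : Fin n, μ (x+1) (ω x)) * (A * mm vec n (fun x => μ (x+1)) (fun x => val (x+1) (o x)) ω 0 W ^ d +
      ∑ ω0, ∑ ω0', if vec ω0' - vec ω0 ∉ W ∧ μ 0 ω0 ≠ 0 ∧ μ 0 ω0' ≠ 0 then p * κ ^ d *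
        mm vec n (fun x => μ (x+1)) (fun x => val (x+1) (o x)) ω 0
          (W ⊔ Submodule.span ℚ {vec ω0' - vec ω0}) ^ d else 0)) := by
        apply Finset.sum_le_sum; intro o _
        apply Finset.sum_le_sum; intro ω _
        refine mul_le_mul_of_nonneg_left ?_ (Finset.prod_nonneg (fun x _ => hP' x x.2 _))
        exact mul_le_mul_of_nonneg_left (key o ω) (Finset.prod_nonneg (fun x _ => hμ' x x.2 _))
    _ = _ := by
        unfold GG
        have hx : ∀ (c : ℝ) (W' : Submodule ℚ E), c * ∑ o : Fin n → ι, (∏ x : Fin n, P (x+1) (o x)) * ∑ ω : Fin n → X, (∏ x : Fin n, μ (x+1) (ω x)) *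
            (mm vec n (fun x => μ (x+1)) (fun x => val (x+1) (o x)) ω 0 W') ^ d =
            ∑ o : Fin n → ι, ∑ ω : Fin n → X, (∏ x : Fin n, P (x+1) (o x)) *
            ((∏ x : Fin n, μ (x+1) (ω x)) * (c * (mm vec n (fun x => μ (x+1)) (fun x => val (x+1) (o x)) ω 0 W') ^ d)) := by
          intro c W'
          rw [Finset.mul_sum]
          apply Finset.sum_congr rfl; intro o _
          rw [Finset.mul_sum, Finset.mul_sum]
          apply Finset.sum_congr rfl; intro ω _
          ring
        beta_reduce
        simp only [hx]
        have hy : ∀ (c : Prop) [Decidable c] (F : (Fin n → ι) → (Fin n → X) → ℝ),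
            (if c then ∑ o, ∑ ω, F o ω else 0) = ∑ o, ∑ ω, if c then F o ω else 0 := by
          intro c _ F; split_ifs <;> simp
        simp only [hy]
        simp only [mul_add, Finset.sum_add_distrib]
        congr 1
        simp only [Finset.mul_sum]
        rw [Finset.sum_congr rfl (fun o _ => Finset.sum_comm)]
        rw [Finset.sum_comm]
        apply Finset.sum_congr rfl; intro ω0 _
        rw [Finset.sum_congr rfl (fun o _ => Finset.sum_comm)]
        rw [Finset.sum_comm]
        apply Finset.sum_congr rfl; intro ω0' _
        apply Finset.sum_congr rfl; intro o _
        apply Finset.sum_congr rfl; intro ω _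
        split_ifs <;> simp

end Coll

end FGK


namespace FGK

set_option linter.unusedSectionVars false

section Udim
variable {r : ℕ}
local notation "EE" => ((Fin r → Bool) → ℚ)

lemma udim_eq (i : ℕ) (W : Submodule ℚ EE) :
    udim (VV r) (i+1) W = ((Module.finrank ℚ (VV r (i+1)) : ℝ) - Module.finrank ℚ ↥(W ⊓ VV r (i+1))) -
      ((Module.finrank ℚ (VV r i) : ℝ) - Module.finrank ℚ ↥(W ⊓ VV r i)) := by
  unfold udim
  have h := Submodule.finrank_sup_add_finrank_inf_eq (W ⊓ VV r (i+1)) (VV r i)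
  have e : W ⊓ VV r (i+1) ⊓ VV r i = W ⊓ VV r i := by
    rw [inf_assoc, inf_eq_right.mpr (VV_mono r (Nat.le_succ i))]
  rw [e] at h
  have h' : (Module.finrank ℚ ↥(W ⊓ VV r (i+1) ⊔ VV r i) : ℝ) + Module.finrank ℚ ↥(W ⊓ VV r i) =
    Module.finrank ℚ ↥(W ⊓ VV r (i+1)) + Module.finrank ℚ (VV r i) := by exact_mod_cast h
  show (Module.finrank ℚ (VV r (i+1)) : ℝ) - Module.finrank ℚ ↥(W ⊓ VV r (i+1) ⊔ VV r i) = _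
  linarith

lemma udim_tele (j : ℕ) (W : Submodule ℚ EE) (hW : VV r 0 ≤ W) :
    ∑ i ∈ Finset.range j, udim (VV r) (i+1) W =
      (Module.finrank ℚ (VV r j) : ℝ) - Module.finrank ℚ ↥(W ⊓ VV r j) := by
  induction j with
  | zero => rw [inf_eq_right.mpr hW]; simp
  | succ j ih => rw [Finset.sum_range_succ, ih, udim_eq]; ring

lemma udim_nonneg (i : ℕ) (W : Submodule ℚ EE) : 0 ≤ udim (VV r) (i+1) W := by
  unfold udim
  have : W ⊓ VV r (i+1) ⊔ VV r (i+1-1) ≤ VV r (i+1) := sup_le inf_le_right (VV_mono r (by omega))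
  have := Submodule.finrank_mono this
  have : (Module.finrank ℚ ↥(W ⊓ VV r (i+1) ⊔ VV r (i+1-1)) : ℝ) ≤ Module.finrank ℚ (VV r (i+1)) := by
    exact_mod_cast this
  linarith

lemma udim_anti (i : ℕ) {W W' : Submodule ℚ EE} (h : W ≤ W') :
    udim (VV r) (i+1) W' ≤ udim (VV r) (i+1) W := by
  unfold udim
  have : W ⊓ VV r (i+1) ⊔ VV r (i+1-1) ≤ W' ⊓ VV r (i+1) ⊔ VV r (i+1-1) :=
    sup_le_sup_right (inf_le_inf_right _ h) _
  have := Submodule.finrank_mono this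
  have : (Module.finrank ℚ ↥(W ⊓ VV r (i+1) ⊔ VV r (i+1-1)) : ℝ) ≤
    Module.finrank ℚ ↥(W' ⊓ VV r (i+1) ⊔ VV r (i+1-1)) := by exact_mod_cast this
  linarith

lemma inf_sup_span {V W : Submodule ℚ EE} {v : EE} (hv : v ∈ V) :
    (W ⊔ Submodule.span ℚ {v}) ⊓ V = (W ⊓ V) ⊔ Submodule.span ℚ {v} := by
  have h : Submodule.span ℚ {v} ≤ V := by
    rw [Submodule.span_le]; simpa using hv
  rw [sup_comm, sup_inf_assoc_of_le W h, sup_comm]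

lemma udim_jump_hi (i j : ℕ) (hij : j ≤ i) {W : Submodule ℚ EE} {v : EE} (hv : v ∈ VV r j) :
    udim (VV r) (i+1) (W ⊔ Submodule.span ℚ {v}) = udim (VV r) (i+1) W := by
  unfold udim
  rw [inf_sup_span (VV_mono r (by omega : j ≤ i+1) hv)]
  have h : Submodule.span ℚ {v} ≤ VV r (i+1-1) := by
    rw [Submodule.span_le]; simpa using VV_mono r (by omega : j ≤ i + 1 - 1) hv
  rw [sup_assoc, sup_eq_right.mpr h]

lemma udim_jump_sum (j : ℕ) {W : Submodule ℚ EE} (hW : VV r 0 ≤ W) {v : EE} (hv : v ∈ VV r j)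
    (hvW : v ∉ W) :
    ∑ i ∈ Finset.range j, (udim (VV r) (i+1) W - udim (VV r) (i+1) (W ⊔ Submodule.span ℚ {v})) = 1 := by
  rw [Finset.sum_sub_distrib, udim_tele j W hW, udim_tele j _ (hW.trans le_sup_left), inf_sup_span hv]
  have hne : v ≠ 0 := fun h => hvW (h ▸ W.zero_mem)
  have h := Submodule.finrank_sup_add_finrank_inf_eq (W ⊓ VV r j) (Submodule.span ℚ {v})
  have e : W ⊓ VV r j ⊓ Submodule.span ℚ {v} = ⊥ := by
    rw [Submodule.eq_bot_iff]
    intro x hx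
    obtain ⟨⟨h1, _⟩, h2⟩ := hx
    obtain ⟨t, rfl⟩ := Submodule.mem_span_singleton.mp h2
    by_cases ht : t = 0
    · simp [ht]
    · exact absurd ((W.smul_mem_iff ht).mp h1) hvW
  rw [e, finrank_bot, finrank_span_singleton hne] at h
  rw [show Module.finrank ℚ ↥(W ⊓ VV r j ⊔ Submodule.span ℚ {v}) = Module.finrank ℚ ↥(W ⊓ VV r j) + 1 by omega]
  push_cast; ring

lemma udim_zero (i : ℕ) (hi : i < r) : udim (VV r) (i+1) (VV r 0) = 2 ^ i := by
  rw [udim_eq, inf_eq_left.mpr (VV_mono r (Nat.zero_le _)), inf_eq_left.mpr (VV_mono r (Nat.zero_le _)),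
    finrank_VV r (i+1) hi, finrank_VV r i hi.le]
  push_cast; ring

end Udim

lemma exp_quad {t : ℝ} (ht : t ≤ 0) : Real.exp t ≤ 1 + t + t^2 := by
  by_cases h : -1 ≤ t
  · have := Real.abs_exp_sub_one_sub_id_le (x := t) (by rw [abs_le]; constructor <;> linarith)
    have := (abs_le.mp this).2
    linarith
  · push Not at h
    have := Real.exp_le_one_iff.mpr ht
    nlinarith

/-- the second moment constant -/
noncomputable def Kc {X : Type*} [Fintype X] (ν : X → ℝ) : ℝ := ∑ ω, ν ω * (Real.log (ν ω))^2

lemma Kc_nonneg {X : Type*} [Fintype X] (ν : X → ℝ) (h0 : ∀ ω, 0 ≤ ν ω) : 0 ≤ Kc ν :=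
  Finset.sum_nonneg (fun ω _ => mul_nonneg (h0 ω) (sq_nonneg _))

lemma moment_le {E X : Type*} [AddCommGroup E] [Module ℚ E] [Fintype X] (ν : X → ℝ) (vec : X → E)
    (h0 : ∀ ω, 0 ≤ ν ω) (h1 : ∑ ω, ν ω = 1) (W : Submodule ℚ E) {d : ℝ} (hd : 0 < d) :
    ∑ ω, ν ω * cmass ν vec W ω ^ d ≤ 1 - d * ent ν vec W + d^2 * Kc ν := by
  have hR : 1 - d * ent ν vec W + d^2 * Kc ν =
      ∑ ω, ν ω * (1 + d * Real.log (cmass ν vec W ω) + d^2 * (Real.log (ν ω))^2) := by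
    unfold ent Kc
    nth_rewrite 1 [← h1]
    rw [Finset.mul_sum, Finset.mul_sum, ← Finset.sum_sub_distrib, ← Finset.sum_add_distrib]
    apply Finset.sum_congr rfl; intro i _; ring
  rw [hR]
  apply Finset.sum_le_sum
  intro ω _
  rcases (h0 ω).eq_or_lt with h | h
  · rw [← h]; simp
  · apply mul_le_mul_of_nonneg_left _ h.le
    have hle : ν ω ≤ cmass ν vec W ω := by
      unfold cmass
      have := Finset.single_le_sum (f := fun ω' => if vec ω' - vec ω ∈ W then ν ω' else 0)
        (s := Finset.univ) (by intro i _; split_ifs; exact h0 i; exact le_rfl)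
        (Finset.mem_univ ω)
      simpa using this
    have hle1 : cmass ν vec W ω ≤ 1 := by
      rw [← h1]; unfold cmass
      apply Finset.sum_le_sum
      intro i _
      split_ifs; exact le_rfl; exact h0 i
    have hc : 0 < cmass ν vec W ω := h.trans_le hle
    have hl : Real.log (cmass ν vec W ω) ≤ 0 := Real.log_nonpos hc.le hle1
    have hl2 : Real.log (ν ω) ≤ Real.log (cmass ν vec W ω) := Real.log_le_log h hle
    rw [Real.rpow_def_of_pos hc]
    have := exp_quad (t := Real.log (cmass ν vec W ω) * d) (by nlinarith)
    have h2 : (Real.log (cmass ν vec W ω))^2 ≤ (Real.log (ν ω))^2 := by nlinarith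
    have h3 : d^2 * (Real.log (cmass ν vec W ω))^2 ≤ d^2 * (Real.log (ν ω))^2 := by gcongr
    nlinarith

lemma moment_le_one {E X : Type*} [AddCommGroup E] [Module ℚ E] [Fintype X] (ν : X → ℝ) (vec : X → E)
    (h0 : ∀ ω, 0 ≤ ν ω) (h1 : ∑ ω, ν ω = 1) (W : Submodule ℚ E) {d : ℝ} (hd : 0 < d) :
    ∑ ω, ν ω * cmass ν vec W ω ^ d ≤ 1 := by
  rw [← h1]
  apply Finset.sum_le_sum
  intro ω _
  apply mul_le_of_le_one_right (h0 ω)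
  apply Real.rpow_le_one _ _ hd.le
  · unfold cmass; apply Finset.sum_nonneg; intro i _; split_ifs; exact h0 i; exact le_rfl
  · rw [← h1]; unfold cmass
    apply Finset.sum_le_sum
    intro i _
    split_ifs; exact le_rfl; exact h0 i

lemma Sys.supp {r : ℕ} {c : ℕ → ℝ} {lam : ℕ → ℕ → ℝ} {μ : ℕ → XT r → ℝ} {δ : ℝ} (hS : Sys r c lam μ δ) :
    ∀ j ≤ r, ∀ x y, μ j x ≠ 0 → μ j y ≠ 0 → vecX x - vecX y ∈ VV r j :=
  fun j hj x y hx hy => (VV r j).sub_mem (hS.supp1 j hj x hx) (hS.supp1 j hj y hy)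

/-- exponent -/
noncomputable def Phi (r : ℕ) (v : ℕ → ℝ) (W : Submodule ℚ ((Fin r → Bool) → ℚ)) : ℝ :=
  ∑ i ∈ Finset.range r, udim (VV r) (i+1) W * v (i+1)

variable {r : ℕ} {c : ℕ → ℝ} {lam : ℕ → ℕ → ℝ} {μ : ℕ → XT r → ℝ} {δ : ℝ}

lemma sum_ite_range (r j : ℕ) (hj : j ≤ r) (f : ℕ → ℝ) :
    ∑ i ∈ Finset.range r, (if i + 1 ≤ j then f i else 0) = ∑ i ∈ Finset.range j, f i := by
  rw [← Finset.sum_filter]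
  apply Finset.sum_congr _ (fun _ _ => rfl)
  ext i; simp only [Finset.mem_filter, Finset.mem_range]; omega

/-- single step of the potential -/
lemma pot_step (hS : Sys r c lam μ δ) {d'' d C0 : ℝ} (hd'' : 0 < d'') (hd : 0 < d) (hC0 : 0 ≤ C0)
    (hK : ∀ j ≤ r, d * Kc (μ j) ≤ d''/2)
    (hC : (Fintype.card (XT r) : ℝ)^2 * C0 ^ d ≤ d * d'' / 2)
    (j : ℕ) (hj : j ≤ r) (p pos : ℝ) (hp0 : 0 ≤ p) (hp1 : p ≤ 1) (v v' : ℕ → ℝ)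
    (hv : ∀ i, 1 ≤ i → i ≤ r → v i ≤ v' i + if i ≤ j then p * (lam j i - d'') else 0)
    (hpos : ∀ i, 1 ≤ i → i ≤ j → v' i ≤ pos)
    (W : Submodule ℚ ((Fin r → Bool) → ℚ)) (hW : VV r 0 ≤ W)
    (G : Submodule ℚ ((Fin r → Bool) → ℚ) → ℝ) (hG0 : ∀ W, 0 ≤ G W)
    (hG : ∀ W, VV r 0 ≤ W → G W ≤ Real.exp (-d * Phi r v' W)) :
    ((1 - p) + p * ∑ ω, μ j ω * cmass (μ j) vecX W ω ^ d) * G W +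
      (∑ ω, ∑ ω', if vecX ω' - vecX ω ∉ W ∧ μ j ω ≠ 0 ∧ μ j ω' ≠ 0 then
        p * (C0 * Real.exp (-pos)) ^ d * G (W ⊔ Submodule.span ℚ {vecX ω' - vecX ω}) else 0) ≤
    Real.exp (-d * Phi r v W) := by
  have hm0 := hS.mu0 j hj
  have hm1 := hS.mu1 j hj
  set M := ∑ ω, μ j ω * cmass (μ j) vecX W ω ^ d with hM
  have hM0 : 0 ≤ M := by
    apply Finset.sum_nonneg; intro ω _
    apply mul_nonneg (hm0 ω)
    apply Real.rpow_nonneg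
    unfold cmass; apply Finset.sum_nonneg; intro i _; split_ifs; exact hm0 i; exact le_rfl
  set T' := Real.exp (-d * Phi r v' W) with hT'
  have hT'pos : 0 < T' := Real.exp_pos _
  set S := ∑ i ∈ Finset.range j, udim (VV r) (i+1) W with hSd
  set H := ent (μ j) vecX W with hH
  have hent := hS.ent j hj W hW
  -- comparison of exponents
  have hPhi : Phi r v W ≤ Phi r v' W + p * (H - d'' * S) := by
    have h1 : Phi r v W ≤ ∑ i ∈ Finset.range r, (udim (VV r) (i+1) W * v' (i+1) +
        if i + 1 ≤ j then p * (lam j (i+1) * udim (VV r) (i+1) W) - p * d'' * udim (VV r) (i+1) W else 0) := by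
      unfold Phi
      apply Finset.sum_le_sum
      intro i hi
      have := mul_le_mul_of_nonneg_left (hv (i+1) (by omega) (by have := Finset.mem_range.mp hi; omega))
        (udim_nonneg (r := r) i W)
      refine this.trans (le_of_eq ?_)
      rw [mul_add]; congr 1
      split_ifs <;> ring
    rw [Finset.sum_add_distrib, sum_ite_range r j hj, Finset.sum_sub_distrib, ← Finset.mul_sum,
      ← Finset.mul_sum] at h1
    have h2 := mul_le_mul_of_nonneg_left hent hp0
    unfold Phi at *
    nlinarith
  have hTT : Real.exp (-d * p * (H - d'' * S)) * T' ≤ Real.exp (-d * Phi r v W) := by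
    rw [hT', ← Real.exp_add]
    apply Real.exp_le_exp.mpr
    nlinarith
  by_cases hA : ∀ ω ω', μ j ω ≠ 0 → μ j ω' ≠ 0 → vecX ω' - vecX ω ∈ W
  · -- Case A
    have hz : (∑ ω, ∑ ω', if vecX ω' - vecX ω ∉ W ∧ μ j ω ≠ 0 ∧ μ j ω' ≠ 0 then
        p * (C0 * Real.exp (-pos)) ^ d * G (W ⊔ Submodule.span ℚ {vecX ω' - vecX ω}) else 0) = 0 := by
      apply Finset.sum_eq_zero; intro ω _
      apply Finset.sum_eq_zero; intro ω' _
      rw [if_neg]; rintro ⟨h1, h2, h3⟩; exact h1 (hA ω ω' h2 h3)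
    rw [hz, add_zero]
    have hH0 : H = 0 := by
      rw [hH]; unfold ent
      apply Finset.sum_eq_zero; intro ω _
      by_cases h : μ j ω = 0
      · simp [h]
      · have : cmass (μ j) vecX W ω = 1 := by
          rw [← hm1]; unfold cmass
          apply Finset.sum_congr rfl; intro ω' _
          by_cases h' : μ j ω' = 0
          · simp [h']
          · rw [if_pos (hA ω ω' h h')]
        rw [this]; simp
    have hS0 : 0 ≤ S := Finset.sum_nonneg (fun i _ => udim_nonneg i W)
    have hM1 := moment_le_one (μ j) vecX hm0 hm1 W hd
    have h1 : (1 - p) + p * M ≤ 1 := by nlinarith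
    calc _ ≤ 1 * T' := mul_le_mul h1 (hG W hW) (hG0 W) zero_le_one
      _ ≤ Real.exp (-d * p * (H - d'' * S)) * T' := by
        apply mul_le_mul_of_nonneg_right _ hT'pos.le
        apply Real.one_le_exp
        rw [hH0]
        have : 0 ≤ d * p * (d'' * S) := by positivity
        nlinarith
      _ ≤ _ := hTT
  · push Not at hA
    obtain ⟨ω1, ω2, h1, h2, h12⟩ := hA
    have hS1 : 1 ≤ S := by
      have := udim_jump_sum j hW (hS.supp j hj ω2 ω1 h2 h1) h12
      rw [Finset.sum_sub_distrib] at this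
      have h0 : 0 ≤ ∑ i ∈ Finset.range j, udim (VV r) (i+1) (W ⊔ Submodule.span ℚ {vecX ω2 - vecX ω1}) :=
        Finset.sum_nonneg (fun i _ => udim_nonneg i _)
      linarith
    have hjump : ∀ ω ω', (if vecX ω' - vecX ω ∉ W ∧ μ j ω ≠ 0 ∧ μ j ω' ≠ 0 then
        p * (C0 * Real.exp (-pos)) ^ d * G (W ⊔ Submodule.span ℚ {vecX ω' - vecX ω}) else 0) ≤
        p * C0 ^ d * T' := by
      intro ω ω'
      split_ifs with h
      · obtain ⟨hn, hw, hw'⟩ := h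
        have hvj := hS.supp j hj ω' ω hw' hw
        have hg := hG (W ⊔ Submodule.span ℚ {vecX ω' - vecX ω}) (hW.trans le_sup_left)
        have hdiff : Phi r v' W - Phi r v' (W ⊔ Submodule.span ℚ {vecX ω' - vecX ω}) ≤ pos := by
          have e : Phi r v' W - Phi r v' (W ⊔ Submodule.span ℚ {vecX ω' - vecX ω}) =
            ∑ i ∈ Finset.range r, if i + 1 ≤ j then (udim (VV r) (i+1) W -
              udim (VV r) (i+1) (W ⊔ Submodule.span ℚ {vecX ω' - vecX ω})) * v' (i+1) else 0 := by
            unfold Phi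
            rw [← Finset.sum_sub_distrib]
            apply Finset.sum_congr rfl; intro i _
            split_ifs with hi
            · ring
            · rw [udim_jump_hi i j (by omega) hvj]; ring
          rw [e, sum_ite_range r j hj (fun i => (udim (VV r) (i+1) W -
              udim (VV r) (i+1) (W ⊔ Submodule.span ℚ {vecX ω' - vecX ω})) * v' (i+1))]
          calc _ ≤ ∑ i ∈ Finset.range j, (udim (VV r) (i+1) W -
              udim (VV r) (i+1) (W ⊔ Submodule.span ℚ {vecX ω' - vecX ω})) * pos := by
                apply Finset.sum_le_sum; intro i hi
                apply mul_le_mul_of_nonneg_left (hpos (i+1) (by omega) (by have := Finset.mem_range.mp hi; omega))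
                have := udim_anti (r := r) i (le_sup_left : W ≤ W ⊔ Submodule.span ℚ {vecX ω' - vecX ω})
                linarith
            _ = pos := by rw [← Finset.sum_mul, udim_jump_sum j hW hvj hn, one_mul]
        rw [Real.mul_rpow hC0 (Real.exp_pos _).le, ← Real.exp_mul]
        calc _ ≤ p * (C0 ^ d * Real.exp (-pos * d)) * Real.exp (-d * Phi r v' (W ⊔ Submodule.span ℚ {vecX ω' - vecX ω})) := by
              apply mul_le_mul_of_nonneg_left hg; positivity
          _ = p * C0 ^ d * Real.exp (-pos * d + -d * Phi r v' (W ⊔ Submodule.span ℚ {vecX ω' - vecX ω})) := by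
              rw [Real.exp_add]; ring
          _ ≤ _ := by
              rw [hT']
              apply mul_le_mul_of_nonneg_left _ (by positivity)
              apply Real.exp_le_exp.mpr
              nlinarith
      · positivity
    have hsum : (∑ ω, ∑ ω', if vecX ω' - vecX ω ∉ W ∧ μ j ω ≠ 0 ∧ μ j ω' ≠ 0 then
        p * (C0 * Real.exp (-pos)) ^ d * G (W ⊔ Submodule.span ℚ {vecX ω' - vecX ω}) else 0) ≤
        (d * d''/2) * p * T' := by
      calc _ ≤ ∑ ω : XT r, ∑ ω' : XT r, p * C0 ^ d * T' :=
            Finset.sum_le_sum (fun ω _ => Finset.sum_le_sum (fun ω' _ => hjump ω ω'))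
        _ = ((Fintype.card (XT r) : ℝ)^2 * C0 ^ d) * (p * T') := by
            simp only [Finset.sum_const, Finset.card_univ, nsmul_eq_mul]; ring
        _ ≤ (d * d''/2) * (p * T') := by
            apply mul_le_mul_of_nonneg_right hC; positivity
        _ = _ := by ring
    have hMle := moment_le (μ j) vecX hm0 hm1 W hd
    have hKj := mul_le_mul_of_nonneg_left (hK j hj) hd.le
    have hfac : (1 - p) + p * M ≤ 1 - p * (d * H) + p * (d * d''/2) := by
      have : M ≤ 1 - d * H + d * d''/2 := by rw [hM]; nlinarith
      nlinarith
    have h1 : ((1 - p) + p * M) * G W ≤ (1 - p * (d * H) + p * (d * d''/2)) * T' :=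
      mul_le_mul hfac (hG W hW) (hG0 W) (by
        have : 0 ≤ (1 - p) + p * M := by nlinarith [mul_nonneg hp0 hM0]
        linarith)
    have h2 : 1 - p * (d * H) + p * (d * d'') ≤ Real.exp (-d * p * (H - d'' * S)) := by
      have := Real.add_one_le_exp (-d * p * (H - d'' * S))
      have h3 : d * p * d'' * 1 ≤ d * p * d'' * S := mul_le_mul_of_nonneg_left hS1 (by positivity)
      nlinarith
    have h3 := mul_le_mul_of_nonneg_right h2 hT'pos.le
    nlinarith

lemma pot_ind (hS : Sys r c lam μ δ) {d'' d C0 : ℝ} (hd'' : 0 < d'') (hd : 0 < d) (hd1 : d ≤ 1) (hC0 : 0 ≤ C0)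
    (hK : ∀ j ≤ r, d * Kc (μ j) ≤ d''/2)
    (hC : (Fintype.card (XT r) : ℝ)^2 * C0 ^ d ≤ d * d'' / 2) {ι : Type*} [Fintype ι] (n : ℕ) :
    ∀ (lev : ℕ → ℕ) (P : ℕ → ι → ℝ) (val : ℕ → ι → ℚ) (p pos : ℕ → ℝ) (v : ℕ → ℕ → ℝ),
    (∀ x < n, lev x ≤ r) → (∀ x < n, ∀ i, 0 ≤ P x i) → (∀ x < n, ∑ i, P x i = 1) →
    (∀ x < n, ∑ i ∈ Finset.univ.filter (fun i => val x i ≠ 0), P x i = p x) →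
    (∀ x < n, ∀ t : ℚ, t ≠ 0 → ∑ i ∈ Finset.univ.filter (fun i => val x i = t), P x i ≤
      p x * (C0 * Real.exp (-pos x))) →
    (∀ x < n, ∀ i, 1 ≤ i → i ≤ r → v x i ≤ v (x+1) i + if i ≤ lev x then p x * (lam (lev x) i - d'') else 0) →
    (∀ x < n, ∀ i, 1 ≤ i → i ≤ lev x → v (x+1) i ≤ pos x) →
    (∀ i, 1 ≤ i → i ≤ r → v n i ≤ 0) →
    ∀ W, VV r 0 ≤ W → GG vecX n (fun x => μ (lev x)) P val d W ≤ Real.exp (-d * Phi r (v 0) W) := by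
  induction n with
  | zero =>
    intro lev P val p pos v _ _ _ _ _ _ _ hv W hW
    have : GG vecX 0 (fun x => μ (lev x)) P val d W = 1 := by
      simp [GG, mm]
    rw [this]
    apply Real.one_le_exp
    have : Phi r (v 0) W ≤ 0 := by
      unfold Phi
      apply Finset.sum_nonpos
      intro i hi
      exact mul_nonpos_of_nonneg_of_nonpos (udim_nonneg i W)
        (hv (i+1) (by omega) (by have := Finset.mem_range.mp hi; omega))
    nlinarith
  | succ n ih =>
    intro lev P val p pos v hlev hP hP1 hp hc hv hpos hvn W hW
    have hx : ∀ x, x < n → x + 1 < n + 1 := fun x hx => by omega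
    have hI := ih (fun x => lev (x+1)) (fun x => P (x+1)) (fun x => val (x+1)) (fun x => p (x+1))
      (fun x => pos (x+1)) (fun x => v (x+1)) (fun x h => hlev _ (hx x h)) (fun x h => hP _ (hx x h))
      (fun x h => hP1 _ (hx x h)) (fun x h => hp _ (hx x h)) (fun x h => hc _ (hx x h))
      (fun x h => hv _ (hx x h)) (fun x h => hpos _ (hx x h)) hvn
    have h0 : (0:ℕ) < n + 1 := by omega
    have hp0 : 0 ≤ p 0 := by rw [← hp 0 h0]; exact Finset.sum_nonneg (fun i _ => hP 0 h0 i)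
    have hp1 : p 0 ≤ 1 := by
      rw [← hp 0 h0, ← hP1 0 h0]
      exact Finset.sum_le_sum_of_subset_of_nonneg (Finset.filter_subset _ _) (fun i _ _ => hP 0 h0 i)
    have hμ : ∀ x < n + 1, ∀ i, 0 ≤ (fun x => μ (lev x)) x i := fun x h => hS.mu0 _ (hlev x h)
    refine (head_step (vec := vecX) hμ (hS.mu1 _ (hlev 0 h0)) hP (hP1 0 h0) val W (p 0)
      (C0 * Real.exp (-pos 0)) (by positivity) (hp 0 h0) (hc 0 h0) hd hd1).trans ?_
    exact pot_step hS hd'' hd hC0 hK hC (lev 0) (hlev 0 h0) (p 0) (pos 0) hp0 hp1 (v 0) (v 1)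
      (hv 0 h0) (hpos 0 h0) W hW (fun W => GG vecX n (fun x => μ (lev (x+1))) (fun x => P (x+1)) (fun x => val (x+1)) d W)
      (fun W => GG_nonneg (fun x h => hμ _ (hx x h)) (fun x h => hP _ (hx x h)) _ _ _) hI

theorem potential (hS : Sys r c lam μ δ) {d'' : ℝ} (hd'' : 0 < d'') :
    ∃ d : ℝ, 0 < d ∧ d ≤ 1 ∧ ∀ C0 C1 : ℝ, 0 < C0 → ∃ l : ℝ, 0 ≤ l ∧ ∀ {ι : Type} [Fintype ι] (n : ℕ)
    (lev : ℕ → ℕ) (P : ℕ → ι → ℝ) (val : ℕ → ι → ℚ) (p pos : ℕ → ℝ) (v : ℕ → ℕ → ℝ),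
    (∀ x < n, lev x ≤ r) → (∀ x < n, ∀ i, 0 ≤ P x i) → (∀ x < n, ∑ i, P x i = 1) →
    (∀ x < n, ∑ i ∈ Finset.univ.filter (fun i => val x i ≠ 0), P x i = p x) →
    (∀ x < n, ∀ t : ℚ, t ≠ 0 → ∑ i ∈ Finset.univ.filter (fun i => val x i = t), P x i ≤
      p x * (C0 * Real.exp (-pos x))) →
    (∀ x < n, ∀ i, 1 ≤ i → i ≤ r → v x i ≤ v (x+1) i + if i ≤ lev x then p x * (lam (lev x) i - d'') else 0) →
    (∀ x < n, ∀ i, 1 ≤ i → i ≤ lev x → v (x+1) i ≤ pos x + C1) →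
    (∀ i, 1 ≤ i → i ≤ r → v n i ≤ C1) →
    GG vecX n (fun x => μ (lev x)) P val d (VV r 0) ≤
      Real.exp (-d * ∑ i ∈ Finset.range r, 2^i * (v 0 (i+1) - l)) := by
  set K := ∑ j ∈ Finset.range (r+1), Kc (μ j) with hKdef
  have hKn : ∀ j ∈ Finset.range (r+1), 0 ≤ Kc (μ j) := fun j hj =>
    Kc_nonneg _ (hS.mu0 j (by have := Finset.mem_range.mp hj; omega))
  have hK0 : 0 ≤ K := Finset.sum_nonneg hKn
  refine ⟨min 1 (d''/(2*(K+1))), by positivity, min_le_left _ _, ?_⟩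
  set d := min 1 (d''/(2*(K+1))) with hd
  have hd0 : 0 < d := by positivity
  have hdK : ∀ j ≤ r, d * Kc (μ j) ≤ d''/2 := by
    intro j hj
    have h1 : Kc (μ j) ≤ K := Finset.single_le_sum hKn (Finset.mem_range.mpr (by omega))
    have h2 : d ≤ d''/(2*(K+1)) := min_le_right _ _
    calc d * Kc (μ j) ≤ d''/(2*(K+1)) * (K+1) := by
          apply mul_le_mul h2 (by linarith) (hKn j (Finset.mem_range.mpr (by omega))) (by positivity)
      _ = d''/2 := by field_simp
  intro C0 C1 hC0
  set X2 := (Fintype.card (XT r) : ℝ)^2 with hX2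
  have hX : 0 < X2 := by rw [hX2]; have : 0 < Fintype.card (XT r) := Fintype.card_pos; positivity
  -- choose l
  set A := Real.log (d * d''/2 / X2) with hA
  set l := max 0 (C1 + Real.log C0 + |A| / d + |C1|) with hl
  have hl0 : 0 ≤ l := le_max_left _ _
  set l := max l |C1| with hl'
  refine ⟨l, hl0.trans (le_max_left _ _), ?_⟩
  intro ι _ n lev P val p pos v hlev hP hP1 hp hc hv hpos hvn
  have hlC1 : C1 ≤ l := (le_abs_self _).trans (le_max_right _ _)
  have hl2 : C1 + Real.log C0 + |A|/d ≤ l := by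
    refine le_trans ?_ (le_max_left _ _)
    refine le_trans ?_ (le_max_right _ _)
    linarith [abs_nonneg C1]
  have h := pot_ind hS hd'' hd0 (min_le_left _ _) (C0 := C0 * Real.exp (C1 - l)) (by positivity) hdK (by
    rw [Real.rpow_def_of_pos (by positivity), Real.log_mul hC0.ne' (Real.exp_pos _).ne', Real.log_exp]
    have : (Real.log C0 + (C1 - l)) * d ≤ A := by
      have h1 : (Real.log C0 + (C1 - l)) ≤ -(|A|/d) := by linarith
      calc _ ≤ -(|A|/d) * d := mul_le_mul_of_nonneg_right h1 hd0.le
        _ = -|A| := by field_simp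
        _ ≤ A := neg_abs_le A
    calc X2 * Real.exp ((Real.log C0 + (C1 - l)) * d) ≤ X2 * Real.exp A := by gcongr
      _ = d * d''/2 := by rw [hA, Real.exp_log (by positivity)]; field_simp) n lev P val p
    (fun x => pos x + C1 - l) (fun x i => v x i - l) hlev hP hP1 hp (by
      intro x hx t ht
      refine (hc x hx t ht).trans (le_of_eq ?_)
      rw [mul_assoc C0, ← Real.exp_add]; congr 3; ring) (by
      intro x hx i h1 h2; have := hv x hx i h1 h2; linarith) (by
      intro x hx i h1 h2; have := hpos x hx i h1 h2; linarith) (by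
      intro i h1 h2; have := hvn i h1 h2; linarith) (VV r 0) le_rfl
  refine h.trans (le_of_eq ?_)
  unfold Phi
  congr 2
  apply Finset.sum_congr rfl
  intro i hi
  rw [udim_zero i (Finset.mem_range.mp hi)]

end FGK


namespace FGK

set_option linter.unusedSectionVars false

/-- expectation over random subsets with odds `w` -/
noncomputable def EA (P : Finset ℕ) (w : ℕ → ℝ) (F : Finset ℕ → ℝ) : ℝ :=
  (∑ A ∈ P.powerset, (∏ p ∈ A, w p) * F A) / ∏ p ∈ P, (1 + w p)

section EA
variable {w : ℕ → ℝ} (hw : ∀ p, 0 ≤ w p)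
include hw

lemma EA_den_pos (P : Finset ℕ) : 0 < ∏ p ∈ P, (1 + w p) :=
  Finset.prod_pos (fun p _ => by have := hw p; linarith)

lemma EA_mono {P : Finset ℕ} {F G : Finset ℕ → ℝ} (h : ∀ A, A ⊆ P → F A ≤ G A) : EA P w F ≤ EA P w G := by
  unfold EA
  apply div_le_div_of_nonneg_right _ (EA_den_pos hw P).le
  apply Finset.sum_le_sum
  intro A hA
  exact mul_le_mul_of_nonneg_left (h A (Finset.mem_powerset.mp hA)) (Finset.prod_nonneg (fun p _ => hw p))

omit hw in
lemma EA_congr {P : Finset ℕ} {F G : Finset ℕ → ℝ} (h : ∀ A, A ⊆ P → F A = G A) : EA P w F = EA P w G := by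
  unfold EA
  congr 1
  apply Finset.sum_congr rfl
  intro A hA
  rw [h A (Finset.mem_powerset.mp hA)]

omit hw in
lemma EA_add (P : Finset ℕ) (F G : Finset ℕ → ℝ) : EA P w (fun A => F A + G A) = EA P w F + EA P w G := by
  unfold EA
  rw [← add_div, ← Finset.sum_add_distrib]
  congr 1
  apply Finset.sum_congr rfl; intro A _; ring

omit hw in
lemma EA_mul (P : Finset ℕ) (c : ℝ) (F : Finset ℕ → ℝ) : EA P w (fun A => c * F A) = c * EA P w F := by
  unfold EA
  rw [← mul_div_assoc, Finset.mul_sum]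
  congr 1
  apply Finset.sum_congr rfl; intro A _; ring

omit hw in
lemma EA_sum {I : Type*} (s : Finset I) (P : Finset ℕ) (F : I → Finset ℕ → ℝ) :
    EA P w (fun A => ∑ i ∈ s, F i A) = ∑ i ∈ s, EA P w (F i) := by
  unfold EA
  rw [← Finset.sum_div, Finset.sum_comm]
  congr 1
  apply Finset.sum_congr rfl; intro A _; rw [Finset.mul_sum]

lemma EA_const (P : Finset ℕ) (c : ℝ) : EA P w (fun _ => c) = c := by
  unfold EA
  rw [← Finset.sum_mul, div_eq_iff (EA_den_pos hw P).ne', mul_comm]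
  congr 1
  rw [Finset.prod_one_add]

lemma EA_nonneg {P : Finset ℕ} {F : Finset ℕ → ℝ} (h : ∀ A, A ⊆ P → 0 ≤ F A) : 0 ≤ EA P w F := by
  have := EA_mono hw (P := P) (F := fun _ => 0) (G := F) h
  rwa [EA_const hw] at this

omit hw in
lemma EA_empty (F : Finset ℕ → ℝ) : EA ∅ w F = F ∅ := by
  simp [EA]

lemma EA_insert {P : Finset ℕ} {q : ℕ} (hq : q ∉ P) (F : Finset ℕ → ℝ) :
    EA (insert q P) w F = (EA P w F + w q * EA P w (fun A => F (insert q A))) / (1 + w q) := by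
  have h1 : (1 + w q) ≠ 0 := by have := hw q; positivity
  have h2 := (EA_den_pos hw P).ne'
  unfold EA
  rw [Finset.sum_powerset_insert hq, Finset.prod_insert hq]
  have : ∑ t ∈ P.powerset, (∏ p ∈ insert q t, w p) * F (insert q t) =
      w q * ∑ t ∈ P.powerset, (∏ p ∈ t, w p) * F (insert q t) := by
    rw [Finset.mul_sum]
    apply Finset.sum_congr rfl
    intro t ht
    rw [Finset.prod_insert (fun h => hq (Finset.mem_powerset.mp ht h))]; ring
  rw [this]
  field_simp

lemma EA_union {P Q : Finset ℕ} (h : Disjoint P Q) (F : Finset ℕ → ℝ) :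
    EA (P ∪ Q) w F = EA P w (fun A => EA Q w (fun B => F (A ∪ B))) := by
  induction P using Finset.induction_on generalizing F with
  | empty => rw [EA_empty]; simp
  | insert q P hq ih =>
    rw [Finset.disjoint_insert_left] at h
    rw [Finset.insert_union, EA_insert hw (by simp [hq, h.1]), EA_insert hw hq, ih h.2, ih h.2]
    simp only [Finset.insert_union]

/-- factorisation over disjoint pieces -/
lemma prodE {ι : Type*} (Z : Finset ι) (G : ι → Finset ℕ) (f : ι → Finset ℕ → ℝ) :
    ∀ (P : Finset ℕ), (∀ z ∈ Z, G z ⊆ P) → (∀ z ∈ Z, ∀ z' ∈ Z, z ≠ z' → Disjoint (G z) (G z')) →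
    EA P w (fun A => ∏ z ∈ Z, f z (A ∩ G z)) = ∏ z ∈ Z, EA (G z) w (f z) := by
  induction Z using Finset.induction_on with
  | empty => intro P _ _; simp [EA_const hw]
  | insert z Z hz ih =>
    intro P hG hd
    have hGz := hG z (Finset.mem_insert_self _ _)
    have e : P = G z ∪ (P \ G z) := by rw [Finset.union_sdiff_of_subset hGz]
    have hdz : ∀ z' ∈ Z, Disjoint (G z) (G z') := fun z' hz' =>
      hd z (Finset.mem_insert_self _ _) z' (Finset.mem_insert_of_mem hz') (fun h => hz (h ▸ hz'))
    rw [e, EA_union hw Finset.disjoint_sdiff, Finset.prod_insert hz]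
    have key : ∀ A, A ⊆ G z → EA (P \ G z) w (fun B => ∏ z' ∈ insert z Z, f z' ((A ∪ B) ∩ G z')) =
        (∏ z' ∈ Z, EA (G z') w (f z')) * f z A := by
      intro A hA
      rw [← ih (P \ G z) ?_ ?_, mul_comm, ← EA_mul]
      · apply EA_congr
        intro B hB
        rw [Finset.prod_insert hz]
        have h1 : (A ∪ B) ∩ G z = A := by
          ext p; simp only [Finset.mem_inter, Finset.mem_union]
          constructor
          · rintro ⟨h | h, h2⟩
            · exact h
            · exact absurd h2 (Finset.mem_sdiff.mp (hB h)).2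
          · intro h; exact ⟨Or.inl h, hA h⟩
        rw [h1]
        congr 1
        apply Finset.prod_congr rfl
        intro z' hz'
        congr 1
        ext p; simp only [Finset.mem_inter, Finset.mem_union]
        constructor
        · rintro ⟨h | h, h2⟩
          · exact absurd h2 (Finset.disjoint_left.mp (hdz z' hz') (hA h))
          · exact ⟨h, h2⟩
        · rintro ⟨h, h2⟩; exact ⟨Or.inr h, h2⟩
      · intro z' hz' p hp
        exact Finset.mem_sdiff.mpr ⟨hG z' (Finset.mem_insert_of_mem hz') hp,
          fun h => Finset.disjoint_left.mp (hdz z' hz') h hp⟩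
      · intro z1 h1 z2 h2 hne
        exact hd z1 (Finset.mem_insert_of_mem h1) z2 (Finset.mem_insert_of_mem h2) hne
    rw [EA_congr key, EA_mul, mul_comm]

/-- function of a piece only -/
lemma EA_piece {G P : Finset ℕ} (hG : G ⊆ P) (f : Finset ℕ → ℝ) :
    EA P w (fun A => f (A ∩ G)) = EA G w f := by
  have := prodE hw (Finset.univ : Finset Unit) (fun _ => G) (fun _ => f) P (fun _ _ => hG)
    (fun _ _ _ _ h => absurd rfl h)
  simpa using this

omit hw in
lemma EA_single {P S : Finset ℕ} (hS : S ⊆ P) :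
    EA P w (fun A => if A = S then 1 else 0) = (∏ p ∈ S, w p) / ∏ p ∈ P, (1 + w p) := by
  unfold EA
  congr 1
  rw [Finset.sum_eq_single S]
  · simp
  · intro b _ hb; simp [hb]
  · intro h; exact absurd (Finset.mem_powerset.mpr hS) h

lemma EA_den_ge_one (P : Finset ℕ) : 1 ≤ ∏ p ∈ P, (1 + w p) := by
  have := Finset.prod_le_prod (s := P) (f := fun _ => (1:ℝ)) (g := fun p => 1 + w p) (fun _ _ => zero_le_one)
    (fun p _ => by have := hw p; linarith)
  simpa using this

lemma EA_den_le_exp (P : Finset ℕ) : ∏ p ∈ P, (1 + w p) ≤ Real.exp (∑ p ∈ P, w p) := by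
  rw [Real.exp_sum]
  apply Finset.prod_le_prod
  · intro p _; have := hw p; linarith
  · intro p _; have := Real.add_one_le_exp (w p); linarith

end EA

/-- the outcome of a cell: the unique element if there is exactly one -/
noncomputable def outc (A G : Finset ℕ) : Finset ℕ := if (A ∩ G).card = 1 then A ∩ G else ∅

end FGK


namespace FGK

set_option linter.unusedSectionVars false

/-- internal nodes of the binary tree of depth `r` -/
abbrev Node (r : ℕ) : Type := Σ i : Fin r, (Fin i.val → Bool)

/-- the rightmost leaf below child `b` of node `ν` -/
def rmn {r : ℕ} (ν : Node r) (b : Bool) : Fin r → Bool := fun j =>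
  if h : j.val < ν.1.val then ν.2 ⟨j.val, h⟩ else if j = ν.1 then b else true

/-- leaf lies below child 0 of the node -/
def under {r : ℕ} (s : Fin r → Bool) (ν : Node r) : Prop :=
  (fun j : Fin ν.1.val => s ⟨j.val, by have := j.2; have := ν.1.2; omega⟩) = ν.2 ∧ s ν.1 = false

/-- integer bit -/
def bz (b : Bool) : ℤ := if b then 1 else 0

lemma bz_cast (b : Bool) : ((bz b : ℤ) : ℚ) = bv b := by cases b <;> simp [bz, bv]

/-- mixed leaf -/
def mixl {r : ℕ} (s : Fin r → Bool) (i : ℕ) : Fin r → Bool := fun j => if j.val < i then s j else true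

lemma tele {r : ℕ} (z : (Fin r → Bool) → ℤ) (s : Fin r → Bool) :
    z s + ∑ ν : Node r, (if under s ν then z (rmn ν true) - z (rmn ν false) else 0) = z (fun _ => true) := by
  have h1 : ∀ i : Fin r, ∑ t : Fin i.val → Bool, (if under s ⟨i, t⟩ then z (rmn ⟨i, t⟩ true) - z (rmn ⟨i, t⟩ false) else 0)
      = z (mixl s i) - z (mixl s (i+1)) := by
    intro i
    set t0 : Fin i.val → Bool := fun j => s ⟨j.val, by have := j.2; have := i.2; omega⟩ with ht0
    rw [Finset.sum_eq_single t0]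
    · have e1 : mixl s i = rmn ⟨i, t0⟩ true := by
        funext j; simp only [mixl, rmn, ht0]
        split_ifs <;> rfl
      by_cases hs : s i = false
      · have hu : under s ⟨i, t0⟩ := ⟨rfl, hs⟩
        rw [if_pos hu]
        have e2 : mixl s (i+1) = rmn ⟨i, t0⟩ false := by
          funext j; simp only [mixl, rmn, ht0]
          by_cases hj : j.val < i.val
          · rw [if_pos (by omega), dif_pos hj]
          · rw [dif_neg hj]
            by_cases hji : j = i
            · rw [if_pos (by rw [hji]; omega), if_pos hji, hji, hs]
            · rw [if_neg, if_neg hji]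
              intro h; exact hji (Fin.ext (by omega))
        rw [e1, e2]
      · have hu : ¬ under s ⟨i, t0⟩ := fun h => hs h.2
        rw [if_neg hu]
        have e2 : mixl s (i+1) = mixl s i := by
          funext j; simp only [mixl]
          by_cases hj : j.val < i.val
          · rw [if_pos (by omega), if_pos hj]
          · rw [if_neg hj]
            by_cases hji : j = i
            · rw [if_pos (by rw [hji]; omega), hji]; simpa using hs
            · rw [if_neg]
              intro h; exact hji (Fin.ext (by omega))
        rw [e2, sub_self]
    · intro t _ ht
      rw [if_neg]
      intro h; exact ht h.1.symm
    · intro h; exact absurd (Finset.mem_univ _) h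
  rw [Fintype.sum_sigma]
  rw [Finset.sum_congr rfl (fun i _ => h1 i)]
  rw [Fin.sum_univ_eq_sum_range (fun i => z (mixl s i) - z (mixl s (i+1))) r, Finset.sum_range_sub']
  have e0 : mixl s 0 = fun _ => true := by funext j; simp [mixl]
  have er : mixl s r = s := by funext j; simp [mixl]
  rw [e0, er]; ring

/-- differences required at the node -/
def Lz {r n : ℕ} (b : Fin n → ℕ) (ω : Fin n → XT r) (ν : Node r) : ℤ :=
  ∑ x, (b x : ℤ) * (bz (ω x (rmn ν true)) - bz (ω x (rmn ν false)))

lemma Lz_inj {r n : ℕ} (b : Fin n → ℕ) (ω ω' : Fin n → XT r) (h : Lz b ω = Lz b ω') :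
    (0 : (Fin r → Bool) → ℚ) + ∑ x, (b x : ℚ) • (vecX (ω' x) - vecX (ω x)) ∈ VV r 0 := by
  set z : (Fin r → Bool) → ℤ := fun s => ∑ x, (b x : ℤ) * (bz (ω' x s) - bz (ω x s)) with hz
  have h0 : ∀ ν, z (rmn ν true) - z (rmn ν false) = 0 := by
    intro ν
    have h1 := congrFun h ν
    have : z (rmn ν true) - z (rmn ν false) = Lz b ω' ν - Lz b ω ν := by
      simp only [hz, Lz]
      rw [← Finset.sum_sub_distrib, ← Finset.sum_sub_distrib]
      apply Finset.sum_congr rfl; intro x _; ring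
    rw [this, h1, sub_self]
  have hc : ∀ s, z s = z (fun _ => true) := by
    intro s
    have := tele z s
    simpa [h0] using this
  have hv : ∀ s, ((0 : (Fin r → Bool) → ℚ) + ∑ x, (b x : ℚ) • (vecX (ω' x) - vecX (ω x))) s = (z s : ℚ) := by
    intro s
    simp only [zero_add, Finset.sum_apply, Pi.smul_apply, Pi.sub_apply, smul_eq_mul, hz]
    push_cast
    apply Finset.sum_congr rfl; intro x _
    rw [bz_cast, bz_cast]; rfl
  rw [mem_VV]
  intro s t _
  rw [hv, hv, hc s, hc t]

/-- success: `2^r` distinct subsets with equal sums -/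
def Succ (r : ℕ) (a : ℕ → ℕ) (A : Finset ℕ) (Cn : ℝ) : Prop :=
  ∃ F : (Fin r → Bool) → Finset ℕ, (∀ s, F s ⊆ A) ∧ Function.Injective F ∧
    (∃ σ : ℕ, ∀ s, ∑ p ∈ F s, a p = σ) ∧ ∀ s, ((F s).card : ℝ) ≤ Cn

lemma exists_under {r : ℕ} (s s' : Fin r → Bool) (h : s ≠ s') :
    ∃ ν : Node r, (under s ν ∧ ¬ under s' ν) ∨ (under s' ν ∧ ¬ under s ν) := by
  have hex : ∃ m, ∃ i : Fin r, i.val = m ∧ s i ≠ s' i := by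
    by_contra H; push Not at H
    exact h (funext fun i => H _ i rfl)
  have hm := Nat.find_spec hex
  have hmin := fun m (hm : m < Nat.find hex) => Nat.find_min hex hm
  obtain ⟨i, hi, hne⟩ := hm
  have hag : ∀ j : Fin r, j.val < i.val → s j = s' j := by
    intro j hj
    by_contra H
    exact hmin j.val (by omega) ⟨j, rfl, H⟩
  refine ⟨⟨i, fun j => s ⟨j.val, by have := j.2; have := i.2; omega⟩⟩, ?_⟩
  have heq : (fun j : Fin i.val => s' ⟨j.val, by have := j.2; have := i.2; omega⟩) =
      fun j : Fin i.val => s ⟨j.val, by have := j.2; have := i.2; omega⟩ := by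
    funext j; exact (hag _ j.2).symm
  by_cases hs : s i = false
  · left
    refine ⟨⟨rfl, hs⟩, fun H => hne ?_⟩
    rw [hs]; exact H.2.symm
  · right
    refine ⟨⟨heq, ?_⟩, fun H => hs H.2⟩
    have hs1 : s i = true := by simpa using hs
    rw [hs1] at hne
    simpa using hne.symm

lemma succ_of {r n : ℕ} (a : ℕ → ℕ) (A : Finset ℕ) (S : Fin n → Finset ℕ) (cl : ℕ → Option (Node r × Bool))
    (hSA : ∀ x, S x ⊆ A) (hS1 : ∀ x, (S x).card ≤ 1) (hSd : ∀ x y, x ≠ y → Disjoint (S x) (S y))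
    (hScl : ∀ x, ∀ p ∈ S x, cl p = none) (ω : Fin n → XT r) (g : Node r → Bool → ℕ)
    (hgA : ∀ ν b, g ν b ∈ A) (hgcl : ∀ ν b, cl (g ν b) = some (ν, b))
    (hL : ∀ ν, (a (g ν true) : ℤ) - a (g ν false) = Lz (fun x => ∑ p ∈ S x, a p) ω ν) :
    Succ r a A (n + 2^r) := by
  set B : (Fin r → Bool) → Fin n → Finset ℕ := fun s x => if ω x s then S x else ∅ with hB
  set gs : (Fin r → Bool) → Node r → ℕ := fun s ν => g ν (if under s ν then true else false) with hgs
  have hgsinj : ∀ s, Function.Injective (gs s) := by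
    intro s ν ν' h
    have := congrArg cl h
    simp only [hgs, hgcl, Option.some.injEq, Prod.mk.injEq] at this
    exact this.1
  have hBsub : ∀ s x, B s x ⊆ S x := by
    intro s x; simp only [hB]; split_ifs
    · exact Finset.Subset.refl _
    · exact Finset.empty_subset _
  have hdisj : ∀ s, Disjoint (Finset.univ.biUnion (B s)) (Finset.univ.image (gs s)) := by
    intro s
    rw [Finset.disjoint_left]
    intro p hp hp'
    obtain ⟨x, _, hx⟩ := Finset.mem_biUnion.mp hp
    obtain ⟨ν, _, hν⟩ := Finset.mem_image.mp hp'
    have h1 := hScl x p (hBsub s x hx)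
    rw [← hν] at h1
    simp [hgs, hgcl] at h1
  refine ⟨fun s => Finset.univ.biUnion (B s) ∪ Finset.univ.image (gs s), ?_, ?_, ?_, ?_⟩
  · intro s p hp
    rcases Finset.mem_union.mp hp with h | h
    · obtain ⟨x, _, hx⟩ := Finset.mem_biUnion.mp h
      exact hSA x (hBsub s x hx)
    · obtain ⟨ν, _, hν⟩ := Finset.mem_image.mp h
      rw [← hν]; exact hgA _ _
  · intro s s' h
    by_contra hne
    have key : ∀ s s' ν, under s ν → ¬ under s' ν →
        Finset.univ.biUnion (B s) ∪ Finset.univ.image (gs s) ≠ Finset.univ.biUnion (B s') ∪ Finset.univ.image (gs s') := by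
      intro s s' ν h1 h2 he
      have hin : gs s ν ∈ Finset.univ.biUnion (B s') ∪ Finset.univ.image (gs s') := by
        rw [← he]; exact Finset.mem_union_right _ (Finset.mem_image_of_mem _ (Finset.mem_univ _))
      have hcl : cl (gs s ν) = some (ν, true) := by simp only [hgs, hgcl, h1, if_true]
      rcases Finset.mem_union.mp hin with h | h
      · obtain ⟨x, _, hx⟩ := Finset.mem_biUnion.mp h
        have := hScl x _ (hBsub s' x hx)
        rw [hcl] at this; exact absurd this (by simp)
      · obtain ⟨ν', _, hν⟩ := Finset.mem_image.mp h
        rw [← hν] at hcl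
        simp only [hgs, hgcl, Option.some.injEq, Prod.mk.injEq] at hcl
        obtain ⟨e, h3⟩ := hcl
        rw [e, if_neg h2] at h3
        exact absurd h3 (by simp)
    obtain ⟨ν, h1 | h1⟩ := exists_under s s' hne
    · exact key s s' ν h1.1 h1.2 h
    · exact key s' s ν h1.1 h1.2 h.symm
  · set z : (Fin r → Bool) → ℤ := fun s => ∑ x, ((∑ p ∈ S x, a p : ℕ) : ℤ) * bz (ω x s) with hz
    have hLz : ∀ ν, Lz (fun x => ∑ p ∈ S x, a p) ω ν = z (rmn ν true) - z (rmn ν false) := by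
      intro ν; simp only [Lz, hz]; rw [← Finset.sum_sub_distrib]
      apply Finset.sum_congr rfl; intro x _; ring
    have hsum : ∀ s, ((∑ p ∈ Finset.univ.biUnion (B s) ∪ Finset.univ.image (gs s), a p : ℕ) : ℤ) =
        z (fun _ => true) + ∑ ν, (a (g ν false) : ℤ) := by
      intro s
      rw [Finset.sum_union (hdisj s), Finset.sum_biUnion, Finset.sum_image (fun x _ y _ h => hgsinj s h)]
      · push_cast
        have e1 : ∑ x, ∑ p ∈ B s x, (a p : ℤ) = z s := by
          simp only [hz, hB]
          apply Finset.sum_congr rfl; intro x _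
          cases h : ω x s <;> simp [bz]
        have e2 : ∑ ν, (a (gs s ν) : ℤ) = ∑ ν, (a (g ν false) : ℤ) +
            ∑ ν : Node r, (if under s ν then z (rmn ν true) - z (rmn ν false) else 0) := by
          rw [← Finset.sum_add_distrib]
          apply Finset.sum_congr rfl; intro ν _
          rw [← hLz, ← hL]
          simp only [hgs]
          by_cases h : under s ν <;> simp [h]
        rw [e1, e2, ← tele z s]; ring
      · intro x _ y _ hxy
        exact (hSd x y hxy).mono (hBsub s x) (hBsub s y)
    refine ⟨∑ p ∈ Finset.univ.biUnion (B (fun _ => true)) ∪ Finset.univ.image (gs (fun _ => true)), a p, ?_⟩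
    intro s
    have := (hsum s).trans (hsum (fun _ => true)).symm
    exact_mod_cast this
  · intro s
    have h1 : (Finset.univ.biUnion (B s)).card ≤ n := by
      refine (Finset.card_biUnion_le).trans ?_
      calc _ ≤ ∑ x : Fin n, 1 := Finset.sum_le_sum (fun x _ => (Finset.card_le_card (hBsub s x)).trans (hS1 x))
        _ = n := by simp
    have h2 : (Finset.univ.image (gs s)).card ≤ 2^r := by
      refine Finset.card_image_le.trans ?_
      rw [Finset.card_univ, Fintype.card_sigma]
      simp only [Fintype.card_pi, Fintype.card_bool, Finset.prod_const, Finset.card_univ, Fintype.card_fin]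
      rw [Fin.sum_univ_eq_sum_range (fun i => 2^i) r]
      exact (Nat.geomSum_lt (le_refl 2) (by simp)).le
    have := (Finset.card_union_le (Finset.univ.biUnion (B s)) (Finset.univ.image (gs s))).trans (add_le_add h1 h2)
    exact_mod_cast this

end FGK


namespace FGK

set_option linter.unusedSectionVars false

/-- the pair event -/
def pev (a : ℕ → ℕ) (H1 H3 : Finset ℕ) (l : ℤ) (B : Finset ℕ) : Prop :=
  ∃ p1 ∈ H1, ∃ p3 ∈ H3, B = {p1, p3} ∧ (a p1 : ℤ) - a p3 = l

lemma pair_uniq {H1 H3 : Finset ℕ} (hd : Disjoint H1 H3) {p q p' q' : ℕ} (hp : p ∈ H1) (hq : q ∈ H3)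
    (hp' : p' ∈ H1) (hq' : q' ∈ H3) (h : ({p, q} : Finset ℕ) = {p', q'}) : p = p' ∧ q = q' := by
  have n1 : p ≠ q' := fun e => (Finset.disjoint_left.mp hd hp) (e ▸ hq')
  have n2 : q ≠ p' := fun e => (Finset.disjoint_left.mp hd hp') (e ▸ hq)
  have m1 : p ∈ ({p', q'} : Finset ℕ) := h ▸ (by simp)
  have m2 : q ∈ ({p', q'} : Finset ℕ) := h ▸ (by simp)
  simp only [Finset.mem_insert, Finset.mem_singleton] at m1 m2
  tauto

section
variable {w : ℕ → ℝ} (hw : ∀ p, 0 ≤ w p)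
include hw

lemma pair_prob (a : ℕ → ℕ) {H1 H3 : Finset ℕ} (hd : Disjoint H1 H3) (K : ℕ) {β s : ℝ} (hβ : 0 ≤ β)
    (l : ℤ) (hl : |l| ≤ K)
    (h1 : ∀ b, K ≤ b → b < 3 * K → β ≤ ∑ p ∈ H1.filter (fun p => a p = b), w p)
    (h3 : ∀ b, K ≤ b → b < 3 * K → β ≤ ∑ p ∈ H3.filter (fun p => a p = b), w p)
    (hs : ∑ p ∈ H1 ∪ H3, w p ≤ s) :
    K * β ^ 2 * Real.exp (-s) ≤ EA (H1 ∪ H3) w (fun B => if pev a H1 H3 l B then 1 else 0) := by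
  set T := (H1 ×ˢ H3).filter (fun q => (a q.1 : ℤ) - a q.2 = l) with hT
  have hTm : ∀ q ∈ T, q.1 ∈ H1 ∧ q.2 ∈ H3 ∧ (a q.1 : ℤ) - a q.2 = l := by
    intro q hq; simp only [hT, Finset.mem_filter, Finset.mem_product] at hq; tauto
  have e1 : EA (H1 ∪ H3) w (fun B => ∑ q ∈ T, if B = {q.1, q.2} then 1 else 0)
      ≤ EA (H1 ∪ H3) w (fun B => if pev a H1 H3 l B then 1 else 0) := by
    apply EA_mono hw
    intro B _
    by_cases h : pev a H1 H3 l B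
    · rw [if_pos h, Finset.sum_boole]
      have : (T.filter (fun q => B = {q.1, q.2})).card ≤ 1 := by
        rw [Finset.card_le_one]
        intro q hq q' hq'
        rw [Finset.mem_filter] at hq hq'
        obtain ⟨i1, i2, _⟩ := hTm q hq.1
        obtain ⟨j1, j2, _⟩ := hTm q' hq'.1
        obtain ⟨u, v⟩ := pair_uniq hd i1 i2 j1 j2 (hq.2.symm.trans hq'.2)
        exact Prod.ext u v
      exact_mod_cast this
    · rw [if_neg h]
      apply le_of_eq
      apply Finset.sum_eq_zero
      intro q hq
      rw [if_neg]
      intro e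
      obtain ⟨i1, i2, i3⟩ := hTm q hq
      exact h ⟨q.1, i1, q.2, i2, e, i3⟩
  refine le_trans ?_ e1
  rw [EA_sum]
  have e2 : ∀ q ∈ T, EA (H1 ∪ H3) w (fun B => if B = {q.1, q.2} then 1 else 0)
      = (w q.1 * w q.2) / ∏ p ∈ H1 ∪ H3, (1 + w p) := by
    intro q hq
    obtain ⟨i1, i2, _⟩ := hTm q hq
    rw [EA_single, Finset.prod_pair]
    · intro e; exact Finset.disjoint_left.mp hd i1 (e ▸ i2)
    · intro p hp
      simp only [Finset.mem_insert, Finset.mem_singleton] at hp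
      rcases hp with rfl | rfl
      · exact Finset.mem_union_left _ i1
      · exact Finset.mem_union_right _ i2
  rw [Finset.sum_congr rfl e2, ← Finset.sum_div]
  have e3 : (K:ℝ) * β ^ 2 ≤ ∑ q ∈ T, w q.1 * w q.2 := by
    set bs : Finset ℕ := if 0 ≤ l then Finset.Ico K (2*K) else Finset.Ico (2*K) (3*K) with hbs
    have hbc : bs.card = K := by
      rw [hbs]; split_ifs <;> simp <;> omega
    have hb1 : ∀ b ∈ bs, K ≤ b ∧ b < 3 * K ∧ K ≤ ((b:ℤ) + l).toNat ∧ ((b:ℤ) + l).toNat < 3 * K ∧ 0 ≤ (b:ℤ) + l := by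
      intro b hb
      rw [abs_le] at hl
      rw [hbs] at hb
      split_ifs at hb <;> rw [Finset.mem_Ico] at hb <;> omega
    calc (K:ℝ) * β ^ 2 = ∑ b ∈ bs, β * β := by rw [Finset.sum_const, hbc, nsmul_eq_mul]; ring
      _ ≤ ∑ b ∈ bs, (∑ p ∈ H1.filter (fun p => a p = ((b:ℤ)+l).toNat), w p) * (∑ p ∈ H3.filter (fun p => a p = b), w p) := by
          apply Finset.sum_le_sum
          intro b hb
          obtain ⟨u1, u2, u3, u4, _⟩ := hb1 b hb
          have := h1 _ u3 u4
          have := h3 _ u1 u2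
          apply mul_le_mul (by assumption) (by assumption) hβ (le_trans hβ (by assumption))
      _ = ∑ b ∈ bs, ∑ q ∈ T.filter (fun q => a q.2 = b), w q.1 * w q.2 := by
          apply Finset.sum_congr rfl
          intro b hb
          obtain ⟨u1, u2, u3, u4, u5⟩ := hb1 b hb
          rw [Finset.sum_mul_sum, ← Finset.sum_product']
          apply Finset.sum_congr _ (fun _ _ => rfl)
          ext q
          simp only [hT, Finset.mem_filter, Finset.mem_product]
          constructor
          · rintro ⟨⟨c1, c2⟩, c3, c4⟩
            refine ⟨⟨⟨c1, c3⟩, ?_⟩, c4⟩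
            omega
          · rintro ⟨⟨⟨c1, c3⟩, c5⟩, c4⟩
            refine ⟨⟨c1, ?_⟩, c3, c4⟩
            omega
      _ ≤ ∑ q ∈ T, w q.1 * w q.2 := by
          have e4 : ∑ b ∈ bs, ∑ q ∈ T.filter (fun q => a q.2 = b), w q.1 * w q.2 =
              ∑ b ∈ bs, ∑ q ∈ (T.filter (fun q => a q.2 ∈ bs)).filter (fun q => a q.2 = b), w q.1 * w q.2 := by
            apply Finset.sum_congr rfl
            intro b hb
            apply Finset.sum_congr _ (fun _ _ => rfl)
            ext q; simp only [Finset.mem_filter]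
            constructor
            · rintro ⟨c1, c2⟩; exact ⟨⟨c1, c2 ▸ hb⟩, c2⟩
            · rintro ⟨⟨c1, _⟩, c2⟩; exact ⟨c1, c2⟩
          rw [e4, Finset.sum_fiberwise_of_maps_to]
          · apply Finset.sum_le_sum_of_subset_of_nonneg (Finset.filter_subset _ _)
            intro q _ _; exact mul_nonneg (hw _) (hw _)
          · intro q hq; exact (Finset.mem_filter.mp hq).2
  have hden : ∏ p ∈ H1 ∪ H3, (1 + w p) ≤ Real.exp s :=
    (EA_den_le_exp hw _).trans (Real.exp_le_exp.mpr hs)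
  rw [le_div_iff₀ (EA_den_pos hw _)]
  calc K * β ^ 2 * Real.exp (-s) * ∏ p ∈ H1 ∪ H3, (1 + w p) ≤ K * β ^ 2 * Real.exp (-s) * Real.exp s := by gcongr
    _ = K * β ^ 2 := by rw [mul_assoc, ← Real.exp_add]; simp
    _ ≤ _ := e3

/-- success of a try, in terms of the reserved primes -/
def tgood {r : ℕ} (a : ℕ → ℕ) (H : Node r → Bool → Finset ℕ) (LL : Finset (Node r → ℤ)) (B : Finset ℕ) : Prop :=
  ∃ l ∈ LL, ∀ ν, pev a (H ν true) (H ν false) (l ν) (B ∩ (H ν true ∪ H ν false))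

lemma try_prob {r : ℕ} (a : ℕ → ℕ) (H : Node r → Bool → Finset ℕ)
    (hH : ∀ ν b ν' b', (ν, b) ≠ (ν', b') → Disjoint (H ν b) (H ν' b'))
    (LL : Finset (Node r → ℤ)) (q : Node r → ℝ) (hq : ∀ ν, 0 ≤ q ν)
    (hp : ∀ l ∈ LL, ∀ ν, q ν ≤ EA (H ν true ∪ H ν false) w (fun B => if pev a (H ν true) (H ν false) (l ν) B then 1 else 0))
    (G : Finset ℕ) (hG : ∀ ν b, H ν b ⊆ G) :
    EA G w (fun B => if tgood a H LL B then 0 else 1) ≤ 1 - LL.card * ∏ ν, q ν := by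
  have e1 : ∀ B : Finset ℕ, (if tgood a H LL B then (0:ℝ) else 1) ≤
      1 + (-1) * ∑ l ∈ LL, ∏ ν, (if pev a (H ν true) (H ν false) (l ν) (B ∩ (H ν true ∪ H ν false)) then (1:ℝ) else 0) := by
    intro B
    have hz : ∀ l : Node r → ℤ, ∏ ν, (if pev a (H ν true) (H ν false) (l ν) (B ∩ (H ν true ∪ H ν false)) then (1:ℝ) else 0)
        = if ∀ ν, pev a (H ν true) (H ν false) (l ν) (B ∩ (H ν true ∪ H ν false)) then 1 else 0 := by
      intro l; rw [Finset.prod_boole]; simp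
    simp only [hz]
    rw [Finset.sum_boole]
    have hc : (LL.filter (fun l => ∀ ν, pev a (H ν true) (H ν false) (l ν) (B ∩ (H ν true ∪ H ν false)))).card ≤ 1 := by
      rw [Finset.card_le_one]
      intro l hl l' hl'
      rw [Finset.mem_filter] at hl hl'
      funext ν
      obtain ⟨p, hp1, p3, hp3, he, hd⟩ := hl.2 ν
      obtain ⟨p', hp1', p3', hp3', he', hd'⟩ := hl'.2 ν
      obtain ⟨u, v⟩ := pair_uniq (hH ν true ν false (by simp)) hp1 hp3 hp1' hp3' (he.symm.trans he')
      rw [← hd, ← hd', u, v]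
    by_cases hg : tgood a H LL B
    · rw [if_pos hg]
      have : ((LL.filter (fun l => ∀ ν, pev a (H ν true) (H ν false) (l ν) (B ∩ (H ν true ∪ H ν false)))).card : ℝ) ≤ 1 := by
        exact_mod_cast hc
      linarith
    · rw [if_neg hg]
      have : (LL.filter (fun l => ∀ ν, pev a (H ν true) (H ν false) (l ν) (B ∩ (H ν true ∪ H ν false)))) = ∅ := by
        rw [Finset.filter_eq_empty_iff]
        intro l hl h; exact hg ⟨l, hl, h⟩
      rw [this]; simp
  refine (EA_mono hw (fun B _ => e1 B)).trans ?_
  rw [EA_add, EA_mul, EA_sum, EA_const hw]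
  have e2 : ∀ l ∈ LL, ∏ ν, q ν ≤ EA G w (fun B => ∏ ν, (if pev a (H ν true) (H ν false) (l ν) (B ∩ (H ν true ∪ H ν false)) then (1:ℝ) else 0)) := by
    intro l hl
    rw [prodE hw Finset.univ (fun ν => H ν true ∪ H ν false) (fun ν B => if pev a (H ν true) (H ν false) (l ν) B then (1:ℝ) else 0) G]
    · exact Finset.prod_le_prod (fun ν _ => hq ν) (fun ν _ => hp l hl ν)
    · intro ν _; exact Finset.union_subset (hG _ _) (hG _ _)
    · intro ν _ ν' _ hne
      simp only [Finset.disjoint_union_left, Finset.disjoint_union_right]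
      refine ⟨⟨?_, ?_⟩, ?_, ?_⟩ <;> apply hH <;> simp [hne]
  have := Finset.card_nsmul_le_sum LL _ _ e2
  rw [nsmul_eq_mul] at this
  linarith

end

/-- the possible difference vectors have large support -/
lemma LL_card {r n : ℕ} (μ : ℕ → XT r → ℝ) (hμ : ∀ x < n, ∀ i, 0 ≤ μ x i) (hμ1 : ∀ x < n, ∑ i, μ x i = 1)
    (b : Fin n → ℕ) {d : ℝ} (hd : 0 < d) :
    1 ≤ ((Finset.image (Lz b) (Finset.univ.filter (fun ω : Fin n → XT r => ∏ x : Fin n, μ x (ω x) ≠ 0))).card : ℝ) ^ d *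
      ∑ ω : Fin n → XT r, (∏ x : Fin n, μ x (ω x)) * (mm vecX n μ (fun x => (b x : ℚ)) ω 0 (VV r 0)) ^ d := by
  set M : (Fin n → XT r) → ℝ := fun ω => ∏ x : Fin n, μ x (ω x) with hM
  have hM0 : ∀ ω, 0 ≤ M ω := fun ω => Finset.prod_nonneg (fun x _ => hμ x x.2 _)
  set U := Finset.univ.filter (fun ω : Fin n → XT r => M ω ≠ 0) with hU
  set LL := Finset.image (Lz b) U with hLL
  set q : (Node r → ℤ) → ℝ := fun l => ∑ ω ∈ U.filter (fun ω => Lz b ω = l), M ω with hq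
  have hq0 : ∀ l, 0 ≤ q l := fun l => Finset.sum_nonneg (fun ω _ => hM0 ω)
  have hmaps : ∀ ω ∈ U, Lz b ω ∈ LL := fun ω h => Finset.mem_image_of_mem _ h
  have hUsum : ∀ f : (Fin n → XT r) → ℝ, ∑ ω ∈ U, M ω * f ω = ∑ ω, M ω * f ω := by
    intro f
    rw [hU, Finset.sum_filter]
    apply Finset.sum_congr rfl
    intro ω _
    split_ifs with h
    · rfl
    · simp at h; simp [h]
  have hsum1 : ∑ l ∈ LL, q l = 1 := by
    rw [hq, Finset.sum_fiberwise_of_maps_to hmaps]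
    have := hUsum (fun _ => 1)
    simp only [mul_one] at this
    rw [this, hM]; exact prob_pi n μ hμ1
  have hpm := Real.rpow_sum_le_const_mul_sum_rpow LL (f := q) (p := 1 + d) (by linarith)
  have habs : ∀ l, |q l| = q l := fun l => abs_of_nonneg (hq0 l)
  simp only [habs, hsum1, Real.one_rpow, add_sub_cancel_left] at hpm
  refine hpm.trans ?_
  apply mul_le_mul_of_nonneg_left _ (by positivity)
  have hmm : ∀ ω, q (Lz b ω) ≤ mm vecX n μ (fun x => (b x : ℚ)) ω 0 (VV r 0) := by
    intro ω
    unfold mm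
    rw [hq]
    simp only []
    rw [hU, Finset.filter_filter, Finset.sum_filter]
    apply Finset.sum_le_sum
    intro ω' _
    by_cases h : M ω' ≠ 0 ∧ Lz b ω' = Lz b ω
    · rw [if_pos h, if_pos (Lz_inj b ω ω' h.2.symm), mul_one]
    · rw [if_neg h]
      apply mul_nonneg (hM0 ω')
      split_ifs <;> norm_num
  calc ∑ l ∈ LL, q l ^ (1 + d) = ∑ l ∈ LL, ∑ ω ∈ U.filter (fun ω => Lz b ω = l), M ω * q (Lz b ω) ^ d := by
        apply Finset.sum_congr rfl
        intro l _
        rw [Real.rpow_add' (hq0 l) (by linarith), Real.rpow_one]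
        conv_lhs => rw [hq]
        simp only []
        rw [Finset.sum_mul]
        apply Finset.sum_congr rfl
        intro ω hω
        rw [(Finset.mem_filter.mp hω).2]
    _ = ∑ ω ∈ U, M ω * q (Lz b ω) ^ d := Finset.sum_fiberwise_of_maps_to hmaps _
    _ = ∑ ω, M ω * q (Lz b ω) ^ d := hUsum _
    _ ≤ _ := by
        apply Finset.sum_le_sum
        intro ω _
        apply mul_le_mul_of_nonneg_left _ (hM0 ω)
        exact Real.rpow_le_rpow (hq0 _) (hmm ω) hd.le

end FGK


namespace FGK

set_option linter.unusedSectionVars false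

lemma outc_sub (A G : Finset ℕ) : outc A G ⊆ A ∩ G := by
  unfold outc; split_ifs <;> simp

lemma outc_card (A G : Finset ℕ) : (outc A G).card ≤ 1 := by
  unfold outc; split_ifs <;> simp [*]

lemma outc_inter (A G : Finset ℕ) : outc (A ∩ G) G = outc A G := by
  unfold outc; simp [Finset.inter_assoc]

/-- value of an outcome -/
noncomputable def oval (a : ℕ → ℕ) (S : Finset ℕ) : ℕ := ∑ p ∈ S, a p

section
variable {w : ℕ → ℝ} (hw : ∀ p, 0 ≤ w p)
include hw

/-- probability of an outcome in a cell -/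
noncomputable def PP (P0 : Finset ℕ) (w : ℕ → ℝ) (G : ℕ → Finset ℕ) (x : ℕ) (i : {S // S ∈ P0.powerset}) : ℝ :=
  EA (G x) w (fun B => if outc B (G x) = i.1 then 1 else 0)

lemma PP_nonneg (P0 : Finset ℕ) (G : ℕ → Finset ℕ) (x : ℕ) (i : {S // S ∈ P0.powerset}) : 0 ≤ PP P0 w G x i :=
  EA_nonneg hw (fun B _ => by split_ifs <;> norm_num)

omit hw in
lemma PP_sum {P0 : Finset ℕ} {G : ℕ → Finset ℕ} {x : ℕ} (hG : G x ⊆ P0) (φ : Finset ℕ → Prop) :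
    ∑ i ∈ (Finset.univ : Finset {S // S ∈ P0.powerset}).filter (fun i => φ i.1), PP P0 w G x i
      = EA (G x) w (fun B => if φ (outc B (G x)) then 1 else 0) := by
  unfold PP
  rw [← EA_sum]
  apply EA_congr
  intro B hB
  have hm : outc B (G x) ∈ P0.powerset := by
    rw [Finset.mem_powerset]
    exact ((outc_sub _ _).trans Finset.inter_subset_right).trans hG
  rw [Finset.sum_filter]
  rw [Finset.sum_eq_single ⟨outc B (G x), hm⟩]
  · simp
  · intro i _ hi
    have : outc B (G x) ≠ i.1 := fun h => hi (Subtype.ext h.symm)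
    simp [this]
  · intro h; exact absurd (Finset.mem_univ _) h

lemma EQ_GG {P0 : Finset ℕ} {n : ℕ} {G : ℕ → Finset ℕ} (hG : ∀ x < n, G x ⊆ P0)
    (hGd : ∀ x y, x ≠ y → Disjoint (G x) (G y)) (Φ : (Fin n → Finset ℕ) → ℝ) :
    EA P0 w (fun A => Φ (fun x => outc A (G x))) =
      ∑ o : Fin n → {S // S ∈ P0.powerset}, (∏ x : Fin n, PP P0 w G x (o x)) * Φ (fun x => (o x).1) := by
  have e1 : ∀ A : Finset ℕ, A ⊆ P0 → Φ (fun x => outc A (G x)) =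
      ∑ o : Fin n → {S // S ∈ P0.powerset}, Φ (fun x => (o x).1) *
        ∏ x : Fin n, (if outc (A ∩ G x) (G x) = (o x).1 then (1:ℝ) else 0) := by
    intro A hA
    have hm : ∀ x, outc A (G x) ∈ P0.powerset := fun x => by
      rw [Finset.mem_powerset]
      exact ((outc_sub _ _).trans Finset.inter_subset_left).trans hA
    rw [Finset.sum_eq_single (fun x : Fin n => (⟨outc A (G x), hm x⟩ : {S // S ∈ P0.powerset}))]
    · simp [outc_inter]
    · intro o _ ho
      have : ∃ x : Fin n, outc (A ∩ G x) (G x) ≠ (o x).1 := by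
        by_contra hcon
        push Not at hcon
        apply ho
        funext x
        apply Subtype.ext
        rw [← hcon x, outc_inter]
      obtain ⟨x, hx⟩ := this
      rw [Finset.prod_eq_zero (Finset.mem_univ x) (by rw [if_neg hx]), mul_zero]
    · intro h; exact absurd (Finset.mem_univ _) h
  rw [EA_congr e1, EA_sum]
  apply Finset.sum_congr rfl
  intro o _
  rw [EA_mul, mul_comm]
  congr 1
  rw [prodE hw Finset.univ (fun x : Fin n => G x) (fun x B => if outc B (G x) = (o x).1 then (1:ℝ) else 0) P0]
  · rfl
  · intro x _; exact hG x x.2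
  · intro x _ y _ hne; exact hGd _ _ (fun h => hne (Fin.ext h))

omit hw in
lemma EA_card_one (G : Finset ℕ) (φ : ℕ → Prop) :
    EA G w (fun B => if ∃ p ∈ G, φ p ∧ B = {p} then 1 else 0) = (∑ p ∈ G.filter φ, w p) / ∏ p ∈ G, (1 + w p) := by
  have e : ∀ B : Finset ℕ, B ⊆ G → (if ∃ p ∈ G, φ p ∧ B = {p} then (1:ℝ) else 0) = ∑ p ∈ G.filter φ, if B = {p} then (1:ℝ) else 0 := by
    intro B _
    split_ifs with h
    · obtain ⟨p, hp, hφ, rfl⟩ := h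
      rw [Finset.sum_eq_single p]
      · simp
      · intro q _ hq; rw [if_neg]; intro h; exact hq (Finset.singleton_injective h).symm
      · intro h; exact absurd (Finset.mem_filter.mpr ⟨hp, hφ⟩) h
    · symm; apply Finset.sum_eq_zero
      intro p hp
      rw [if_neg]
      intro e; rw [Finset.mem_filter] at hp; exact h ⟨p, hp.1, hp.2, e⟩
  rw [EA_congr e, EA_sum, Finset.sum_div]
  apply Finset.sum_congr rfl
  intro p hp
  rw [EA_single (by simpa using (Finset.mem_filter.mp hp).1)]
  simp

omit hw in
lemma cell_p (a : ℕ → ℕ) (G : Finset ℕ) (ha : ∀ p ∈ G, 0 < a p) (φ : ℕ → Prop) (h0 : ¬ φ 0) :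
    EA G w (fun B => if φ (oval a (outc B G)) then 1 else 0)
      = (∑ p ∈ G.filter (fun p => φ (a p)), w p) / ∏ p ∈ G, (1 + w p) := by
  rw [← EA_card_one]
  apply EA_congr
  intro B hB
  have : φ (oval a (outc B G)) ↔ ∃ p ∈ G, φ (a p) ∧ B = {p} := by
    have hBG : B ∩ G = B := Finset.inter_eq_left.mpr hB
    unfold outc oval
    rw [hBG]
    constructor
    · intro h
      split_ifs at h with hc
      · obtain ⟨p, rfl⟩ := Finset.card_eq_one.mp hc
        exact ⟨p, hB (by simp), by simpa using h, rfl⟩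
      · simp at h; exact absurd h h0
    · rintro ⟨p, _, hφ, rfl⟩
      simpa using hφ
  simp only [this]

end

end FGK


namespace FGK

set_option linter.unusedSectionVars false

/-- level of a box -/
def levY (r : ℕ) (Y : ℕ → ℕ) (x : ℕ) : ℕ := ((Finset.Icc 1 r).filter (fun j => Y j ≤ x)).card

lemma levY_le (r : ℕ) (Y : ℕ → ℕ) (x : ℕ) : levY r Y x ≤ r := by
  unfold levY
  refine (Finset.card_filter_le _ _).trans ?_
  simp

lemma levY_iff {r : ℕ} {Y : ℕ → ℕ} (hY : ∀ i j, 1 ≤ i → i ≤ j → j ≤ r + 1 → Y i ≤ Y j) {i x : ℕ} (hi : 1 ≤ i) (hir : i ≤ r) :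
    i ≤ levY r Y x ↔ Y i ≤ x := by
  unfold levY
  constructor
  · intro h
    by_contra hc
    have : (Finset.Icc 1 r).filter (fun j => Y j ≤ x) ⊆ Finset.Icc 1 (i-1) := by
      intro j hj
      rw [Finset.mem_filter, Finset.mem_Icc] at hj
      rw [Finset.mem_Icc]
      refine ⟨hj.1.1, ?_⟩
      by_contra hji
      have := hY i j hi (by omega) (by omega)
      omega
    have := Finset.card_le_card this
    simp at this
    omega
  · intro h
    have : Finset.Icc 1 i ⊆ (Finset.Icc 1 r).filter (fun j => Y j ≤ x) := by
      intro j hj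
      rw [Finset.mem_Icc] at hj
      rw [Finset.mem_filter, Finset.mem_Icc]
      have := hY j i hj.1 hj.2 (by omega)
      exact ⟨⟨hj.1, by omega⟩, by omega⟩
    have := Finset.card_le_card this
    simpa using this

lemma levY_eq {r : ℕ} {Y : ℕ → ℕ} (hY : ∀ i j, 1 ≤ i → i ≤ j → j ≤ r + 1 → Y i ≤ Y j) {j x : ℕ} (hj : 1 ≤ j) (hjr : j ≤ r)
    (hx : x < Y (r+1)) : levY r Y x = j ↔ Y j ≤ x ∧ x < Y (j+1) := by
  have h1 := levY_iff hY (x := x) hj hjr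
  by_cases h : j = r
  · subst h
    have := levY_le j Y x
    omega
  · have h2 := levY_iff hY (i := j+1) (x := x) (by omega) (by omega)
    omega

lemma sum_levY {r : ℕ} {Y : ℕ → ℕ} (hr : 1 ≤ r) (hY1 : Y 1 = 0) (hY : ∀ i j, 1 ≤ i → i ≤ j → j ≤ r + 1 → Y i ≤ Y j) (h : ℕ → ℝ) :
    ∑ x ∈ Finset.range (Y (r+1)), h (levY r Y x) = ∑ j ∈ Finset.Icc 1 r, ((Y (j+1) : ℝ) - Y j) * h j := by
  rw [← Finset.sum_fiberwise_of_maps_to (s := Finset.range (Y (r+1))) (t := Finset.Icc 1 r) (g := levY r Y)]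
  · apply Finset.sum_congr rfl
    intro j hj
    rw [Finset.mem_Icc] at hj
    have e : (Finset.range (Y (r+1))).filter (fun x => levY r Y x = j) = Finset.Ico (Y j) (Y (j+1)) := by
      ext x
      rw [Finset.mem_filter, Finset.mem_range, Finset.mem_Ico]
      have := hY (j+1) (r+1) (by omega) (by omega) le_rfl
      constructor
      · rintro ⟨a, b⟩; exact (levY_eq hY hj.1 hj.2 a).mp b
      · intro b; have a : x < Y (r+1) := by omega
        exact ⟨a, (levY_eq hY hj.1 hj.2 a).mpr b⟩
    have e2 : ∑ x ∈ (Finset.range (Y (r+1))).filter (fun x => levY r Y x = j), h (levY r Y x)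
        = ∑ x ∈ (Finset.range (Y (r+1))).filter (fun x => levY r Y x = j), h j := by
      apply Finset.sum_congr rfl
      intro x hx; rw [(Finset.mem_filter.mp hx).2]
    rw [e2, e, Finset.sum_const, Nat.card_Ico, nsmul_eq_mul, Nat.cast_sub (hY j (j+1) hj.1 (by omega) (by omega))]
  · intro x _
    rw [Finset.mem_Icc]
    exact ⟨(levY_iff hY le_rfl hr).mpr (by omega), levY_le _ _ _⟩

/-- box boundaries -/
noncomputable def Yb (c : ℕ → ℝ) (N : ℕ) (T : ℝ) (j : ℕ) : ℕ := ⌈N * (1 - c j) * T⌉₊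

variable {r : ℕ} {c : ℕ → ℝ} {lam : ℕ → ℕ → ℝ} {μ : ℕ → XT r → ℝ} {δ : ℝ}

lemma Sys.c_mono (hS : Sys r c lam μ δ) : ∀ i j, 1 ≤ i → i ≤ j → j ≤ r + 1 → c j ≤ c i := by
  intro i j hi hij
  induction j, hij using Nat.le_induction with
  | base => intro _; exact le_rfl
  | succ j hij ih =>
    intro hj
    exact (hS.canti j (by omega) (by omega)).le.trans (ih (by omega))

lemma Sys.c_le_one (hS : Sys r c lam μ δ) : ∀ j, 1 ≤ j → j ≤ r + 1 → c j ≤ 1 := by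
  intro j h1 h2
  have := hS.c_mono 1 j le_rfl h1 h2
  rwa [hS.c1] at this

section box
variable (hS : Sys r c lam μ δ) {N : ℕ} (hN : 1 ≤ N) {T : ℝ} (hT : 0 ≤ T)
include hS hN hT

lemma Yb_one : Yb c N T 1 = 0 := by simp [Yb, hS.c1]

lemma Yb_mono : ∀ i j, 1 ≤ i → i ≤ j → j ≤ r + 1 → Yb c N T i ≤ Yb c N T j := by
  intro i j hi hij hj
  unfold Yb
  have := hS.c_mono i j hi hij hj
  apply Nat.ceil_le_ceil
  gcongr

omit hS hN hT in
lemma Yb_ge (j : ℕ) : N * (1 - c j) * T ≤ Yb c N T j := Nat.le_ceil _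

omit hN in
lemma Yb_lt (j : ℕ) (h1 : 1 ≤ j) (h2 : j ≤ r + 1) : (Yb c N T j : ℝ) < N * (1 - c j) * T + 1 := by
  apply Nat.ceil_lt_add_one
  have := hS.c_le_one j h1 h2
  have : 0 ≤ 1 - c j := by linarith
  positivity

/-- the constant -/
noncomputable def Bc (r : ℕ) (lam : ℕ → ℕ → ℝ) : ℝ := 2 + ∑ i ∈ Finset.range (r+1), ∑ j ∈ Finset.range (r+1), |lam j i|

omit hS hN hT in
lemma lam_le_Bc {i j : ℕ} (hi : i ≤ r) (hj : j ≤ r) : |lam j i| + 2 ≤ Bc r lam := by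
  unfold Bc
  have h1 : |lam j i| ≤ ∑ j ∈ Finset.range (r+1), |lam j i| :=
    Finset.single_le_sum (f := fun j => |lam j i|) (fun _ _ => abs_nonneg _) (Finset.mem_range.mpr (by omega))
  have h2 : ∑ j ∈ Finset.range (r+1), |lam j i| ≤ ∑ i ∈ Finset.range (r+1), ∑ j ∈ Finset.range (r+1), |lam j i| :=
    Finset.single_le_sum (f := fun i => ∑ j ∈ Finset.range (r+1), |lam j i|) (fun _ _ => Finset.sum_nonneg (fun _ _ => abs_nonneg _)) (Finset.mem_range.mpr (by omega))
  linarith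

/-- the potential vector -/
noncomputable def vb (c : ℕ → ℝ) (lam : ℕ → ℕ → ℝ) (δ : ℝ) (r N : ℕ) (T : ℝ) (p : ℕ → ℝ) (x i : ℕ) : ℝ :=
  c i * T - ∑ y ∈ Finset.range x, if i ≤ levY r (Yb c N T) y then p y * (lam (levY r (Yb c N T) y) i - δ / 8) else 0

lemma vb_end {p : ℕ → ℝ} (hp : ∀ x < Yb c N T (r+1), (1 - δ/8) / N ≤ p x ∧ p x ≤ (1 + δ/8) / N) {i : ℕ} (hi : 1 ≤ i) (hir : i ≤ r) :
    vb c lam δ r N T p (Yb c N T (r+1)) i ≤ r * Bc r lam := by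
  have hδ0 := hS.δ0
  have hδ1 := hS.δ1
  have hN0 : (0:ℝ) < N := by exact_mod_cast hN
  have hY1 := Yb_one hS hN hT
  have hYm := Yb_mono hS hN hT
  set Y := Yb c N T with hYdef
  have hlam0 : ∀ j, i ≤ j → j ≤ r → 0 ≤ lam j i := by
    intro j h1 h2
    rcases Nat.eq_or_lt_of_le h1 with h | h
    · subst h; have := hS.diag i hi hir; linarith
    · exact (hS.off i j hi h h2).1
  set s : ℕ → ℝ := fun j => (1 - δ/8) * lam j i - (1 + δ/8) * (δ/8) with hs
  have h1 : ∑ y ∈ Finset.range (Y (r+1)), (fun j => if i ≤ j then s j / N else 0) (levY r Y y) ≤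
      ∑ y ∈ Finset.range (Y (r+1)), if i ≤ levY r Y y then p y * (lam (levY r Y y) i - δ / 8) else 0 := by
    apply Finset.sum_le_sum
    intro y hy
    simp only []
    split_ifs with h
    · obtain ⟨p1, p2⟩ := hp y (Finset.mem_range.mp hy)
      have hl := hlam0 _ h (levY_le _ _ _)
      have e : s (levY r Y y) / N = (1 - δ/8) / N * lam (levY r Y y) i - (1 + δ/8) / N * (δ/8) := by
        simp only [hs]; ring
      rw [e, mul_sub]
      gcongr
    · exact le_rfl
  have h1' := sum_levY hS.r1 hY1 hYm (fun j => if i ≤ j then s j / N else 0)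
  rw [h1'] at h1
  have h2 : ∑ j ∈ Finset.Icc 1 r, ((Y (j+1) : ℝ) - Y j) * (if i ≤ j then s j / N else 0) =
      ∑ j ∈ Finset.Icc i r, ((Y (j+1) : ℝ) - Y j) * (s j / N) := by
    have : Finset.Icc i r = (Finset.Icc 1 r).filter (fun j => i ≤ j) := by
      ext j; simp only [Finset.mem_Icc, Finset.mem_filter]; omega
    rw [this, Finset.sum_filter]
    apply Finset.sum_congr rfl
    intro j _
    split_ifs <;> simp
  rw [h2] at h1
  have h3 : ∀ j ∈ Finset.Icc i r, (c j - c (j+1)) * T * s j - Bc r lam ≤ ((Y (j+1) : ℝ) - Y j) * (s j / N) := by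
    intro j hj
    rw [Finset.mem_Icc] at hj
    have a1 := Yb_ge (c := c) (N := N) (T := T) j
    have a2 := Yb_ge (c := c) (N := N) (T := T) (j+1)
    have a3 := Yb_lt hS (N := N) hT j (by omega) (by omega)
    have a4 := Yb_lt hS (N := N) hT (j+1) (by omega) (by omega)
    have hsB : |s j| ≤ Bc r lam := by
      have := lam_le_Bc (lam := lam) hir hj.2
      rw [abs_of_nonneg (hlam0 j hj.1 hj.2)] at this
      have := hlam0 j hj.1 hj.2
      simp only [hs]
      rw [abs_le]; constructor <;> nlinarith
    set u := ((Y (j+1) : ℝ) - Y j) - N * (c j - c (j+1)) * T with hu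
    have hu1 : |u| ≤ 1 := by rw [abs_le]; constructor <;> (rw [hu]; linarith)
    have e : ((Y (j+1) : ℝ) - Y j) * (s j / N) = (c j - c (j+1)) * T * s j + u * s j / N := by
      rw [hu]; field_simp; ring
    rw [e]
    have : |u * s j / N| ≤ Bc r lam := by
      rw [abs_div, abs_mul, abs_of_pos hN0]
      have hN1 : (1:ℝ) ≤ N := by exact_mod_cast hN
      have : |u| * |s j| ≤ Bc r lam := by
        calc |u| * |s j| ≤ 1 * |s j| := by gcongr
          _ ≤ _ := by linarith
      exact (div_le_self (by positivity) hN1).trans this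
    have := (abs_le.mp this).1
    linarith
  have h4 := Finset.sum_le_sum h3
  rw [Finset.sum_sub_distrib, Finset.sum_const, nsmul_eq_mul, Nat.card_Icc] at h4
  have h5 : c i * T ≤ ∑ j ∈ Finset.Icc i r, (c j - c (j+1)) * T * s j := by
    have e : ∑ j ∈ Finset.Icc i r, (c j - c (j+1)) * T * s j =
      T * ((1 - δ/8) * ∑ j ∈ Finset.Icc i r, (c j - c (j+1)) * lam j i - (1 + δ/8) * (δ/8) * ∑ j ∈ Finset.Icc i r, (c j - c (j+1))) := by
      rw [Finset.mul_sum, Finset.mul_sum, ← Finset.sum_sub_distrib, Finset.mul_sum]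
      apply Finset.sum_congr rfl; intro j _; simp only [hs]; ring
    have htel : ∑ j ∈ Finset.Icc i r, (c j - c (j+1)) = c i - c (r+1) := by
      have : Finset.Icc i r = Finset.Ico i (r+1) := by ext j; simp only [Finset.mem_Icc, Finset.mem_Ico]; omega
      rw [this, Finset.sum_Ico_eq_sum_range]
      have e9 := Finset.sum_range_sub' (fun k => c (i + k)) (r + 1 - i)
      rw [show i + (r + 1 - i) = r + 1 by omega] at e9
      exact e9
    have := hS.tot i hi hir
    have hc := hS.cpos (r+1)
    have hci := hS.cpos i
    rw [e, htel, mul_comm (c i) T]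
    apply mul_le_mul_of_nonneg_left _ hT
    calc c i ≤ (1 - δ/8) * ((1+δ) * c i) - (1 + δ/8) * (δ/8) * c i := by
          have : 0 ≤ c i * ((1 - δ/8) * (1+δ) - (1 + δ/8) * (δ/8) - 1) := by
            apply mul_nonneg hci.le; nlinarith
          linarith
      _ ≤ _ := by
          have : 0 ≤ (1 + δ/8) * (δ/8) * c (r+1) := by positivity
          have : (1 - δ/8) * ((1+δ) * c i) ≤ (1 - δ/8) * ∑ j ∈ Finset.Icc i r, (c j - c (j+1)) * lam j i := by
            apply mul_le_mul_of_nonneg_left (hS.tot i hi hir); linarith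
          linarith
  have hB0 : 0 ≤ Bc r lam := by
    have := lam_le_Bc (lam := lam) hir hir
    have := abs_nonneg (lam i i); linarith
  have h6 : ((r + 1 - i : ℕ) : ℝ) * Bc r lam ≤ r * Bc r lam := by
    gcongr; omega
  unfold vb
  linarith

lemma vb_mid {p : ℕ → ℝ} (hp : ∀ x < Yb c N T (r+1), (1 - δ/8) / N ≤ p x ∧ p x ≤ (1 + δ/8) / N) {i x : ℕ} (hi : 1 ≤ i)
    (hx : x < Yb c N T (r+1)) (hix : i ≤ levY r (Yb c N T) x) :
    vb c lam δ r N T p (x+1) i ≤ T - (x+1)/N + (r * Bc r lam + 1) := by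
  have hδ0 := hS.δ0
  have hδ1 := hS.δ1
  have hN0 : (0:ℝ) < N := by exact_mod_cast hN
  have hN1 : (1:ℝ) ≤ N := by exact_mod_cast hN
  have hNi : 1 / (N:ℝ) ≤ 1 := by rw [div_le_one hN0]; exact hN1
  have hir : i ≤ r := hix.trans (levY_le _ _ _)
  have hY1 := Yb_one hS hN hT
  have hYm := Yb_mono hS hN hT
  set Y := Yb c N T with hYdef
  have hB0 : 0 ≤ Bc r lam := by
    have := lam_le_Bc (lam := lam) hir hir
    have := abs_nonneg (lam i i); linarith
  rcases Nat.eq_or_lt_of_le hix with hlev | hlev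
  · -- level exactly i
    have hge : ((x + 1 : ℝ) - Y i) / N ≤ ∑ y ∈ Finset.range (x+1), if i ≤ levY r Y y then p y * (lam (levY r Y y) i - δ / 8) else 0 := by
      have hYi : Y i ≤ x := (levY_iff hYm hi hir).mp hix
      have e : ((x + 1 : ℝ) - Y i) / N = ∑ y ∈ Finset.Ico (Y i) (x+1), (1 / (N:ℝ)) := by
        rw [Finset.sum_const, Nat.card_Ico, nsmul_eq_mul, Nat.cast_sub (by omega)]
        push_cast; ring
      rw [e]
      have e2 : Finset.Ico (Y i) (x+1) = (Finset.range (x+1)).filter (fun y => i ≤ levY r Y y) := by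
        ext y; rw [Finset.mem_Ico, Finset.mem_filter, Finset.mem_range, levY_iff hYm hi hir]; omega
      rw [e2, Finset.sum_filter]
      apply Finset.sum_le_sum
      intro y hy
      rw [Finset.mem_range] at hy
      split_ifs with h
      · have hly : levY r Y y = i := by
          have hx2 := (levY_eq hYm hi hir hx).mp hlev.symm
          have hy2 := (levY_iff hYm hi hir).mp h
          exact (levY_eq hYm hi hir (by omega)).mpr ⟨hy2, by omega⟩
        rw [hly]
        obtain ⟨p1, p2⟩ := hp y (by omega)
        have hd := hS.diag i hi hir
        calc 1 / (N:ℝ) ≤ (1 - δ/8) / N * (1 + δ - δ/8) := by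
              rw [div_mul_eq_mul_div]; gcongr; nlinarith
          _ ≤ p y * (lam i i - δ/8) := by
              apply mul_le_mul p1 (by linarith) (by linarith) 
              exact le_trans (div_nonneg (by linarith) hN0.le) p1
      · exact le_rfl
    have hYl := Yb_lt hS (N := N) hT i hi (by omega)
    have : (Y i : ℝ) / N ≤ (1 - c i) * T + 1 := by
      rw [div_le_iff₀ hN0]
      have e : ((1 - c i) * T + 1) * N = N * (1 - c i) * T + N := by ring
      rw [e]
      change (Yb c N T i : ℝ) ≤ _
      linarith
    unfold vb
    rw [sub_div] at hge
    have : 0 ≤ r * Bc r lam := by positivity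
    linarith
  · have hend := vb_end hS hN hT hp hi hir
    have hsplit : vb c lam δ r N T p (x+1) i = vb c lam δ r N T p (Y (r+1)) i +
        ∑ y ∈ Finset.Ico (x+1) (Y (r+1)), if i ≤ levY r Y y then p y * (lam (levY r Y y) i - δ / 8) else 0 := by
      unfold vb
      have := Finset.sum_range_add_sum_Ico (fun y => if i ≤ levY r Y y then p y * (lam (levY r Y y) i - δ / 8) else 0) (show x+1 ≤ Y (r+1) by omega)
      linarith
    have hle : ∑ y ∈ Finset.Ico (x+1) (Y (r+1)), (if i ≤ levY r Y y then p y * (lam (levY r Y y) i - δ / 8) else 0) ≤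
        ∑ y ∈ Finset.Ico (x+1) (Y (r+1)), (1 / (N:ℝ)) := by
      apply Finset.sum_le_sum
      intro y hy
      rw [Finset.mem_Ico] at hy
      split_ifs with h
      · have hly : i < levY r Y y := by
          have hr1 : levY r Y x ≤ r := levY_le _ _ _
          have := (levY_iff hYm (i := i+1) (x := x) (by omega) (by omega)).mp hlev
          exact (levY_iff hYm (i := i+1) (x := y) (by omega) (by omega)).mpr (by omega)
        obtain ⟨p1, p2⟩ := hp y (by omega)
        obtain ⟨o1, o2⟩ := hS.off i _ hi hly (levY_le _ _ _)
        have hp0 : 0 ≤ p y := le_trans (div_nonneg (by linarith) hN0.le) p1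
        calc p y * (lam (levY r Y y) i - δ/8) ≤ p y * (1 - δ/8) := by gcongr
          _ ≤ (1 + δ/8)/N * (1 - δ/8) := by
              apply mul_le_mul_of_nonneg_right p2; linarith
          _ ≤ 1 / N := by
              rw [div_mul_eq_mul_div]; gcongr; nlinarith
      · positivity
    rw [Finset.sum_const, Nat.card_Ico, nsmul_eq_mul, Nat.cast_sub (by omega)] at hle
    push_cast at hle
    have hYl := Yb_lt hS (N := N) hT (r+1) (by omega) le_rfl
    have hcr := hS.cpos (r+1)
    have : (Y (r+1) : ℝ) / N ≤ T + 1 := by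
      rw [div_le_iff₀ hN0]
      have e : (T + 1) * N = N * (1 - c (r+1)) * T + N + N * (c (r+1) * T) := by ring
      rw [e]
      change (Yb c N T (r+1) : ℝ) ≤ _
      have : 0 ≤ N * (c (r+1) * T) := by positivity
      linarith
    have e3 : ((Y (r+1) : ℝ) - (x + 1)) * (1 / (N:ℝ)) = (Y (r+1) : ℝ) / N - (x+1)/N := by ring
    rw [e3] at hle
    rw [hsplit]
    linarith

end box

end FGK


namespace FGK

set_option linter.unusedSectionVars false

lemma harm_lower {m k : ℕ} (hm : 1 ≤ m) (hmk : m ≤ k) : Real.log (k / m) ≤ ∑ b ∈ Finset.Ico m k, (1:ℝ) / b := by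
  induction k, hmk using Nat.le_induction with
  | base => simp
  | succ k hmk ih =>
    rw [Finset.sum_Ico_succ_top hmk]
    have hm0 : (0:ℝ) < m := by exact_mod_cast hm
    have hk0 : (0:ℝ) < k := by exact_mod_cast (by omega : 0 < k)
    have e : (((k+1 : ℕ) : ℝ)) / m = (k / m) * (1 + 1 / k) := by push_cast; field_simp
    rw [e, Real.log_mul (by positivity) (by positivity)]
    have := Real.log_le_sub_one_of_pos (show (0:ℝ) < 1 + 1/k by positivity)
    linarith

lemma harm_upper {m k : ℕ} (hm : 2 ≤ m) (hmk : m ≤ k) : ∑ b ∈ Finset.Ico m k, (1:ℝ) / b ≤ Real.log (((k:ℝ) - 1) / (m - 1)) := by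
  induction k, hmk using Nat.le_induction with
  | base =>
    have : (m:ℝ) - 1 ≠ 0 := by
      have : (2:ℝ) ≤ m := by exact_mod_cast hm
      linarith
    simp [div_self this]
  | succ k hmk ih =>
    rw [Finset.sum_Ico_succ_top hmk]
    have hm0 : (2:ℝ) ≤ m := by exact_mod_cast hm
    have hk0 : (2:ℝ) ≤ k := by exact_mod_cast (by omega : 2 ≤ k)
    have hm1 : (0:ℝ) < (m:ℝ) - 1 := by linarith
    have hk1 : (0:ℝ) < (k:ℝ) - 1 := by linarith
    have e : (((k:ℝ) - 1) / (m - 1)) = ((((k+1:ℕ):ℝ) - 1) / (m - 1)) * (1 - 1 / k) := by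
      push_cast; field_simp; ring
    have h1 : (0:ℝ) < 1 - 1 / k := by
      have : 1 / (k:ℝ) < 1 := by rw [div_lt_one (by linarith)]; linarith
      linarith
    have hx : (0:ℝ) < (((k+1:ℕ):ℝ) - 1) / (m - 1) := by
      push_cast; apply div_pos _ hm1; linarith
    rw [e, Real.log_mul hx.ne' h1.ne'] at ih
    have := Real.log_le_sub_one_of_pos h1
    linarith

/-- harmonic sums over real intervals -/
lemma harm_real {s h : ℝ} (hs : 2 ≤ Real.exp s) (hh : 0 ≤ h) :
    h - Real.exp (-s) ≤ ∑ b ∈ Finset.Ico ⌈Real.exp s⌉₊ ⌈Real.exp (s + h)⌉₊, (1:ℝ) / b ∧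
    ∑ b ∈ Finset.Ico ⌈Real.exp s⌉₊ ⌈Real.exp (s + h)⌉₊, (1:ℝ) / b ≤ h + 2 * Real.exp (-s) := by
  set m := ⌈Real.exp s⌉₊ with hm
  set k := ⌈Real.exp (s + h)⌉₊ with hk
  have e0 := Real.exp_pos s
  have e1 := Real.exp_pos (s+h)
  have m1 : Real.exp s ≤ m := Nat.le_ceil _
  have m2 : (m:ℝ) < Real.exp s + 1 := Nat.ceil_lt_add_one e0.le
  have k1 : Real.exp (s+h) ≤ k := Nat.le_ceil _
  have k2 : (k:ℝ) < Real.exp (s+h) + 1 := Nat.ceil_lt_add_one e1.le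
  have hmk : m ≤ k := Nat.ceil_le_ceil (Real.exp_le_exp.mpr (by linarith))
  have hm2 : 2 ≤ m := by
    have : (2:ℝ) ≤ m := hs.trans m1
    exact_mod_cast this
  have hm2r : (2:ℝ) ≤ m := by exact_mod_cast hm2
  constructor
  · refine le_trans ?_ (harm_lower (by omega) hmk)
    have hl : Real.log (Real.exp (s+h) / (Real.exp s * (1 + Real.exp (-s)))) ≤ Real.log (k / m) := by
      apply Real.log_le_log
      · positivity
      · apply div_le_div₀ (by positivity) k1 (by linarith)
        have : Real.exp s * (1 + Real.exp (-s)) = Real.exp s + 1 := by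
          rw [mul_add, ← Real.exp_add]; simp
        linarith
    refine le_trans ?_ hl
    rw [Real.log_div e1.ne' (by positivity), Real.log_mul e0.ne' (by positivity), Real.log_exp, Real.log_exp]
    have := Real.log_le_sub_one_of_pos (show (0:ℝ) < 1 + Real.exp (-s) by positivity)
    linarith
  · refine (harm_upper hm2 hmk).trans ?_
    have hneg : Real.exp (-s) ≤ 1/2 := by
      rw [Real.exp_neg, inv_le_comm₀ e0 (by norm_num)]; linarith
    have hnp := Real.exp_pos (-s)
    have hes : Real.exp s * Real.exp (-s) = 1 := by rw [← Real.exp_add]; simp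
    have hl : Real.log (((k:ℝ) - 1) / (m - 1)) ≤ Real.log (Real.exp (s+h) / (Real.exp s * (1 - Real.exp (-s)))) := by
      rcases Nat.eq_or_lt_of_le hmk with h' | h'
      · rw [← h', div_self (by linarith), Real.log_one]
        apply Real.log_nonneg
        rw [one_le_div (mul_pos e0 (by linarith))]
        have : Real.exp s ≤ Real.exp (s+h) := Real.exp_le_exp.mpr (by linarith)
        nlinarith
      · have hk2 : (m:ℝ) + 1 ≤ k := by exact_mod_cast h'
        apply Real.log_le_log
        · apply div_pos <;> linarith
        · apply div_le_div₀ e1.le (by linarith) (mul_pos e0 (by linarith))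
          nlinarith
    refine hl.trans ?_
    rw [Real.log_div e1.ne' (mul_pos e0 (by linarith)).ne', Real.log_mul e0.ne' (by linarith), Real.log_exp, Real.log_exp]
    have h3 : -Real.log (1 - Real.exp (-s)) ≤ 2 * Real.exp (-s) := by
      rw [← Real.log_inv]
      have := Real.log_le_sub_one_of_pos (show (0:ℝ) < (1 - Real.exp (-s))⁻¹ by apply inv_pos.mpr; linarith)
      refine this.trans ?_
      have : (1 - Real.exp (-s))⁻¹ ≤ 1 + 2 * Real.exp (-s) := by
        rw [inv_le_iff_one_le_mul₀ (by linarith)]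
        nlinarith
      linarith
    linarith

/-- classes -/
abbrev Cls (r : ℕ) : Type := Option (Node r × Bool)

/-- the density hypothesis -/
def Dens {r : ℕ} (P : Finset ℕ) (w : ℕ → ℝ) (a : ℕ → ℕ) (cl : ℕ → Cls r) (dens : Cls r → ℝ) (κ0 lo hi : ℝ) : Prop :=
  ∀ b : ℕ, lo ≤ (b:ℝ) → (b:ℝ) ≤ hi → ∀ g, |∑ p ∈ P.filter (fun p => a p = b ∧ cl p = g), w p - dens g / b| ≤ κ0 * (dens g / b)

section
variable {r : ℕ} {P : Finset ℕ} {w : ℕ → ℝ} {a : ℕ → ℕ} {cl : ℕ → Cls r} {dens : Cls r → ℝ} {κ0 lo hi : ℝ}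
  (hD : Dens P w a cl dens κ0 lo hi)
include hD

lemma Dens_pt {b : ℕ} (h1 : lo ≤ (b:ℝ)) (h2 : (b:ℝ) ≤ hi) (g : Cls r) :
    (1 - κ0) * (dens g / b) ≤ ∑ p ∈ P.filter (fun p => a p = b ∧ cl p = g), w p ∧
    ∑ p ∈ P.filter (fun p => a p = b ∧ cl p = g), w p ≤ (1 + κ0) * (dens g / b) := by
  have := abs_le.mp (hD b h1 h2 g)
  constructor <;> linarith [this.1, this.2]

lemma Dens_sum {m k : ℕ} (h : ∀ b, m ≤ b → b < k → lo ≤ (b:ℝ) ∧ (b:ℝ) ≤ hi) (g : Cls r) :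
    (1 - κ0) * dens g * ∑ b ∈ Finset.Ico m k, (1:ℝ)/b ≤ ∑ p ∈ P.filter (fun p => cl p = g ∧ m ≤ a p ∧ a p < k), w p ∧
    ∑ p ∈ P.filter (fun p => cl p = g ∧ m ≤ a p ∧ a p < k), w p ≤ (1 + κ0) * dens g * ∑ b ∈ Finset.Ico m k, (1:ℝ)/b := by
  have e : ∑ p ∈ P.filter (fun p => cl p = g ∧ m ≤ a p ∧ a p < k), w p =
      ∑ b ∈ Finset.Ico m k, ∑ p ∈ P.filter (fun p => a p = b ∧ cl p = g), w p := by
    rw [← Finset.sum_fiberwise_of_maps_to (s := P.filter (fun p => cl p = g ∧ m ≤ a p ∧ a p < k)) (t := Finset.Ico m k) (g := a)]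
    · apply Finset.sum_congr rfl
      intro b hb
      apply Finset.sum_congr _ (fun _ _ => rfl)
      rw [Finset.mem_Ico] at hb
      ext p; simp only [Finset.mem_filter]
      constructor
      · rintro ⟨⟨h1, h2, _⟩, h3⟩; exact ⟨h1, h3, h2⟩
      · rintro ⟨h1, h3, h2⟩; exact ⟨⟨h1, h2, by omega⟩, h3⟩
    · intro p hp
      rw [Finset.mem_filter] at hp
      rw [Finset.mem_Ico]; exact hp.2.2
  rw [e, Finset.mul_sum, Finset.mul_sum]
  constructor
  · apply Finset.sum_le_sum
    intro b hb
    rw [Finset.mem_Ico] at hb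
    have := (Dens_pt hD (h b hb.1 hb.2).1 (h b hb.1 hb.2).2 g).1
    calc _ = (1 - κ0) * (dens g / b) := by ring
      _ ≤ _ := this
  · apply Finset.sum_le_sum
    intro b hb
    rw [Finset.mem_Ico] at hb
    have := (Dens_pt hD (h b hb.1 hb.2).1 (h b hb.1 hb.2).2 g).2
    calc _ ≤ (1 + κ0) * (dens g / b) := this
      _ = _ := by ring

/-- box cells -/
noncomputable def Gbox {r : ℕ} (P : Finset ℕ) (a : ℕ → ℕ) (cl : ℕ → Cls r) (N : ℕ) (T : ℝ) (x : ℕ) : Finset ℕ :=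
  P.filter (fun p => cl p = none ∧ ⌈Real.exp (T - (x+1)/N)⌉₊ ≤ a p ∧ a p < ⌈Real.exp (T - x/N)⌉₊)

omit hD in
lemma Gbox_mem {N : ℕ} {T : ℝ} {x p : ℕ} (h : p ∈ Gbox P a cl N T x) :
    p ∈ P ∧ cl p = none ∧ Real.exp (T - (x+1)/N) ≤ a p ∧ (a p : ℝ) < Real.exp (T - x/N) := by
  unfold Gbox at h
  rw [Finset.mem_filter] at h
  exact ⟨h.1, h.2.1, Nat.ceil_le.mp h.2.2.1, Nat.lt_ceil.mp h.2.2.2⟩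

omit hD in
lemma Gbox_disj {N : ℕ} {T : ℝ} {x y : ℕ} (h : x ≠ y) : Disjoint (Gbox P a cl N T x) (Gbox P a cl N T y) := by
  have key : ∀ x y : ℕ, x < y → Disjoint (Gbox P a cl N T x) (Gbox P a cl N T y) := by
    intro x y hxy
    rw [Finset.disjoint_left]
    intro p hp hq
    have h1 := (Gbox_mem hp).2.2.1
    have h2 := (Gbox_mem hq).2.2.2
    have h3 : Real.exp (T - y/N) ≤ Real.exp (T - (x+1)/N) := by
      apply Real.exp_le_exp.mpr
      have : ((x:ℝ)+1) ≤ y := by exact_mod_cast hxy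
      gcongr
    linarith
  rcases Nat.lt_or_gt_of_ne h with h | h
  · exact key x y h
  · exact (key y x h).symm

lemma box_sum {δ : ℝ} (hδ0 : 0 < δ) (hδ1 : δ ≤ 1) (hκ : κ0 = δ/64) (hdn : dens none = 1 - δ/32)
    {N : ℕ} (hN : 64 / δ ≤ N) {T : ℝ} {x : ℕ} (hlo : lo ≤ Real.exp (T - (x+1)/N)) (hhi : Real.exp (T - x/N) ≤ hi)
    (hsm : Real.exp (-(T - (x+1)/N)) ≤ δ / (128 * N)) :
    (1 - 5*δ/64) / N ≤ ∑ p ∈ Gbox P a cl N T x, w p ∧ ∑ p ∈ Gbox P a cl N T x, w p ≤ (1 + δ/16) / N := by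
  have hN1 : (64:ℝ) ≤ N := by
    refine le_trans ?_ hN
    rw [le_div_iff₀ hδ0]; nlinarith
  have hN0 : (0:ℝ) < N := by linarith
  set s := T - (x+1)/N with hs
  have es : T - x/N = s + 1/N := by rw [hs]; field_simp; ring
  have e2 : 2 ≤ Real.exp s := by
    rw [Real.exp_neg] at hsm
    have : δ / (128 * N) ≤ 1/2 := by
      rw [div_le_iff₀ (by positivity)]; linarith
    have h2 : (Real.exp s)⁻¹ ≤ 1/2 := hsm.trans this
    rw [inv_le_comm₀ (Real.exp_pos s) (by norm_num)] at h2
    linarith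
  obtain ⟨l1, l2⟩ := harm_real e2 (show (0:ℝ) ≤ 1/N by positivity)
  rw [← es] at l1 l2
  obtain ⟨d1, d2⟩ := Dens_sum hD (m := ⌈Real.exp s⌉₊) (k := ⌈Real.exp (T - x/N)⌉₊) (by
    intro b h1 h2
    have h1 := Nat.ceil_le.mp h1
    have h2 := Nat.lt_ceil.mp h2
    exact ⟨hlo.trans h1, h2.le.trans hhi⟩) none
  rw [hdn, hκ] at d1 d2
  set S := ∑ b ∈ Finset.Ico ⌈Real.exp s⌉₊ ⌈Real.exp (T - x/N)⌉₊, (1:ℝ)/b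
  have f1 : (1 - δ/128)/N ≤ S := by
    refine le_trans ?_ l1
    rw [sub_div, show δ/128/N = δ/(128*N) by field_simp]; linarith
  have f2 : S ≤ (1 + δ/64)/N := by
    refine l2.trans ?_
    rw [add_div, show δ/64/N = 2*(δ/(128*N)) by field_simp; ring]; linarith
  have g0 : 0 ≤ (1 - δ/64) * (1 - δ/32) := by apply mul_nonneg <;> linarith
  constructor
  · refine le_trans ?_ d1
    calc (1 - 5*δ/64)/N ≤ ((1 - δ/64)*(1 - δ/32)*(1 - δ/128))/N := by gcongr; nlinarith [mul_pos hδ0 hδ0, mul_pos (mul_pos hδ0 hδ0) hδ0]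
      _ = (1 - δ/64)*(1 - δ/32)*((1 - δ/128)/N) := by ring
      _ ≤ _ := by gcongr
  · refine d2.trans ?_
    have g1 : 0 ≤ (1 + δ/64) * (1 - δ/32) := by apply mul_nonneg <;> linarith
    calc _ ≤ (1 + δ/64)*(1 - δ/32)*((1 + δ/64)/N) := by gcongr
      _ = ((1 + δ/64)*(1 - δ/32)*(1 + δ/64))/N := by ring
      _ ≤ _ := by gcongr; nlinarith [mul_pos hδ0 hδ0, mul_pos (mul_pos hδ0 hδ0) hδ0]

end
end FGK


namespace FGK

set_option linter.unusedSectionVars false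

/-- achievable difference vectors -/
noncomputable def LLt {r : ℕ} (μ : ℕ → XT r → ℝ) (c : ℕ → ℝ) (N : ℕ) (T : ℝ) (P : Finset ℕ) (a : ℕ → ℕ) (cl : ℕ → Cls r)
    (A : Finset ℕ) : Finset (Node r → ℤ) :=
  Finset.image (Lz (fun x : Fin (Yb c N T (r+1)) => oval a (outc A (Gbox P a cl N T x))))
    (Finset.univ.filter (fun ω : Fin (Yb c N T (r+1)) → XT r => ∏ x : Fin (Yb c N T (r+1)), μ (levY r (Yb c N T) x) (ω x) ≠ 0))

variable {r : ℕ} {c : ℕ → ℝ} {lam : ℕ → ℕ → ℝ} {μ : ℕ → XT r → ℝ} {δ : ℝ}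

lemma box_pos (hS : Sys r c lam μ δ) {N : ℕ} (hN : 1 ≤ N) {T : ℝ} (hT : 0 ≤ T) {x : ℕ} (hx : x < Yb c N T (r+1)) :
    c (r+1) * T - 1 ≤ T - (x+1)/N := by
  have hN0 : (0:ℝ) < N := by exact_mod_cast hN
  have hN1 : (1:ℝ) ≤ N := by exact_mod_cast hN
  have h1 := Yb_lt hS (N := N) hT (r+1) (by omega) le_rfl
  have h2 : ((x:ℝ)+1) ≤ Yb c N T (r+1) := by exact_mod_cast hx
  have : ((x:ℝ)+1)/N ≤ (1 - c (r+1)) * T + 1 := by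
    rw [div_le_iff₀ hN0]
    have e : ((1 - c (r+1)) * T + 1) * N = N * (1 - c (r+1)) * T + N := by ring
    rw [e]; linarith
  linarith

theorem box_bound (hS : Sys r c lam μ δ) : ∃ d : ℝ, 0 < d ∧ d ≤ 1 ∧ ∀ N : ℕ, 64 / δ ≤ N → ∃ l : ℝ, 0 ≤ l ∧
    ∀ (P : Finset ℕ) (w : ℕ → ℝ) (a : ℕ → ℕ) (cl : ℕ → Cls r) (dens : Cls r → ℝ) (lo hi T : ℝ), (∀ p, 0 ≤ w p) →
      Dens P w a cl dens (δ/64) lo hi → dens none = 1 - δ/32 → 0 ≤ T → lo ≤ Real.exp (c (r+1) * T - 1) → Real.exp T ≤ hi →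
      Real.exp (-(c (r+1) * T - 1)) ≤ δ / (128 * N) →
      EA (P.filter (fun p => cl p = none)) w (fun A => ((LLt μ c N T P a cl A).card : ℝ) ^ (-d)) ≤
        Real.exp (-d * ∑ i ∈ Finset.range r, 2 ^ i * (c (i+1) * T - l)) := by
  have hδ0 := hS.δ0
  have hδ1 := hS.δ1
  obtain ⟨d, hd0, hd1, hpot⟩ := potential hS (d'' := δ/8) (by linarith)
  refine ⟨d, hd0, hd1, ?_⟩
  intro N hN
  have hN1 : (64:ℝ) ≤ N := by
    refine le_trans ?_ hN
    rw [le_div_iff₀ hδ0]; nlinarith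
  have hN0 : (0:ℝ) < N := by linarith
  have hNn : 1 ≤ N := by
    have : (1:ℝ) ≤ N := by linarith
    exact_mod_cast this
  obtain ⟨l, hl0, hpot⟩ := hpot (4 * N) (r * Bc r lam + 1) (by positivity)
  refine ⟨l, hl0, ?_⟩
  intro P w a cl dens lo hi T hw hD hdn hT hlo hhi hsm
  set n := Yb c N T (r+1) with hn
  set P0 := P.filter (fun p => cl p = none) with hP0
  set G := Gbox P a cl N T with hG
  set lev := levY r (Yb c N T) with hlev
  have hGP : ∀ x, G x ⊆ P0 := by
    intro x p hp
    have := Gbox_mem hp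
    rw [hP0, Finset.mem_filter]; exact ⟨this.1, this.2.1⟩
  have hGd : ∀ x y, x ≠ y → Disjoint (G x) (G y) := fun x y h => Gbox_disj h
  have hlevr : ∀ x, lev x ≤ r := fun x => levY_le _ _ _
  set Φ : (Fin n → Finset ℕ) → ℝ := fun o => ∑ ω : Fin n → XT r, (∏ x : Fin n, μ (lev x) (ω x)) *
    (mm vecX n (fun x => μ (lev x)) (fun x => (oval a (o x) : ℚ)) ω 0 (VV r 0)) ^ d with hΦ
  have h1 : EA P0 w (fun A => ((LLt μ c N T P a cl A).card : ℝ) ^ (-d)) ≤ EA P0 w (fun A => Φ (fun x => outc A (G x))) := by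
    apply EA_mono hw
    intro A _
    have key := LL_card (n := n) (fun x => μ (lev x)) (fun x _ i => hS.mu0 _ (hlevr x) i) (fun x _ => hS.mu1 _ (hlevr x))
      (fun x => oval a (outc A (G x))) hd0
    change 1 ≤ ((LLt μ c N T P a cl A).card : ℝ) ^ d * Φ (fun x => outc A (G x)) at key
    rw [Real.rpow_neg (by positivity)]
    rcases eq_or_lt_of_le (show 0 ≤ ((LLt μ c N T P a cl A).card : ℝ) ^ d by positivity) with h | h
    · rw [← h] at key; linarith
    · rw [inv_le_iff_one_le_mul₀ h]; linarith
  refine h1.trans ?_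
  rw [EQ_GG hw (fun x _ => hGP x) hGd Φ]
  change GG vecX n (fun x => μ (lev x)) (PP P0 w G) (fun _ i => (oval a i.1 : ℚ)) d (VV r 0) ≤ _
  set p : ℕ → ℝ := fun x => (∑ q ∈ G x, w q) / ∏ q ∈ G x, (1 + w q) with hp
  have hapos : ∀ x, ∀ q ∈ G x, 0 < a q := by
    intro x q hq
    have h1 := (Gbox_mem hq).2.2.1
    have : (0:ℝ) < a q := lt_of_lt_of_le (Real.exp_pos _) h1
    exact_mod_cast this
  have hbs : ∀ x < n, (1 - 5*δ/64) / N ≤ ∑ p ∈ G x, w p ∧ ∑ p ∈ G x, w p ≤ (1 + δ/16) / N := by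
    intro x hx
    have hb := box_pos hS hNn hT hx
    apply box_sum hD hδ0 hδ1 rfl hdn hN
    · exact hlo.trans (Real.exp_le_exp.mpr hb)
    · refine le_trans (Real.exp_le_exp.mpr ?_) hhi
      have : (0:ℝ) ≤ x / N := by positivity
      linarith
    · refine le_trans (Real.exp_le_exp.mpr ?_) hsm
      linarith
  have hpb : ∀ x < n, (1 - δ/8) / N ≤ p x ∧ p x ≤ (1 + δ/8) / N := by
    intro x hx
    obtain ⟨b1, b2⟩ := hbs x hx
    set W := ∑ p ∈ G x, w p with hW
    have hW0 : 0 ≤ W := Finset.sum_nonneg (fun q _ => hw q)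
    have hden1 := EA_den_ge_one hw (G x)
    have hden2 := EA_den_le_exp hw (G x)
    rw [← hW] at hden2
    have hNd : 1 / (N:ℝ) ≤ δ/64 := by
      rw [div_le_iff₀ hN0]
      rw [div_le_iff₀ hδ0] at hN
      linarith
    constructor
    · have h1 : W * (1 - W) ≤ p x := by
        simp only [hp]
        rw [le_div_iff₀ (EA_den_pos hw _), ← hW]
        have h3 : (1 - W) * ∏ q ∈ G x, (1 + w q) ≤ 1 := by
          by_cases hW1 : W ≤ 1
          · calc (1 - W) * ∏ q ∈ G x, (1 + w q) ≤ Real.exp (-W) * Real.exp W := by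
                  apply mul_le_mul _ hden2 (by linarith) (Real.exp_pos _).le
                  have := Real.add_one_le_exp (-W); linarith
              _ = 1 := by rw [← Real.exp_add]; simp
          · have : (1 - W) * ∏ q ∈ G x, (1 + w q) ≤ 0 := mul_nonpos_of_nonpos_of_nonneg (by linarith) (by linarith)
            linarith
        calc W * (1 - W) * ∏ q ∈ G x, (1 + w q) = W * ((1 - W) * ∏ q ∈ G x, (1 + w q)) := by ring
          _ ≤ W * 1 := by gcongr
          _ = W := mul_one _
      refine le_trans ?_ h1
      have hWs : W ≤ δ/32 := by
        refine b2.trans ?_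
        calc (1 + δ/16)/N ≤ 2 * (1/N) := by rw [mul_one_div]; gcongr; linarith
          _ ≤ δ/32 := by linarith
      calc (1 - δ/8)/N ≤ ((1 - 5*δ/64) * (1 - δ/32))/N := by gcongr; nlinarith
        _ = (1 - 5*δ/64)/N * (1 - δ/32) := by ring
        _ ≤ W * (1 - W) := by
            apply mul_le_mul b1 (by linarith) (by linarith) hW0
    · calc p x ≤ W := div_le_self hW0 hden1
        _ ≤ _ := b2
        _ ≤ _ := by gcongr; linarith
  have hv0 : ∀ i, vb c lam δ r N T p 0 i = c i * T := by intro i; simp [vb]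
  have main := hpot n lev (PP P0 w G) (fun _ i => (oval a i.1 : ℚ)) p (fun x => T - (x+1)/N) (vb c lam δ r N T p)
    (fun x _ => hlevr x) (fun x _ i => PP_nonneg hw P0 G x i) ?_ ?_ ?_ ?_ ?_ ?_
  · refine main.trans (le_of_eq ?_)
    simp only [hv0]
  · intro x _
    have := PP_sum (w := w) (hGP x) (fun _ => True)
    simp only [Finset.filter_true, if_true] at this
    rw [this, EA_const hw]
  · intro x _
    have := PP_sum (w := w) (hGP x) (fun S => (oval a S : ℚ) ≠ 0)
    refine (Eq.trans (Finset.sum_congr (by congr) fun _ _ => rfl) this).trans ?_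
    have h2 := cell_p (w := w) a (G x) (hapos x) (fun m => (m:ℚ) ≠ 0) (by simp)
    rw [h2]
    simp only [hp]
    congr 1
    apply Finset.sum_congr _ (fun _ _ => rfl)
    ext q
    simp only [Finset.mem_filter, and_iff_left_iff_imp]
    intro hq
    have := hapos x q hq
    simp; omega
  · intro x hx t ht
    have := PP_sum (w := w) (hGP x) (fun S => (oval a S : ℚ) = t)
    refine (Eq.trans (Finset.sum_congr (by congr) fun _ _ => rfl) this).trans_le ?_
    have h2 := cell_p (w := w) a (G x) (hapos x) (fun m => (m:ℚ) = t) (by simpa using ht.symm)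
    rw [h2]
    simp only [hp]
    rw [div_mul_eq_mul_div]
    apply div_le_div_of_nonneg_right _ (EA_den_pos hw _).le
    have hWl : 1 / (2 * N) ≤ ∑ q ∈ G x, w q := by
      refine le_trans ?_ (hbs x hx).1
      rw [div_le_div_iff₀ (by positivity) hN0]
      nlinarith
    have hr0 : 2 * Real.exp (-(T - (x+1)/N)) ≤ (∑ q ∈ G x, w q) * (4 * N * Real.exp (-(T - (x+1)/N))) := by
      calc 2 * Real.exp (-(T - (x+1)/N)) = 1 / (2 * N) * (4 * N * Real.exp (-(T - (x+1)/N))) := by field_simp; norm_num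
        _ ≤ _ := by gcongr
    refine le_trans ?_ hr0
    suffices hsuf : ∀ F : Finset ℕ, (∀ q ∈ F, q ∈ G x ∧ (a q : ℚ) = t) → ∑ q ∈ F, w q ≤ 2 * Real.exp (-(T - (x+1)/N)) from
      hsuf _ (fun q hq => (@Finset.mem_filter _ _ (_) _ _).mp hq)
    intro F hFm
    by_cases hne : ∃ q ∈ G x, (a q : ℚ) = t
    · obtain ⟨q0, hq0, hqt⟩ := hne
      obtain ⟨m1, m2, m3, m4⟩ := Gbox_mem hq0
      have hb := box_pos hS hNn hT hx
      have hub := (Dens_pt hD (b := a q0) (hlo.trans ((Real.exp_le_exp.mpr hb).trans m3)) (m4.le.trans (le_trans (Real.exp_le_exp.mpr (by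
        have : (0:ℝ) ≤ x / N := by positivity
        linarith)) hhi)) none).2
      calc ∑ q ∈ F, w q ≤ ∑ q ∈ P.filter (fun p => a p = a q0 ∧ cl p = none), w q := by
            apply Finset.sum_le_sum_of_subset_of_nonneg
            · intro q hq
              have hq := hFm q hq
              rw [Finset.mem_filter]
              have := Gbox_mem hq.1
              refine ⟨this.1, ?_, this.2.1⟩
              have : (a q : ℚ) = a q0 := hq.2.trans hqt.symm
              exact_mod_cast this
            · intro q _ _; exact hw q
        _ ≤ _ := hub
        _ ≤ 2 * Real.exp (-(T - (x+1)/N)) := by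
            rw [hdn, Real.exp_neg, ← mul_div_assoc, div_eq_mul_inv]
            apply mul_le_mul
            · nlinarith
            · exact inv_anti₀ (Real.exp_pos _) m3
            · positivity
            · norm_num
    · have : F = ∅ := by
        rw [Finset.eq_empty_iff_forall_notMem]
        intro q hq; exact hne ⟨q, (hFm q hq).1, (hFm q hq).2⟩
      rw [this, Finset.sum_empty]
      positivity
  · intro x _ i _ _
    unfold vb
    rw [Finset.sum_range_succ]
    linarith
  · intro x hx i hi hix
    exact vb_mid hS hNn hT hpb hi hx hix
  · intro i hi hir
    have := vb_end hS hNn hT hpb hi hir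
    linarith

end FGK


namespace FGK

set_option linter.unusedSectionVars false

/-- gadget scale -/
noncomputable def KK (c : ℕ → ℝ) (Cb T : ℝ) (i : ℕ) : ℕ := ⌈Cb * Real.exp (c (i+1) * T)⌉₊

/-- gadget cells -/
noncomputable def Hgad {r : ℕ} (P : Finset ℕ) (a : ℕ → ℕ) (cl : ℕ → Cls r) (K : ℕ → ℕ) (ν : Node r) (b : Bool) : Finset ℕ :=
  P.filter (fun p => cl p = some (ν, b) ∧ K ν.1 ≤ a p ∧ a p < 3 * K ν.1)

/-- geometric constant -/
noncomputable def Cbc (N : ℕ) : ℝ := 1 / (1 - Real.exp (-(1 / N)))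

lemma Cbc_ge {N : ℕ} (hN : 1 ≤ N) : 1 ≤ Cbc N := by
  have hN0 : (0:ℝ) < N := by exact_mod_cast hN
  have h1 : Real.exp (-(1 / (N:ℝ))) < 1 := by rw [Real.exp_lt_one_iff]; have : 0 < 1 / (N:ℝ) := by positivity
                                              linarith
  have h2 := Real.exp_pos (-(1 / (N:ℝ)))
  unfold Cbc
  rw [le_div_iff₀ (by linarith)]; linarith

lemma oval_outc_le {r : ℕ} {P : Finset ℕ} {a : ℕ → ℕ} {cl : ℕ → Cls r} {N : ℕ} {T : ℝ} (A : Finset ℕ) (x : ℕ) :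
    (oval a (outc A (Gbox P a cl N T x)) : ℝ) ≤ Real.exp (T - x/N) := by
  unfold oval
  have h1 := outc_card A (Gbox P a cl N T x)
  rcases Nat.lt_or_ge (outc A (Gbox P a cl N T x)).card 1 with h | h
  · have : outc A (Gbox P a cl N T x) = ∅ := by rw [← Finset.card_eq_zero]; omega
    rw [this]; simp; positivity
  · obtain ⟨p, hp⟩ := Finset.card_eq_one.mp (le_antisymm h1 h)
    rw [hp, Finset.sum_singleton]
    have : p ∈ Gbox P a cl N T x := by
      have : p ∈ outc A (Gbox P a cl N T x) := by rw [hp]; simp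
      exact (Finset.mem_inter.mp (outc_sub _ _ this)).2
    exact (Gbox_mem this).2.2.2.le

variable {r : ℕ} {c : ℕ → ℝ} {lam : ℕ → ℕ → ℝ} {μ : ℕ → XT r → ℝ} {δ : ℝ}

lemma rmn_agr (ν : Node r) : agr ν.1.val (rmn ν true) (rmn ν false) := by
  intro j hj
  simp [rmn, hj]

lemma LLt_bound (hS : Sys r c lam μ δ) {N : ℕ} (hN : 1 ≤ N) {T : ℝ} (hT : 0 ≤ T) {P : Finset ℕ} {a : ℕ → ℕ} {cl : ℕ → Cls r}
    (A : Finset ℕ) {l : Node r → ℤ} (hl : l ∈ LLt μ c N T P a cl A) (ν : Node r) : |l ν| ≤ KK c (Cbc N) T ν.1 := by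
  have hN0 : (0:ℝ) < N := by exact_mod_cast hN
  unfold LLt at hl
  rw [Finset.mem_image] at hl
  obtain ⟨ω, hω, rfl⟩ := hl
  rw [Finset.mem_filter] at hω
  have hμ : ∀ x : Fin (Yb c N T (r+1)), μ (levY r (Yb c N T) x) (ω x) ≠ 0 := by
    intro x hx; exact hω.2 (Finset.prod_eq_zero (Finset.mem_univ x) hx)
  have hYm := Yb_mono hS hN hT
  have hir : ν.1.val + 1 ≤ r := ν.1.2
  suffices hh : ((|Lz (fun x : Fin (Yb c N T (r+1)) => oval a (outc A (Gbox P a cl N T x))) ω ν| : ℤ) : ℝ) ≤ KK c (Cbc N) T ν.1 by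
    exact_mod_cast hh
  have hterm : ∀ x : Fin (Yb c N T (r+1)), |((oval a (outc A (Gbox P a cl N T x)) : ℤ) : ℝ) * ((bz (ω x (rmn ν true)) - bz (ω x (rmn ν false)) : ℤ) : ℝ)|
      ≤ if Yb c N T (ν.1+1) ≤ x.val then Real.exp T * Real.exp (-(1/N)) ^ x.val else 0 := by
    intro x
    split_ifs with h
    · rw [abs_mul]
      have e : Real.exp T * Real.exp (-(1/N)) ^ x.val = Real.exp (T - x/N) := by
        rw [← Real.exp_nat_mul, ← Real.exp_add]; congr 1; ring
      rw [e]
      have h1 : |((bz (ω x (rmn ν true)) - bz (ω x (rmn ν false)) : ℤ) : ℝ)| ≤ 1 := by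
        cases ω x (rmn ν true) <;> cases ω x (rmn ν false) <;> simp [bz]
      have h2 := oval_outc_le (P := P) (a := a) (cl := cl) (N := N) (T := T) A x
      calc _ ≤ |((oval a (outc A (Gbox P a cl N T x)) : ℤ) : ℝ)| * 1 := by gcongr
        _ ≤ _ := by
            rw [mul_one, abs_of_nonneg (by positivity)]
            exact_mod_cast h2
    · have hlev : levY r (Yb c N T) x ≤ ν.1.val := by
        by_contra hc
        exact h ((levY_iff hYm (i := ν.1.val + 1) (by omega) hir).mp (by omega))
      have hv := hS.supp1 _ (levY_le _ _ _) _ (hμ x)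
      have hv := VV_mono r hlev hv
      rw [mem_VV] at hv
      have hv := hv _ _ (rmn_agr ν)
      have hb : bz (ω x (rmn ν true)) = bz (ω x (rmn ν false)) := by
        have : bv (ω x (rmn ν true)) = bv (ω x (rmn ν false)) := hv
        rw [← bz_cast, ← bz_cast] at this
        exact_mod_cast this
      rw [hb]; simp
  have h1 : ((|Lz (fun x : Fin (Yb c N T (r+1)) => oval a (outc A (Gbox P a cl N T x))) ω ν| : ℤ) : ℝ) ≤
      ∑ x : Fin (Yb c N T (r+1)), if Yb c N T (ν.1+1) ≤ x.val then Real.exp T * Real.exp (-(1/N)) ^ x.val else 0 := by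
    unfold Lz
    rw [Int.cast_abs, Int.cast_sum]
    refine (Finset.abs_sum_le_sum_abs _ _).trans ?_
    apply Finset.sum_le_sum
    intro x _
    refine le_trans (le_of_eq ?_) (hterm x)
    push_cast; rfl
  refine h1.trans ?_
  rw [Fin.sum_univ_eq_sum_range (fun x => if Yb c N T (ν.1+1) ≤ x then Real.exp T * Real.exp (-(1/(N:ℝ))) ^ x else 0), ← Finset.sum_filter]
  have e : (Finset.range (Yb c N T (r+1))).filter (fun x => Yb c N T (ν.1+1) ≤ x) = Finset.Ico (Yb c N T (ν.1+1)) (Yb c N T (r+1)) := by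
    ext x; simp only [Finset.mem_filter, Finset.mem_range, Finset.mem_Ico]; omega
  rw [e, ← Finset.mul_sum]
  have hq1 : Real.exp (-(1 / (N:ℝ))) < 1 := by
    rw [Real.exp_lt_one_iff]
    have : 0 < 1 / (N:ℝ) := by positivity
    linarith
  have hg := geom_sum_Ico_le_of_lt_one (m := Yb c N T (ν.1+1)) (n := Yb c N T (r+1)) (Real.exp_pos (-(1 / (N:ℝ)))).le hq1
  calc _ ≤ Real.exp T * (Real.exp (-(1 / (N:ℝ))) ^ Yb c N T (ν.1+1) / (1 - Real.exp (-(1 / (N:ℝ))))) := by gcongr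
    _ = Cbc N * (Real.exp T * Real.exp (-(1 / (N:ℝ))) ^ Yb c N T (ν.1+1)) := by unfold Cbc; ring
    _ ≤ Cbc N * Real.exp (c (ν.1+1) * T) := by
        have := Cbc_ge hN
        apply mul_le_mul_of_nonneg_left _ (by linarith)
        rw [← Real.exp_nat_mul, ← Real.exp_add]
        apply Real.exp_le_exp.mpr
        have hY := Yb_ge (c := c) (N := N) (T := T) (ν.1+1)
        have : (1 - c (ν.1+1)) * T ≤ Yb c N T (ν.1+1) * (1/N) := by
          rw [mul_one_div, le_div_iff₀ hN0]; linarith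
        linarith
    _ ≤ _ := Nat.le_ceil _

lemma Hgad_disj {P : Finset ℕ} {a : ℕ → ℕ} {cl : ℕ → Cls r} {K K' : ℕ → ℕ} (ν : Node r) (b : Bool) (ν' : Node r) (b' : Bool)
    (h : (ν, b) ≠ (ν', b')) : Disjoint (Hgad P a cl K ν b) (Hgad P a cl K' ν' b') := by
  rw [Finset.disjoint_left]
  intro p hp hq
  unfold Hgad at hp hq
  rw [Finset.mem_filter] at hp hq
  have := hp.2.1.symm.trans hq.2.1
  exact h (Option.some_injective _ this)

/-- deterministic: a good try gives success -/
lemma try_succ (hS : Sys r c lam μ δ) {N : ℕ} {T : ℝ} {P : Finset ℕ} {a : ℕ → ℕ} {cl : ℕ → Cls r} {K : ℕ → ℕ}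
    (A B A' : Finset ℕ) (hA' : A' ⊆ A) (hB : B ⊆ A) (h : tgood a (Hgad P a cl K) (LLt μ c N T P a cl A') B) :
    Succ r a A ((Yb c N T (r+1) : ℕ) + 2^r) := by
  obtain ⟨l, hl, hν⟩ := h
  unfold LLt at hl
  rw [Finset.mem_image] at hl
  obtain ⟨ω, hω, rfl⟩ := hl
  choose p1 hp1 p3 hp3 he hd using hν
  have hmB : ∀ ν, p1 ν ∈ B ∧ p3 ν ∈ B := by
    intro ν
    have h1 : p1 ν ∈ B ∩ (Hgad P a cl K ν true ∪ Hgad P a cl K ν false) := by rw [he]; simp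
    have h3 : p3 ν ∈ B ∩ (Hgad P a cl K ν true ∪ Hgad P a cl K ν false) := by rw [he]; simp
    exact ⟨(Finset.mem_inter.mp h1).1, (Finset.mem_inter.mp h3).1⟩
  refine succ_of a A (fun x : Fin (Yb c N T (r+1)) => outc A' (Gbox P a cl N T x)) cl ?_ ?_ ?_ ?_ ω
    (fun ν b => if b then p1 ν else p3 ν) ?_ ?_ ?_
  · intro x; exact ((outc_sub _ _).trans Finset.inter_subset_left).trans hA'
  · intro x; exact outc_card _ _
  · intro x y hxy
    have := Gbox_disj (P := P) (a := a) (cl := cl) (N := N) (T := T) (x := x.val) (y := y.val) (fun h => hxy (Fin.ext h))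
    exact Finset.disjoint_of_subset_left ((outc_sub _ _).trans Finset.inter_subset_right)
      (Finset.disjoint_of_subset_right ((outc_sub _ _).trans Finset.inter_subset_right) this)
  · intro x p hp
    have := (Finset.mem_inter.mp (outc_sub _ _ hp)).2
    exact (Gbox_mem this).2.1
  · intro ν b; cases b
    · simpa using hB (hmB ν).2
    · simpa using hB (hmB ν).1
  · intro ν b; cases b
    · have := hp3 ν; unfold Hgad at this; rw [Finset.mem_filter] at this; simpa using this.2.1
    · have := hp1 ν; unfold Hgad at this; rw [Finset.mem_filter] at this; simpa using this.2.1
  · intro ν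
    have := hd ν
    simpa [oval] using this

lemma node_sum (f : ℕ → ℝ) : ∑ ν : Node r, f ν.1 = ∑ i ∈ Finset.range r, 2 ^ i * f i := by
  rw [Fintype.sum_sigma, ← Fin.sum_univ_eq_sum_range (fun i => 2 ^ i * f i)]
  apply Finset.sum_congr rfl
  intro i _
  simp

lemma try_one (hS : Sys r c lam μ δ) {N : ℕ} (hN : 1 ≤ N) {T : ℝ} (hT : 0 ≤ T) {P : Finset ℕ} {w : ℕ → ℝ} (hw : ∀ p, 0 ≤ w p)
    {a : ℕ → ℕ} {cl : ℕ → Cls r} {dens : Cls r → ℝ} {lo hi g0 : ℝ} (hD : Dens P w a cl dens (δ/64) lo hi)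
    (hg : ∀ ν b, dens (some (ν, b)) = g0) (hg0 : 0 < g0) (hg1 : g0 ≤ 1)
    (hlo : lo ≤ Real.exp (c (r+1) * T)) (hhi : 6 * Cbc N * Real.exp T ≤ hi) (A G : Finset ℕ)
    (hG : ∀ ν b, Hgad P a cl (KK c (Cbc N) T) ν b ⊆ G) :
    EA G w (fun B => if tgood a (Hgad P a cl (KK c (Cbc N) T)) (LLt μ c N T P a cl A) B then 0 else 1) ≤
      Real.exp (-((LLt μ c N T P a cl A).card * Real.exp (-∑ i ∈ Finset.range r, 2 ^ i * (Real.log (72 * Cbc N * Real.exp 8 / g0 ^ 2) + c (i+1) * T)))) := by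
  have hδ0 := hS.δ0
  have hδ1 := hS.δ1
  have hCb := Cbc_ge hN
  set Cb := Cbc N with hCbdef
  set h := Real.log (72 * Cb * Real.exp 8 / g0 ^ 2) with hh
  have hK1 : ∀ ν : Node r, Cb * Real.exp (c (ν.1+1) * T) ≤ KK c Cb T ν.1 := fun ν => Nat.le_ceil _
  have hX1 : ∀ ν : Node r, 1 ≤ Real.exp (c (ν.1+1) * T) := fun ν => by
    apply Real.one_le_exp; exact mul_nonneg (hS.cpos _).le hT
  have hK2 : ∀ ν : Node r, (KK c Cb T ν.1 : ℝ) ≤ 2 * Cb * Real.exp (c (ν.1+1) * T) := by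
    intro ν
    have := Nat.ceil_lt_add_one (show 0 ≤ Cb * Real.exp (c (ν.1+1) * T) by positivity)
    have h2 : 1 ≤ Cb * Real.exp (c (ν.1+1) * T) := by nlinarith [hX1 ν]
    unfold KK
    linarith
  have hKpos : ∀ ν : Node r, (0:ℝ) < KK c Cb T ν.1 := fun ν => by
    have := hK1 ν; have := hX1 ν; nlinarith
  have hrange : ∀ ν : Node r, ∀ b, KK c Cb T ν.1 ≤ b → b < 3 * KK c Cb T ν.1 → lo ≤ (b:ℝ) ∧ (b:ℝ) ≤ hi := by
    intro ν b h1 h2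
    have hir : ν.1.val + 1 ≤ r := ν.1.2
    have h1' : (KK c Cb T ν.1 : ℝ) ≤ b := by exact_mod_cast h1
    have h2' : (b:ℝ) ≤ 3 * KK c Cb T ν.1 := by exact_mod_cast h2.le
    constructor
    · have : Real.exp (c (r+1) * T) ≤ Real.exp (c (ν.1+1) * T) := by
        apply Real.exp_le_exp.mpr
        exact mul_le_mul_of_nonneg_right (hS.c_mono _ _ (by omega) (by omega) le_rfl) hT
      have := hK1 ν
      have := hX1 ν
      nlinarith
    · have : Real.exp (c (ν.1+1) * T) ≤ Real.exp T := by
        apply Real.exp_le_exp.mpr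
        have := hS.c_le_one (ν.1.val+1) (by omega) (by omega)
        nlinarith
      have := hK2 ν
      nlinarith
  have key := try_prob hw a (Hgad P a cl (KK c Cb T)) (fun ν b ν' b' hne => Hgad_disj ν b ν' b' hne)
    (LLt μ c N T P a cl A) (fun ν => Real.exp (-(h + c (ν.1+1) * T))) (fun ν => (Real.exp_pos _).le) ?_ G hG
  · refine key.trans ?_
    rw [← Real.exp_sum, Finset.sum_neg_distrib, node_sum (fun i => h + c (i+1) * T)]
    have := Real.add_one_le_exp (-((LLt μ c N T P a cl A).card * Real.exp (-∑ i ∈ Finset.range r, 2 ^ i * (h + c (i+1) * T))))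
    linarith
  · intro l hl ν
    have hcell : ∀ b' : Bool, ∀ b, KK c Cb T ν.1 ≤ b → b < 3 * KK c Cb T ν.1 →
        g0 / (6 * KK c Cb T ν.1) ≤ ∑ p ∈ (Hgad P a cl (KK c Cb T) ν b').filter (fun p => a p = b), w p := by
      intro b' b h1 h2
      have := (Dens_pt hD (hrange ν b h1 h2).1 (hrange ν b h1 h2).2 (some (ν, b'))).1
      have h2' : (b:ℝ) ≤ 3 * KK c Cb T ν.1 := by exact_mod_cast h2.le
      have hb0 : (0:ℝ) < b := lt_of_lt_of_le (hKpos ν) (by exact_mod_cast h1)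
      have e : (Hgad P a cl (KK c Cb T) ν b').filter (fun p => a p = b) = P.filter (fun p => a p = b ∧ cl p = some (ν, b')) := by
        ext p; unfold Hgad; simp only [Finset.mem_filter]
        constructor
        · rintro ⟨⟨q1, q2, _⟩, q3⟩; exact ⟨q1, q3, q2⟩
        · rintro ⟨q1, q3, q2⟩; exact ⟨⟨q1, q2, by omega⟩, q3⟩
      rw [e]
      refine le_trans ?_ this
      rw [hg]
      have hk := hKpos ν
      calc g0 / (6 * KK c Cb T ν.1) = (1/2) * (g0 / (3 * KK c Cb T ν.1)) := by field_simp; norm_num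
        _ ≤ (1 - δ/64) * (g0 / b) := by
            apply mul_le_mul (by linarith) _ (by positivity) (by linarith)
            gcongr
    have hsum : ∑ p ∈ Hgad P a cl (KK c Cb T) ν true ∪ Hgad P a cl (KK c Cb T) ν false, w p ≤ 8 := by
      rw [Finset.sum_union (Hgad_disj ν true ν false (by simp))]
      have hone : ∀ b' : Bool, ∑ p ∈ Hgad P a cl (KK c Cb T) ν b', w p ≤ 4 := by
        intro b'
        have := (Dens_sum hD (hrange ν) (some (ν, b'))).2
        refine le_trans this ?_
        rw [hg]
        have hsb : ∑ b ∈ Finset.Ico (KK c Cb T ν.1) (3 * KK c Cb T ν.1), (1:ℝ)/b ≤ 2 := by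
          calc _ ≤ ∑ b ∈ Finset.Ico (KK c Cb T ν.1) (3 * KK c Cb T ν.1), (1:ℝ)/(KK c Cb T ν.1) := by
                apply Finset.sum_le_sum
                intro b hb
                rw [Finset.mem_Ico] at hb
                have := hKpos ν
                have : (KK c Cb T ν.1 : ℝ) ≤ b := by exact_mod_cast hb.1
                gcongr
            _ = 2 := by
                rw [Finset.sum_const, Nat.card_Ico, nsmul_eq_mul, show 3 * KK c Cb T ν.1 - KK c Cb T ν.1 = 2 * KK c Cb T ν.1 by omega]
                have := hKpos ν
                push_cast; field_simp
        have hs0 : 0 ≤ ∑ b ∈ Finset.Ico (KK c Cb T ν.1) (3 * KK c Cb T ν.1), (1:ℝ)/b :=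
          Finset.sum_nonneg (fun b _ => by positivity)
        calc (1 + δ/64) * g0 * _ ≤ 2 * 2 := by
              apply mul_le_mul _ hsb hs0 (by norm_num)
              nlinarith
          _ = 4 := by norm_num
      linarith [hone true, hone false]
    have hpp := pair_prob hw a (Hgad_disj (P := P) (a := a) (cl := cl) (K := KK c Cb T) (K' := KK c Cb T) ν true ν false (by simp)) (KK c Cb T ν.1) (β := g0 / (6 * KK c Cb T ν.1)) (s := 8)
      (by positivity) (l ν) (LLt_bound hS hN hT A hl ν) (hcell true) (hcell false) hsum
    refine le_trans ?_ hpp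
    have hk := hKpos ν
    have e1 : Real.exp (-(h + c (ν.1+1) * T)) = g0 ^ 2 * Real.exp (-8) / (36 * (2 * Cb * Real.exp (c (ν.1+1) * T))) := by
      have : Real.exp (-h) = g0 ^ 2 * Real.exp (-8) / (72 * Cb) := by
        rw [hh, ← Real.log_inv, Real.exp_log (by positivity), Real.exp_neg]
        field_simp
      rw [neg_add, Real.exp_add, this, Real.exp_neg (c (ν.1+1) * T)]
      field_simp; norm_num
    have e2 : (KK c Cb T ν.1 : ℝ) * (g0 / (6 * KK c Cb T ν.1)) ^ 2 * Real.exp (-8) = g0 ^ 2 * Real.exp (-8) / (36 * KK c Cb T ν.1) := by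
      field_simp; norm_num
    rw [e1, e2]
    gcongr
    exact hK2 ν

end FGK


namespace FGK

set_option linter.unusedSectionVars false

lemma exp_neg_le_rpow {z d : ℝ} (hz : 0 < z) (hd0 : 0 < d) (hd1 : d ≤ 1) : Real.exp (-z) ≤ z ^ (-d) := by
  rw [Real.exp_neg, Real.rpow_neg hz.le]
  apply inv_anti₀ (Real.rpow_pos_of_pos hz d)
  have h1 := Real.add_one_le_exp z
  rcases le_total z 1 with h | h
  · have := Real.rpow_le_one hz.le h hd0.le
    linarith
  · have : z ^ d ≤ z ^ (1:ℝ) := Real.rpow_le_rpow_of_exponent_le h hd1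
    rw [Real.rpow_one] at this
    linarith

lemma exp_sum_le {M : ℕ} (hM : 0 < M) (z : ℕ → ℝ) :
    Real.exp (-∑ t ∈ Finset.range M, z t) ≤ (1/M) * ∑ t ∈ Finset.range M, Real.exp (-(M * z t)) := by
  have hM0 : (0:ℝ) < M := by exact_mod_cast hM
  have := convexOn_exp.map_sum_le (t := Finset.range M) (w := fun _ => 1/(M:ℝ)) (p := fun t => -(M * z t))
    (fun _ _ => by positivity) (by simp; field_simp) (fun _ _ => Set.mem_univ _)
  simp only [smul_eq_mul] at this
  rw [← Finset.mul_sum, ← Finset.mul_sum] at this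
  refine le_trans (le_of_eq ?_) this
  congr 1
  rw [Finset.sum_neg_distrib, ← Finset.mul_sum]
  field_simp

lemma core_avg {w : ℕ → ℝ} (hw : ∀ p, 0 ≤ w p) {M : ℕ} (hM : 0 < M) {P0 P1 : Finset ℕ} (hd : Disjoint P0 P1)
    (Gt : ℕ → Finset ℕ) (hG1 : ∀ t < M, Gt t ⊆ P1) (hG2 : ∀ t < M, ∀ t' < M, t ≠ t' → Disjoint (Gt t) (Gt t'))
    (F : Finset ℕ → ℝ) (bad : ℕ → Finset ℕ → Finset ℕ → ℝ)
    (hF : ∀ A0 B, A0 ⊆ P0 → B ⊆ P1 → F (A0 ∪ B) ≤ ∏ t ∈ Finset.range M, bad t A0 (B ∩ Gt t))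
    (hb0 : ∀ t A B, 0 ≤ bad t A B) (z : ℕ → Finset ℕ → ℝ) (hz0 : ∀ t A, 0 < z t A)
    (hb : ∀ t < M, ∀ A, EA (Gt t) w (bad t A) ≤ Real.exp (-z t A)) {d Q : ℝ} (hd0 : 0 < d) (hd1 : d ≤ 1)
    (hz : ∀ t < M, EA P0 w (fun A => (z t A) ^ (-d)) ≤ Q) : EA (P0 ∪ P1) w F ≤ (M:ℝ) ^ (-d) * Q := by
  have hM0 : (0:ℝ) < M := by exact_mod_cast hM
  rw [EA_union hw hd]
  have h1 : ∀ A, A ⊆ P0 → EA P1 w (fun B => F (A ∪ B)) ≤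
      ∑ t ∈ Finset.range M, ((1/M) * (M:ℝ) ^ (-d)) * (z t A) ^ (-d) := by
    intro A hA
    calc EA P1 w (fun B => F (A ∪ B)) ≤ EA P1 w (fun B => ∏ t ∈ Finset.range M, bad t A (B ∩ Gt t)) :=
          EA_mono hw (fun B hB => hF A B hA hB)
      _ = ∏ t ∈ Finset.range M, EA (Gt t) w (bad t A) := by
          apply prodE hw
          · intro t ht; exact hG1 t (Finset.mem_range.mp ht)
          · intro t ht t' ht' h; exact hG2 t (Finset.mem_range.mp ht) t' (Finset.mem_range.mp ht') h
      _ ≤ ∏ t ∈ Finset.range M, Real.exp (-z t A) := by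
          apply Finset.prod_le_prod
          · intro t _; exact EA_nonneg hw (fun B _ => hb0 _ _ _)
          · intro t ht; exact hb t (Finset.mem_range.mp ht) A
      _ = Real.exp (-∑ t ∈ Finset.range M, z t A) := by rw [← Real.exp_sum, Finset.sum_neg_distrib]
      _ ≤ (1/M) * ∑ t ∈ Finset.range M, Real.exp (-(M * z t A)) := exp_sum_le hM _
      _ ≤ (1/M) * ∑ t ∈ Finset.range M, (M:ℝ) ^ (-d) * (z t A) ^ (-d) := by
          gcongr with t _
          rw [← Real.mul_rpow hM0.le (hz0 t A).le]
          exact exp_neg_le_rpow (mul_pos hM0 (hz0 t A)) hd0 hd1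
      _ = _ := by
          rw [Finset.mul_sum]
          apply Finset.sum_congr rfl; intro t _; ring
  refine (EA_mono hw h1).trans ?_
  rw [EA_sum]
  calc ∑ t ∈ Finset.range M, EA P0 w (fun A => ((1/M) * (M:ℝ) ^ (-d)) * (z t A) ^ (-d))
      ≤ ∑ t ∈ Finset.range M, ((1/M) * (M:ℝ) ^ (-d)) * Q := by
        apply Finset.sum_le_sum
        intro t ht
        rw [EA_mul]
        exact mul_le_mul_of_nonneg_left (hz t (Finset.mem_range.mp ht)) (by positivity)
    _ = _ := by rw [Finset.sum_const, Finset.card_range, nsmul_eq_mul]; field_simp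

variable {r : ℕ} {c : ℕ → ℝ} {lam : ℕ → ℕ → ℝ} {μ : ℕ → XT r → ℝ} {δ : ℝ}

lemma LLt_pos (hS : Sys r c lam μ δ) (N : ℕ) (T : ℝ) (P : Finset ℕ) (a : ℕ → ℕ) (cl : ℕ → Cls r) (A : Finset ℕ) :
    0 < ((LLt μ c N T P a cl A).card : ℝ) := by
  have key := LL_card (n := Yb c N T (r+1)) (fun x => μ (levY r (Yb c N T) x)) (fun x _ i => hS.mu0 _ (levY_le _ _ _) i)
    (fun x _ => hS.mu1 _ (levY_le _ _ _)) (fun x => oval a (outc A (Gbox P a cl N T x))) (d := 1) one_pos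
  rcases Nat.eq_zero_or_pos (LLt μ c N T P a cl A).card with h | h
  · unfold LLt at h
    rw [h] at key
    norm_num at key
  · exact_mod_cast h

/-- union of the gadget sets of one try -/
noncomputable def Gtry (P : Finset ℕ) (a : ℕ → ℕ) (cl : ℕ → Cls r) (K : ℕ → ℕ) : Finset ℕ :=
  Finset.univ.biUnion (fun q : Node r × Bool => Hgad P a cl K q.1 q.2)

lemma tgood_inter {P : Finset ℕ} {a : ℕ → ℕ} {cl : ℕ → Cls r} {K : ℕ → ℕ} {LL : Finset (Node r → ℤ)} {B : Finset ℕ} :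
    tgood a (Hgad P a cl K) LL (B ∩ Gtry P a cl K) ↔ tgood a (Hgad P a cl K) LL B := by
  have hs : ∀ ν b, Hgad P a cl K ν b ⊆ Gtry P a cl K := by
    intro ν b p hp
    exact Finset.mem_biUnion.mpr ⟨(ν, b), Finset.mem_univ _, hp⟩
  have : ∀ ν, B ∩ Gtry P a cl K ∩ (Hgad P a cl K ν true ∪ Hgad P a cl K ν false) =
      B ∩ (Hgad P a cl K ν true ∪ Hgad P a cl K ν false) := by
    intro ν
    rw [Finset.inter_assoc]
    congr 1
    exact Finset.inter_eq_right.mpr (Finset.union_subset (hs ν true) (hs ν false))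
  unfold tgood
  simp only [this]

lemma Succ.mono {a : ℕ → ℕ} {A : Finset ℕ} {C C' : ℝ} (h : Succ r a A C) (hC : C ≤ C') : Succ r a A C' := by
  obtain ⟨F, h1, h2, h3, h4⟩ := h
  exact ⟨F, h1, h2, h3, fun s => (h4 s).trans hC⟩

set_option maxHeartbeats 1600000 in
theorem core (hS : Sys r c lam μ δ) {q : ℝ} (hq : 0 < q) {c' : ℝ} (hc0 : 0 < c') (hc' : c' < c (r+1)) :
    ∃ dens : Cls r → ℝ, (∀ g, 0 < dens g) ∧ ∑ g, dens g = 1 ∧ ∃ κ0 > 0, ∃ τ0 Cc : ℝ, ∀ τ ≥ τ0, ∀ (P : Finset ℕ) (w : ℕ → ℝ)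
      (a : ℕ → ℕ) (cl : ℕ → Cls r), (∀ p, 0 ≤ w p) → Dens P w a cl dens κ0 (Real.exp (c' * τ)) (Real.exp τ) →
      EA P w (fun A => if Succ r a A (Cc * τ) then 0 else 1) ≤ q := by
  have hδ0 := hS.δ0
  have hδ1 := hS.δ1
  have hr1 := hS.r1
  have hcr : 0 < c (r+1) := hS.cpos _
  obtain ⟨d, hd0, hd1, hbox⟩ := box_bound hS
  set N := ⌈64/δ⌉₊ with hNdef
  have hN : 64/δ ≤ N := Nat.le_ceil _
  have hN1 : 1 ≤ N := by
    have : (1:ℝ) ≤ N := le_trans (by rw [le_div_iff₀ hδ0]; linarith) hN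
    exact_mod_cast this
  have hN0 : (0:ℝ) < N := by exact_mod_cast hN1
  obtain ⟨l, hl0, hbox⟩ := hbox N hN
  have hcard : 0 < Fintype.card (Node r × Bool) := by
    apply Fintype.card_pos_iff.mpr
    exact ⟨(⟨⟨0, hr1⟩, fun _ => true⟩, true)⟩
  have hcard1 : (1:ℝ) ≤ Fintype.card (Node r × Bool) := by exact_mod_cast hcard
  set g0 : ℝ := (δ/32) / Fintype.card (Node r × Bool) with hg0def
  have hg0 : 0 < g0 := by positivity
  have hg1 : g0 ≤ 1 := by
    rw [hg0def, div_le_one (by positivity)]; linarith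
  have hCb := Cbc_ge hN1
  set Cb := Cbc N with hCbdef
  set h := Real.log (72 * Cb * Real.exp 8 / g0 ^ 2) with hh
  set S := ∑ i ∈ Finset.range r, (2:ℝ) ^ i * (h + l) with hSdef
  -- number of tries
  obtain ⟨M, hM0, hMq⟩ : ∃ M : ℕ, 0 < M ∧ (M:ℝ) ^ (-d) * Real.exp (d * S) ≤ q := by
    have h1 : Tendsto (fun M : ℕ => (M:ℝ) ^ (-d) * Real.exp (d * S)) atTop (nhds (0 * Real.exp (d * S))) :=
      ((tendsto_rpow_neg_atTop hd0).comp tendsto_natCast_atTop_atTop).mul_const _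
    rw [zero_mul] at h1
    obtain ⟨M, hM⟩ := ((h1.eventually (gt_mem_nhds hq)).and (eventually_gt_atTop 0)).exists
    exact ⟨M, hM.2, hM.1.le⟩
  set D0 := Real.log 9 / c (r+1) + Real.log (6 * Cb) with hD0
  have hlog9 : 0 < Real.log 9 := Real.log_pos (by norm_num)
  have hlogC : 0 ≤ Real.log (6 * Cb) := Real.log_nonneg (by linarith)
  have hD00 : 0 < D0 := by positivity
  refine ⟨fun g => g.elim (1 - δ/32) (fun _ => g0), ?_, ?_, δ/64, by positivity,
    max 1 (max ((1 + c (r+1) * (M * D0)) / (c (r+1) - c')) (Real.log (128 * N / δ) / c')), N + 1 + 2^r, ?_⟩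
  · intro g; cases g
    · simp only [Option.elim]; linarith
    · simpa using hg0
  · rw [Fintype.sum_option]
    simp only [Option.elim, Finset.sum_const, nsmul_eq_mul, Finset.card_univ]
    rw [hg0def]; field_simp; ring
  intro τ hτ P w a cl hw hD
  have hτ1 : 1 ≤ τ := le_trans (le_max_left _ _) hτ
  have hτ2 : 1 + c (r+1) * (M * D0) ≤ τ * (c (r+1) - c') := by
    have := le_trans (le_trans (le_max_left _ _) (le_max_right _ _)) hτ
    rwa [div_le_iff₀ (by linarith)] at this
  have hτ3 : Real.log (128 * N / δ) ≤ c' * τ := by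
    have := le_trans (le_trans (le_max_right _ _) (le_max_right _ _)) hτ
    rw [div_le_iff₀ hc0] at this; linarith
  set dens : Cls r → ℝ := fun g => g.elim (1 - δ/32) (fun _ => g0) with hdens
  set Tt : ℕ → ℝ := fun t => τ - (t+1) * D0 with hTt
  have hTle : ∀ t, Tt t + D0 ≤ τ := by
    intro t; simp only [hTt]
    have : 0 ≤ (t:ℝ) * D0 := by positivity
    linarith
  have hTlow : ∀ t < M, c' * τ ≤ c (r+1) * Tt t - 1 := by
    intro t ht
    have h1 : ((t:ℝ)+1) ≤ M := by exact_mod_cast ht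
    have h2 : ((t:ℝ)+1) * D0 ≤ M * D0 := by gcongr
    have h3 : c (r+1) * (((t:ℝ)+1) * D0) ≤ c (r+1) * (M * D0) := by gcongr
    simp only [hTt]; nlinarith
  have hT0 : ∀ t < M, 0 ≤ Tt t := by
    intro t ht
    have h1 := hTlow t ht
    have h2 : 0 ≤ c' * τ := by positivity
    by_contra hneg
    push Not at hneg
    nlinarith
  set K : ℕ → ℕ → ℕ := fun t => KK c Cb (Tt t) with hK
  set P0 := P.filter (fun p => cl p = none) with hP0
  set P1 := P.filter (fun p => ¬ cl p = none) with hP1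
  have hPu : P = P0 ∪ P1 := (Finset.filter_union_filter_not_eq _ _).symm
  have hPd : Disjoint P0 P1 := Finset.disjoint_filter_filter_not _ _ _
  have hHP1 : ∀ K ν b, Hgad P a cl K ν b ⊆ P1 := by
    intro K ν b p hp
    unfold Hgad at hp
    rw [Finset.mem_filter] at hp
    rw [hP1, Finset.mem_filter]
    refine ⟨hp.1, ?_⟩
    rw [hp.2.1]; simp
  have hGt1 : ∀ t < M, Gtry P a cl (K t) ⊆ P1 := by
    intro t _ p hp
    obtain ⟨x, _, hx⟩ := Finset.mem_biUnion.mp hp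
    exact hHP1 _ _ _ hx
  have hsep : ∀ t t', t < t' → t' < M → ∀ i : Fin r, 3 * K t' i ≤ K t i := by
    intro t t' htt ht' i
    have hX1 : 1 ≤ Real.exp (c (i+1) * Tt t') := Real.one_le_exp (mul_nonneg (hS.cpos _).le (hT0 t' ht'))
    have h1 := Nat.ceil_lt_add_one (show 0 ≤ Cb * Real.exp (c (i+1) * Tt t') by positivity)
    have h2 : 1 ≤ Cb * Real.exp (c (i+1) * Tt t') := by nlinarith
    have h3 : Cb * Real.exp (c (i+1) * Tt t) ≤ K t i := Nat.le_ceil _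
    have h4 : 9 * Real.exp (c (i+1) * Tt t') ≤ Real.exp (c (i+1) * Tt t) := by
      have : (9:ℝ) = Real.exp (Real.log 9) := (Real.exp_log (by norm_num)).symm
      rw [this, ← Real.exp_add]
      apply Real.exp_le_exp.mpr
      have hci : c (r+1) ≤ c (i+1) := hS.c_mono _ _ (by omega) (by omega) le_rfl
      have h5 : D0 ≤ Tt t - Tt t' := by
        simp only [hTt]
        have : ((t:ℝ)+1) ≤ t' := by exact_mod_cast htt
        nlinarith
      have h6 : Real.log 9 ≤ c (r+1) * D0 := by
        rw [hD0, mul_add, mul_div_cancel₀ _ hcr.ne']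
        have := mul_nonneg hcr.le hlogC
        linarith
      have h7 : c (r+1) * D0 ≤ c (i+1) * (Tt t - Tt t') := mul_le_mul hci h5 hD00.le (hS.cpos _).le
      linarith
    have h8 : ((K t' i : ℕ):ℝ) < Cb * Real.exp (c (i+1) * Tt t') + 1 := h1
    have : ((3 * K t' i : ℕ):ℝ) ≤ K t i := by push_cast; nlinarith
    exact_mod_cast this
  have hGd : ∀ t t', t < t' → t' < M → Disjoint (Gtry P a cl (K t)) (Gtry P a cl (K t')) := by
    intro t t' htt ht'
    rw [Finset.disjoint_left]
    intro p hp hp'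
    obtain ⟨⟨ν, b⟩, _, hx⟩ := Finset.mem_biUnion.mp hp
    obtain ⟨⟨ν', b'⟩, _, hx'⟩ := Finset.mem_biUnion.mp hp'
    unfold Hgad at hx hx'
    rw [Finset.mem_filter] at hx hx'
    have e := Option.some_injective _ (hx.2.1.symm.trans hx'.2.1)
    simp only [Prod.mk.injEq] at e
    obtain ⟨rfl, rfl⟩ := e
    have := hsep t t' htt ht' ν.1
    have h1 := hx.2.2.1
    have h2 := hx'.2.2.2
    simp only at h1 h2
    omega
  have hGt2 : ∀ t < M, ∀ t' < M, t ≠ t' → Disjoint (Gtry P a cl (K t)) (Gtry P a cl (K t')) := by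
    intro t ht t' ht' hne
    rcases lt_or_gt_of_ne hne with hl | hl
    · exact hGd t t' hl ht'
    · exact (hGd t' t hl ht).symm
  set E : ℕ → ℝ := fun t => ∑ i ∈ Finset.range r, 2 ^ i * (h + c (i+1) * Tt t) with hE
  have key := core_avg (P0 := P0) (P1 := P1) hw hM0 hPd (fun t => Gtry P a cl (K t)) hGt1 hGt2
    (fun A => if Succ r a A ((N + 1 + 2^r) * τ) then 0 else 1)
    (fun t A B => if tgood a (Hgad P a cl (K t)) (LLt μ c N (Tt t) P a cl A) B then 0 else 1) ?_ ?_
    (fun t A => (LLt μ c N (Tt t) P a cl A).card * Real.exp (-E t)) ?_ ?_ hd0 hd1 (Q := Real.exp (d * S)) ?_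
  · rw [hPu]; exact key.trans hMq
  · intro A B hA hB
    by_cases hex : ∃ t < M, tgood a (Hgad P a cl (K t)) (LLt μ c N (Tt t) P a cl A) (B ∩ Gtry P a cl (K t))
    · obtain ⟨t, ht, hg⟩ := hex
      have h1 := try_succ hS (A ∪ B) B A Finset.subset_union_left Finset.subset_union_right (tgood_inter.mp hg)
      have h2 : Succ r a (A ∪ B) ((N + 1 + 2^r) * τ) := by
        apply h1.mono
        have h3 := Yb_lt hS (N := N) (hT0 t ht) (r+1) (by omega) le_rfl
        have h4 : (N:ℝ) * (1 - c (r+1)) * Tt t ≤ N * τ := by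
          have : (1 - c (r+1)) * Tt t ≤ τ := by
            have := hTle t; have := hT0 t ht
            nlinarith
          calc (N:ℝ) * (1 - c (r+1)) * Tt t = N * ((1 - c (r+1)) * Tt t) := by ring
            _ ≤ _ := by gcongr
        have h5 : (1:ℝ) + 2^r ≤ (1 + 2^r) * τ := by
          have : (0:ℝ) < 2^r := by positivity
          nlinarith
        nlinarith
      rw [if_pos h2]
      exact Finset.prod_nonneg (fun t _ => by split_ifs <;> norm_num)
    · push Not at hex
      rw [Finset.prod_congr rfl (fun t ht => if_neg (hex t (Finset.mem_range.mp ht)))]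
      simp only [Finset.prod_const_one]
      split_ifs <;> norm_num
  · intro t A B; split_ifs <;> norm_num
  · intro t A
    exact mul_pos (LLt_pos hS _ _ _ _ _ _) (Real.exp_pos _)
  · intro t ht A
    apply try_one hS hN1 (hT0 t ht) hw hD (g0 := g0) (fun ν b => rfl) hg0 hg1
    · apply Real.exp_le_exp.mpr
      have := hTlow t ht; linarith
    · have : 6 * Cbc N = Real.exp (Real.log (6 * Cb)) := (Real.exp_log (by linarith)).symm
      rw [this, ← Real.exp_add]
      apply Real.exp_le_exp.mpr
      have h1 := hTle t
      have h2 : Real.log (6 * Cb) ≤ D0 := by rw [hD0]; have : 0 ≤ Real.log 9 / c (r+1) := by positivity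
                                             linarith
      linarith
    · intro ν b p hp
      exact Finset.mem_biUnion.mpr ⟨(ν, b), Finset.mem_univ _, hp⟩
  · intro t ht
    have hb := hbox P w a cl dens _ _ (Tt t) hw hD rfl (hT0 t ht) (Real.exp_le_exp.mpr (hTlow t ht))
      (Real.exp_le_exp.mpr (by have := hTle t; linarith)) (by
        have h1 : Real.exp (-(c (r+1) * Tt t - 1)) ≤ Real.exp (-Real.log (128 * N / δ)) := by
          apply Real.exp_le_exp.mpr
          have := hTlow t ht; linarith
        rw [Real.exp_neg (Real.log _), Real.exp_log (by positivity), inv_div] at h1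
        exact h1)
    have e : EA P0 w (fun A => ((LLt μ c N (Tt t) P a cl A).card * Real.exp (-E t)) ^ (-d)) =
        Real.exp (d * E t) * EA P0 w (fun A => ((LLt μ c N (Tt t) P a cl A).card : ℝ) ^ (-d)) := by
      rw [← EA_mul]
      apply EA_congr
      intro A _
      rw [Real.mul_rpow (Nat.cast_nonneg _) (Real.exp_pos _).le, ← Real.exp_mul, mul_comm]
      congr 2; ring
    rw [e]
    calc _ ≤ Real.exp (d * E t) * Real.exp (-d * ∑ i ∈ Finset.range r, 2 ^ i * (c (i+1) * Tt t - l)) := by gcongr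
      _ = Real.exp (d * S) := by
        rw [← Real.exp_add]
        congr 1
        rw [neg_mul, ← sub_eq_add_neg, ← mul_sub, hE, hSdef, ← Finset.sum_sub_distrib]
        congr 1
        apply Finset.sum_congr rfl
        intro i _; ring
end FGK


namespace FGK

set_option linter.unusedSectionVars false

/-- primes below `n+1` -/
noncomputable def prs (n : ℕ) : Finset ℕ := (Finset.range n).filter Nat.Prime

lemma mem_prs {n p : ℕ} : p ∈ prs n ↔ p < n ∧ p.Prime := by simp [prs]

lemma log_fact_eq (n : ℕ) : Real.log (n.factorial) = ∑ p ∈ prs (n+1), (n.factorial.factorization p : ℝ) * Real.log p := by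
  have h0 := Nat.prod_factorization_pow_eq_self (Nat.factorial_ne_zero n)
  have hs : n.factorial.factorization.support = prs (n+1) := by
    ext p
    rw [Nat.support_factorization, Nat.mem_primeFactors, mem_prs]
    constructor
    · rintro ⟨hp, hd, _⟩
      exact ⟨Nat.lt_succ_of_le ((hp.dvd_factorial).mp hd), hp⟩
    · rintro ⟨h1, hp⟩
      exact ⟨hp, (hp.dvd_factorial).mpr (Nat.le_of_lt_succ h1), Nat.factorial_ne_zero n⟩
  conv_lhs => rw [← h0]
  rw [Finsupp.prod, hs, Nat.cast_prod, Real.log_prod]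
  · apply Finset.sum_congr rfl
    intro p _
    rw [Nat.cast_pow, Real.log_pow]
  · intro p hp
    have := (mem_prs.mp hp).2.pos
    positivity

lemma fact_val_upper {n p : ℕ} (hp : p.Prime) : (n.factorial.factorization p : ℝ) ≤ n / (p - 1) := by
  haveI : Fact p.Prime := ⟨hp⟩
  have h := sub_one_mul_padicValNat_factorial (p := p) n
  rw [← Nat.factorization_def _ hp] at h
  have h1 : (p - 1) * n.factorial.factorization p ≤ n := by rw [h]; exact Nat.sub_le _ _
  have hp1 : (0:ℝ) < p - 1 := by have := hp.one_lt; have : (1:ℝ) < p := by exact_mod_cast this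
                                 linarith
  rw [le_div_iff₀ hp1]
  have h2 : (((p - 1 : ℕ) * n.factorial.factorization p : ℕ) : ℝ) ≤ n := by exact_mod_cast h1
  rw [Nat.cast_mul, Nat.cast_sub hp.one_lt.le, Nat.cast_one] at h2
  linarith

lemma fact_val_lower {n p : ℕ} (hp : p.Prime) : (n:ℝ) / p - 1 ≤ n.factorial.factorization p := by
  have h1 : n / p ≤ n.factorial.factorization p := by
    have hd : p ^ (n / p) ∣ n.factorial := by
      have h2 : p ^ (n/p) ∣ (p * (n/p)).factorial := by
        generalize n / p = k
        induction k with
        | zero => simp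
        | succ k ih =>
          rw [pow_succ, Nat.mul_succ]
          have : (p * k + p).factorial = (p * k + p) * (p * k + p - 1).factorial := by
            have := hp.pos
            exact (Nat.mul_factorial_pred (by omega)).symm
          rw [this, mul_comm]
          apply Nat.mul_dvd_mul
          · exact Dvd.intro (k+1) (by ring)
          · exact ih.trans (Nat.factorial_dvd_factorial (by have := hp.pos; omega))
      exact h2.trans (Nat.factorial_dvd_factorial (Nat.mul_div_le n p))
    exact (hp.pow_dvd_iff_le_factorization (Nat.factorial_ne_zero n)).mp hd
  have h3 : (n:ℝ) / p < (n / p : ℕ) + 1 := by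
    have hp0 : (0:ℝ) < p := by exact_mod_cast hp.pos
    rw [div_lt_iff₀ hp0]
    have := Nat.lt_mul_div_succ n hp.pos
    have h4 : (n:ℝ) < (p * (n/p + 1) : ℕ) := by exact_mod_cast this
    push_cast at h4; push_cast; linarith
  have h5 : ((n / p : ℕ):ℝ) ≤ n.factorial.factorization p := by exact_mod_cast h1
  linarith

lemma sum_extra : ∃ C0 : ℝ, 0 ≤ C0 ∧ ∀ n, ∑ p ∈ prs n, Real.log p / (p * (p - 1)) ≤ C0 := by
  have hs : Summable (fun k : ℕ => 4 * (1 / (k:ℝ) ^ (3/2:ℝ))) := (Real.summable_one_div_nat_rpow.mpr (by norm_num)).mul_left 4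
  refine ⟨∑' k : ℕ, 4 * (1 / (k:ℝ) ^ (3/2:ℝ)), tsum_nonneg (fun k => by positivity), ?_⟩
  intro n
  refine le_trans (Finset.sum_le_sum ?_) (hs.sum_le_tsum (prs n) (fun k _ => by positivity))
  intro p hp
  have hp2 : (2:ℝ) ≤ p := by exact_mod_cast (mem_prs.mp hp).2.two_le
  have hl := Real.log_le_rpow_div (show (0:ℝ) ≤ p by linarith) (show (0:ℝ) < 1/2 by norm_num)
  have hp0 : (0:ℝ) < p := by linarith
  have e : (p:ℝ) ^ (3/2:ℝ) * (p:ℝ) ^ (1/2:ℝ) = p ^ 2 := by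
    rw [← Real.rpow_add hp0]; norm_num
  have hq : 0 < (p:ℝ) ^ (3/2:ℝ) := by positivity
  rw [mul_one_div, div_le_div_iff₀ (by nlinarith) hq]
  calc Real.log p * (p:ℝ) ^ (3/2:ℝ) ≤ ((p:ℝ) ^ (1/2:ℝ) / (1/2)) * (p:ℝ) ^ (3/2:ℝ) := by gcongr
    _ = 2 * p^2 := by rw [← e]; ring
    _ ≤ 4 * (p * (p - 1)) := by nlinarith

theorem mertens : ∃ C : ℝ, 0 ≤ C ∧ ∀ n : ℕ, 1 ≤ n → |∑ p ∈ prs (n+1), Real.log p / p - Real.log n| ≤ C := by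
  obtain ⟨C0, hC0, hex⟩ := sum_extra
  have hl4 : 0 ≤ Real.log 4 := Real.log_nonneg (by norm_num)
  refine ⟨Real.log 4 + 1 + C0, by linarith, ?_⟩
  intro n hn
  have hn0 : (0:ℝ) < n := by exact_mod_cast hn
  have hlog : ∀ p ∈ prs (n+1), 0 ≤ Real.log p := fun p hp => Real.log_natCast_nonneg p
  have hth : ∑ p ∈ prs (n+1), Real.log p ≤ Real.log 4 * n := by
    have := Chebyshev.theta_le_log4_mul_x hn0.le
    rw [Chebyshev.theta_eq_sum_Icc] at this
    refine le_trans (le_of_eq ?_) this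
    apply Finset.sum_congr _ (fun _ _ => rfl)
    ext p
    rw [mem_prs]
    simp only [Nat.floor_natCast, Finset.mem_filter, Finset.mem_Icc]
    constructor
    · rintro ⟨h1, h2⟩; exact ⟨⟨by omega, by omega⟩, h2⟩
    · rintro ⟨⟨_, h1⟩, h2⟩; exact ⟨by omega, h2⟩
  have hf1 : Real.log n.factorial ≤ n * Real.log n := by
    rw [← Real.log_pow]
    apply Real.log_le_log (by exact_mod_cast Nat.factorial_pos n)
    exact_mod_cast Nat.factorial_le_pow n
  have hf2 : n * Real.log n - n ≤ Real.log n.factorial := by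
    have := Stirling.le_log_factorial_stirling (n := n) (by omega)
    have h1 : 0 ≤ Real.log n := Real.log_natCast_nonneg n
    have h2 : 0 ≤ Real.log (2 * Real.pi) := Real.log_nonneg (by have := Real.pi_gt_three; linarith)
    linarith
  have hsum := log_fact_eq n
  have hup : Real.log n.factorial ≤ n * (∑ p ∈ prs (n+1), Real.log p / p + C0) := by
    rw [hsum]
    calc _ ≤ ∑ p ∈ prs (n+1), n * (Real.log p / p + Real.log p / (p * (p - 1))) := by
          apply Finset.sum_le_sum
          intro p hp
          have hpp := (mem_prs.mp hp).2
          have hp2 : (2:ℝ) ≤ p := by exact_mod_cast hpp.two_le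
          calc _ ≤ n / ((p:ℝ) - 1) * Real.log p := mul_le_mul_of_nonneg_right (fact_val_upper hpp) (hlog p hp)
            _ = _ := by
              have h1 : (p:ℝ) ≠ 0 := by linarith
              have h2 : (p:ℝ) - 1 ≠ 0 := by linarith
              field_simp
              ring
      _ = n * (∑ p ∈ prs (n+1), Real.log p / p + ∑ p ∈ prs (n+1), Real.log p / (p * (p - 1))) := by
          rw [← Finset.mul_sum, Finset.sum_add_distrib]
      _ ≤ _ := by gcongr; exact hex _
  have hlow : n * ∑ p ∈ prs (n+1), Real.log p / p - Real.log 4 * n ≤ Real.log n.factorial := by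
    rw [hsum]
    calc _ ≤ n * ∑ p ∈ prs (n+1), Real.log p / p - ∑ p ∈ prs (n+1), Real.log p := by linarith
      _ = ∑ p ∈ prs (n+1), ((n:ℝ)/p - 1) * Real.log p := by
          rw [Finset.mul_sum, ← Finset.sum_sub_distrib]
          apply Finset.sum_congr rfl; intro p _; ring
      _ ≤ _ := by
          apply Finset.sum_le_sum
          intro p hp
          exact mul_le_mul_of_nonneg_right (fact_val_lower (mem_prs.mp hp).2) (hlog p hp)
  rw [abs_le]
  constructor
  · have h : n * (Real.log n - 1) ≤ n * (∑ p ∈ prs (n+1), Real.log p / p + C0) := by linarith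
    have := le_of_mul_le_mul_left h hn0
    linarith
  · have h : n * (∑ p ∈ prs (n+1), Real.log p / p - Real.log 4) ≤ n * Real.log n := by linarith
    have := le_of_mul_le_mul_left h hn0
    linarith

theorem mertens_real : ∃ C : ℝ, 0 ≤ C ∧ ∀ z : ℝ, 2 ≤ z → |∑ p ∈ prs ⌈z⌉₊, Real.log p / p - Real.log z| ≤ C := by
  obtain ⟨C, hC, h⟩ := mertens
  refine ⟨C + 1, by linarith, ?_⟩
  intro z hz
  obtain ⟨n, hn⟩ : ∃ n, ⌈z⌉₊ = n + 1 := ⟨⌈z⌉₊ - 1, by have : 0 < ⌈z⌉₊ := Nat.ceil_pos.mpr (by linarith)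
                                                      omega⟩
  have h1 : (n:ℝ) < z := Nat.lt_ceil.mp (by omega)
  have h2 : z ≤ n + 1 := by have := Nat.le_ceil z; rw [hn] at this; exact_mod_cast this
  have hn1 : 1 ≤ n := by
    have : (0:ℝ) < n := by linarith
    exact_mod_cast this
  have hn0 : (1:ℝ) ≤ n := by exact_mod_cast hn1
  have h3 := h n hn1
  rw [hn]
  have h4 : Real.log n ≤ Real.log z := Real.log_le_log (by linarith) h1.le
  have h5 : Real.log z - Real.log n ≤ 1 := by
    rw [← Real.log_div (by linarith) (by linarith)]
    have h6 := Real.log_le_sub_one_of_pos (show 0 < z / n by apply div_pos <;> linarith)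
    have h7 : z / n ≤ 2 := by rw [div_le_iff₀ (by linarith)]; linarith
    linarith
  rw [abs_le] at h3 ⊢
  constructor <;> linarith [h3.1, h3.2]

/-- sum of `1/p` over a log-interval -/
theorem mertens_int : ∃ C : ℝ, 0 ≤ C ∧ ∀ (α β : ℝ), 1 ≤ α → α ≤ β → ∀ Q : Finset ℕ,
    (∀ p, p ∈ Q ↔ p.Prime ∧ α ≤ Real.log p ∧ Real.log p < β) →
    (β - α - C) / β ≤ ∑ p ∈ Q, 1 / (p:ℝ) ∧ ∑ p ∈ Q, 1 / (p:ℝ) ≤ (β - α + C) / α := by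
  obtain ⟨C, hC, h⟩ := mertens_real
  refine ⟨2 * C, by linarith, ?_⟩
  intro α β hα hαβ Q hQ
  have e2 : ∀ t, 1 ≤ t → 2 ≤ Real.exp t := fun t ht => by have := Real.add_one_le_exp t; linarith
  have h1 := h (Real.exp α) (e2 _ hα)
  have h2 := h (Real.exp β) (e2 _ (hα.trans hαβ))
  rw [Real.log_exp] at h1 h2
  have hmem : ∀ t p, p ∈ prs ⌈Real.exp t⌉₊ ↔ p.Prime ∧ Real.log p < t := by
    intro t p
    rw [mem_prs, Nat.lt_ceil, and_comm]
    apply and_congr_right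
    intro hp
    rw [Real.log_lt_iff_lt_exp (by exact_mod_cast hp.pos)]
  have hu : prs ⌈Real.exp β⌉₊ = prs ⌈Real.exp α⌉₊ ∪ Q := by
    ext p
    rw [Finset.mem_union, hmem, hmem, hQ]
    constructor
    · rintro ⟨hp, hb⟩
      rcases lt_or_ge (Real.log p) α with h | h
      · exact Or.inl ⟨hp, h⟩
      · exact Or.inr ⟨hp, h, hb⟩
    · rintro (⟨hp, h⟩ | ⟨hp, _, h⟩)
      · exact ⟨hp, h.trans_le hαβ⟩
      · exact ⟨hp, h⟩
  have hd : Disjoint (prs ⌈Real.exp α⌉₊) Q := by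
    rw [Finset.disjoint_left]
    intro p h1 h2
    rw [hmem] at h1; rw [hQ] at h2
    linarith [h1.2, h2.2.1]
  rw [hu, Finset.sum_union hd] at h2
  rw [abs_le] at h1 h2
  have hl : β - α - 2 * C ≤ ∑ p ∈ Q, Real.log p / p := by linarith [h1.1, h1.2, h2.1, h2.2]
  have hh : ∑ p ∈ Q, Real.log p / p ≤ β - α + 2 * C := by linarith [h1.1, h1.2, h2.1, h2.2]
  have hp0 : ∀ p ∈ Q, (0:ℝ) < p := fun p hp => by exact_mod_cast ((hQ p).mp hp).1.pos
  constructor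
  · rw [div_le_iff₀ (by linarith), Finset.sum_mul]
    refine hl.trans (Finset.sum_le_sum ?_)
    intro p hp
    rw [div_eq_inv_mul, one_div]
    exact mul_le_mul_of_nonneg_left ((hQ p).mp hp).2.2.le (inv_nonneg.mpr (hp0 p hp).le)
  · rw [le_div_iff₀ (by linarith), Finset.sum_mul]
    refine le_trans (Finset.sum_le_sum ?_) hh
    intro p hp
    rw [one_div, div_eq_inv_mul]
    exact mul_le_mul_of_nonneg_left ((hQ p).mp hp).2.1 (inv_nonneg.mpr (hp0 p hp).le)

end FGK


namespace FGK

set_option linter.unusedSectionVars false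

lemma split_unit {ι : Type*} (dens : ι → ℝ) (hpos : ∀ g, 0 < dens g) (S : Finset ι) :
    ∃ s : ι → ℝ, (∀ g ∈ S, 0 ≤ s g ∧ s g + dens g ≤ ∑ g ∈ S, dens g) ∧
      ∀ f, 0 ≤ f → f < ∑ g ∈ S, dens g → ∃ g ∈ S, (s g ≤ f ∧ f < s g + dens g) ∧
        ∀ g' ∈ S, s g' ≤ f ∧ f < s g' + dens g' → g' = g := by
  induction S using Finset.induction_on with
  | empty =>
    refine ⟨fun _ => 0, by simp, ?_⟩
    intro f h0 h1; simp at h1; linarith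
  | insert g0 S hg0 ih =>
    obtain ⟨s, h1, h2⟩ := ih
    have hS0 : 0 ≤ ∑ g ∈ S, dens g := Finset.sum_nonneg (fun g _ => (hpos g).le)
    refine ⟨Function.update s g0 (∑ g ∈ S, dens g), ?_, ?_⟩
    · intro g hg
      rw [Finset.sum_insert hg0]
      rcases eq_or_ne g g0 with rfl | hne
      · rw [Function.update_self]; exact ⟨hS0, by linarith⟩
      · rw [Function.update_of_ne hne]
        have := h1 g (Finset.mem_of_mem_insert_of_ne hg hne)
        exact ⟨this.1, by linarith [this.2, hpos g0]⟩
    · intro f hf0 hf1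
      rw [Finset.sum_insert hg0] at hf1
      rcases lt_or_ge f (∑ g ∈ S, dens g) with hlt | hge
      · obtain ⟨g, hg, hfg, hu⟩ := h2 f hf0 hlt
        have hne : g ≠ g0 := fun h => hg0 (h ▸ hg)
        refine ⟨g, Finset.mem_insert_of_mem hg, by rw [Function.update_of_ne hne]; exact hfg, ?_⟩
        intro g' hg' hf'
        rcases eq_or_ne g' g0 with rfl | hne'
        · rw [Function.update_self] at hf'; linarith [hf'.1]
        · rw [Function.update_of_ne hne'] at hf'
          exact hu g' (Finset.mem_of_mem_insert_of_ne hg' hne') hf'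
      · refine ⟨g0, Finset.mem_insert_self _ _, by rw [Function.update_self]; exact ⟨hge, by linarith⟩, ?_⟩
        intro g' hg' hf'
        by_contra hne'
        rw [Function.update_of_ne hne'] at hf'
        have := h1 g' (Finset.mem_of_mem_insert_of_ne hg' hne')
        linarith [hf'.2, this.2]

lemma class_fun {ι : Type*} [Fintype ι] (dens : ι → ℝ) (hpos : ∀ g, 0 < dens g) (hsum : ∑ g, dens g = 1) :
    ∃ (cf : ℝ → ι) (s : ι → ℝ), (∀ g, 0 ≤ s g ∧ s g + dens g ≤ 1) ∧
      ∀ f, 0 ≤ f → f < 1 → ∀ g, (cf f = g ↔ s g ≤ f ∧ f < s g + dens g) := by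
  obtain ⟨s, h1, h2⟩ := split_unit dens hpos Finset.univ
  rw [hsum] at h1 h2
  obtain ⟨g0, -, -⟩ := h2 0 le_rfl one_pos
  have h3 : ∀ f : ℝ, ∃ g, 0 ≤ f → f < 1 → (s g ≤ f ∧ f < s g + dens g) ∧ ∀ g', s g' ≤ f ∧ f < s g' + dens g' → g' = g := by
    intro f
    by_cases hf : 0 ≤ f ∧ f < 1
    · obtain ⟨g, _, h, hu⟩ := h2 f hf.1 hf.2
      exact ⟨g, fun _ _ => ⟨h, fun g' => hu g' (Finset.mem_univ _)⟩⟩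
    · exact ⟨g0, fun ha hb => absurd ⟨ha, hb⟩ hf⟩
  choose cf hcf using h3
  refine ⟨cf, s, fun g => h1 g (Finset.mem_univ _), ?_⟩
  intro f hf0 hf1 g
  obtain ⟨ha, hb⟩ := hcf f hf0 hf1
  constructor
  · rintro rfl; exact ha
  · intro h; exact (hb g h).symm

/-- discretised log -/
noncomputable def afun (un : ℝ) (p : ℕ) : ℕ := ⌊Real.log p / un⌋₊

lemma dens_primes {r : ℕ} (dens : Cls r → ℝ) (hpos : ∀ g, 0 < dens g) (hsum : ∑ g, dens g = 1) {κ0 : ℝ} (hκ0 : 0 < κ0) :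
    ∃ (u0 B0 : ℝ) (cf : ℝ → Cls r), ∀ un ≥ u0, ∀ (P : Finset ℕ) (lo hi : ℝ), B0 ≤ lo → (∀ p ∈ P, p.Prime) →
      (∀ p : ℕ, p.Prime → lo ≤ afun un p → (afun un p : ℝ) ≤ hi → p ∈ P) →
      Dens P (fun p => 1 / (p:ℝ)) (afun un) (fun p => cf (Real.log p / un - afun un p)) dens κ0 lo hi := by
  obtain ⟨cf, s, hs, hcf⟩ := class_fun dens hpos hsum
  obtain ⟨C, hC, hM⟩ := mertens_int
  set κ := min κ0 1 with hκdef
  have hκ : 0 < κ := lt_min hκ0 one_pos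
  have hκ1 : κ ≤ 1 := min_le_right _ _
  refine ⟨1 + ∑ g, 2 * C / (κ * dens g), max 1 (2/κ), cf, ?_⟩
  intro un hun P lo hi hlo hP1 hP2 b hb1 hb2 g
  have hsn : ∀ g, 0 ≤ 2 * C / (κ * dens g) := fun g => div_nonneg (by linarith) (mul_nonneg hκ.le (hpos g).le)
  have hun1 : 1 ≤ un := by
    have : 0 ≤ ∑ g, 2 * C / (κ * dens g) := Finset.sum_nonneg (fun g _ => hsn g)
    linarith
  have hun0 : 0 < un := by linarith
  have hCu : C ≤ un * (κ/2 * dens g) := by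
    have h1 : 2 * C / (κ * dens g) ≤ un := by
      have := Finset.single_le_sum (f := fun g => 2 * C / (κ * dens g)) (fun g _ => hsn g) (Finset.mem_univ g)
      linarith
    rw [div_le_iff₀ (mul_pos hκ (hpos g))] at h1
    linarith
  have hb : 1 ≤ (b:ℝ) := (le_max_left _ _).trans (hlo.trans hb1)
  have hb' : 2 ≤ κ * b := by
    have := (le_max_right 1 (2/κ)).trans (hlo.trans hb1)
    rw [div_le_iff₀ hκ] at this; linarith
  have hb0 : (0:ℝ) < b := by linarith
  obtain ⟨hs0, hs1⟩ := hs g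
  have hD := hpos g
  set D := dens g with hDdef
  have hα : 1 ≤ un * (b + s g) := by nlinarith
  have hQ := hM (un * (b + s g)) (un * (b + s g + D)) hα (mul_le_mul_of_nonneg_left (by linarith) hun0.le)
    (P.filter (fun p => afun un p = b ∧ cf (Real.log p / un - afun un p) = g)) ?_
  · obtain ⟨h1, h2⟩ := hQ
    have e : un * (b + s g + D) - un * (b + s g) = un * D := by ring
    rw [e] at h1 h2
    suffices hk : |∑ p ∈ P.filter (fun p => afun un p = b ∧ cf (Real.log p / un - afun un p) = g), 1 / (p:ℝ) - D / b| ≤ κ * (D / b) by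
      refine le_trans ?_ (hk.trans (mul_le_mul_of_nonneg_right (min_le_left _ _) (by positivity)))
      exact le_of_eq rfl
    rw [abs_le]
    constructor
    · have h3 : (1 - κ) * (D/b) ≤ (un * D - C) / (un * (b + s g + D)) := by
        rw [← mul_div_assoc, div_le_div_iff₀ hb0 (by positivity)]
        have h4 : un * D * (1 - κ/2) ≤ un * D - C := by nlinarith
        have h5 : b + s g + D ≤ (b:ℝ) + 1 := by linarith
        have h6 : (1 - κ) * ((b:ℝ) + 1) ≤ (1 - κ/2) * b := by nlinarith
        calc (1 - κ) * D * (un * (b + s g + D)) ≤ (1 - κ) * D * (un * (b + 1)) := by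
              have : 0 ≤ (1 - κ) * D := mul_nonneg (by linarith) hD.le
              gcongr
          _ = un * D * ((1 - κ) * (b + 1)) := by ring
          _ ≤ un * D * ((1 - κ/2) * b) := by gcongr
          _ = un * D * (1 - κ/2) * b := by ring
          _ ≤ _ := by gcongr
      linarith
    · have h3 : (un * D + C) / (un * (b + s g)) ≤ (1 + κ) * (D/b) := by
        rw [← mul_div_assoc, div_le_div_iff₀ (by positivity) hb0]
        have h4 : un * D + C ≤ (1 + κ) * (un * D) := by nlinarith [mul_pos hun0 hD]
        calc (un * D + C) * b ≤ (1 + κ) * (un * D) * b := by gcongr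
          _ = (1 + κ) * D * (un * b) := by ring
          _ ≤ _ := by gcongr; linarith
      linarith
  · intro p
    rw [Finset.mem_filter]
    constructor
    · rintro ⟨hp, ha, hc⟩
      have hpp := hP1 p hp
      have hl0 : 0 ≤ Real.log p / un := div_nonneg (Real.log_natCast_nonneg p) hun0.le
      have hf0 : 0 ≤ Real.log p / un - afun un p := sub_nonneg.mpr (Nat.floor_le hl0)
      have hf1 : Real.log p / un - afun un p < 1 := by have := Nat.lt_floor_add_one (Real.log p / un); unfold afun; linarith
      have := (hcf _ hf0 hf1 g).mp hc
      rw [ha] at this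
      obtain ⟨t1, t2⟩ := this
      have e : Real.log p = un * (Real.log p / un) := by field_simp
      refine ⟨hpp, ?_, ?_⟩
      · rw [e]; gcongr; linarith
      · rw [e]; gcongr; linarith
    · rintro ⟨hpp, h1, h2⟩
      have e : Real.log p = un * (Real.log p / un) := by field_simp
      rw [e] at h1 h2
      have h1 := le_of_mul_le_mul_left h1 hun0
      have h2 := lt_of_mul_lt_mul_left h2 hun0.le
      have ha : afun un p = b := by
        unfold afun
        rw [Nat.floor_eq_iff (by linarith)]
        constructor <;> linarith
      refine ⟨hP2 p hpp (by rw [ha]; exact hb1) (by rw [ha]; exact hb2), ha, ?_⟩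
      rw [ha]
      exact (hcf _ (by linarith) (by linarith) g).mpr ⟨by linarith, by linarith⟩

end FGK


namespace FGK

set_option linter.unusedSectionVars false

lemma le_DeltaV {v : ℝ} {n k : ℕ} (u : ℝ)
    (h : k ≤ (Finset.filter (fun d : ℕ => Real.exp u < (d : ℝ) ∧ (d : ℝ) ≤ Real.exp (u + v)) n.divisors).card) : k ≤ DeltaV v n := by
  have hmem : ∀ d : ℝ, d ∈ (do let a ← n.divisors; pure (a:ℝ) : Finset ℝ) ↔ ∃ k ∈ n.divisors, (k:ℝ) = d := by
    intro d
    simp [Finset.bind_def, eq_comm]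
  have hb : BddAbove (Set.range (fun u : ℝ => (Finset.filter (fun d : ℝ => Real.exp u < d ∧ d ≤ Real.exp (u + v))
      (do let a ← n.divisors; pure (a:ℝ) : Finset ℝ)).card)) := by
    refine ⟨(do let a ← n.divisors; pure (a:ℝ) : Finset ℝ).card, ?_⟩
    rintro _ ⟨u, rfl⟩
    exact Finset.card_filter_le _ _
  unfold DeltaV
  refine h.trans (le_trans ?_ (le_ciSup hb u))
  apply Finset.card_le_card_of_injOn (fun d : ℕ => (d:ℝ))
  · intro d hd
    rw [Finset.mem_coe, Finset.mem_filter] at hd ⊢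
    exact ⟨(hmem _).mpr ⟨d, hd.1, rfl⟩, hd.2⟩
  · intro a _ b _ h
    exact Nat.cast_injective h

lemma many_div {r : ℕ} (J : Finset ℕ) {un v : ℝ} (hun : 0 < un) (hv : 0 < v) (A : Finset ℕ) (hA : ∀ p ∈ A, p.Prime)
    (Pj : ℕ → Finset ℕ) (hP : ∀ i ∈ J, ∀ j ∈ J, i ≠ j → Disjoint (Pj i) (Pj j)) (Cn : ℕ → ℝ)
    (hs : ∀ j ∈ J, Succ r (afun un) (A ∩ Pj j) (Cn j)) (hC : un * ∑ j ∈ J, Cn j ≤ v / 2) :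
    2 ^ (r * J.card) ≤ DeltaV v (∏ p ∈ A, p) := by
  have hs' : ∀ j, ∃ (F : (Fin r → Bool) → Finset ℕ) (σ : ℕ), j ∈ J → (∀ s, F s ⊆ A ∩ Pj j) ∧ Function.Injective F ∧
      (∀ s, ∑ p ∈ F s, afun un p = σ) ∧ ∀ s, ((F s).card : ℝ) ≤ Cn j := by
    intro j
    by_cases hj : j ∈ J
    · obtain ⟨F, h1, h2, ⟨σ, h3⟩, h4⟩ := hs j hj
      exact ⟨F, σ, fun _ => ⟨h1, h2, h3, h4⟩⟩
    · exact ⟨fun _ => ∅, 0, fun h => absurd h hj⟩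
  choose F σ hF using hs'
  set Sf : (↥J → (Fin r → Bool)) → Finset ℕ := fun φ => Finset.univ.biUnion (fun j : ↥J => F j (φ j)) with hSf
  have hSP : ∀ (φ : ↥J → (Fin r → Bool)) (j : ↥J), F j (φ j) ⊆ Pj j := fun φ j =>
    ((hF j j.2).1 _).trans Finset.inter_subset_right
  have hdis : ∀ (φ : ↥J → (Fin r → Bool)) (i j : ↥J), i ≠ j → Disjoint (F i (φ i)) (F j (φ j)) := by
    intro φ i j hij
    exact Finset.disjoint_of_subset_left (hSP φ i) (Finset.disjoint_of_subset_right (hSP φ j)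
      (hP i i.2 j j.2 (fun h => hij (Subtype.ext h))))
  have hSA : ∀ φ, Sf φ ⊆ A := by
    intro φ p hp
    obtain ⟨j, _, hj⟩ := Finset.mem_biUnion.mp hp
    exact (Finset.mem_inter.mp ((hF j j.2).1 _ hj)).1
  have hinj : Function.Injective Sf := by
    intro φ ψ h
    have hinter : ∀ (φ : ↥J → (Fin r → Bool)) (j : ↥J), Sf φ ∩ Pj j = F j (φ j) := by
      intro φ j
      ext p
      rw [Finset.mem_inter]
      constructor
      · rintro ⟨h1, h2⟩
        obtain ⟨i, _, hi⟩ := Finset.mem_biUnion.mp h1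
        by_cases hij : i = j
        · subst hij; exact hi
        · exact absurd h2 (Finset.disjoint_left.mp (hP i i.2 j j.2 (fun h => hij (Subtype.ext h))) (hSP φ i hi))
      · intro hp
        exact ⟨Finset.mem_biUnion.mpr ⟨j, Finset.mem_univ _, hp⟩, hSP φ j hp⟩
    funext j
    apply (hF j j.2).2.1
    rw [← hinter φ j, ← hinter ψ j, h]
  have hsumS : ∀ (f : ℕ → ℝ) φ, ∑ p ∈ Sf φ, f p = ∑ j : ↥J, ∑ p ∈ F j (φ j), f p := by
    intro f φ
    exact Finset.sum_biUnion (fun i _ j _ hij => hdis φ i j hij)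
  set Sg : ℝ := ∑ j : ↥J, (σ j : ℝ) with hSg
  have hasum : ∀ φ, ∑ p ∈ Sf φ, (afun un p : ℝ) = Sg := by
    intro φ
    rw [hsumS]
    apply Finset.sum_congr rfl
    intro j _
    rw [← (hF j j.2).2.2.1 (φ j)]; push_cast; rfl
  have hcard : ∀ φ, ((Sf φ).card : ℝ) ≤ ∑ j ∈ J, Cn j := by
    intro φ
    have := hsumS (fun _ => 1) φ
    simp only [Finset.sum_const, nsmul_eq_mul, mul_one] at this
    rw [this, ← Finset.sum_coe_sort J]
    exact Finset.sum_le_sum (fun j _ => (hF j j.2).2.2.2 _)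
  apply le_DeltaV (un * Sg - v / 2)
  have hcu : 2 ^ (r * J.card) = (Finset.univ : Finset (↥J → (Fin r → Bool))).card := by
    rw [Finset.card_univ, Fintype.card_fun, Fintype.card_fun]
    simp [pow_mul]
  rw [hcu]
  apply Finset.card_le_card_of_injOn (fun φ => ∏ p ∈ Sf φ, p)
  · intro φ _
    have hpos : ∀ p ∈ Sf φ, (0:ℝ) < p := fun p hp => by exact_mod_cast (hA p (hSA φ hp)).pos
    rw [Finset.mem_coe, Finset.mem_filter, Nat.mem_divisors]
    have hlog : Real.log ((∏ p ∈ Sf φ, p : ℕ) : ℝ) = ∑ p ∈ Sf φ, Real.log p := by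
      rw [Nat.cast_prod, Real.log_prod (fun p hp => (hpos p hp).ne')]
    have hD0 : (0:ℝ) < ((∏ p ∈ Sf φ, p : ℕ) : ℝ) := by
      rw [Nat.cast_prod]; exact Finset.prod_pos hpos
    have hlow : un * Sg ≤ ∑ p ∈ Sf φ, Real.log p := by
      rw [← hasum φ, Finset.mul_sum]
      apply Finset.sum_le_sum
      intro p hp
      have := Nat.floor_le (div_nonneg (Real.log_natCast_nonneg p) hun.le)
      rw [le_div_iff₀ hun] at this
      unfold afun; linarith
    have hupp : ∑ p ∈ Sf φ, Real.log p ≤ un * Sg + un * (Sf φ).card := by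
      rw [← hasum φ, Finset.mul_sum, mul_comm un ((Sf φ).card : ℝ), ← nsmul_eq_mul, ← Finset.sum_const, ← Finset.sum_add_distrib]
      apply Finset.sum_le_sum
      intro p hp
      have := (Nat.lt_floor_add_one (Real.log p / un)).le
      rw [div_le_iff₀ hun] at this
      unfold afun; linarith
    have hc := mul_le_mul_of_nonneg_left (hcard φ) hun.le
    refine ⟨⟨Finset.prod_dvd_prod_of_subset _ _ _ (hSA φ), ?_⟩, ?_, ?_⟩
    · exact (Finset.prod_pos (fun p hp => (hA p hp).pos)).ne'
    · rw [← Real.lt_log_iff_exp_lt hD0, hlog]; linarith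
    · rw [← Real.log_le_iff_le_exp hD0, hlog]; linarith
  · intro φ _ ψ _ h
    apply hinj
    have h1 : (∏ p ∈ Sf φ, p).primeFactors = Sf φ := Nat.primeFactors_prod (fun p hp => hA p (hSA φ hp))
    have h2 : (∏ p ∈ Sf ψ, p).primeFactors = Sf ψ := Nat.primeFactors_prod (fun p hp => hA p (hSA ψ hp))
    rw [← h1, ← h2]
    simp only at h
    rw [h]

/-- many blocks fail with small probability -/
lemma few_fail {w : ℕ → ℝ} (hw : ∀ p, 0 ≤ w p) (m : ℕ) (Pj : ℕ → Finset ℕ) (P : Finset ℕ) (hPs : ∀ j < m, Pj j ⊆ P)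
    (hPd : ∀ i < m, ∀ j < m, i ≠ j → Disjoint (Pj i) (Pj j)) (Sc : ℕ → Finset ℕ → Prop) {q θ : ℝ} (hq : 0 < q) (hq1 : q ≤ 1)
    (hSc : ∀ j < m, EA (Pj j) w (fun A => if Sc j A then 0 else 1) ≤ q) (F : Finset ℕ → ℝ)
    (hF : ∀ A, A ⊆ P → F A ≤ 1) (hF0 : ∀ A, A ⊆ P → (1 - θ) * m ≤ (((Finset.range m).filter (fun j => Sc j (A ∩ Pj j))).card : ℝ) → F A ≤ 0) :
    EA P w F ≤ 2 ^ m * q ^ (θ * m) := by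
  have hpt : ∀ A, A ⊆ P → F A ≤ q ^ (θ * m) * ∏ j ∈ Finset.range m, (1 + (1/q - 1) * if Sc j (A ∩ Pj j) then (0:ℝ) else 1) := by
    intro A hA
    set k := ((Finset.range m).filter (fun j => ¬ Sc j (A ∩ Pj j))).card with hk
    have hprod : ∏ j ∈ Finset.range m, (1 + (1/q - 1) * if Sc j (A ∩ Pj j) then (0:ℝ) else 1) = (1/q) ^ k := by
      have : ∀ j ∈ Finset.range m, (1 + (1/q - 1) * if Sc j (A ∩ Pj j) then (0:ℝ) else 1) = if ¬ Sc j (A ∩ Pj j) then 1/q else 1 := by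
        intro j _
        by_cases h : Sc j (A ∩ Pj j) <;> simp [h]
      rw [Finset.prod_congr rfl this, ← Finset.prod_filter, Finset.prod_const]
    rw [hprod]
    by_cases hc : (1 - θ) * m ≤ (((Finset.range m).filter (fun j => Sc j (A ∩ Pj j))).card : ℝ)
    · refine (hF0 A hA hc).trans (by positivity)
    · push Not at hc
      refine (hF A hA).trans ?_
      have hadd := Finset.card_filter_add_card_filter_not (s := Finset.range m) (fun j => Sc j (A ∩ Pj j))
      rw [Finset.card_range] at hadd
      have hadd' : (((Finset.range m).filter (fun j => Sc j (A ∩ Pj j))).card : ℝ) + k = m := by exact_mod_cast hadd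
      have hk' : θ * m ≤ k := by linarith
      have : q ^ (k:ℝ) ≤ q ^ (θ * m) := Real.rpow_le_rpow_of_exponent_ge hq hq1 hk'
      rw [Real.rpow_natCast] at this
      calc (1:ℝ) = q ^ k * (1/q) ^ k := by rw [← mul_pow]; field_simp; simp
        _ ≤ _ := by gcongr
  refine (EA_mono hw hpt).trans ?_
  rw [EA_mul, mul_comm]
  refine mul_le_mul_of_nonneg_right ?_ (by positivity)
  have := prodE hw (Finset.range m) Pj (fun j B => 1 + (1/q - 1) * if Sc j B then (0:ℝ) else 1) P
    (fun j hj => hPs j (Finset.mem_range.mp hj)) (fun i hi j hj h => hPd i (Finset.mem_range.mp hi) j (Finset.mem_range.mp hj) h)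
  rw [this]
  have hq2 : 0 ≤ 1/q - 1 := by rw [sub_nonneg, le_div_iff₀ hq]; linarith
  calc _ ≤ ∏ j ∈ Finset.range m, (2:ℝ) := by
        apply Finset.prod_le_prod
        · intro j _
          apply EA_nonneg hw
          intro B _
          split_ifs
          · simp
          · linarith
        · intro j hj
          rw [EA_add, EA_const hw, EA_mul]
          have h1 := mul_le_mul_of_nonneg_left (hSc j (Finset.mem_range.mp hj)) hq2
          have h2 : (1/q - 1) * q = 1 - q := by field_simp
          linarith
    _ = 2 ^ m := by simp

end FGK


namespace FGK

set_option linter.unusedSectionVars false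

/-- primes in `[y,x)` -/
noncomputable def Pyx (y x : ℝ) : Finset ℕ := (Finset.range ⌈x⌉₊).filter (fun p : ℕ => p.Prime ∧ y ≤ (p:ℝ) ∧ (p:ℝ) < x)

lemma mem_Pyx {y x : ℝ} {p : ℕ} : p ∈ Pyx y x ↔ p.Prime ∧ y ≤ (p:ℝ) ∧ (p:ℝ) < x := by
  unfold Pyx
  rw [Finset.mem_filter, Finset.mem_range]
  constructor
  · exact fun h => h.2
  · exact fun h => ⟨Nat.lt_ceil.mpr h.2.2, h⟩

lemma translate (y x : ℝ) (Q : ℕ → Prop) :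
    primeProd y x * ∑ᶠ n ∈ {n | n ∈ Sset y x ∧ Q n}, ((n : ℝ))⁻¹ =
      EA (Pyx y x) (fun p => 1 / (p:ℝ)) (fun A => if Q (∏ p ∈ A, p) then 1 else 0) := by
  have h1 : primeProd y x = ∏ p ∈ Pyx y x, ((1:ℝ) + 1 / p)⁻¹ := by
    unfold primeProd
    have : {p : ℕ | p.Prime ∧ y ≤ (p : ℝ) ∧ (p : ℝ) < x} = ↑(Pyx y x) := by
      ext p; simp only [Set.mem_setOf_eq, Finset.mem_coe, mem_Pyx]
    rw [this, finprod_mem_coe_finset]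
  have hpf : ∀ A ∈ (Pyx y x).powerset, (∏ p ∈ A, p).primeFactors = A := fun A hA =>
    Nat.primeFactors_prod (fun p hp => (mem_Pyx.mp (Finset.mem_powerset.mp hA hp)).1)
  have h2 : {n | n ∈ Sset y x ∧ Q n} = ↑(((Pyx y x).powerset.filter (fun A => Q (∏ p ∈ A, p))).image (fun A => ∏ p ∈ A, p)) := by
    ext n
    simp only [Set.mem_setOf_eq, Finset.mem_coe, Finset.mem_image, Finset.mem_filter]
    constructor
    · rintro ⟨⟨h0, hs, hp⟩, hQ⟩
      have hn := Nat.prod_primeFactors_of_squarefree hs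
      refine ⟨n.primeFactors, ⟨?_, by rwa [hn]⟩, hn⟩
      rw [Finset.mem_powerset]
      intro p hpn
      exact mem_Pyx.mpr ⟨Nat.prime_of_mem_primeFactors hpn, hp p hpn⟩
    · rintro ⟨A, ⟨hA, hQ⟩, rfl⟩
      have hAp : ∀ p ∈ A, p.Prime := fun p hp => (mem_Pyx.mp (Finset.mem_powerset.mp hA hp)).1
      refine ⟨⟨Finset.prod_pos (fun p hp => (hAp p hp).pos), ?_, ?_⟩, hQ⟩
      · refine Finset.squarefree_prod_of_pairwise_isCoprime ?_ (fun p hp => (hAp p hp).squarefree)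
        · intro p hp q hq hpq
          exact Nat.coprime_iff_isRelPrime.mp ((Nat.coprime_primes (hAp p hp) (hAp q hq)).mpr hpq)
      · rw [hpf A hA]
        exact fun p hp => (mem_Pyx.mp (Finset.mem_powerset.mp hA hp)).2
  rw [h1, h2, finsum_mem_coe_finset, Finset.sum_image]
  · unfold EA
    rw [Finset.prod_inv_distrib, div_eq_inv_mul, Finset.sum_filter]
    congr 1
    apply Finset.sum_congr rfl
    intro A hA
    by_cases hQ : Q (∏ p ∈ A, p)
    · simp [hQ]
    · simp [hQ]
  · intro A hA B hB h
    have hA' := hpf A (Finset.mem_filter.mp hA).1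
    have hB' := hpf B (Finset.mem_filter.mp hB).1
    simp only at h
    rw [← hA', ← hB', h]

end FGK


namespace FGK

set_option linter.unusedSectionVars false

set_option maxHeartbeats 800000 in
lemma main_fix {r : ℕ} {dens : Cls r → ℝ} {κ0 τ0 Cc q c' : ℝ} (hq : 0 < q) (hq1 : q ≤ 1)
    (hcore : ∀ τ ≥ τ0, ∀ (P : Finset ℕ) (w : ℕ → ℝ) (a : ℕ → ℕ) (cl : ℕ → Cls r), (∀ p, 0 ≤ w p) →
      Dens P w a cl dens κ0 (Real.exp (c' * τ)) (Real.exp τ) → EA P w (fun A => if Succ r a A (Cc * τ) then 0 else 1) ≤ q)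
    {u0 B0 : ℝ} {cf : ℝ → Cls r}
    (hdp : ∀ un ≥ u0, ∀ (P : Finset ℕ) (lo hi : ℝ), B0 ≤ lo → (∀ p ∈ P, p.Prime) →
      (∀ p : ℕ, p.Prime → lo ≤ (afun un p : ℝ) → (afun un p : ℝ) ≤ hi → p ∈ P) →
      Dens P (fun p => 1 / (p:ℝ)) (afun un) (fun p => cf (Real.log p / un - afun un p)) dens κ0 lo hi)
    {c2 θ e0 L v T x un : ℝ} {m : ℕ} (hc2 : 0 < c2) (hc21 : c2 < 1) (hc2c : c2 < c') (hT : 0 < T) (hv : 0 < v)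
    (hun : 0 < un) (hun0 : u0 ≤ un) (hx : 0 < x)
    (h1 : ∀ j < m, τ0 ≤ c2 ^ j * T) (h2 : ∀ j < m, B0 ≤ Real.exp (c' * (c2 ^ j * T)))
    (h3 : ∀ j < m, v ≤ un * Real.exp (c' * (c2 ^ j * T)))
    (h4 : un * (Real.exp T + 1) ≤ Real.log x)
    (h5 : un * (|Cc| * (T / (1 - c2))) ≤ v / 2)
    (h6 : L ^ e0 ≤ (2:ℝ) ^ ((r:ℝ) * ((1 - θ) * m))) :
    EA (Pyx (Real.exp v) x) (fun p => 1 / (p:ℝ)) (fun A => if (DeltaV v (∏ p ∈ A, p) : ℝ) < L ^ e0 then 1 else 0)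
      ≤ 2 ^ m * q ^ (θ * m) := by
  set Pj : ℕ → Finset ℕ := fun j => (Pyx (Real.exp v) x).filter (fun p => Real.exp (c' * (c2 ^ j * T)) ≤ (afun un p : ℝ) ∧
    (afun un p : ℝ) ≤ Real.exp (c2 ^ j * T)) with hPj
  have hpr : ∀ {p}, p ∈ Pyx (Real.exp v) x → p.Prime := fun h => (mem_Pyx.mp h).1
  have hdlt : ∀ i j, i < j → Disjoint (Pj i) (Pj j) := by
    intro i j hij
    rw [Finset.disjoint_left]
    intro p hp hp'
    have a1 := (Finset.mem_filter.mp hp).2.1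
    have a2 := (Finset.mem_filter.mp hp').2.2
    have a3 := Real.exp_le_exp.mp (a1.trans a2)
    have a4 : c2 ^ j ≤ c2 ^ (i+1) := pow_le_pow_of_le_one hc2.le hc21.le hij
    have a5 : 0 < c2 ^ i * T := by positivity
    have a6 : c2 ^ j * T ≤ c2 * (c2 ^ i * T) := by
      calc c2 ^ j * T ≤ c2 ^ (i+1) * T := by gcongr
        _ = _ := by ring
    nlinarith
  have hd : ∀ i j, i ≠ j → Disjoint (Pj i) (Pj j) := by
    intro i j hij
    rcases lt_or_gt_of_ne hij with h | h
    · exact hdlt i j h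
    · exact (hdlt j i h).symm
  have hw : ∀ p : ℕ, (0:ℝ) ≤ (fun p : ℕ => 1 / (p:ℝ)) p := fun p => by positivity
  refine few_fail hw m Pj _ (fun j _ => Finset.filter_subset _ _) (fun i _ j _ h => hd i j h)
    (fun j B => Succ r (afun un) B (Cc * (c2 ^ j * T))) hq hq1 ?_ _ ?_ ?_
  · intro j hj
    refine hcore _ (h1 j hj) _ _ (afun un) (fun p => cf (Real.log p / un - afun un p)) hw ?_
    refine hdp un hun0 _ _ _ (h2 j hj) (fun p hp => hpr (Finset.mem_filter.mp hp).1) ?_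
    intro p hp hl hu
    refine Finset.mem_filter.mpr ⟨mem_Pyx.mpr ⟨hp, ?_, ?_⟩, hl, hu⟩
    · have hp0 : (0:ℝ) < p := by exact_mod_cast hp.pos
      rw [← Real.le_log_iff_exp_le hp0]
      have := Nat.floor_le (div_nonneg (Real.log_natCast_nonneg p) hun.le)
      rw [le_div_iff₀ hun] at this
      have h' : un * Real.exp (c' * (c2 ^ j * T)) ≤ un * afun un p := by gcongr
      have := h3 j hj
      unfold afun at h'; linarith
    · have hp0 : (0:ℝ) < p := by exact_mod_cast hp.pos
      rw [← Real.log_lt_log_iff hp0 hx]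
      have := (Nat.lt_floor_add_one (Real.log p / un))
      rw [div_lt_iff₀ hun] at this
      have h' : c2 ^ j * T ≤ T := by
        have := pow_le_one₀ (n := j) hc2.le hc21.le
        nlinarith
      have h'' := hu.trans (Real.exp_le_exp.mpr h')
      refine this.trans_le (le_trans ?_ h4)
      rw [mul_comm]
      unfold afun at h''
      gcongr
  · intro A _
    split_ifs <;> norm_num
  · intro A hA hcard
    rw [if_neg]
    rw [not_lt]
    set J := (Finset.range m).filter (fun j => Succ r (afun un) (A ∩ Pj j) (Cc * (c2 ^ j * T))) with hJ
    have hmd := many_div (r := r) J hun hv A (fun p hp => hpr (hA hp)) Pj (fun i _ j _ h => hd i j h)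
      (fun j => Cc * (c2 ^ j * T)) (fun j hj => (Finset.mem_filter.mp hj).2) (by
        refine le_trans ?_ h5
        refine mul_le_mul_of_nonneg_left ?_ hun.le
        calc ∑ j ∈ J, Cc * (c2 ^ j * T) ≤ ∑ j ∈ J, |Cc| * (c2 ^ j * T) := by
              apply Finset.sum_le_sum
              intro j _
              gcongr
              exact le_abs_self _
          _ ≤ ∑ j ∈ Finset.range m, |Cc| * (c2 ^ j * T) :=
              Finset.sum_le_sum_of_subset_of_nonneg (Finset.filter_subset _ _) (fun _ _ _ => by positivity)
          _ = |Cc| * (T * ∑ j ∈ Finset.range m, c2 ^ j) := by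
              rw [Finset.mul_sum, Finset.mul_sum]
              exact Finset.sum_congr rfl fun _ _ => by ring
          _ ≤ _ := by
              rw [div_eq_mul_inv]
              gcongr
              rw [← tsum_geometric_of_lt_one hc2.le hc21]
              exact (summable_geometric_of_lt_one hc2.le hc21).sum_le_tsum _ (fun _ _ => by positivity))
    have hmd' : (2:ℝ) ^ (r * J.card) ≤ (DeltaV v (∏ p ∈ A, p) : ℝ) := by exact_mod_cast hmd
    refine h6.trans (le_trans ?_ hmd')
    rw [← Real.rpow_natCast]
    apply Real.rpow_le_rpow_of_exponent_le one_le_two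
    push_cast
    gcongr

end FGK


namespace FGK

set_option linter.unusedSectionVars false

lemma ev_ineq {ε θ c' Cc c2 u0 B0 τ0 k1 k2 : ℝ} (hε : 0 < ε) (hθ : 0 < θ) (hc' : 0 < c') (hc2 : c2 < 1) (hk1 : 0 < k1) :
    ∀ᶠ L : ℝ in atTop, 2 ≤ L ∧ Real.sqrt L ≤ ε / 4 * L ∧ 1 < 3 * ε / 4 * L ∧ u0 ≤ Real.exp (3 * ε / 4 * L) / L ^ 2 ∧
      |Cc| * ((ε / 2 * L) / (1 - c2)) / L ^ 2 ≤ 1 / 2 ∧ τ0 ≤ ε / 2 * L ^ θ ∧ B0 ≤ Real.exp (c' * (ε / 2 * L ^ θ)) ∧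
      L ^ 2 ≤ Real.exp (c' * (ε / 2 * L ^ θ)) ∧ k2 ≤ k1 * Real.log L := by
  have hθT := tendsto_rpow_atTop hθ
  have hG : Tendsto (fun L : ℝ => ε / 2 * L ^ θ) atTop atTop := hθT.const_mul_atTop (by positivity)
  have hG' : Tendsto (fun L : ℝ => c' * (ε / 2 * L ^ θ)) atTop atTop := hG.const_mul_atTop hc'
  have hid : Tendsto (fun L : ℝ => 3 * ε / 4 * L) atTop atTop := tendsto_id.const_mul_atTop (by positivity)
  have e2 : ∀ᶠ L : ℝ in atTop, Real.sqrt L ≤ ε / 4 * L := by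
    filter_upwards [eventually_ge_atTop ((4/ε)^2), eventually_gt_atTop 0] with L h h0
    have : 4/ε ≤ Real.sqrt L := Real.le_sqrt_of_sq_le h
    rw [div_le_iff₀ hε] at this
    have h2 := Real.mul_self_sqrt h0.le
    have h3 := Real.sqrt_nonneg L
    nlinarith
  have e4 : ∀ᶠ L : ℝ in atTop, u0 ≤ Real.exp (3 * ε / 4 * L) / L ^ 2 := by
    have h : Tendsto (fun L : ℝ => Real.exp (3 * ε / 4 * L) / L ^ (2:ℝ)) atTop atTop :=
      tendsto_exp_mul_div_rpow_atTop 2 _ (by positivity)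
    filter_upwards [h.eventually_ge_atTop u0] with L hL
    have : L ^ (2:ℝ) = L ^ 2 := by exact_mod_cast Real.rpow_natCast L 2
    rwa [this] at hL
  have e5 : ∀ᶠ L : ℝ in atTop, |Cc| * ((ε / 2 * L) / (1 - c2)) / L ^ 2 ≤ 1 / 2 := by
    filter_upwards [eventually_ge_atTop (2 * (|Cc| * ((ε/2) / (1 - c2)))), eventually_gt_atTop 0] with L h h0
    have : |Cc| * ((ε / 2 * L) / (1 - c2)) / L ^ 2 = |Cc| * ((ε/2) / (1 - c2)) / L := by field_simp
    rw [this, div_le_iff₀ h0]; linarith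
  have e8 : ∀ᶠ L : ℝ in atTop, L ^ 2 ≤ Real.exp (c' * (ε / 2 * L ^ θ)) := by
    have h := (isLittleO_log_rpow_atTop hθ).bound (show 0 < c' * (ε/2) / 2 by positivity)
    filter_upwards [h, eventually_ge_atTop 1] with L hL h1
    rw [Real.norm_of_nonneg (Real.log_nonneg h1), Real.norm_of_nonneg (by positivity)] at hL
    rw [← Real.log_le_iff_le_exp (by positivity), Real.log_pow]
    push_cast; linarith
  filter_upwards [eventually_ge_atTop 2, e2, hid.eventually_gt_atTop 1, e4, e5, hG.eventually_ge_atTop τ0,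
    (Real.tendsto_exp_atTop.comp hG').eventually_ge_atTop B0, e8, (Real.tendsto_log_atTop.const_mul_atTop hk1).eventually_ge_atTop k2]
    with L a1 a2 a3 a4 a5 a6 a7 a8 a9
  exact ⟨a1, a2, a3, a4, a5, a6, a7, a8, a9⟩

lemma LLog2_large {L0 : ℝ} (h0 : 1 < L0) {x : ℝ} (hx : Real.exp (Real.exp L0) ≤ x) :
    L0 ≤ LLog2 x ∧ Real.log x = Real.exp (LLog2 x) := by
  have hx0 : 0 < x := (Real.exp_pos _).trans_le hx
  have h1 : Real.exp L0 ≤ Real.log x := (Real.le_log_iff_exp_le hx0).mpr hx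
  have h2 : LLog x = Real.log x := by
    unfold LLog; apply max_eq_right
    have := Real.add_one_le_exp L0
    linarith
  have h3 : 0 < Real.log x := (Real.exp_pos _).trans_le h1
  have h4 : L0 ≤ Real.log (Real.log x) := (Real.le_log_iff_exp_le h3).mpr h1
  have h5 : LLog2 x = Real.log (Real.log x) := by
    unfold LLog2; rw [h2]; unfold LLog; apply max_eq_right; linarith
  rw [h5, Real.exp_log h3]
  exact ⟨h4, rfl⟩

lemma LLog2_inv {y : ℝ} (hy : 0 < y) (h : 1 < LLog2 y) : LLog y = Real.exp (LLog2 y) ∧ y = Real.exp (LLog y) := by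
  have h1 : 1 ≤ LLog y := le_max_left _ _
  have h2 : LLog2 y = Real.log (LLog y) := by
    change max 1 (Real.log (LLog y)) = _
    apply max_eq_right
    by_contra hc
    have : LLog2 y = 1 := max_eq_left (by linarith)
    linarith
  have h3 : LLog y = Real.exp (LLog2 y) := by rw [h2, Real.exp_log (by linarith)]
  refine ⟨h3, ?_⟩
  have h4 : 1 < LLog y := by
    rw [h3]; have := Real.add_one_le_exp (LLog2 y); linarith
  have h5 : LLog y = Real.log y := by
    unfold LLog; apply max_eq_right
    by_contra hc
    have : LLog y = 1 := max_eq_left (by linarith)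
    linarith
  rw [h5, Real.exp_log hy]

set_option maxHeartbeats 800000 in
lemma fixedL {r : ℕ} {dens : Cls r → ℝ} {κ0 τ0 Cc q c' : ℝ} (hq0 : 0 < q) (hq1 : q ≤ 1)
    (hcore : ∀ τ ≥ τ0, ∀ (P : Finset ℕ) (w : ℕ → ℝ) (a : ℕ → ℕ) (cl : ℕ → Cls r), (∀ p, 0 ≤ w p) →
      Dens P w a cl dens κ0 (Real.exp (c' * τ)) (Real.exp τ) → EA P w (fun A => if Succ r a A (Cc * τ) then 0 else 1) ≤ q)
    {u0 B0 : ℝ} {cf : ℝ → Cls r}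
    (hdp : ∀ un ≥ u0, ∀ (P : Finset ℕ) (lo hi : ℝ), B0 ≤ lo → (∀ p ∈ P, p.Prime) →
      (∀ p : ℕ, p.Prime → lo ≤ (afun un p : ℝ) → (afun un p : ℝ) ≤ hi → p ∈ P) →
      Dens P (fun p => 1 / (p:ℝ)) (afun un) (fun p => cf (Real.log p / un - afun un p)) dens κ0 lo hi)
    {ε η' e0 θ Λ K c2 : ℝ} (hε : 0 < ε) (hη'0 : 0 < η') (hΛ0 : 0 < Λ) (hΛr : η' * Λ < r * Real.log 2) (hc2 : c2 = Real.exp (-Λ))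
    (hc20 : 0 < c2) (hc21 : c2 < 1) (hc'0 : 0 < c') (hc2c : c2 < c') (hθ0 : 0 < θ) (hθ' : 0 < 1 - θ) (hK : K = Λ / (1 - θ))
    (hK0 : 0 < K) (hqθ : q ^ θ = Real.exp (-K) / 2)
    {L x v l : ℝ} (hlogx : Real.log x = Real.exp L) (hx0 : 0 < x) (hv : v = Real.exp l)
    (hl1 : 3 * ε / 4 * L ≤ l) (hl2' : l ≤ (1 - 3 * ε / 4) * L) (b1 : 2 ≤ L)
    (b4 : u0 ≤ Real.exp (3 * ε / 4 * L) / L ^ 2)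
    (b5 : |Cc| * ((ε / 2 * L) / (1 - c2)) / L ^ 2 ≤ 1 / 2) (b6 : τ0 ≤ ε / 2 * L ^ θ) (b7 : B0 ≤ Real.exp (c' * (ε / 2 * L ^ θ)))
    (b8 : L ^ 2 ≤ Real.exp (c' * (ε / 2 * L ^ θ))) (b9 : r * Real.log 2 ≤ (η' * (1 - θ)^2 - e0) * Real.log L) :
    EA (Pyx (Real.exp v) x) (fun p => 1 / (p:ℝ)) (fun A => if (DeltaV v (∏ p ∈ A, p) : ℝ) < L ^ e0 then 1 else 0)
      ≤ Real.exp K / L := by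
  have hl2 : 0 < Real.log 2 := Real.log_pos one_lt_two
  have hL0 : 0 < L := by linarith
  have hv0 : 0 < v := by rw [hv]; exact Real.exp_pos _
  obtain ⟨T, hT⟩ : ∃ T, T = ε / 2 * L := ⟨_, rfl⟩
  have hT0 : 0 < T := by rw [hT]; positivity
  rw [← hT] at b5
  obtain ⟨M, hM⟩ : ∃ M, M = (1 - θ) * Real.log L / Λ := ⟨_, rfl⟩
  have hlL : 0 ≤ Real.log L := Real.log_nonneg (by linarith)
  have hM0 : 0 ≤ M := by rw [hM]; positivity
  obtain ⟨m, hm⟩ : ∃ m, m = ⌊M⌋₊ := ⟨_, rfl⟩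
  have hm1 : (m:ℝ) ≤ M := by rw [hm]; exact Nat.floor_le hM0
  have hm2 : M - 1 ≤ m := by have := Nat.lt_floor_add_one M; rw [hm]; linarith
  have hMΛ : M * Λ = (1 - θ) * Real.log L := by rw [hM]; field_simp
  have hτ : ∀ j < m, ε / 2 * L ^ θ ≤ c2 ^ j * T := by
    intro j hj
    have h1 : c2 ^ m ≤ c2 ^ j := pow_le_pow_of_le_one hc20.le hc21.le hj.le
    have h2 : L ^ (θ - 1) ≤ c2 ^ m := by
      rw [hc2, ← Real.exp_nat_mul, Real.rpow_def_of_pos hL0]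
      apply Real.exp_le_exp.mpr
      nlinarith
    have h3 : L ^ θ = L ^ (θ - 1) * L := by
      rw [Real.rpow_sub_one hL0.ne']; field_simp
    rw [h3, hT]
    have := h2.trans h1
    calc ε / 2 * (L ^ (θ - 1) * L) ≤ ε / 2 * (c2 ^ j * L) := by gcongr
      _ = _ := by ring
  have hexp : ∀ j < m, Real.exp (c' * (ε / 2 * L ^ θ)) ≤ Real.exp (c' * (c2 ^ j * T)) := fun j hj =>
    Real.exp_le_exp.mpr (mul_le_mul_of_nonneg_left (hτ j hj) hc'0.le)
  have hmain := main_fix (r := r) hq0 hq1 hcore hdp (c2 := c2) (θ := θ) (e0 := e0) (L := L) (v := v) (T := T) (x := x) (un := v / L^2)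
    (m := m) hc20 hc21 hc2c hT0 hv0 (by positivity)
    (b4.trans (by rw [hv]; gcongr)) hx0
    (fun j hj => b6.trans (hτ j hj)) (fun j hj => b7.trans (hexp j hj))
    (fun j hj => by
      have := b8.trans (hexp j hj)
      calc v = v / L^2 * L^2 := by field_simp
        _ ≤ _ := by gcongr)
    (by
      rw [hlogx, hv]
      have h1 : (1:ℝ) ≤ Real.exp T := Real.one_le_exp (by positivity)
      calc Real.exp l / L^2 * (Real.exp T + 1) ≤ Real.exp ((1 - 3 * ε / 4) * L) / 2 * (2 * Real.exp T) := by
            gcongr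
            · nlinarith
            · linarith
        _ = Real.exp ((1 - 3 * ε / 4) * L + T) := by rw [Real.exp_add]; ring
        _ ≤ _ := by
            apply Real.exp_le_exp.mpr
            rw [hT]; nlinarith)
    (by
      calc v / L^2 * (|Cc| * (T / (1 - c2))) = v * (|Cc| * (T / (1 - c2)) / L^2) := by ring
        _ ≤ v * (1/2) := by gcongr
        _ = _ := by ring)
    (by
      rw [Real.rpow_def_of_pos hL0, Real.rpow_def_of_pos two_pos]
      apply Real.exp_le_exp.mpr
      have h1 : (r * Real.log 2) * (1 - θ) * (M - 1) ≤ (r * Real.log 2) * (1 - θ) * m := by gcongr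
      have h2 : η' * (1 - θ)^2 * Real.log L ≤ (r * Real.log 2) * (1 - θ) * M := by
        calc η' * (1 - θ)^2 * Real.log L = η' * Λ * ((1 - θ) * M) := by
              rw [hM]; field_simp
          _ ≤ r * Real.log 2 * ((1 - θ) * M) := by gcongr
          _ = _ := by ring
      have h3 : (r * Real.log 2) * (1 - θ) ≤ r * Real.log 2 := by
        have : 0 ≤ r * Real.log 2 * θ := by positivity
        linarith
      linarith)
  refine hmain.trans ?_
  · have h1 : (2:ℝ) ^ m * q ^ (θ * m) = Real.exp (-(K * m)) := by
      rw [Real.rpow_mul hq0.le, hqθ, Real.rpow_natCast, ← mul_pow, mul_div_cancel₀ _ (two_ne_zero), ← Real.exp_nat_mul]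
      congr 1; ring
    rw [h1]
    calc Real.exp (-(K * m)) ≤ Real.exp (K - Real.log L) := by
          apply Real.exp_le_exp.mpr
          have h2 : K * (M - 1) ≤ K * m := by gcongr
          have h3 : K * M = Real.log L := by rw [hK, hM]; field_simp
          linarith
      _ = _ := by rw [Real.exp_sub, Real.exp_log hL0]

end FGK


namespace FGK

set_option linter.unusedSectionVars false

set_option maxHeartbeats 1600000 in
theorem final (ρ : ℝ) (hρ0 : 0 < ρ) (hρ1 : ρ < 1/3)
    (a : ℕ → ℝ) (ha1 : a 1 = 2) (ha2 : a 2 = 2 + (2:ℝ) ^ ρ)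
    (harec : ∀ j : ℕ, 3 ≤ j → a j = a (j-1) ^ 2 + a (j-1) ^ ρ - a (j-2) ^ (2*ρ))
    (hlim : Filter.Tendsto (fun j : ℕ => (2:ℝ) ^ ((j:ℝ) - 2) / Real.log (a j))
      Filter.atTop (nhds (1 - ρ/2)))
    (ε : ℝ) (hε : 0 < ε) (hε' : ε < 1/2) :
    ∃ C : ℝ, 0 < C ∧ ∃ x₀ : ℝ, ∀ x : ℝ, x₀ ≤ x → ∀ r : ℕ,
      (1 + ε) * LLog2 x ≤ r → (r : ℝ) ≤ (2 - ε) * LLog2 x →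
      ∀ y ∈ Yset ((r : ℝ) / LLog2 x - 1) x,
      primeProd y x * ∑ᶠ n ∈ {n | n ∈ Sset y x ∧
          (DeltaV (LLog y) n : ℝ) < LLog2 x ^ (Real.log 2 / Real.log (2/ρ) - ε/2)},
          ((n : ℝ))⁻¹
        ≤ C / LLog2 x := by
  have hl2 : 0 < Real.log 2 := Real.log_pos one_lt_two
  set η := Real.log 2 / Real.log (2/ρ) with hη
  have hη0 : 0 < η := by
    apply div_pos hl2 (Real.log_pos _)
    rw [lt_div_iff₀ hρ0]; linarith
  obtain ⟨η', hη'0, hη'1, hη'2⟩ : ∃ η', 0 < η' ∧ η' < η ∧ η - ε/2 < η' := by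
    have hm := min_le_left (ε/4) (η/2)
    have hm' := min_le_right (ε/4) (η/2)
    have hm0 : 0 < min (ε/4) (η/2) := lt_min (by positivity) (by positivity)
    exact ⟨η - min (ε/4) (η/2), by linarith, by linarith, by linarith⟩
  set e0 := η - ε/2 with he0
  obtain ⟨r, c, lam, μ, δ, hS, hr⟩ := system_exists ρ hρ0 hρ1 a ha1 ha2 harec hlim η' hη'0 hη'1
  have hr1 : (1:ℝ) ≤ r := by exact_mod_cast hS.r1
  set cr := c (r+1) with hcr
  have hcr0 : 0 < cr := hS.cpos _
  have hcr1 : cr ≤ 1 := hS.c_le_one _ (by omega) le_rfl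
  set s := (r * Real.log 2 - η' * Real.log (1/cr)) / (2 * η') with hs
  have hs0 : 0 < s := div_pos (by linarith) (by positivity)
  set Λ := Real.log (1/cr) + s with hΛ
  have hlc : 0 ≤ Real.log (1/cr) := Real.log_nonneg (by rw [le_div_iff₀ hcr0]; linarith)
  have hΛ0 : 0 < Λ := by positivity
  have hΛr : η' * Λ < r * Real.log 2 := by
    have : η' * s = (r * Real.log 2 - η' * Real.log (1/cr)) / 2 := by rw [hs]; field_simp
    rw [hΛ, mul_add, this]; linarith
  set c2 := Real.exp (-Λ) with hc2
  have hc20 : 0 < c2 := Real.exp_pos _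
  have hc21 : c2 < 1 := (Real.exp_lt_one_iff.mpr (by linarith))
  have hc2e : c2 = cr * Real.exp (-s) := by
    rw [hc2, hΛ, neg_add, Real.exp_add, one_div, Real.log_inv, neg_neg, Real.exp_log hcr0]
  set c' := cr * Real.exp (-(s/2)) with hc'
  have hc'0 : 0 < c' := by positivity
  have hc'1 : c' < cr := mul_lt_of_lt_one_right hcr0 ((Real.exp_lt_one_iff.mpr (by linarith)))
  have hc2c : c2 < c' := by
    rw [hc2e, hc']
    exact mul_lt_mul_of_pos_left (Real.exp_lt_exp.mpr (by linarith)) hcr0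
  obtain ⟨θ, hθ0, hθ1, hθ2⟩ : ∃ θ, 0 < θ ∧ θ < 1 ∧ e0 < η' * (1 - θ)^2 := by
    have hm := min_le_left (1/2) ((η' - e0) / (4 * η'))
    have hm' := min_le_right (1/2) ((η' - e0) / (4 * η'))
    have hpos : 0 < (η' - e0) / (4 * η') := div_pos (by linarith) (by positivity)
    have hm0 : 0 < min (1/2) ((η' - e0) / (4 * η')) := lt_min (by norm_num) hpos
    refine ⟨min (1/2) ((η' - e0) / (4 * η')), hm0, by linarith, ?_⟩
    rw [le_div_iff₀ (by positivity)] at hm'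
    nlinarith [mul_nonneg hη'0.le (sq_nonneg (min (1/2) ((η' - e0) / (4 * η'))))]
  have hθ' : 0 < 1 - θ := by linarith
  set K := Λ / (1 - θ) with hK
  have hK0 : 0 < K := div_pos hΛ0 hθ'
  have hKe : Real.exp (-K) / 2 ≤ 1 := by
    have : Real.exp (-K) < 1 := (Real.exp_lt_one_iff.mpr (by linarith))
    linarith
  set q := (Real.exp (-K) / 2) ^ (1/θ) with hq
  have hq0 : 0 < q := by positivity
  have hq1 : q ≤ 1 := Real.rpow_le_one (by positivity) hKe (by positivity)
  have hqθ : q ^ θ = Real.exp (-K) / 2 := by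
    rw [hq, ← Real.rpow_mul (by positivity), one_div, inv_mul_cancel₀ hθ0.ne', Real.rpow_one]
  obtain ⟨dens, hd0, hd1, κ0, hκ0, τ0, Cc, hcore⟩ := core hS hq0 hc'0 hc'1
  obtain ⟨u0, B0, cf, hdp⟩ := dens_primes dens hd0 hd1 hκ0
  have hev := ev_ineq (ε := ε) (θ := θ) (c' := c') (Cc := Cc) (c2 := c2) (u0 := u0) (B0 := B0) (τ0 := τ0)
    (k1 := η' * (1 - θ)^2 - e0) (k2 := r * Real.log 2) hε hθ0 hc'0 hc21 (by linarith)
  obtain ⟨L1, hL1⟩ := eventually_atTop.mp hev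
  refine ⟨Real.exp K, Real.exp_pos _, Real.exp (Real.exp (max L1 2)), ?_⟩
  intro x hx r' hr'1 hr'2 y hy
  obtain ⟨hLL, hlogx⟩ := LLog2_large (lt_of_lt_of_le one_lt_two (le_max_right L1 2)) hx
  have hx0 : 0 < x := (Real.exp_pos _).trans_le hx
  obtain ⟨b1, b2, b3, b4, b5, b6, b7, b8, b9⟩ := hL1 (LLog2 x) ((le_max_left _ _).trans hLL)
  have hL0 : 0 < LLog2 x := by linarith
  obtain ⟨hy0, hy1, -⟩ := hy
  have hαL : ((r' : ℝ) / LLog2 x - 1) * LLog2 x = r' - LLog2 x := by field_simp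
  rw [hαL, abs_le] at hy1
  have hl1 : 3 * ε / 4 * LLog2 x ≤ LLog2 y := by linarith [hy1.1]
  have hl2' : LLog2 y ≤ (1 - 3 * ε / 4) * LLog2 x := by linarith [hy1.2]
  obtain ⟨hv, hyv⟩ := LLog2_inv hy0 (by linarith)
  have hmain := fixedL hq0 hq1 hcore hdp hε hη'0 hΛ0 hΛr hc2 hc20 hc21 hc'0 hc2c hθ0 hθ' hK hK0 hqθ hlogx hx0 hv hl1 hl2' b1 b4 b5 b6 b7 b8 b9
  rw [← hyv] at hmain
  have htr := translate y x (fun n => (DeltaV (LLog y) n : ℝ) < LLog2 x ^ e0)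
  exact htr.trans_le hmain

end FGK

theorem statement10 (ρ : ℝ) (hρ0 : 0 < ρ) (hρ1 : ρ < 1/3)
    (a : ℕ → ℝ) (ha1 : a 1 = 2) (ha2 : a 2 = 2 + (2:ℝ) ^ ρ)
    (harec : ∀ j : ℕ, 3 ≤ j → a j = a (j-1) ^ 2 + a (j-1) ^ ρ - a (j-2) ^ (2*ρ))
    (hlim : Filter.Tendsto (fun j : ℕ => (2:ℝ) ^ ((j:ℝ) - 2) / Real.log (a j))
      Filter.atTop (nhds (1 - ρ/2)))
    (ε : ℝ) (hε : 0 < ε) (hε' : ε < 1/2) :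
    ∃ C : ℝ, 0 < C ∧ ∃ x₀ : ℝ, ∀ x : ℝ, x₀ ≤ x → ∀ r : ℕ,
      (1 + ε) * LLog2 x ≤ r → (r : ℝ) ≤ (2 - ε) * LLog2 x →
      ∀ y ∈ Yset ((r : ℝ) / LLog2 x - 1) x,
      primeProd y x * ∑ᶠ n ∈ {n | n ∈ Sset y x ∧
          (DeltaV (LLog y) n : ℝ) < LLog2 x ^ (Real.log 2 / Real.log (2/ρ) - ε/2)},
          ((n : ℝ))⁻¹
        ≤ C / LLog2 x := by
  exact FGK.final ρ hρ0 hρ1 a ha1 ha2 harec hlim ε hε hε'
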